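/- Let k be a field of characteristic zero and F a finitely generated field extension of k with trdeg_k(F) ≥ 1 such that k is relatively algebraically closed in F. For m ≥ 1 let K_m = F(x₁,…,x_m) be the rational function field in m variables over F, and let Aut_k(K_m) denote the group of field automorphisms of K_m fixing (the image of) k pointwise. Let ι_m : Aut_k(K_m) → Aut_k(K_{m+1}) be the group homomorphism sending σ to its unique extension to K_{m+1} = K_m(x_{m+1}) that agrees with σ on K_m and fixes x_{m+1}. Then for every m ≥ 3, the induced homomorphism of abelianizations Aut_k(K_m)^{ab} → Aut_k(K_{m+1})^{ab} is not surjective. -/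

import Mathlib

section
namespace CrBir
open Polynomial

/-- extension of `d/dX` -/
theorem exists_derivation {C L : Type*} [Field C] [Field L] [Algebra C L] [CharZero C]
    (X : L) (hX : Transcendental C X)
    (halg : ∀ z : L, IsAlgebraic (IntermediateField.adjoin C {X}) z) :
    ∃ D : Derivation C L L, D X = 1 := by
  letI : Algebra C[X] L := (aeval X).toAlgebra
  have hmap : ∀ p : C[X], algebraMap C[X] L p = aeval X p := fun p => rfl
  haveI : IsScalarTower C C[X] L := IsScalarTower.of_algebraMap_eq (fun c => by
    rw [hmap]; simp)
  have hinj : Function.Injective (algebraMap C[X] L) := transcendental_iff_injective.mp hX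
  haveI : FaithfulSMul C[X] L := (faithfulSMul_iff_algebraMap_injective _ _).mpr hinj
  let Q := FractionRing C[X]
  letI : Algebra Q L := FractionRing.liftAlgebra C[X] L
  haveI : IsScalarTower C[X] Q L := FractionRing.isScalarTower_liftAlgebra _ _
  haveI : IsScalarTower C Q L := IsScalarTower.of_algebraMap_eq (fun c => by
    rw [IsScalarTower.algebraMap_apply C C[X] L, IsScalarTower.algebraMap_apply C[X] Q L,
      ← IsScalarTower.algebraMap_apply C C[X] Q])
  haveI : CharZero C[X] := charZero_of_injective_algebraMap (R := C) (FaithfulSMul.algebraMap_injective _ _)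
  haveI : CharZero Q := charZero_of_injective_algebraMap (R := C[X]) (FaithfulSMul.algebraMap_injective _ _)
  haveI : Algebra.IsAlgebraic Q L := by
    constructor
    intro z
    have hle : IntermediateField.adjoin C {X} ≤ (IsScalarTower.toAlgHom C Q L).fieldRange := by
      rw [IntermediateField.adjoin_simple_le_iff]
      refine ⟨algebraMap C[X] Q Polynomial.X, ?_⟩
      change algebraMap Q L (algebraMap C[X] Q Polynomial.X) = X
      rw [← IsScalarTower.algebraMap_apply, hmap, aeval_X]
    obtain ⟨p, hp0, hp⟩ := halg z
    obtain ⟨q, hq⟩ : ∃ q : Q[X], q.map (algebraMap Q L) = p.map (algebraMap _ L) := by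
      rw [← Polynomial.mem_lifts, Polynomial.lifts_iff_coeff_lifts]
      intro n
      rw [coeff_map]
      obtain ⟨c, hc⟩ := hle (p.coeff n).2
      exact ⟨c, hc⟩
    refine ⟨q, ?_, ?_⟩
    · rintro rfl
      apply hp0
      rw [Polynomial.map_zero] at hq
      exact (Polynomial.map_eq_zero _).mp hq.symm
    · rw [aeval_def, ← eval_map, hq, eval_map, ← aeval_def, hp]
  haveI : Algebra.FormallyEtale C[X] Q := Algebra.FormallyEtale.of_isLocalization (nonZeroDivisors C[X])
  haveI : Algebra.FormallyEtale Q L := Algebra.FormallyEtale.of_isSeparable Q L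
  haveI : Algebra.FormallyEtale C[X] L := Algebra.FormallyEtale.comp C[X] Q L
  have hb := KaehlerDifferential.isBaseChange_of_formallyEtale C C[X] L
  let d : Derivation C C[X] L := Polynomial.mkDerivation C (1 : L)
  let ℓ := hb.lift d.liftKaehlerDifferential
  refine ⟨ℓ.compDer (KaehlerDifferential.D C L), ?_⟩
  have h1 : KaehlerDifferential.D C L X = KaehlerDifferential.map C C C[X] L
      (KaehlerDifferential.D C C[X] Polynomial.X) := by
    rw [KaehlerDifferential.map_D, hmap, aeval_X]
  change ℓ (KaehlerDifferential.D C L X) = 1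
  rw [h1, hb.lift_eq, Derivation.liftKaehlerDifferential_comp_D]
  simp [d]

end CrBir
end

section
namespace CrBir
open Polynomial IntermediateField.algebraAdjoinAdjoin

section vals
variable {L : Type*} [Field L]

/-- `h` has value divisible by five -/
def Div5 (O : ValuationSubring L) (h : L) : Prop := ∃ w, w ≠ 0 ∧ O.valuation h = O.valuation w ^ 5

theorem mem_iff_val {O : ValuationSubring L} {h : L} : h ∈ O ↔ O.valuation h ≤ 1 :=
  (O.valuation_le_one_iff h).symm

theorem val_pos {O : ValuationSubring L} {h : L} (hh : h ≠ 0) : 0 < O.valuation h := by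
  rw [zero_lt_iff]; exact (Valuation.ne_zero_iff _).mpr hh

theorem val_const {C : Type*} [Field C] [Algebra C L] {O : ValuationSubring L}
    (hC : ∀ c : C, algebraMap C L c ∈ O) {c : C} (hc : c ≠ 0) :
    O.valuation (algebraMap C L c) = 1 := by
  apply le_antisymm (mem_iff_val.mp (hC c))
  have h := mem_iff_val.mp (hC c⁻¹)
  rw [map_inv₀, map_inv₀] at h
  have h0 : 0 < O.valuation (algebraMap C L c) := val_pos (by simpa using hc)
  exact (inv_le_one₀ h0).mp h

theorem val_eq_one_add {O : ValuationSubring L} {a b : L} (ha : O.valuation a = 1)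
    (hb : O.valuation b < 1) : O.valuation (a + b) = 1 := by
  rw [Valuation.map_add_eq_of_lt_left _ (by rwa [ha]), ha]

theorem val_add_lt {O : ValuationSubring L} {a b : L} (ha : O.valuation a < 1)
    (hb : O.valuation b < 1) : O.valuation (a + b) < 1 := Valuation.map_add_lt _ ha hb

theorem val_mul_lt {O : ValuationSubring L} {a b : L} (ha : O.valuation a < 1)
    (hb : b ∈ O) : O.valuation (a * b) < 1 := by
  rw [map_mul]; exact mul_lt_one_of_lt_of_le ha (mem_iff_val.mp hb)

/-- elements of `C(u)`-algebraic fields are bounded by powers of `u` -/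
theorem arch {C : Type*} [Field C] [Algebra C L] {O : ValuationSubring L}
    (hC : ∀ c : C, algebraMap C L c ∈ O) {u b : L} (hu0 : u ≠ 0) (hu : O.valuation u < 1)
    (hb : b ∈ O) (hb0 : b ≠ 0) (halg : IsAlgebraic (IntermediateField.adjoin C {u}) b) :
    ∃ n : ℕ, O.valuation u ^ n ≤ O.valuation b := by
  have huO : u ∈ O := mem_iff_val.mpr hu.le
  have hBO : ∀ z ∈ Algebra.adjoin C {u}, z ∈ O := by
    intro z hz
    induction hz using Algebra.adjoin_induction with
    | mem x hx => rw [Set.mem_singleton_iff] at hx; rwa [hx]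
    | algebraMap r => exact hC r
    | add x y _ _ hx hy => exact O.add_mem _ _ hx hy
    | mul x y _ _ hx hy => exact O.mul_mem _ _ hx hy
  have h2 : IsAlgebraic (Algebra.adjoin C {u}) b :=
    (IsFractionRing.isAlgebraic_iff (Algebra.adjoin C {u}) (IntermediateField.adjoin C {u}) L).mpr halg
  obtain ⟨q, hq0, hq⟩ := h2.exists_nonzero_coeff_and_aeval_eq_zero (mem_nonZeroDivisors_of_ne_zero hb0)
  have hval : ∀ p : (Algebra.adjoin C {u})[X], aeval b p ∈ O := by
    intro p
    induction p using Polynomial.induction_on' with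
    | add p q hp hq => rw [map_add]; exact O.add_mem _ _ hp hq
    | monomial n a =>
      rw [aeval_monomial]
      exact O.mul_mem _ _ (hBO _ a.2) (pow_mem hb n)
  have h3 : ((q.coeff 0 : Algebra.adjoin C {u}) : L) = - (b * aeval b q.divX) := by
    have := congrArg (aeval b) (X_mul_divX_add q)
    rw [hq, map_add, map_mul, aeval_X, aeval_C] at this
    change _ + ((q.coeff 0 : Algebra.adjoin C {u}) : L) = 0 at this
    linear_combination this
  have h4 : O.valuation (q.coeff 0 : L) ≤ O.valuation b := by
    rw [h3, Valuation.map_neg, map_mul]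
    exact mul_le_of_le_one_right' (mem_iff_val.mp (hval _))
  have h5 : ∀ z ∈ Algebra.adjoin C {u}, z ≠ 0 → ∃ n : ℕ, O.valuation z = O.valuation u ^ n := by
    intro z hz hz0
    rw [Algebra.adjoin_singleton_eq_range_aeval] at hz
    obtain ⟨p, rfl⟩ := hz
    have hp0 : p ≠ 0 := by rintro rfl; simp at hz0
    obtain ⟨g, hg, hgd⟩ := Polynomial.exists_eq_pow_rootMultiplicity_mul_and_not_dvd p hp0 0
    refine ⟨p.rootMultiplicity 0, ?_⟩
    have hg0 : g.coeff 0 ≠ 0 := by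
      intro h
      apply hgd
      rw [map_zero, sub_zero]
      exact X_dvd_iff.mpr h
    have h6 : O.valuation (aeval u g) = 1 := by
      have := congrArg (aeval u) (X_mul_divX_add g)
      rw [map_add, map_mul, aeval_X, aeval_C] at this
      rw [← this, add_comm]
      apply val_eq_one_add (val_const hC hg0)
      apply val_mul_lt hu
      apply hBO
      exact aeval_mem_adjoin_singleton _ _
    change O.valuation (aeval u p) = _
    conv_lhs => rw [hg]
    rw [map_mul, map_mul, h6, mul_one]
    simp
  obtain ⟨n, hn⟩ := h5 _ (q.coeff 0).2 (by simpa using hq0)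
  exact ⟨n, hn ▸ h4⟩

end vals

section nice
variable {C L : Type*} [Field C] [Field L] [Algebra C L]

/-- `O` is a discrete valuation ring with uniformizer `u` adapted to `D` -/
structure NiceAt (D : Derivation C L L) (O : ValuationSubring L) (u : L) : Prop where
  hC : ∀ c : C, algebraMap C L c ∈ O
  u0 : u ≠ 0
  um : O.valuation u < 1
  ord : ∀ h : L, h ≠ 0 → ∃ n : ℤ, O.valuation h = O.valuation u ^ n
  dO : ∀ h ∈ O, D h ∈ O
  du : O.valuation (D u) = 1
  res : ∀ h ∈ O, ∃ c : C, O.valuation (h - algebraMap C L c) < 1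

theorem NiceAt.dord [CharZero C] {D : Derivation C L L} {O : ValuationSubring L} {u : L}
    (H : NiceAt D O u) {h : L} (n : ℤ) (hn : n ≠ 0)
    (hv : O.valuation h = O.valuation u ^ n) :
    O.valuation (D h) = O.valuation u ^ (n - 1) := by
  have hun : u ^ n ≠ 0 := zpow_ne_zero _ H.u0
  have hup : 0 < O.valuation u := val_pos H.u0
  obtain ⟨e, he⟩ : ∃ e, h = u ^ n * e := ⟨h / u ^ n, by field_simp⟩
  have hve : O.valuation e = 1 := by
    rw [he, map_mul, map_zpow₀] at hv
    exact mul_left_cancel₀ (zpow_ne_zero _ hup.ne') (by rw [hv, mul_one])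
  have hDe := H.dO e (mem_iff_val.mpr hve.le)
  have h1 : D h = algebraMap C L n * u ^ (n-1) * D u * e + u ^ n * D e := by
    rw [he, Derivation.leibniz, Derivation.leibniz_zpow]
    simp only [smul_eq_mul, zsmul_eq_mul, map_intCast]
    ring
  have h2 : O.valuation (algebraMap C L n * u ^ (n-1) * D u * e) = O.valuation u ^ (n-1) := by
    rw [map_mul, map_mul, map_mul, val_const H.hC (by exact_mod_cast hn), hve, H.du, map_zpow₀]
    simp
  rw [h1, Valuation.map_add_eq_of_lt_left, h2]
  rw [h2, map_mul, map_zpow₀]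
  calc O.valuation u ^ n * O.valuation (D e) ≤ O.valuation u ^ n := mul_le_of_le_one_right' (mem_iff_val.mp hDe)
    _ < _ := zpow_lt_zpow_right_of_lt_one₀ hup H.um (by omega)

theorem NiceAt.zpow_le [CharZero C] {D : Derivation C L L} {O : ValuationSubring L} {u : L}
    (H : NiceAt D O u) {m n : ℤ} : O.valuation u ^ m ≤ O.valuation u ^ n ↔ n ≤ m :=
  zpow_le_zpow_iff_right_of_lt_one₀ (val_pos H.u0) H.um

theorem NiceAt.zpow_lt [CharZero C] {D : Derivation C L L} {O : ValuationSubring L} {u : L}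
    (H : NiceAt D O u) {m n : ℤ} : O.valuation u ^ m < O.valuation u ^ n ↔ n < m :=
  zpow_lt_zpow_iff_right_of_lt_one₀ (val_pos H.u0) H.um

theorem NiceAt.zpow_eq [CharZero C] {D : Derivation C L L} {O : ValuationSubring L} {u : L}
    (H : NiceAt D O u) {m n : ℤ} : O.valuation u ^ m = O.valuation u ^ n ↔ m = n := by
  constructor
  · intro h
    exact le_antisymm (H.zpow_le.mp h.ge) (H.zpow_le.mp h.le)
  · rintro rfl; rfl

theorem NiceAt.zpow_le_one [CharZero C] {D : Derivation C L L} {O : ValuationSubring L} {u : L}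
    (H : NiceAt D O u) {m : ℤ} : O.valuation u ^ m ≤ 1 ↔ 0 ≤ m := by
  rw [← H.zpow_le, zpow_zero]

theorem NiceAt.zpow_lt_one [CharZero C] {D : Derivation C L L} {O : ValuationSubring L} {u : L}
    (H : NiceAt D O u) {m : ℤ} : O.valuation u ^ m < 1 ↔ 0 < m := by
  rw [← H.zpow_lt, zpow_zero]

theorem NiceAt.zpow_eq_one [CharZero C] {D : Derivation C L L} {O : ValuationSubring L} {u : L}
    (H : NiceAt D O u) {m : ℤ} : O.valuation u ^ m = 1 ↔ m = 0 := by
  rw [← H.zpow_eq, zpow_zero]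

theorem chart {D : Derivation C L L} {O : ValuationSubring L}
    (hC : ∀ c : C, algebraMap C L c ∈ O) {u w e q : L} (hu0 : u ≠ 0)
    (hu : O.valuation u < 1) (hw : O.valuation w < 1)
    (halg : ∀ z : L, IsAlgebraic (IntermediateField.adjoin C {u}) z)
    (hfrac : ∀ z : L, ∃ a ∈ Algebra.adjoin C {u, w}, ∃ b ∈ Algebra.adjoin C {u, w}, b ≠ 0 ∧ z = a / b)
    (hDu : D u ∈ Algebra.adjoin C {u, w}) (hDw : D w ∈ Algebra.adjoin C {u, w})
    (he : e ∈ Algebra.adjoin C {u, w}) (hq : q ∈ Algebra.adjoin C {u, w})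
    (hve : O.valuation e = 1) (heq : e * w = q * u) (hDu1 : O.valuation (D u) = 1) :
    NiceAt D O u ∧ ∀ O' : ValuationSubring L, (∀ c : C, algebraMap C L c ∈ O') →
      O'.valuation u < 1 → O'.valuation w < 1 → O ≤ O' := by
  set B := Algebra.adjoin C {u, w} with hB
  have huB : u ∈ B := Algebra.subset_adjoin (by simp)
  have hwB : w ∈ B := Algebra.subset_adjoin (by simp)
  have hup : 0 < O.valuation u := val_pos hu0
  have hBO' : ∀ O' : ValuationSubring L, (∀ c : C, algebraMap C L c ∈ O') →
      O'.valuation u < 1 → O'.valuation w < 1 → ∀ z ∈ B, z ∈ O' := by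
    intro O' hC hu hw z hz
    induction hz using Algebra.adjoin_induction with
    | mem x hx =>
      rcases hx with rfl | rfl
      · exact mem_iff_val.mpr hu.le
      · exact mem_iff_val.mpr hw.le
    | algebraMap r => exact hC r
    | add x y _ _ hx hy => exact O'.add_mem _ _ hx hy
    | mul x y _ _ hx hy => exact O'.mul_mem _ _ hx hy
  have hBO := hBO' O hC hu hw
  have hDB : ∀ z ∈ B, D z ∈ B := by
    intro z hz
    induction hz using Algebra.adjoin_induction with
    | mem x hx =>
      rcases hx with rfl | rfl
      · exact hDu
      · exact hDw
    | algebraMap r => simp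
    | add x y _ _ hx hy => rw [map_add]; exact B.add_mem hx hy
    | mul x y hxB hyB hx hy =>
      rw [Derivation.leibniz, smul_eq_mul, smul_eq_mul]
      exact B.add_mem (B.mul_mem hxB hy) (B.mul_mem hyB hx)
  have hdec : ∀ z ∈ B, ∃ c : C, ∃ b₁ ∈ B, ∃ b₂ ∈ B, z = algebraMap C L c + (u * b₁ + w * b₂) := by
    intro z hz
    induction hz using Algebra.adjoin_induction with
    | mem x hx =>
      rcases hx with rfl | rfl
      · exact ⟨0, 1, B.one_mem, 0, B.zero_mem, by simp⟩
      · exact ⟨0, 0, B.zero_mem, 1, B.one_mem, by simp⟩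
    | algebraMap r => exact ⟨r, 0, B.zero_mem, 0, B.zero_mem, by simp⟩
    | add x y _ _ hx hy =>
      obtain ⟨c, b₁, h₁, b₂, h₂, rfl⟩ := hx
      obtain ⟨c', b₁', h₁', b₂', h₂', rfl⟩ := hy
      exact ⟨c + c', b₁ + b₁', B.add_mem h₁ h₁', b₂ + b₂', B.add_mem h₂ h₂', by rw [map_add]; ring⟩
    | mul x y _ hyB hx hy =>
      obtain ⟨c, b₁, h₁, b₂, h₂, rfl⟩ := hx
      obtain ⟨c', b₁', h₁', b₂', h₂', rfl⟩ := hy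
      refine ⟨c * c', algebraMap C L c * b₁' + b₁ * (algebraMap C L c' + (u * b₁' + w * b₂')),
        B.add_mem (B.mul_mem (B.algebraMap_mem _) h₁') (B.mul_mem h₁ hyB),
        algebraMap C L c * b₂' + b₂ * (algebraMap C L c' + (u * b₁' + w * b₂')),
        B.add_mem (B.mul_mem (B.algebraMap_mem _) h₂') (B.mul_mem h₂ hyB), ?_⟩
      rw [map_mul]; ring
  have hmm : ∀ O' : ValuationSubring L, (∀ c : C, algebraMap C L c ∈ O') →
      O'.valuation u < 1 → O'.valuation w < 1 → ∀ b₁ ∈ B, ∀ b₂ ∈ B,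
      O'.valuation (u * b₁ + w * b₂) < 1 := fun O' hC hu hw b₁ h₁ b₂ h₂ =>
    val_add_lt (val_mul_lt hu (hBO' O' hC hu hw _ h₁)) (val_mul_lt hw (hBO' O' hC hu hw _ h₂))
  have hstep : ∀ b ∈ B, ∀ n : ℕ, (∃ m : ℕ, ∃ b' ∈ B, O.valuation b' = 1 ∧ e ^ m * b = u ^ m * b') ∨
      ∃ b' ∈ B, e ^ n * b = u ^ n * b' := by
    intro b hb n
    induction n with
    | zero => exact Or.inr ⟨b, hb, by simp⟩
    | succ n ih =>
      rcases ih with h | ⟨b', hb', h⟩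
      · exact Or.inl h
      · obtain ⟨c, b₁, h₁, b₂, h₂, hb2⟩ := hdec b' hb'
        by_cases hc : c = 0
        · right
          refine ⟨e * b₁ + q * b₂, B.add_mem (B.mul_mem he h₁) (B.mul_mem hq h₂), ?_⟩
          subst hc
          rw [map_zero, zero_add] at hb2
          rw [pow_succ, mul_right_comm, h, hb2]
          linear_combination u ^ n * b₂ * heq
        · left
          refine ⟨n, b', hb', ?_, h⟩
          rw [hb2]
          exact val_eq_one_add (val_const hC hc) (hmm O hC hu hw _ h₁ _ h₂)
  have hfac : ∀ b ∈ B, b ≠ 0 → ∃ m : ℕ, ∃ b' ∈ B, O.valuation b' = 1 ∧ e ^ m * b = u ^ m * b' := by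
    intro b hb hb0
    obtain ⟨n, hn⟩ := arch hC hu0 hu (hBO b hb) hb0 (halg b)
    rcases hstep b hb (n+1) with h | ⟨b', hb', h⟩
    · exact h
    · exfalso
      have h1 := congrArg O.valuation h
      rw [map_mul, map_mul, map_pow, map_pow, hve, one_pow, one_mul] at h1
      have h2 : O.valuation b ≤ O.valuation u ^ (n+1) := by
        rw [h1]; exact mul_le_of_le_one_right' (mem_iff_val.mp (hBO _ hb'))
      have h3 : O.valuation u ^ (n+1) < O.valuation u ^ n := pow_lt_pow_right_of_lt_one₀ hup hu (by omega)
      exact absurd (hn.trans h2) (not_le.mpr h3)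
  have he0 : e ≠ 0 := by rintro rfl; simp at hve
  have hord : ∀ h : L, h ≠ 0 → ∃ m₁ m₂ : ℕ, ∃ a ∈ B, ∃ b ∈ B, O.valuation a = 1 ∧ O.valuation b = 1 ∧
      h * (u ^ m₂ * b) = u ^ m₁ * a := by
    intro h hh
    obtain ⟨a, ha, b, hb, hb0, rfl⟩ := hfrac h
    have ha0 : a ≠ 0 := by rintro rfl; simp at hh
    obtain ⟨m₁, a', ha', hva, hm₁⟩ := hfac a ha ha0
    obtain ⟨m₂, b', hb', hvb, hm₂⟩ := hfac b hb hb0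
    refine ⟨m₁, m₂, a' * e ^ m₂, B.mul_mem ha' (B.pow_mem he _), b' * e ^ m₁,
      B.mul_mem hb' (B.pow_mem he _), ?_, ?_, ?_⟩
    · rw [map_mul, map_pow, hva, hve]; simp
    · rw [map_mul, map_pow, hvb, hve]; simp
    · field_simp
      linear_combination e ^ m₂ * b * hm₁ - e ^ m₁ * a * hm₂
  have hrep : ∀ h ∈ O, ∃ a ∈ B, ∃ b ∈ B, O.valuation b = 1 ∧ h = a / b := by
    intro h hh
    by_cases hh0 : h = 0
    · exact ⟨0, B.zero_mem, 1, B.one_mem, by simp, by simp [hh0]⟩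
    obtain ⟨m₁, m₂, a, ha, b, hb, hva, hvb, hab⟩ := hord h hh0
    have hb0 : b ≠ 0 := by rintro rfl; simp at hvb
    have hle : m₂ ≤ m₁ := by
      by_contra hlt
      push Not at hlt
      have h1 := congrArg O.valuation hab
      rw [map_mul, map_mul, map_mul, hva, hvb, map_pow, map_pow, mul_one, mul_one] at h1
      have h2 : O.valuation u ^ m₁ ≤ O.valuation u ^ m₂ := by
        rw [← h1]; exact mul_le_of_le_one_left' (mem_iff_val.mp hh)
      exact absurd (pow_lt_pow_right_of_lt_one₀ hup hu hlt) (not_lt.mpr h2)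
    obtain ⟨d, rfl⟩ := Nat.exists_eq_add_of_le hle
    refine ⟨u ^ d * a, B.mul_mem (B.pow_mem huB _) ha, b, hb, hvb, ?_⟩
    rw [eq_div_iff hb0]
    apply mul_left_cancel₀ (pow_ne_zero m₂ hu0)
    linear_combination hab
  have hc_of : ∀ b ∈ B, O.valuation b = 1 → ∃ c : C, c ≠ 0 ∧ ∃ b₁ ∈ B, ∃ b₂ ∈ B,
      b = algebraMap C L c + (u * b₁ + w * b₂) := by
    intro b hb hvb
    obtain ⟨c, b₁, h₁, b₂, h₂, hb2⟩ := hdec b hb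
    refine ⟨c, ?_, b₁, h₁, b₂, h₂, hb2⟩
    rintro rfl
    rw [map_zero, zero_add] at hb2
    have := hmm O hC hu hw _ h₁ _ h₂
    rw [← hb2, hvb] at this
    exact lt_irrefl _ this
  refine ⟨⟨hC, hu0, hu, ?_, ?_, hDu1, ?_⟩, ?_⟩
  · intro h hh
    obtain ⟨m₁, m₂, a, ha, b, hb, hva, hvb, hab⟩ := hord h hh
    refine ⟨m₁ - m₂, ?_⟩
    have h1 := congrArg O.valuation hab
    rw [map_mul, map_mul, map_mul, hva, hvb, map_pow, map_pow, mul_one, mul_one] at h1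
    rw [zpow_sub₀ hup.ne', zpow_natCast, zpow_natCast, eq_div_iff (pow_ne_zero _ hup.ne'), h1]
  · intro h hh
    obtain ⟨a, ha, b, hb, hvb, rfl⟩ := hrep h hh
    rw [Derivation.leibniz_div, smul_eq_mul, smul_eq_mul, smul_eq_mul]
    have h1 : b⁻¹ ∈ O := by rw [mem_iff_val, map_inv₀, hvb, inv_one]
    exact O.mul_mem _ _ (pow_mem h1 2) (hBO _ (B.sub_mem (B.mul_mem hb (hDB _ ha)) (B.mul_mem ha (hDB _ hb))))
  · intro h hh
    obtain ⟨a, ha, b, hb, hvb, rfl⟩ := hrep h hh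
    have hb0 : b ≠ 0 := by rintro rfl; simp at hvb
    obtain ⟨c, hc, b₁, h₁, b₂, h₂, hb2⟩ := hc_of b hb hvb
    obtain ⟨c', b₁', h₁', b₂', h₂', hb2'⟩ := hdec a ha
    refine ⟨c' / c, ?_⟩
    have hcL : algebraMap C L c ≠ 0 := by simpa using hc
    have : a / b - algebraMap C L (c' / c) = (u * (b₁' - algebraMap C L (c'/c) * b₁) + w * (b₂' - algebraMap C L (c'/c) * b₂)) / b := by
      rw [eq_div_iff hb0, sub_mul, div_mul_cancel₀ _ hb0, hb2, hb2', map_div₀]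
      field_simp
      ring
    rw [this, map_div₀, hvb, div_one]
    exact hmm O hC hu hw _ (B.sub_mem h₁' (B.mul_mem (B.algebraMap_mem _) h₁)) _
      (B.sub_mem h₂' (B.mul_mem (B.algebraMap_mem _) h₂))
  · intro O' hC' hu' hw' h hh
    obtain ⟨a, ha, b, hb, hvb, rfl⟩ := hrep h hh
    obtain ⟨c, hc, b₁, h₁, b₂, h₂, hb2⟩ := hc_of b hb hvb
    have h1 : O'.valuation b = 1 := by
      rw [hb2]; exact val_eq_one_add (val_const hC' hc) (hmm O' hC' hu' hw' _ h₁ _ h₂)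
    rw [mem_iff_val, map_div₀, h1, div_one, ← mem_iff_val]
    exact hBO' O' hC' hu' hw' a ha

end nice
end CrBir
end

section
namespace CrBir
open Polynomial IntermediateField.algebraAdjoinAdjoin

theorem alg_of_trdeg_one {C L : Type*} [Field C] [Field L] [Algebra C L] {X u : L}
    (hX : Transcendental C X)
    (halg : ∀ z : L, IsAlgebraic (IntermediateField.adjoin C {X}) z) (hu : Transcendental C u) :
    ∀ z : L, IsAlgebraic (IntermediateField.adjoin C {u}) z := by
  have h1 : AlgebraicIndependent C (fun _ : Unit => X) := by
    rw [algebraicIndependent_unique_type_iff]; exact hX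
  have h2 : AlgebraicIndependent C (fun _ : Unit => u) := by
    rw [algebraicIndependent_unique_type_iff]; exact hu
  have hb : IsTranscendenceBasis C (fun _ : Unit => X) := by
    rw [h1.isTranscendenceBasis_iff_isAlgebraic]
    constructor
    intro z
    rw [Set.range_const]
    exact (IsFractionRing.isAlgebraic_iff (Algebra.adjoin C {X}) (IntermediateField.adjoin C {X}) L).mpr (halg z)
  have h3 : IsTranscendenceBasis C (fun _ : Unit => u) := by
    apply h2.isTranscendenceBasis_of_lift_trdeg_le_of_finite
    rw [← hb.lift_cardinalMk_eq_trdeg]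
  have h4 := h3.isAlgebraic_field
  rw [Set.range_const] at h4
  exact h4.isAlgebraic

/-- A Weierstrass function field with its invariant derivation -/
structure WD (C L : Type*) [Field C] [Field L] [Algebra C L] where
  X : L
  Y : L
  A : C
  B : C
  eq : Y ^ 2 = X ^ 3 + algebraMap C L A * X + algebraMap C L B
  disc : 4 * A ^ 3 + 27 * B ^ 2 ≠ 0
  tr : Transcendental C X
  gen : IntermediateField.adjoin C {X, Y} = ⊤
  D : Derivation C L L
  hDX : D X = 2 * Y
  hDY : D Y = 3 * X ^ 2 + algebraMap C L A

theorem const_of_alg {C L : Type*} [Field C] [Field L] [Algebra C L] [IsAlgClosed C] {u : L}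
    (h : IsAlgebraic C u) : ∃ c : C, algebraMap C L c = u :=
  minpoly.mem_range_of_degree_eq_one C u
    (IsAlgClosed.degree_eq_one_of_irreducible C (minpoly.irreducible h.isIntegral))

theorem tr_of_lt {C L : Type*} [Field C] [Field L] [Algebra C L] [IsAlgClosed C]
    {O : ValuationSubring L} (hC : ∀ c : C, algebraMap C L c ∈ O) {u : L} (hu0 : u ≠ 0)
    (hu : O.valuation u < 1) : Transcendental C u := by
  intro h
  obtain ⟨c, rfl⟩ := const_of_alg h
  rw [val_const hC (by rintro rfl; simp at hu0)] at hu
  exact lt_irrefl _ hu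

theorem mem_of_integral {L : Type*} [Field L] {O : ValuationSubring L} {z : L}
    (h : IsIntegral O z) : z ∈ O := by
  obtain ⟨y, rfl⟩ := IsIntegrallyClosed.isIntegral_iff.mp h
  exact y.2

theorem eq_top_of_alg {C L : Type*} [Field C] [Field L] [Algebra C L] {O : ValuationSubring L}
    (E : IntermediateField C L) (hE : ∀ z ∈ E, z ∈ O) (halg : ∀ z : L, IsAlgebraic E z) : O = ⊤ := by
  rw [eq_top_iff]
  intro z _
  apply mem_of_integral
  have h := (halg z).isIntegral
  let f : E →+* O := ⟨⟨⟨fun z => ⟨z, hE z z.2⟩, rfl⟩, fun _ _ => rfl⟩, rfl, fun _ _ => rfl⟩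
  obtain ⟨p, hp, hpz⟩ := h
  refine ⟨p.map f, hp.map _, ?_⟩
  rw [eval₂_map]
  exact hpz

section
variable {C L : Type*} [Field C] [Field L] [Algebra C L] [CharZero C]

theorem isAlgebraic_WX {X Y : L} {A B : C}
    (eq : Y ^ 2 = X ^ 3 + algebraMap C L A * X + algebraMap C L B)
    (gen : IntermediateField.adjoin C {X, Y} = ⊤) (z : L) :
    IsAlgebraic (IntermediateField.adjoin C {X}) z := by
  set E := IntermediateField.adjoin C {X} with hE
  have hXE : X ∈ E := IntermediateField.mem_adjoin_simple_self C X
  have hY : IsAlgebraic E Y := by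
    let c : E := ⟨X, hXE⟩ ^ 3 + algebraMap C E A * ⟨X, hXE⟩ + algebraMap C E B
    have hc : (algebraMap E L) c = Y ^ 2 := by rw [eq]; rfl
    have : IsAlgebraic E (Y ^ 2) := hc ▸ isAlgebraic_algebraMap c
    exact this.of_pow (by norm_num)
  have hle : (⊤ : IntermediateField C L) ≤ (algebraicClosure E L).restrictScalars C := by
    rw [← gen, IntermediateField.adjoin_le_iff]
    rintro w (rfl | rfl)
    · exact (mem_algebraicClosure_iff.mpr (isAlgebraic_algebraMap (⟨w, hXE⟩ : E)))
    · exact (mem_algebraicClosure_iff.mpr hY)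
  exact mem_algebraicClosure_iff.mp (hle (IntermediateField.mem_top (x := z)))

theorem exists_WD {X Y : L} {A B : C}
    (eq : Y ^ 2 = X ^ 3 + algebraMap C L A * X + algebraMap C L B)
    (disc : 4 * A ^ 3 + 27 * B ^ 2 ≠ 0)
    (tr : Transcendental C X)
    (gen : IntermediateField.adjoin C {X, Y} = ⊤) :
    ∃ W : WD C L, W.X = X ∧ W.Y = Y ∧ W.A = A ∧ W.B = B := by
  obtain ⟨D, hD⟩ := exists_derivation X tr (isAlgebraic_WX eq gen)
  have hY0 : Y ≠ 0 := by
    rintro rfl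
    apply tr
    refine ⟨Polynomial.X ^ 3 + Polynomial.C A * Polynomial.X + Polynomial.C B, ?_, ?_⟩
    · intro h
      have := congrArg (fun p => p.coeff 3) h
      simp [coeff_X, coeff_C] at this
    · simp; rw [← eq]; ring
  haveI : CharZero L := charZero_of_injective_algebraMap (FaithfulSMul.algebraMap_injective C L)
  refine ⟨⟨X, Y, A, B, eq, disc, tr, gen, (2 * Y) • D, by simp [hD], ?_⟩, rfl, rfl, rfl, rfl⟩
  have h1 := congrArg D eq
  rw [Derivation.leibniz_pow] at h1
  simp only [map_add, Derivation.leibniz, Derivation.leibniz_pow, Derivation.map_algebraMap, hD,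
    smul_eq_mul, nsmul_eq_mul] at h1
  rw [Derivation.smul_apply, smul_eq_mul]
  push_cast at h1
  linear_combination h1

namespace WD
variable (W : WD C L)

theorem Yne : W.Y ≠ 0 := by
  intro h
  have h1 := W.eq
  rw [h] at h1
  apply W.tr
  refine ⟨Polynomial.X ^ 3 + Polynomial.C W.A * Polynomial.X + Polynomial.C W.B, ?_, ?_⟩
  · intro h
    have := congrArg (fun p => p.coeff 3) h
    simp [coeff_X, coeff_C] at this
  · simp; rw [← h1]; ring

theorem alg (z : L) : IsAlgebraic (IntermediateField.adjoin C {W.X}) z := isAlgebraic_WX W.eq W.gen z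

theorem alg_u (W : WD C L) {u : L} (hu : Transcendental C u) (z : L) :
    IsAlgebraic (IntermediateField.adjoin C {u}) z := alg_of_trdeg_one W.tr W.alg hu z

theorem frac {u w : L} (hX : W.X ∈ IntermediateField.adjoin C {u, w})
    (hY : W.Y ∈ IntermediateField.adjoin C {u, w}) (z : L) :
    ∃ a ∈ Algebra.adjoin C {u, w}, ∃ b ∈ Algebra.adjoin C {u, w}, b ≠ 0 ∧ z = a / b := by
  have h : z ∈ IntermediateField.adjoin C {u, w} := by
    have hle : (⊤ : IntermediateField C L) ≤ IntermediateField.adjoin C {u, w} := by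
      rw [← W.gen, IntermediateField.adjoin_le_iff]
      rintro w (rfl | rfl)
      · exact hX
      · exact hY
    exact hle IntermediateField.mem_top
  obtain ⟨a, ha, b, hb, h⟩ := IntermediateField.mem_adjoin_iff_div.mp h
  by_cases hb0 : b = 0
  · exact ⟨0, Subalgebra.zero_mem _, 1, Subalgebra.one_mem _, one_ne_zero, by rw [h, hb0]; simp⟩
  · exact ⟨a, ha, b, hb, hb0, h⟩


theorem inf_vals {O : ValuationSubring L} (hC : ∀ c : C, algebraMap C L c ∈ O) {X Y : L} {A B : C}
    (eq : Y ^ 2 = X ^ 3 + algebraMap C L A * X + algebraMap C L B) (hX : X ∉ O) :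
    O.valuation Y ^ 2 = O.valuation X ^ 3 ∧ O.valuation (X / Y) < 1 ∧ O.valuation (1 / Y) < 1 ∧ Y ≠ 0 := by
  have hX1 : 1 < O.valuation X := by rwa [mem_iff_val, not_le] at hX
  have hX0 : 0 < O.valuation X := zero_lt_one.trans hX1
  have h1 : O.valuation (algebraMap C L A * X + algebraMap C L B) < O.valuation (X ^ 3) := by
    apply Valuation.map_add_lt
    · rw [map_mul, map_pow]
      calc _ ≤ O.valuation X := mul_le_of_le_one_left' (mem_iff_val.mp (hC A))
        _ < _ := by
          conv_lhs => rw [← pow_one (O.valuation X)]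
          exact pow_lt_pow_right₀ hX1 (by norm_num)
    · rw [map_pow]
      exact lt_of_le_of_lt (mem_iff_val.mp (hC B)) (one_lt_pow₀ hX1 (by norm_num))
  have h2 : O.valuation Y ^ 2 = O.valuation X ^ 3 := by
    rw [← map_pow, eq, add_assoc, Valuation.map_add_eq_of_lt_left _ h1, map_pow]
  have hY0 : Y ≠ 0 := by
    rintro rfl
    rw [map_zero, zero_pow (by norm_num)] at h2
    exact absurd h2.symm (pow_ne_zero _ hX0.ne')
  have hXY : O.valuation X < O.valuation Y := by
    by_contra h
    push Not at h
    have : O.valuation Y ^ 2 ≤ O.valuation X ^ 2 := pow_le_pow_left₀ zero_le h 2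
    rw [h2] at this
    exact absurd (pow_lt_pow_right₀ hX1 (show 2 < 3 by norm_num)) (not_lt.mpr this)
  refine ⟨h2, ?_, ?_, hY0⟩
  · rw [map_div₀, div_lt_one₀ (val_pos hY0)]; exact hXY
  · rw [map_div₀, map_one, div_lt_one₀ (val_pos hY0)]; exact hX1.trans hXY

theorem inf_chart [IsAlgClosed C] {O : ValuationSubring L} (hC : ∀ c : C, algebraMap C L c ∈ O)
    (hX : W.X ∉ O) : NiceAt W.D O (W.X / W.Y) ∧
    ∀ O' : ValuationSubring L, (∀ c : C, algebraMap C L c ∈ O') → W.X ∉ O' → O ≤ O' := by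
  obtain ⟨_, hU, hW, hY0⟩ := inf_vals hC W.eq hX
  have hX0 : W.X ≠ 0 := by intro h; rw [h] at hX; exact hX O.zero_mem
  have heq := W.eq
  have hDU : W.D (W.X / W.Y) = -1 + algebraMap C L (2 * W.A) * (W.X / W.Y) * (1 / W.Y) +
      algebraMap C L (3 * W.B) * (1 / W.Y) ^ 2 := by
    rw [Derivation.leibniz_div, W.hDX, W.hDY]
    simp only [smul_eq_mul, map_mul, map_ofNat]
    field_simp
    linear_combination (3 : L) * heq
  have hDW : W.D (1 / W.Y) = -3 * (W.X / W.Y) ^ 2 - algebraMap C L W.A * (1 / W.Y) ^ 2 := by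
    rw [one_div, Derivation.leibniz_inv, W.hDY, smul_eq_mul]
    field_simp
    ring
  set U := W.X / W.Y with hUdef
  set V := 1 / W.Y with hVdef
  have hUB : U ∈ Algebra.adjoin C {U, V} := Algebra.subset_adjoin (by simp)
  have hVB : V ∈ Algebra.adjoin C {U, V} := Algebra.subset_adjoin (by simp)
  have hU0 : U ≠ 0 := div_ne_zero hX0 hY0
  have hUF : U ∈ IntermediateField.adjoin C {U, V} := IntermediateField.subset_adjoin _ _ (by simp)
  have hVF : V ∈ IntermediateField.adjoin C {U, V} := IntermediateField.subset_adjoin _ _ (by simp)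
  have hUO : U ∈ O := mem_iff_val.mpr hU.le
  have hVO : V ∈ O := mem_iff_val.mpr hW.le
  have hYF : W.Y ∈ IntermediateField.adjoin C {U, V} := by
    have : W.Y = V⁻¹ := by rw [hVdef]; simp
    rw [this]; exact inv_mem hVF
  have hXF : W.X ∈ IntermediateField.adjoin C {U, V} := by
    have : W.X = U * W.Y := by rw [hUdef]; field_simp
    rw [this]; exact mul_mem hUF hYF
  have hch := chart (D := W.D) hC hU0 hU hW (e := 1 - algebraMap C L W.A * U * V - algebraMap C L W.B * V ^ 2)
    (q := U ^ 2) (W.alg_u (tr_of_lt hC hU0 hU)) (W.frac hXF hYF)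
    (by rw [hDU]
        exact add_mem (add_mem (neg_mem (one_mem _)) (mul_mem (mul_mem (Subalgebra.algebraMap_mem _ _) hUB) hVB))
          (mul_mem (Subalgebra.algebraMap_mem _ _) (pow_mem hVB _)))
    (by rw [hDW]
        exact sub_mem (mul_mem (neg_mem (by exact_mod_cast Subalgebra.natCast_mem _ 3)) (pow_mem hUB 2))
          (mul_mem (Subalgebra.algebraMap_mem _ _) (pow_mem hVB _)))
    (sub_mem (sub_mem (one_mem _) (mul_mem (mul_mem (Subalgebra.algebraMap_mem _ _) hUB) hVB))
      (mul_mem (Subalgebra.algebraMap_mem _ _) (pow_mem hVB _)))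
    (pow_mem hUB _)
    (by
      rw [sub_sub, sub_eq_add_neg]
      apply val_eq_one_add (map_one _)
      rw [Valuation.map_neg]
      apply val_add_lt
      · rw [mul_comm]; exact val_mul_lt hW (O.mul_mem _ _ (hC _) hUO)
      · rw [mul_comm, pow_two, mul_assoc]; exact val_mul_lt hW (O.mul_mem _ _ hVO (hC _)))
    (by
      rw [hUdef, hVdef]
      field_simp
      linear_combination heq)
    (by
      rw [hDU, add_assoc]
      apply val_eq_one_add (by simp)
      apply val_add_lt
      · rw [mul_comm]; exact val_mul_lt hW (O.mul_mem _ _ (hC _) hUO)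
      · rw [mul_comm, pow_two, mul_assoc]; exact val_mul_lt hW (O.mul_mem _ _ hVO (hC _)))
  refine ⟨hch.1, fun O' hC' hX' => ?_⟩
  obtain ⟨_, hU', hW', _⟩ := inf_vals hC' W.eq hX'
  exact hch.2 O' hC' hU' hW'

theorem unique_inf [IsAlgClosed C] {O O' : ValuationSubring L} (hC : ∀ c : C, algebraMap C L c ∈ O)
    (hC' : ∀ c : C, algebraMap C L c ∈ O') (hX : W.X ∉ O) (hX' : W.X ∉ O') : O = O' :=
  le_antisymm ((W.inf_chart hC hX).2 O' hC' hX') ((W.inf_chart hC' hX').2 O hC hX)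

theorem pt_chart [IsAlgClosed C] {O : ValuationSubring L} (hC : ∀ c : C, algebraMap C L c ∈ O)
    {x₀ y₀ : C} (hx : O.valuation (W.X - algebraMap C L x₀) < 1)
    (hy : O.valuation (W.Y - algebraMap C L y₀) < 1) : (∃ u, NiceAt W.D O u) ∧
    ∀ O' : ValuationSubring L, (∀ c : C, algebraMap C L c ∈ O') →
      O'.valuation (W.X - algebraMap C L x₀) < 1 → O'.valuation (W.Y - algebraMap C L y₀) < 1 → O ≤ O' := by
  have heq := W.eq
  have hXO : W.X ∈ O := by
    have := O.add_mem _ _ (mem_iff_val.mpr hx.le) (hC x₀); rwa [sub_add_cancel] at this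
  have hYO : W.Y ∈ O := by
    have := O.add_mem _ _ (mem_iff_val.mpr hy.le) (hC y₀); rwa [sub_add_cancel] at this
  have hxy : y₀ ^ 2 = x₀ ^ 3 + W.A * x₀ + W.B := by
    by_contra hne
    have h1 := val_const (L := L) hC (sub_ne_zero.mpr hne)
    have h2 : algebraMap C L (y₀ ^ 2 - (x₀ ^ 3 + W.A * x₀ + W.B)) =
        (W.X - algebraMap C L x₀) * (W.X ^ 2 + W.X * algebraMap C L x₀ + algebraMap C L x₀ ^ 2 + algebraMap C L W.A)
        + (W.Y - algebraMap C L y₀) * (-(W.Y + algebraMap C L y₀)) := by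
      simp only [map_sub, map_add, map_mul, map_pow]
      linear_combination heq
    rw [h2] at h1
    have h3 : O.valuation ((W.X - algebraMap C L x₀) * (W.X ^ 2 + W.X * algebraMap C L x₀ + algebraMap C L x₀ ^ 2 + algebraMap C L W.A)
        + (W.Y - algebraMap C L y₀) * (-(W.Y + algebraMap C L y₀))) < 1 := by
      apply val_add_lt (val_mul_lt hx _) (val_mul_lt hy _)
      · exact add_mem (add_mem (add_mem (pow_mem hXO _) (mul_mem hXO (hC _))) (pow_mem (hC _) _)) (hC _)
      · exact neg_mem (add_mem hYO (hC _))
    rw [h1] at h3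
    exact lt_irrefl _ h3
  have hxyL : algebraMap C L y₀ ^ 2 = algebraMap C L x₀ ^ 3 + algebraMap C L W.A * algebraMap C L x₀ + algebraMap C L W.B := by
    rw [← map_pow, hxy]; simp
  set a := W.X - algebraMap C L x₀ with ha
  set b := W.Y - algebraMap C L y₀ with hb
  have hXa : W.X = a + algebraMap C L x₀ := by rw [ha]; ring
  have hYb : W.Y = b + algebraMap C L y₀ := by rw [hb]; ring
  have ha0 : a ≠ 0 := by
    intro h
    rw [h, zero_add] at hXa
    apply W.tr; rw [hXa]; exact isAlgebraic_algebraMap _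
  have hDa : W.D a = 2 * W.Y := by rw [ha, map_sub, W.hDX]; simp
  have hDb : W.D b = 3 * W.X ^ 2 + algebraMap C L W.A := by rw [hb, map_sub, W.hDY]; simp
  have hmemF : ∀ u w : L, ({a, b} : Set L) = {u, w} → W.X ∈ IntermediateField.adjoin C {u, w} ∧
      W.Y ∈ IntermediateField.adjoin C {u, w} := by
    intro u w h
    rw [← h]
    constructor
    · rw [hXa]; exact add_mem (IntermediateField.subset_adjoin _ _ (by simp)) (IntermediateField.algebraMap_mem _ _)
    · rw [hYb]; exact add_mem (IntermediateField.subset_adjoin _ _ (by simp)) (IntermediateField.algebraMap_mem _ _)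
  have hmemB : ∀ u w : L, ({a, b} : Set L) = {u, w} → W.X ∈ Algebra.adjoin C {u, w} ∧
      W.Y ∈ Algebra.adjoin C {u, w} := by
    intro u w h
    rw [← h]
    constructor
    · rw [hXa]; exact add_mem (Algebra.subset_adjoin (by simp)) (Subalgebra.algebraMap_mem _ _)
    · rw [hYb]; exact add_mem (Algebra.subset_adjoin (by simp)) (Subalgebra.algebraMap_mem _ _)
  have hDm : ∀ B : Subalgebra C L, W.X ∈ B → W.Y ∈ B → W.D a ∈ B ∧ W.D b ∈ B := by
    intro B hX hY
    rw [hDa, hDb]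
    refine ⟨mul_mem ?_ hY, add_mem (mul_mem ?_ (pow_mem hX _)) (Subalgebra.algebraMap_mem _ _)⟩
    · exact_mod_cast B.natCast_mem 2
    · exact_mod_cast B.natCast_mem 3
  by_cases hy0 : y₀ = 0
  · have hbY : b = W.Y := by rw [hb, hy0]; simp
    have hb0 : b ≠ 0 := by rw [hbY]; exact W.Yne
    have hset : ({a, b} : Set L) = {b, a} := Set.pair_comm a b
    have hd : 3 * x₀ ^ 2 + W.A ≠ 0 := by
      intro h
      apply W.disc
      rw [hy0] at hxy
      have hA : W.A = - 3 * x₀ ^ 2 := by linear_combination h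
      have hB : W.B = 2 * x₀ ^ 3 := by linear_combination -hxy - x₀ * hA
      rw [hA, hB]; ring
    obtain ⟨hX', hY'⟩ := hmemB b a hset
    have hch := chart (D := W.D) hC hb0 hy hx
      (e := W.X ^ 2 + W.X * algebraMap C L x₀ + algebraMap C L x₀ ^ 2 + algebraMap C L W.A)
      (q := W.Y) (W.alg_u (tr_of_lt hC hb0 hy)) (W.frac (hmemF _ _ hset).1 (hmemF _ _ hset).2)
      (hDm _ hX' hY').2 (hDm _ hX' hY').1
      (add_mem (add_mem (add_mem (pow_mem hX' _) (mul_mem hX' (Subalgebra.algebraMap_mem _ _)))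
        (pow_mem (Subalgebra.algebraMap_mem _ _) _)) (Subalgebra.algebraMap_mem _ _)) hY'
      (by
        have : W.X ^ 2 + W.X * algebraMap C L x₀ + algebraMap C L x₀ ^ 2 + algebraMap C L W.A =
          algebraMap C L (3 * x₀ ^ 2 + W.A) + a * (W.X + 2 * algebraMap C L x₀) := by
          simp only [map_add, map_mul, map_pow, map_ofNat]; rw [ha]; ring
        rw [this]
        apply val_eq_one_add (val_const hC hd) (val_mul_lt hx _)
        exact add_mem hXO (mul_mem (by exact_mod_cast natCast_mem O 2) (hC _)))
      (by
        rw [hy0, map_zero] at hxyL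
        rw [hbY, ha]; linear_combination -heq + hxyL)
      (by
        have : W.D b = algebraMap C L (3 * x₀ ^ 2 + W.A) + a * (3 * (W.X + algebraMap C L x₀)) := by
          rw [hDb]
          simp only [map_add, map_mul, map_pow, map_ofNat]; rw [ha]; ring
        rw [this]
        apply val_eq_one_add (val_const hC hd) (val_mul_lt hx _)
        exact mul_mem (by exact_mod_cast natCast_mem O 3) (add_mem hXO (hC _)))
    exact ⟨⟨_, hch.1⟩, fun O' hC' hx' hy' => hch.2 O' hC' hy' hx'⟩
  · obtain ⟨hX', hY'⟩ := hmemB a b rfl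
    have h2y : (2 * y₀) ≠ 0 := mul_ne_zero two_ne_zero hy0
    have hch := chart (D := W.D) hC ha0 hx hy
      (e := W.Y + algebraMap C L y₀)
      (q := W.X ^ 2 + W.X * algebraMap C L x₀ + algebraMap C L x₀ ^ 2 + algebraMap C L W.A)
      (W.alg_u (tr_of_lt hC ha0 hx)) (W.frac (hmemF _ _ rfl).1 (hmemF _ _ rfl).2)
      (hDm _ hX' hY').1 (hDm _ hX' hY').2
      (add_mem hY' (Subalgebra.algebraMap_mem _ _))
      (add_mem (add_mem (add_mem (pow_mem hX' _) (mul_mem hX' (Subalgebra.algebraMap_mem _ _)))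
        (pow_mem (Subalgebra.algebraMap_mem _ _) _)) (Subalgebra.algebraMap_mem _ _))
      (by
        have : W.Y + algebraMap C L y₀ = algebraMap C L (2 * y₀) + b := by
          simp only [map_mul, map_ofNat]; rw [hb]; ring
        rw [this]
        exact val_eq_one_add (val_const hC h2y) hy)
      (by rw [ha, hb]; linear_combination heq - hxyL)
      (by
        have : W.D a = algebraMap C L (2 * y₀) + b * 2 := by
          rw [hDa]
          simp only [map_mul, map_ofNat]; rw [hb]; ring
        rw [this]
        exact val_eq_one_add (val_const hC h2y) (val_mul_lt hy (by exact_mod_cast natCast_mem O 2)))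
    exact ⟨⟨_, hch.1⟩, fun O' hC' hx' hy' => hch.2 O' hC' hx' hy'⟩

theorem exists_pt [IsAlgClosed C] {O : ValuationSubring L} (hC : ∀ c : C, algebraMap C L c ∈ O)
    (hO : O ≠ ⊤) (hX : W.X ∈ O) : ∃ x₀ y₀ : C, O.valuation (W.X - algebraMap C L x₀) < 1 ∧
      O.valuation (W.Y - algebraMap C L y₀) < 1 := by
  have hYO : W.Y ∈ O := by
    apply mem_of_integral
    apply IsIntegral.of_pow (n := 2) (by norm_num)
    rw [W.eq]
    have : W.X ^ 3 + algebraMap C L W.A * W.X + algebraMap C L W.B ∈ O :=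
      add_mem (add_mem (pow_mem hX _) (mul_mem (hC _) hX)) (hC _)
    exact isIntegral_algebraMap (R := O) (A := L) (x := ⟨_, this⟩)
  obtain ⟨x₀, hx₀⟩ : ∃ x₀ : C, O.valuation (W.X - algebraMap C L x₀) < 1 := by
    by_contra hcon
    push Not at hcon
    apply hO
    have h1 : ∀ c : C, O.valuation (W.X - algebraMap C L c) = 1 := fun c =>
      le_antisymm (mem_iff_val.mp (sub_mem hX (hC c))) (hcon c)
    have h2 : ∀ p : C[X], p ≠ 0 → O.valuation (aeval W.X p) = 1 := by
      intro p hp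
      have hs := IsAlgClosed.splits p
      rw [hs.eq_prod_roots, map_mul, map_mul, aeval_C, val_const hC (leadingCoeff_ne_zero.mpr hp), one_mul,
        map_multiset_prod, map_multiset_prod, Multiset.map_map, Multiset.map_map]
      apply Multiset.prod_eq_one
      intro x hx
      obtain ⟨c, _, rfl⟩ := Multiset.mem_map.mp hx
      simp [h1 c]
    apply eq_top_of_alg (IntermediateField.adjoin C {W.X}) _ W.alg
    intro z hz
    obtain ⟨a, b, rfl⟩ := (IntermediateField.mem_adjoin_simple_iff C z).mp hz
    by_cases ha : a = 0
    · rw [ha]; simp [O.zero_mem]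
    by_cases hb : b = 0
    · rw [hb]; simp [O.zero_mem]
    rw [mem_iff_val, map_div₀, h2 a ha, h2 b hb]; simp
  obtain ⟨y, hy⟩ := IsAlgClosed.exists_pow_nat_eq (x₀ ^ 3 + W.A * x₀ + W.B) (show 0 < 2 by norm_num)
  have h3 : (W.Y - algebraMap C L y) * (W.Y - algebraMap C L (-y)) =
      (W.X - algebraMap C L x₀) * (W.X ^ 2 + W.X * algebraMap C L x₀ + algebraMap C L x₀ ^ 2 + algebraMap C L W.A) := by
    have hyL := congrArg (algebraMap C L) hy
    simp only [map_add, map_mul, map_pow, map_neg] at hyL ⊢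
    linear_combination W.eq - hyL
  have h4 : O.valuation ((W.Y - algebraMap C L y) * (W.Y - algebraMap C L (-y))) < 1 := by
    rw [h3]
    apply val_mul_lt hx₀
    exact add_mem (add_mem (add_mem (pow_mem hX _) (mul_mem hX (hC _))) (pow_mem (hC _) _)) (hC _)
  by_cases h5 : O.valuation (W.Y - algebraMap C L y) < 1
  · exact ⟨x₀, y, hx₀, h5⟩
  · refine ⟨x₀, -y, hx₀, ?_⟩
    have h6 : O.valuation (W.Y - algebraMap C L y) = 1 :=
      le_antisymm (mem_iff_val.mp (sub_mem hYO (hC _))) (not_lt.mp h5)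
    rwa [map_mul, h6, one_mul] at h4

theorem nice [IsAlgClosed C] {O : ValuationSubring L} (hC : ∀ c : C, algebraMap C L c ∈ O)
    (hO : O ≠ ⊤) : ∃ u, NiceAt W.D O u := by
  by_cases hX : W.X ∈ O
  · obtain ⟨x₀, y₀, hx, hy⟩ := W.exists_pt hC hO hX
    exact (W.pt_chart hC hx hy).1
  · exact ⟨_, (W.inf_chart hC hX).1⟩

end WD

/-- the intersection of all valuation rings containing `C` is `C` -/
theorem const_of_mem_all [IsAlgClosed C] {z : L}
    (h : ∀ O : ValuationSubring L, (∀ c : C, algebraMap C L c ∈ O) → O ≠ ⊤ → z ∈ O) :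
    ∃ c : C, algebraMap C L c = z := by
  apply const_of_alg
  have h1 := iInf_valuationSubring_superset (K := L) (s := Set.range (algebraMap C L))
  have h2 : z ∈ (integralClosure (Subring.closure (Set.range (algebraMap C L))) L).toSubring := by
    rw [← h1, Subring.mem_iInf]
    rintro ⟨V, hV⟩
    by_cases hT : V = ⊤
    · subst hT; exact ValuationSubring.mem_top z
    · exact h V (fun c => hV ⟨c, rfl⟩) hT
  have h3 : IsIntegral (Subring.closure (Set.range (algebraMap C L))) z := h2
  have h4 : Subring.closure (Set.range (algebraMap C L)) = (algebraMap C L).range := by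
    rw [← RingHom.coe_range, Subring.closure_eq]
  rw [h4] at h3
  obtain ⟨p, hp, hpz⟩ := h3
  have hl : p ∈ Polynomial.lifts ((algebraMap C L).rangeRestrict) := by
    rw [Polynomial.lifts_iff_coeff_lifts]
    intro n
    exact (algebraMap C L).rangeRestrict_surjective (p.coeff n)
  obtain ⟨q, hq, _, hqm⟩ := Polynomial.lifts_and_degree_eq_and_monic hl hp
  refine ⟨q, hqm.ne_zero, ?_⟩
  rw [← hq, eval₂_map] at hpz
  exact hpz
end
end CrBir
end

section
namespace CrBir
open Polynomial

section
variable {C L : Type*} [Field C] [Field L] [Algebra C L] [CharZero C]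

theorem Div5.ne {O : ValuationSubring L} {h : L} (H : Div5 O h) : h ≠ 0 := by
  obtain ⟨w, hw, h1⟩ := H
  rintro rfl
  rw [map_zero] at h1
  exact absurd h1.symm (pow_ne_zero _ (val_pos hw).ne')

theorem Div5.mul {O : ValuationSubring L} {a b : L} (H : Div5 O a) (H' : Div5 O b) : Div5 O (a * b) := by
  obtain ⟨w, hw, h1⟩ := H
  obtain ⟨w', hw', h1'⟩ := H'
  exact ⟨w * w', mul_ne_zero hw hw', by rw [map_mul, h1, h1', map_mul, mul_pow]⟩

theorem Div5.inv {O : ValuationSubring L} {a : L} (H : Div5 O a) : Div5 O a⁻¹ := by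
  obtain ⟨w, hw, h1⟩ := H
  exact ⟨w⁻¹, inv_ne_zero hw, by rw [map_inv₀, h1, map_inv₀, inv_pow]⟩

theorem Div5.of_val {O : ValuationSubring L} {a b : L} (H : Div5 O a)
    (h : O.valuation a = O.valuation b) : Div5 O b := by
  obtain ⟨w, hw, h1⟩ := H
  exact ⟨w, hw, h ▸ h1⟩

theorem Div5.pow5 (O : ValuationSubring L) {a : L} (ha : a ≠ 0) : Div5 O (a ^ 5) :=
  ⟨a, ha, map_pow _ _ _⟩

theorem Div5.pow {O : ValuationSubring L} {a : L} (H : Div5 O a) (n : ℕ) : Div5 O (a ^ n) := by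
  obtain ⟨w, hw, h1⟩ := H
  exact ⟨w ^ n, pow_ne_zero _ hw, by rw [map_pow, h1, map_pow, ← pow_mul, ← pow_mul, mul_comm]⟩

theorem Div5.unit {O : ValuationSubring L} {a : L} (h : O.valuation a = 1) : Div5 O a :=
  ⟨1, one_ne_zero, by simp [h]⟩

theorem Div5.of_mul {O : ValuationSubring L} {a b : L} (H : Div5 O (a * b)) (H' : Div5 O b) : Div5 O a := by
  have h := H.mul H'.inv
  rwa [mul_assoc, mul_inv_cancel₀ H'.ne, mul_one] at h

theorem Div5.of_pow {O : ValuationSubring L} {a : L} {j : ℕ} (hj : j = 1 ∨ j = 2) (H : Div5 O (a ^ j)) :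
    Div5 O a := by
  rcases hj with rfl | rfl
  · simpa using H
  · have ha : a ≠ 0 := by have := H.ne; rintro rfl; simp at this
    have h := (Div5.pow5 O ha).mul (H.pow 2).inv
    have e : a ^ 5 * ((a ^ 2) ^ 2)⁻¹ = a := by field_simp
    rwa [e] at h

theorem NiceAt.val54 {D : Derivation C L L} {O : ValuationSubring L} {u : L}
    (H : NiceAt D O u) {a b : L} {i j : ℤ} (ha : O.valuation a = O.valuation u ^ i)
    (hb : O.valuation b = O.valuation u ^ j) : O.valuation (a ^ 5 / b ^ 4) = O.valuation u ^ (5 * i - 4 * j) := by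
  have h0 : O.valuation u ≠ 0 := (val_pos H.u0).ne'
  rw [map_div₀, map_pow, map_pow, ha, hb, zpow_sub₀ h0, ← zpow_natCast, ← zpow_mul, ← zpow_natCast, ← zpow_mul]
  congr 2 <;> (push_cast; ring)

theorem val_one_add_of_gt {O : ValuationSubring L} {z : L} (h : 1 < O.valuation z) :
    O.valuation (1 + z) = O.valuation z := by
  rw [Valuation.map_add_eq_of_lt_right]; simpa using h

theorem WD.fermat (W : WD C L) [IsAlgClosed C] {z : L}
    (h : ∀ O : ValuationSubring L, (∀ c : C, algebraMap C L c ∈ O) → O ≠ ⊤ → Div5 O (1 + z ^ 5)) :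
    ∃ c : C, algebraMap C L c = z := by
  by_contra hcon
  obtain ⟨O₁, hC₁, hT₁, hz₁⟩ : ∃ O : ValuationSubring L, (∀ c : C, algebraMap C L c ∈ O) ∧ O ≠ ⊤ ∧ z ∉ O := by
    by_contra h2
    push Not at h2
    exact hcon (const_of_mem_all h2)
  have key : ∀ O : ValuationSubring L, (∀ c : C, algebraMap C L c ∈ O) → O ≠ ⊤ → z ∉ O →
      O.valuation ((W.D z) ^ 5 / (1 + z ^ 5) ^ 4) < 1 ∧ W.D z ≠ 0 := by
    intro O hC hO hz
    obtain ⟨u, H⟩ := W.nice hC hO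
    have hz1 : 1 < O.valuation z := by rwa [mem_iff_val, not_le] at hz
    have hz0 : z ≠ 0 := by rintro rfl; exact hz O.zero_mem
    obtain ⟨n, hn⟩ := H.ord z hz0
    have hn0 : n < 0 := by
      by_contra h
      rw [hn] at hz1
      exact absurd (H.zpow_le_one.mpr (not_lt.mp h)) (not_le.mpr hz1)
    have h1 := H.dord n hn0.ne hn
    have h2 : O.valuation (1 + z ^ 5) = O.valuation u ^ (5 * n) := by
      rw [val_one_add_of_gt (by rw [map_pow]; exact one_lt_pow₀ hz1 (by norm_num)), map_pow, hn, ← zpow_natCast,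
        ← zpow_mul]
      congr 1; push_cast; ring
    refine ⟨?_, ?_⟩
    · rw [H.val54 h1 h2, H.zpow_lt_one]; omega
    · intro h0
      rw [h0, map_zero] at h1
      exact absurd h1.symm (zpow_ne_zero _ (val_pos H.u0).ne')
  obtain ⟨hlt, hD0⟩ := key O₁ hC₁ hT₁ hz₁
  have h0 := (h O₁ hC₁ hT₁).ne
  obtain ⟨c, hc⟩ : ∃ c : C, algebraMap C L c = (W.D z) ^ 5 / (1 + z ^ 5) ^ 4 := by
    apply const_of_mem_all
    intro O hC hO
    by_cases hz : z ∈ O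
    swap
    · exact mem_iff_val.mpr (key O hC hO hz).1.le
    obtain ⟨u, H⟩ := W.nice hC hO
    have hDz := H.dO z hz
    have h1O : 1 + z ^ 5 ∈ O := add_mem (one_mem O) (pow_mem hz 5)
    rcases (mem_iff_val.mp h1O).lt_or_eq with h1 | h1
    · obtain ⟨w, hw, hw1⟩ := h O hC hO
      obtain ⟨n, hn⟩ := H.ord w hw
      have h2 : O.valuation (1 + z ^ 5) = O.valuation u ^ (5 * n) := by
        rw [hw1, hn, ← zpow_natCast, ← zpow_mul]; congr 1; push_cast; ring
      have hn0 : 0 < n := by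
        rw [h2, H.zpow_lt_one] at h1; omega
      have h3 := H.dord (5 * n) (by omega) h2
      have hvz : O.valuation z = 1 := by
        rcases (mem_iff_val.mp hz).lt_or_eq with h4 | h4
        · exfalso
          have := val_eq_one_add (O := O) (a := 1) (b := z ^ 5) (map_one _) (by
            rw [map_pow]; exact pow_lt_one₀ zero_le h4 (by norm_num))
          rw [this] at h1
          exact lt_irrefl _ h1
        · exact h4
      have h4 : W.D (1 + z ^ 5) = algebraMap C L 5 * z ^ 4 * W.D z := by
        rw [map_add, Derivation.leibniz_pow]
        simp only [Derivation.map_one_eq_zero, smul_eq_mul, nsmul_eq_mul, map_ofNat]; push_cast; ring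
      have h5 : O.valuation (W.D z) = O.valuation u ^ (5 * n - 1) := by
        rw [← h3, h4, map_mul, map_mul, map_pow, hvz, val_const hC (by norm_num)]
        simp
      rw [mem_iff_val, H.val54 h5 h2, H.zpow_le_one]
      omega
    · rw [mem_iff_val, map_div₀, map_pow, map_pow, h1, one_pow, div_one]
      exact pow_le_one₀ zero_le (mem_iff_val.mp hDz)
  rw [← hc, val_const hC₁] at hlt
  · exact lt_irrefl _ hlt
  · rintro rfl
    rw [map_zero] at hc
    exact div_ne_zero (pow_ne_zero 5 hD0) (pow_ne_zero 4 h0) hc.symm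

/-- the special products -/
def Pi5 {R : Type*} [CommRing R] : List R → R
  | [] => 1
  | z :: l => Pi5 l * (1 + Pi5 l ^ 5 * z ^ 25)

theorem Pi5_map {R S : Type*} [CommRing R] [CommRing S] (f : R →+* S) (l : List R) :
    f (Pi5 l) = Pi5 (l.map f) := by
  induction l with
  | nil => simp [Pi5]
  | cons z l ih => simp [Pi5, ih]

theorem div5_step (O : ValuationSubring L) {p z : L} (h : Div5 O (p * (1 + p ^ 5 * z ^ 25))) : Div5 O p := by
  have hp : p ≠ 0 := by intro h0; apply h.ne; rw [h0]; ring
  have e : p ^ 5 * z ^ 25 = (p * z ^ 5) ^ 5 := by ring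
  rw [e] at h
  rcases lt_trichotomy (O.valuation (p * z ^ 5)) 1 with h1 | h1 | h1
  · refine h.of_val ?_
    rw [map_mul, val_eq_one_add (map_one _), mul_one]
    rw [map_pow]; exact pow_lt_one₀ zero_le h1 (by norm_num)
  · have hz : z ≠ 0 := by rintro rfl; simp at h1
    exact Div5.of_mul (Div5.unit h1) (Div5.pow5 O hz)
  · have h2 : 1 < O.valuation ((p * z ^ 5) ^ 5) := by rw [map_pow]; exact one_lt_pow₀ h1 (by norm_num)
    have h3 : p * z ^ 5 ≠ 0 := by intro h0; rw [h0] at h1; simp at h1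
    exact h.of_mul ((Div5.pow5 O h3).of_val (val_one_add_of_gt h2).symm)

theorem WD.list (W : WD C L) [IsAlgClosed C] (l : List L)
    (h : ∀ O : ValuationSubring L, (∀ c : C, algebraMap C L c ∈ O) → O ≠ ⊤ → Div5 O (Pi5 l)) (h0 : Pi5 l ≠ 0) :
    ∀ z ∈ l, ∃ c : C, algebraMap C L c = z := by
  induction l with
  | nil => simp
  | cons z l ih =>
    have hp0 : Pi5 l ≠ 0 := by intro h; apply h0; simp [Pi5, h]
    have hp : ∀ O : ValuationSubring L, (∀ c : C, algebraMap C L c ∈ O) → O ≠ ⊤ → Div5 O (Pi5 l) :=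
      fun O hC hO => div5_step O (h O hC hO)
    have hl := ih hp hp0
    have h1 : ∃ c : C, algebraMap C L c = Pi5 l * z ^ 5 := by
      apply W.fermat
      intro O hC hO
      have h2 := h O hC hO
      change Div5 O (Pi5 l * _) at h2
      rw [mul_comm] at h2
      have h3 := h2.of_mul (hp O hC hO)
      have e : Pi5 l ^ 5 * z ^ 25 = (Pi5 l * z ^ 5) ^ 5 := by ring
      rwa [e] at h3
    have h4 : ∀ l : List L, (∀ z ∈ l, ∃ c : C, algebraMap C L c = z) → ∃ c : C, algebraMap C L c = Pi5 l := by
      intro l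
      induction l with
      | nil => intro _; exact ⟨1, by simp [Pi5]⟩
      | cons z l ih =>
        intro h
        obtain ⟨c, hc⟩ := ih (fun z hz => h z (by simp [hz]))
        obtain ⟨d, hd⟩ := h z (by simp)
        exact ⟨c * (1 + c ^ 5 * d ^ 25), by simp [Pi5, hc, hd]⟩
    obtain ⟨c, hc⟩ := h1
    obtain ⟨d, hd⟩ := h4 l hl
    intro w hw
    rcases List.mem_cons.mp hw with rfl | hw
    · apply const_of_alg
      have : w ^ 5 = algebraMap C L (c / d) := by
        rw [map_div₀, hc, hd]; field_simp
      have h5 : IsAlgebraic C (w ^ 5) := this ▸ isAlgebraic_algebraMap _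
      exact h5.of_pow (by norm_num)
    · exact hl w hw

/-- invariant differentials pull back to constant multiples -/
theorem WD.eta (W : WD C L) [IsAlgClosed C] {x y : L} {a b : C}
    (eq : y ^ 2 = x ^ 3 + algebraMap C L a * x + algebraMap C L b) (disc : 4 * a ^ 3 + 27 * b ^ 2 ≠ 0) :
    ∃ c : C, W.D x = algebraMap C L c * (2 * y) := by
  haveI : CharZero L := charZero_of_injective_algebraMap (FaithfulSMul.algebraMap_injective C L)
  have hder : 2 * y * W.D y = (3 * x ^ 2 + algebraMap C L a) * W.D x := by
    have h1 := congrArg W.D eq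
    rw [Derivation.leibniz_pow] at h1
    simp only [map_add, Derivation.leibniz, Derivation.leibniz_pow, Derivation.map_algebraMap,
      smul_eq_mul, nsmul_eq_mul] at h1
    push_cast at h1
    linear_combination h1
  by_cases hy0 : y = 0
  · refine ⟨0, ?_⟩
    have : IsAlgebraic C x := by
      refine ⟨Polynomial.X ^ 3 + Polynomial.C a * Polynomial.X + Polynomial.C b, ?_, ?_⟩
      · intro h
        have := congrArg (fun p => p.coeff 3) h
        simp [coeff_X, coeff_C] at this
      · simp; rw [← eq, hy0]; ring
    obtain ⟨c, rfl⟩ := const_of_alg this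
    simp
  suffices ∃ c : C, algebraMap C L c = W.D x / (2 * y) by
    obtain ⟨c, hc⟩ := this
    exact ⟨c, by rw [hc]; field_simp⟩
  apply const_of_mem_all
  intro O hC hO
  have h2 : O.valuation 2 = 1 := by
    have := val_const (L := L) hC (show (2 : C) ≠ 0 by norm_num)
    rwa [map_ofNat] at this
  obtain ⟨u, H⟩ := W.nice hC hO
  rw [mem_iff_val, map_div₀, map_mul, h2, one_mul]
  by_cases hx : x ∈ O
  · have hyO : y ∈ O := by
      apply mem_of_integral
      apply IsIntegral.of_pow (n := 2) (by norm_num)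
      rw [eq]
      have : x ^ 3 + algebraMap C L a * x + algebraMap C L b ∈ O :=
        add_mem (add_mem (pow_mem hx _) (mul_mem (hC _) hx)) (hC _)
      exact isIntegral_algebraMap (R := O) (A := L) (x := ⟨_, this⟩)
    rcases (mem_iff_val.mp hyO).lt_or_eq with hy | hy
    · have hd : O.valuation (3 * x ^ 2 + algebraMap C L a) = 1 := by
        have hmem : 3 * x ^ 2 + algebraMap C L a ∈ O :=
          add_mem (mul_mem (by exact_mod_cast natCast_mem O 3) (pow_mem hx _)) (hC _)
        by_contra hne
        have hlt := lt_of_le_of_ne (mem_iff_val.mp hmem) hne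
        -- discriminant identity
        have hid : algebraMap C L (4 * a ^ 3 + 27 * b ^ 2) =
            y * (y * (27 * (algebraMap C L b - x ^ 3 - algebraMap C L a * x)))
            + (3 * x ^ 2 + algebraMap C L a) * ((3 * x ^ 2 + algebraMap C L a) * (3 * x ^ 2 + 4 * algebraMap C L a)) := by
          simp only [map_add, map_mul, map_pow, map_ofNat]
          linear_combination (-27) * (algebraMap C L b - x ^ 3 - algebraMap C L a * x) * eq
        have := val_const (L := L) hC disc
        rw [hid] at this
        have h27 : (27 : L) ∈ O := by exact_mod_cast natCast_mem O 27
        have h3 : (3 : L) ∈ O := by exact_mod_cast natCast_mem O 3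
        have h4 : (4 : L) ∈ O := by exact_mod_cast natCast_mem O 4
        have hlt2 := val_add_lt (val_mul_lt hy (b := (y * (27 * (algebraMap C L b - x ^ 3 - algebraMap C L a * x))))
            (mul_mem hyO (mul_mem h27 (sub_mem (sub_mem (hC _) (pow_mem hx _)) (mul_mem (hC _) hx)))))
          (val_mul_lt hlt (b := ((3 * x ^ 2 + algebraMap C L a) * (3 * x ^ 2 + 4 * algebraMap C L a)))
            (mul_mem hmem (add_mem (mul_mem h3 (pow_mem hx _)) (mul_mem h4 (hC _)))))
        rw [this] at hlt2
        exact lt_irrefl _ hlt2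
      have h5 := congrArg O.valuation hder
      rw [map_mul, map_mul, map_mul, hd, h2, one_mul, one_mul] at h5
      rw [← h5, mul_div_cancel_left₀ _ (val_pos hy0).ne']
      exact mem_iff_val.mp (H.dO _ hyO)
    · rw [hy, div_one]
      exact mem_iff_val.mp (H.dO _ hx)
  · obtain ⟨h3, _, _, _⟩ := WD.inf_vals hC eq hx
    have hx0 : x ≠ 0 := by rintro rfl; exact hx O.zero_mem
    have hx1 : 1 < O.valuation x := by rwa [mem_iff_val, not_le] at hx
    obtain ⟨n, hn⟩ := H.ord x hx0
    obtain ⟨m, hm⟩ := H.ord y hy0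
    have hn0 : n < 0 := by
      by_contra h
      rw [hn] at hx1
      exact absurd (H.zpow_le_one.mpr (not_lt.mp h)) (not_le.mpr hx1)
    have h4 : m * 2 = n * 3 := by
      rw [hm, hn, ← zpow_natCast, ← zpow_mul, ← zpow_natCast, ← zpow_mul, H.zpow_eq] at h3
      exact_mod_cast h3
    rw [H.dord n hn0.ne hn, hm, ← zpow_sub₀ (val_pos H.u0).ne', H.zpow_le_one]
    omega

end
end CrBir
end

section
namespace CrBir
open Polynomial IntermediateField.algebraAdjoinAdjoin

section
variable {C L : Type*} [Field C] [Field L] [Algebra C L] [CharZero C]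

theorem WD.ker (W : WD C L) [IsAlgClosed C] {z : L} (h : W.D z = 0) : ∃ c : C, algebraMap C L c = z := by
  apply const_of_mem_all
  intro O hC hO
  obtain ⟨u, H⟩ := W.nice hC hO
  by_contra hz
  have hz0 : z ≠ 0 := by rintro rfl; exact hz (zero_mem O)
  obtain ⟨n, hn⟩ := H.ord z hz0
  have hn0 : n ≠ 0 := by
    rintro rfl
    apply hz; rw [mem_iff_val, hn]; simp
  have := H.dord n hn0 hn
  rw [h, map_zero] at this
  exact zpow_ne_zero _ ((Valuation.ne_zero_iff _).mpr H.u0) this.symm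

/-- rational-function elements as quotients -/
theorem mem_adjoin_simple_div {X z : L} (hz : z ∈ IntermediateField.adjoin C {X}) :
    ∃ p q : C[X], q.aeval X ≠ 0 ∧ z = p.aeval X / q.aeval X := by
  rw [IntermediateField.mem_adjoin_simple_iff] at hz
  obtain ⟨r, s, h⟩ := hz
  by_cases hs : aeval X s = 0
  · exact ⟨0, 1, by simp, by rw [h, hs]; simp⟩
  · exact ⟨r, s, hs, h⟩

theorem WD.Y_not_mem (W : WD C L) : W.Y ∉ IntermediateField.adjoin C {W.X} := by
  intro h
  obtain ⟨p, q, hq, h⟩ := mem_adjoin_simple_div h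
  have h1 := W.eq
  rw [h, div_pow, div_eq_iff (pow_ne_zero 2 hq)] at h1
  have h2 : p ^ 2 = (Polynomial.X ^ 3 + Polynomial.C W.A * Polynomial.X + Polynomial.C W.B) * q ^ 2 := by
    apply transcendental_iff_injective.mp W.tr
    simpa using h1
  have hq0 : q ≠ 0 := by rintro rfl; simp at hq
  have hd : (Polynomial.X ^ 3 + Polynomial.C W.A * Polynomial.X + Polynomial.C W.B).natDegree = 3 := by compute_degree!
  have h3 := congrArg natDegree h2
  rw [natDegree_pow, natDegree_mul (by intro h; rw [h] at hd; simp at hd) (pow_ne_zero 2 hq0), natDegree_pow, hd] at h3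
  omega

theorem WD.D_simple (W : WD C L) {z : L} (hz : z ∈ IntermediateField.adjoin C {W.X}) :
    ∃ w ∈ IntermediateField.adjoin C {W.X}, W.D z = w * W.Y := by
  induction hz using IntermediateField.adjoin_induction with
  | mem x hx =>
    rw [Set.mem_singleton_iff] at hx
    subst hx
    exact ⟨2, by exact_mod_cast natCast_mem (IntermediateField.adjoin C {W.X}) 2, W.hDX⟩
  | algebraMap x => exact ⟨0, zero_mem _, by simp⟩
  | add x y hx hy h1 h2 =>
    obtain ⟨a, ha, h1⟩ := h1
    obtain ⟨b, hb, h2⟩ := h2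
    exact ⟨a + b, add_mem ha hb, by rw [map_add, h1, h2]; ring⟩
  | inv x hx h1 =>
    obtain ⟨a, ha, h1⟩ := h1
    refine ⟨- x⁻¹ ^ 2 * a, mul_mem (neg_mem (pow_mem (inv_mem hx) 2)) ha, ?_⟩
    rw [Derivation.leibniz_inv, h1, smul_eq_mul]
    ring
  | mul x y hx hy h1 h2 =>
    obtain ⟨a, ha, h1⟩ := h1
    obtain ⟨b, hb, h2⟩ := h2
    exact ⟨x * b + y * a, add_mem (mul_mem hx hb) (mul_mem hy ha), by
      rw [Derivation.leibniz, h1, h2, smul_eq_mul, smul_eq_mul]; ring⟩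

theorem WD.pt (W : WD C L) [IsAlgClosed C] {x y : L} {a b : C}
    (eq : y ^ 2 = x ^ 3 + algebraMap C L a * x + algebraMap C L b) (disc : 4 * a ^ 3 + 27 * b ^ 2 ≠ 0)
    (hx : x ∈ IntermediateField.adjoin C {W.X}) (hy : y ∈ IntermediateField.adjoin C {W.X}) :
    ∃ c : C, algebraMap C L c = x := by
  obtain ⟨c, hc⟩ := W.eta eq disc
  obtain ⟨w, hw, h⟩ := W.D_simple hx
  apply W.ker
  by_contra hne
  apply W.Y_not_mem
  have hw0 : w ≠ 0 := by rintro rfl; apply hne; rw [h]; simp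
  have : W.Y = algebraMap C L c * (2 * y) / w := by
    rw [← hc, h]; field_simp
  rw [this]
  exact div_mem (mul_mem (IntermediateField.algebraMap_mem _ c) (mul_mem
    (by exact_mod_cast natCast_mem (IntermediateField.adjoin C {W.X}) 2) hy)) hw

theorem exists_WD_sub {X Y : L} {A B : C}
    (eq : Y ^ 2 = X ^ 3 + algebraMap C L A * X + algebraMap C L B)
    (disc : 4 * A ^ 3 + 27 * B ^ 2 ≠ 0) (tr : Transcendental C X) :
    ∃ W : WD C (IntermediateField.adjoin C {X, Y}), (W.X : L) = X ∧ (W.Y : L) = Y ∧ W.A = A ∧ W.B = B := by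
  let E := IntermediateField.adjoin C {X, Y}
  have hX : X ∈ E := IntermediateField.subset_adjoin C _ (by simp)
  have hY : Y ∈ E := IntermediateField.subset_adjoin C _ (by simp)
  obtain ⟨W, h1, h2, h3, h4⟩ := exists_WD (C := C) (L := E) (X := ⟨X, hX⟩) (Y := ⟨Y, hY⟩) (A := A) (B := B)
    (by ext; simpa using eq) disc (by
      intro h; apply tr
      exact h.algebraMap (A := L)) (by
      apply IntermediateField.lift_injective
      have := IntermediateField.lift_adjoin C E {⟨X, hX⟩, ⟨Y, hY⟩}
      rw [this, IntermediateField.lift_top, Set.image_pair])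
  exact ⟨W, by rw [h1], by rw [h2], h3, h4⟩

theorem exists_WD_of_tr [IsAlgClosed L] {ξ : L} (tr : Transcendental C ξ) :
    ∃ (E : IntermediateField C L) (W : WD C E), (W.X : L) = ξ := by
  obtain ⟨η, hη⟩ := IsAlgClosed.exists_pow_nat_eq (ξ ^ 3 - ξ) (n := 2) (by norm_num)
  obtain ⟨W, h, -⟩ := exists_WD_sub (C := C) (X := ξ) (Y := η) (A := -1) (B := 0)
    (by rw [hη]; simp; ring) (by norm_num) tr
  exact ⟨_, W, h⟩

theorem pt_const' [IsAlgClosed L] [IsAlgClosed C] {ξ x y : L} {a b : C}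
    (eq : y ^ 2 = x ^ 3 + algebraMap C L a * x + algebraMap C L b) (disc : 4 * a ^ 3 + 27 * b ^ 2 ≠ 0)
    (hx : x ∈ IntermediateField.adjoin C {ξ}) (hy : y ∈ IntermediateField.adjoin C {ξ}) :
    ∃ c : C, algebraMap C L c = x := by
  by_cases hξ : Transcendental C ξ
  · obtain ⟨E, W, hW⟩ := exists_WD_of_tr hξ
    have key : ∀ z ∈ IntermediateField.adjoin C {ξ}, ∃ z' : E, (z' : L) = z ∧ z' ∈ IntermediateField.adjoin C {W.X} := by
      intro z hz
      have := IntermediateField.lift_adjoin C E {W.X}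
      rw [Set.image_singleton, hW] at this
      rw [← this] at hz
      have hzE : z ∈ E := IntermediateField.lift_le _ hz
      exact ⟨⟨z, hzE⟩, rfl, (IntermediateField.mem_lift ⟨z, hzE⟩).mp hz⟩
    obtain ⟨x', rfl, hx'⟩ := key x hx
    obtain ⟨y', rfl, hy'⟩ := key y hy
    obtain ⟨c, hc⟩ := W.pt (x := x') (y := y') (a := a) (b := b) (by
      apply (algebraMap E L).injective
      simpa using eq) disc hx' hy'
    exact ⟨c, by rw [← hc]; rfl⟩
  · apply const_of_alg
    have : Algebra.IsAlgebraic C (IntermediateField.adjoin C {ξ}) := by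
      apply IntermediateField.isAlgebraic_adjoin
      intro z hz
      rw [Set.mem_singleton_iff] at hz; subst hz
      exact (not_not.mp hξ : IsAlgebraic C z).isIntegral
    exact (this.isAlgebraic ⟨x, hx⟩).algebraMap (A := L)
end
end CrBir
end

section
namespace CrBir
open Polynomial IntermediateField.algebraAdjoinAdjoin
universe u v

/-- `Z/k` is non-uniruled in a strong sense -/
def NU (k : Type v) (Z : Type u) [Field k] [Field Z] [Algebra k Z] : Prop :=
  ∀ (C M : Type u) [Field C] [Field M] [Algebra C M] [IsAlgClosed C] [IsAlgClosed M]
    (ψ : Z →+* M) (ξ : M), (∀ c : k, ψ (algebraMap k Z c) ∈ (algebraMap C M).fieldRange) →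
    (∀ z, ψ z ∈ IntermediateField.adjoin C {ξ}) → ∀ z, ψ z ∈ (algebraMap C M).fieldRange

section
variable {k : Type v} [Field k]

theorem mem_range_of_alg {C M : Type*} [Field C] [Field M] [Algebra C M] [IsAlgClosed C] {z : M}
    (h : IsAlgebraic C z) : z ∈ (algebraMap C M).fieldRange := const_of_alg h

theorem mem_range_of_alg_sub {C M : Type*} [Field C] [Field M] [Algebra C M] [IsAlgClosed C]
    (S : Subfield M) (hS : ∀ z ∈ S, z ∈ (algebraMap C M).fieldRange) {z : M}
    (h : IsAlgebraic S z) : z ∈ (algebraMap C M).fieldRange := by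
  apply mem_range_of_alg
  obtain ⟨p, hp0, hp⟩ := h
  have hlift : ∃ q : C[X], q.map (algebraMap C M) = p.map (algebraMap S M) := by
    rw [← Polynomial.mem_lifts, Polynomial.lifts_iff_coeff_lifts]
    intro n
    rw [Polynomial.coeff_map]
    exact hS _ (p.coeff n).2
  obtain ⟨q, hq⟩ := hlift
  refine ⟨q, ?_, ?_⟩
  · rintro rfl
    apply hp0
    rw [Polynomial.map_zero] at hq
    exact (Polynomial.map_eq_zero _).mp hq.symm
  · rw [aeval_def, ← eval_map, hq, eval_map, ← aeval_def, hp]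

/-- ring hom sending a generating set into a subfield -/
theorem hom_mem_of_gen {Z M : Type*} [Field Z] [Field M] [Algebra k Z] (ψ : Z →+* M) (S : Subfield M)
    {s : Set Z} (hk : ∀ c : k, ψ (algebraMap k Z c) ∈ S) (hs : ∀ z ∈ s, ψ z ∈ S) :
    ∀ z ∈ IntermediateField.adjoin k s, ψ z ∈ S := by
  intro z hz
  induction hz using IntermediateField.adjoin_induction with
  | mem x hx => exact hs x hx
  | algebraMap x => exact hk x
  | add x y hx hy h1 h2 => rw [map_add]; exact add_mem h1 h2
  | inv x hx h1 => rw [map_inv₀]; exact inv_mem h1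
  | mul x y hx hy h1 h2 => rw [map_mul]; exact mul_mem h1 h2

theorem NU.of_alg {Z L : Type u} [Field Z] [Field L] [Algebra k Z] [Algebra k L] (H : NU k Z)
    (j : Z →ₐ[k] L) (hj : ∀ l : L, IsAlgebraic j.fieldRange l) : NU k L := by
  intro C M _ _ _ _ _ ψ ξ hk hξ z
  have h1 := H C M (ψ.comp j.toRingHom) ξ (fun c => by simpa using hk c) (fun z => hξ _)
  apply mem_range_of_alg_sub ((j.fieldRange.toSubfield).map ψ)
  · rintro _ ⟨_, ⟨y, rfl⟩, rfl⟩
    exact h1 y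
  · obtain ⟨p, hp0, hp⟩ := hj z
    let f : j.fieldRange →+* (j.fieldRange.toSubfield).map ψ :=
      (ψ.comp (algebraMap j.fieldRange L)).codRestrict _ (fun x => ⟨x, x.2, rfl⟩)
    refine ⟨p.map f, (Polynomial.map_ne_zero_iff f.injective).mpr hp0, ?_⟩
    have hf : (algebraMap ((j.fieldRange.toSubfield).map ψ) M).comp f = ψ.comp (algebraMap j.fieldRange L) := rfl
    rw [aeval_def, eval₂_map, hf, ← hom_eval₂, ← aeval_def, hp, map_zero]

theorem NU.of_equiv {Z L : Type u} [Field Z] [Field L] [Algebra k Z] [Algebra k L] (H : NU k Z)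
    (j : Z ≃ₐ[k] L) : NU k L :=
  H.of_alg j.toAlgHom (fun l => by
    have : l ∈ j.toAlgHom.fieldRange := ⟨j.symm l, by simp⟩
    exact isAlgebraic_algebraMap (A := L) (⟨l, this⟩ : j.toAlgHom.fieldRange))

/-- the function `f` on the curve -/
def cf {R : Type*} [CommRing R] (x w : R) : R := -(w + x ^ 2 + x * w)

theorem cf_map {R S : Type*} [CommRing R] [CommRing S] (f : R →+* S) (x w : R) : f (cf x w) = cf (f x) (f w) := by
  simp [cf]

theorem cf_mul {R : Type*} [CommRing R] {x w : R} (h : w ^ 2 + w = x ^ 3 - x ^ 2) :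
    cf x w * cf x (-1 - w) = -x ^ 5 := by
  unfold cf
  linear_combination (-(1+x)^2) * h

theorem cf_ne {R : Type*} [Field R] {x w : R} (h : w ^ 2 + w = x ^ 3 - x ^ 2) (hx : x ≠ 0) : cf x w ≠ 0 := by
  intro h0
  have := cf_mul h
  rw [h0, zero_mul] at this
  exact pow_ne_zero 5 hx (by linear_combination this)

structure CData (k : Type v) (F' κ : Type u) [Field k] [Field F'] [Field κ] [Algebra k F'] [Algebra k κ]
    (j : ℕ) (s : F') where
  φ : F' →ₐ[k] κ
  x : κ
  w : κ
  r : κ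
  eq : w ^ 2 + w = x ^ 3 - x ^ 2
  hr : r ^ 5 = φ s ^ j * cf x w
  tr : Transcendental φ.fieldRange x

variable {F' κ : Type u} [Field F'] [Field κ] [Algebra k F'] [Algebra k κ]

def CData.Z {j : ℕ} {s : F'} (D : CData k F' κ j s) : IntermediateField k κ :=
  IntermediateField.adjoin k (Set.range D.φ ∪ {D.x, D.w, D.r})

theorem CData.x_mem {j : ℕ} {s : F'} (D : CData k F' κ j s) : D.x ∈ D.Z :=
  IntermediateField.subset_adjoin _ _ (by simp)
theorem CData.w_mem {j : ℕ} {s : F'} (D : CData k F' κ j s) : D.w ∈ D.Z :=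
  IntermediateField.subset_adjoin _ _ (by simp)
theorem CData.r_mem {j : ℕ} {s : F'} (D : CData k F' κ j s) : D.r ∈ D.Z :=
  IntermediateField.subset_adjoin _ _ (by simp)
theorem CData.φ_mem {j : ℕ} {s : F'} (D : CData k F' κ j s) (z : F') : D.φ z ∈ D.Z :=
  IntermediateField.subset_adjoin _ _ (by simp)
theorem CData.x_ne {j : ℕ} {s : F'} (D : CData k F' κ j s) : D.x ≠ 0 := by
  intro h; apply D.tr; rw [h]; exact isAlgebraic_zero

variable [CharZero k]

theorem short_w {M : Type*} [Field M] [CharZero M] {x w : M} (h : w ^ 2 + w = x ^ 3 - x ^ 2) :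
    (w + 1/2) ^ 2 = (x - 1/3) ^ 3 + (-1/3) * (x - 1/3) + 19/108 := by
  linear_combination h

theorem pt_const_w {C M : Type*} [Field C] [Field M] [CharZero C] [Algebra C M] [IsAlgClosed C] [IsAlgClosed M]
    {x w ξ : M} (h : w ^ 2 + w = x ^ 3 - x ^ 2) (hx : x ∈ IntermediateField.adjoin C {ξ})
    (hw : w ∈ IntermediateField.adjoin C {ξ}) : x ∈ (algebraMap C M).fieldRange ∧ w ∈ (algebraMap C M).fieldRange := by
  haveI : CharZero M := charZero_of_injective_algebraMap (FaithfulSMul.algebraMap_injective C M)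
  have h1 : ∀ q : ℚ, (q : M) ∈ IntermediateField.adjoin C {ξ} := fun q => SubfieldClass.ratCast_mem _ q
  have hxr : x ∈ (algebraMap C M).fieldRange := by
    have := pt_const' (C := C) (a := -1/3) (b := 19/108) (ξ := ξ) (y := w + 1/2) (x := x - 1/3)
      (by rw [short_w h]; simp only [map_div₀, map_neg, map_one, map_ofNat]) (by norm_num) (sub_mem hx (by simpa using h1 (1/3))) (add_mem hw (by simpa using h1 (1/2)))
    obtain ⟨c, hc⟩ := this
    exact ⟨c + 1/3, by rw [map_add, hc]; simp only [map_div₀, map_one, map_ofNat]; ring⟩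
  refine ⟨hxr, mem_range_of_alg ?_⟩
  obtain ⟨c, rfl⟩ := hxr
  refine ⟨Polynomial.X ^ 2 + Polynomial.X - Polynomial.C (c ^ 3 - c ^ 2), ?_, ?_⟩
  · intro h
    have := congrArg (fun p => p.coeff 2) h
    simp [-map_sub, -map_pow, coeff_X, coeff_C] at this
  · simp [h]

theorem CData.nu {j : ℕ} (hj : j = 1 ∨ j = 2) {l : List F'} (hl : IntermediateField.adjoin k {z | z ∈ l} = ⊤)
    (hs : Pi5 l ≠ 0) (D : CData k F' κ j (Pi5 l)) : NU k D.Z := by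
  intro C M _ _ _ _ _ ψ ξ hk hξ
  haveI : CharZero F' := charZero_of_injective_algebraMap (FaithfulSMul.algebraMap_injective k F')
  haveI : CharZero D.Z := charZero_of_injective_algebraMap (FaithfulSMul.algebraMap_injective k D.Z)
  haveI : CharZero M := charZero_of_injective_ringHom ψ.injective
  haveI : CharZero C := (algebraMap C M).charZero_iff (algebraMap C M).injective |>.mpr inferInstance
  set x := ψ ⟨D.x, D.x_mem⟩ with hx
  set w := ψ ⟨D.w, D.w_mem⟩ with hw
  set r := ψ ⟨D.r, D.r_mem⟩ with hr
  let φ : F' →+* M := ψ.comp ((D.φ : F' →+* κ).codRestrict D.Z.toSubfield D.φ_mem)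
  have eq : w ^ 2 + w = x ^ 3 - x ^ 2 := by
    simp only [hx, hw, ← map_pow, ← map_add, ← map_sub]
    congr 1; ext; simpa using D.eq
  have hr5 : r ^ 5 = φ (Pi5 l) ^ j * cf x w := by
    have : (⟨D.r, D.r_mem⟩ : D.Z) ^ 5 = (⟨D.φ (Pi5 l), D.φ_mem _⟩ : D.Z) ^ j * cf ⟨D.x, D.x_mem⟩ ⟨D.w, D.w_mem⟩ := by
      ext; exact D.hr
    have := congrArg ψ this
    rw [map_pow, map_mul, map_pow, cf_map] at this
    exact this
  have hx0 : x ≠ 0 := by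
    rw [hx, _root_.map_ne_zero]; intro h; exact D.x_ne (congrArg Subtype.val h)
  have hf0 := cf_ne eq hx0
  obtain ⟨hxC, hwC⟩ := pt_const_w eq (hξ _) (hξ _)
  have hfC : cf x w ∈ (algebraMap C M).fieldRange := by
    unfold cf
    exact neg_mem (add_mem (add_mem hwC (pow_mem hxC 2)) (mul_mem hxC hwC))
  have hkφ : ∀ c : k, φ (algebraMap k F' c) ∈ (algebraMap C M).fieldRange := by
    intro c
    have := hk c
    convert this using 1
    change ψ _ = ψ _
    congr 1
    ext
    exact D.φ.commutes c
  have hφ : ∀ z : F', φ z ∈ (algebraMap C M).fieldRange := by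
    by_cases hξt : Transcendental C ξ
    · obtain ⟨E, W, hWξ⟩ := exists_WD_of_tr hξt
      have hξE : ∀ z ∈ IntermediateField.adjoin C {ξ}, z ∈ E := by
        intro z hz
        apply (IntermediateField.adjoin_le_iff.mpr _) hz
        rw [Set.singleton_subset_iff, ← hWξ]; exact W.X.2
      let φE : F' →+* E := φ.codRestrict E.toSubfield (fun z => hξE _ (hξ _))
      have hlist := W.list (l.map φE) (by
        intro O hC hO
        rw [← Pi5_map]
        apply Div5.of_pow hj
        obtain ⟨c, hc⟩ := hfC
        have hc0 : c ≠ 0 := by rintro rfl; rw [map_zero] at hc; exact hf0 hc.symm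
        have hrE : (⟨r, hξE _ (hξ _)⟩ : E) ^ 5 = φE (Pi5 l) ^ j * algebraMap C E c := by
          apply Subtype.ext
          change r ^ 5 = φ (Pi5 l) ^ j * algebraMap C M c
          rw [hc, hr5]
        have h5 : (⟨r, hξE _ (hξ _)⟩ : E) ≠ 0 := by
          intro h
          rw [h, zero_pow (by norm_num)] at hrE
          rcases mul_eq_zero.mp hrE.symm with h | h
          · exact hs ((map_eq_zero _).mp (pow_eq_zero_iff (by omega) |>.mp h))
          · exact hc0 ((map_eq_zero _).mp h)
        have h6 := Div5.pow5 O h5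
        rw [hrE] at h6
        exact h6.of_mul (Div5.unit (val_const hC hc0))) (by
        rw [← Pi5_map]; exact (_root_.map_ne_zero _).mpr hs)
      intro z
      apply hom_mem_of_gen φ _ hkφ (s := {z | z ∈ l})
      · intro y hy
        obtain ⟨c, hc⟩ := hlist (φE y) (List.mem_map_of_mem hy)
        exact ⟨c, congrArg Subtype.val hc⟩
      · rw [hl]; trivial
    · intro z
      apply mem_range_of_alg
      have : Algebra.IsAlgebraic C (IntermediateField.adjoin C {ξ}) := by
        apply IntermediateField.isAlgebraic_adjoin
        intro z hz
        rw [Set.mem_singleton_iff] at hz; subst hz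
        exact (not_not.mp hξt : IsAlgebraic C z).isIntegral
      exact (this.isAlgebraic ⟨φ z, hξ _⟩).algebraMap (A := M)
  have hrC : r ∈ (algebraMap C M).fieldRange := by
    apply mem_range_of_alg
    obtain ⟨c, hc⟩ : r ^ 5 ∈ (algebraMap C M).fieldRange := by
      rw [hr5]; exact mul_mem (pow_mem (hφ _) _) hfC
    exact IsAlgebraic.of_pow (n := 5) (by norm_num) (hc ▸ isAlgebraic_algebraMap c)
  rintro ⟨z, hz⟩
  revert hz
  suffices ∀ z ∈ D.Z, ∃ h : z ∈ D.Z, ψ ⟨z, h⟩ ∈ (algebraMap C M).fieldRange by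
    intro hz; exact (this z hz).2
  intro z hz
  unfold CData.Z at hz
  induction hz using IntermediateField.adjoin_induction with
  | mem x hx =>
    rcases hx with ⟨y, rfl⟩ | rfl | rfl | rfl
    · exact ⟨D.φ_mem y, hφ y⟩
    · exact ⟨D.x_mem, hxC⟩
    · exact ⟨D.w_mem, hwC⟩
    · exact ⟨D.r_mem, hrC⟩
  | algebraMap x => exact ⟨_, hk x⟩
  | add x y hx hy h1 h2 =>
    obtain ⟨a, ha⟩ := h1
    obtain ⟨b, hb⟩ := h2
    exact ⟨add_mem a b, by have := add_mem ha hb; rw [← map_add] at this; exact this⟩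
  | inv x hx h1 =>
    obtain ⟨a, ha⟩ := h1
    exact ⟨inv_mem a, by have := inv_mem ha; rw [← map_inv₀] at this; exact this⟩
  | mul x y hx hy h1 h2 =>
    obtain ⟨a, ha⟩ := h1
    obtain ⟨b, hb⟩ := h2
    exact ⟨mul_mem a b, by have := mul_mem ha hb; rw [← map_mul] at this; exact this⟩
end
end CrBir
end

section
namespace CrBir
open Polynomial IntermediateField.algebraAdjoinAdjoin

section
variable {C L : Type*} [Field C] [Field L] [Algebra C L] [CharZero C]

theorem pt_const [IsAlgClosed C] {ξ x y : L} {a b : C}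
    (eq : y ^ 2 = x ^ 3 + algebraMap C L a * x + algebraMap C L b) (disc : 4 * a ^ 3 + 27 * b ^ 2 ≠ 0)
    (hx : x ∈ IntermediateField.adjoin C {ξ}) (hy : y ∈ IntermediateField.adjoin C {ξ}) :
    ∃ c : C, algebraMap C L c = x := by
  let N := AlgebraicClosure L
  let f : L →ₐ[C] N := IsScalarTower.toAlgHom C L N
  have key : ∀ z ∈ IntermediateField.adjoin C {ξ}, f z ∈ IntermediateField.adjoin C {f ξ} := by
    intro z hz
    have : f z ∈ (IntermediateField.adjoin C {ξ}).map f := ⟨z, hz, rfl⟩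
    rwa [IntermediateField.adjoin_map, Set.image_singleton] at this
  obtain ⟨c, hc⟩ := pt_const' (C := C) (L := N) (x := f x) (y := f y) (a := a) (b := b) (ξ := f ξ)
    (by rw [← map_pow, eq]; simp) disc (key x hx) (key y hy)
  exact ⟨c, f.injective (by change f _ = f _; rw [← hc]; simp)⟩

/-- regular away from the point at infinity -/
def WD.Reg (W : WD C L) (z : L) : Prop :=
  ∀ O : ValuationSubring L, (∀ c : C, algebraMap C L c ∈ O) → O ≠ ⊤ → W.X ∈ O → z ∈ O

theorem WD.Y_reg (W : WD C L) : W.Reg W.Y := by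
  intro O hC hO hX
  apply mem_of_integral
  apply IsIntegral.of_pow (n := 2) (by norm_num)
  rw [W.eq]
  have : W.X ^ 3 + algebraMap C L W.A * W.X + algebraMap C L W.B ∈ O :=
    add_mem (add_mem (pow_mem hX _) (mul_mem (hC _) hX)) (hC _)
  exact isIntegral_algebraMap (R := O) (A := L) (x := ⟨_, this⟩)

theorem ne_top_of_not_mem {O : ValuationSubring L} {z : L} (h : z ∉ O) : O ≠ ⊤ := by
  rintro rfl; exact h (ValuationSubring.mem_top z)

theorem WD.inf_ord (W : WD C L) {O : ValuationSubring L} (hC : ∀ c : C, algebraMap C L c ∈ O) (hX : W.X ∉ O) :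
    O.valuation W.X = O.valuation (W.X / W.Y) ^ (-2 : ℤ) ∧ O.valuation W.Y = O.valuation (W.X / W.Y) ^ (-3 : ℤ) := by
  obtain ⟨h1, h2, h3, h4⟩ := WD.inf_vals hC W.eq hX
  have hX0 : W.X ≠ 0 := by rintro h; apply hX; rw [h]; exact zero_mem O
  have a0 : O.valuation W.X ≠ 0 := (Valuation.ne_zero_iff _).mpr hX0
  have b0 : O.valuation W.Y ≠ 0 := (Valuation.ne_zero_iff _).mpr h4
  rw [map_div₀]
  constructor
  · rw [zpow_neg]
    apply eq_inv_of_mul_eq_one_left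
    rw [show (2 : ℤ) = ((2 : ℕ) : ℤ) from rfl, zpow_natCast, div_pow, h1, ← mul_div_assoc, ← pow_succ', div_self (pow_ne_zero _ a0)]
  · rw [zpow_neg]
    apply eq_inv_of_mul_eq_one_left
    rw [show (3 : ℤ) = ((3 : ℕ) : ℤ) from rfl, zpow_natCast, div_pow, ← h1, ← mul_div_assoc, ← pow_succ', div_self (pow_ne_zero _ b0)]

theorem NiceAt.lt_ord {D : Derivation C L L} {O : ValuationSubring L} {u : L}
    (H : NiceAt D O u) {n : ℤ} {z : L} (h : O.valuation z < O.valuation u ^ n) : O.valuation z ≤ O.valuation u ^ (n + 1) := by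
  by_cases hz : z = 0
  · rw [hz, map_zero]; exact zero_le
  · obtain ⟨m, hm⟩ := H.ord z hz
    rw [hm, H.zpow_lt] at h
    rw [hm, H.zpow_le]; omega

theorem NiceAt.sub_lead {D : Derivation C L L} {O : ValuationSubring L} {u : L}
    (H : NiceAt D O u) {n : ℤ} {z h : L} (hh : O.valuation h = O.valuation u ^ n)
    (hz : O.valuation z ≤ O.valuation u ^ n) :
    ∃ c : C, O.valuation (z - algebraMap C L c * h) ≤ O.valuation u ^ (n + 1) := by
  have h0 : O.valuation h ≠ 0 := by rw [hh]; exact zpow_ne_zero _ ((Valuation.ne_zero_iff _).mpr H.u0)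
  have h0' : h ≠ 0 := (Valuation.ne_zero_iff _).mp h0
  have h1 : z / h ∈ O := by
    rw [mem_iff_val, map_div₀, div_le_one₀ (zero_lt_iff.mpr h0), hh]; exact hz
  obtain ⟨c, hc⟩ := H.res _ h1
  refine ⟨c, H.lt_ord ?_⟩
  have : z - algebraMap C L c * h = (z / h - algebraMap C L c) * h := by field_simp
  rw [this, map_mul, ← hh]
  exact mul_lt_of_lt_one_left (zero_lt_iff.mpr h0) hc

theorem NiceAt.unif_eq {D D' : Derivation C L L} {O : ValuationSubring L} {u u' : L}
    (H : NiceAt D O u) (H' : NiceAt D' O u') : O.valuation u = O.valuation u' := by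
  have h1 : O.valuation u ≤ O.valuation u' := by
    have := H'.lt_ord (n := 0) (z := u) (by simpa using H.um)
    simpa using this
  have h2 : O.valuation u' ≤ O.valuation u := by
    have := H.lt_ord (n := 0) (z := u') (by simpa using H'.um)
    simpa using this
  exact le_antisymm h1 h2

theorem WD.exists_inf (W : WD C L) [IsAlgClosed C] :
    ∃ O : ValuationSubring L, (∀ c : C, algebraMap C L c ∈ O) ∧ W.X ∉ O := by
  by_contra hcon
  push Not at hcon
  obtain ⟨c, hc⟩ := const_of_mem_all (C := C) (z := W.X) (fun O hC _ => hcon O hC)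
  exact W.tr (hc ▸ isAlgebraic_algebraMap c)

theorem WD.const_of_reg (W : WD C L) [IsAlgClosed C] {O : ValuationSubring L} (hC : ∀ c : C, algebraMap C L c ∈ O)
    (hX : W.X ∉ O) {z : L} (hz : W.Reg z) (h : z ∈ O) : ∃ c : C, algebraMap C L c = z := by
  apply const_of_mem_all
  intro O' hC' hO'
  by_cases hX' : W.X ∈ O'
  · exact hz O' hC' hO' hX'
  · rwa [W.unique_inf hC' hC hX' hX]

theorem WD.simple_pole (W : WD C L) [IsAlgClosed C] {O : ValuationSubring L} (hC : ∀ c : C, algebraMap C L c ∈ O)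
    (hX : W.X ∉ O) {h : L} (hh : W.Reg h) (hv : O.valuation h ≤ O.valuation (W.X / W.Y) ^ (-1 : ℤ)) :
    ∃ c : C, algebraMap C L c = h := by
  have H := (W.inf_chart hC hX).1
  by_contra hcon
  have hO : h ∉ O := fun h1 => hcon (W.const_of_reg hC hX hh h1)
  have hv1 : O.valuation h = O.valuation (W.X / W.Y) ^ (-1 : ℤ) := by
    apply le_antisymm hv
    by_contra hlt
    have := H.lt_ord (not_le.mp hlt)
    apply hO; rw [mem_iff_val]; simpa using this
  have key : ∀ n : ℕ, ∀ z : L, W.Reg z → O.valuation z ≤ O.valuation (W.X / W.Y) ^ (-(n : ℤ)) →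
      z ∈ IntermediateField.adjoin C {h} := by
    intro n
    induction n with
    | zero =>
      intro z hz h1
      obtain ⟨c, rfl⟩ := W.const_of_reg hC hX hz (by rw [mem_iff_val]; simpa using h1)
      exact IntermediateField.algebraMap_mem _ c
    | succ n ih =>
      intro z hz h1
      have h2 : O.valuation (h ^ (n + 1)) = O.valuation (W.X / W.Y) ^ (-((n + 1 : ℕ) : ℤ)) := by
        rw [map_pow, hv1, ← zpow_natCast, ← zpow_mul]; congr 1; push_cast; ring
      obtain ⟨c, hc⟩ := H.sub_lead h2 h1
      have h3 := ih (z - algebraMap C L c * h ^ (n + 1))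
        (fun O' a b d => sub_mem (hz O' a b d) (mul_mem (a c) (pow_mem (hh O' a b d) _))) (by
        convert hc using 2; push_cast; ring)
      have h4 : z = (z - algebraMap C L c * h ^ (n + 1)) + algebraMap C L c * h ^ (n + 1) := by ring
      rw [h4]
      exact add_mem h3 (mul_mem (IntermediateField.algebraMap_mem _ c)
        (pow_mem (IntermediateField.mem_adjoin_simple_self C h) _))
  obtain ⟨hoX, hoY⟩ := W.inf_ord hC hX
  obtain ⟨c, hc⟩ := pt_const (ξ := h) W.eq W.disc (key 2 _ (fun O' a b d => d) hoX.le)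
    (key 3 _ W.Y_reg hoY.le)
  exact W.tr (hc ▸ isAlgebraic_algebraMap c)

theorem WD.two_pole (W : WD C L) [IsAlgClosed C] {O : ValuationSubring L} (hC : ∀ c : C, algebraMap C L c ∈ O)
    (hX : W.X ∉ O) {h : L} (hh : W.Reg h) (hv : O.valuation h ≤ O.valuation (W.X / W.Y) ^ (-2 : ℤ)) :
    ∃ γ β : C, h = algebraMap C L γ * W.X + algebraMap C L β := by
  have H := (W.inf_chart hC hX).1
  obtain ⟨c, hc⟩ := H.sub_lead (W.inf_ord hC hX).1 hv
  obtain ⟨b, hb⟩ := W.simple_pole hC hX (h := h - algebraMap C L c * W.X)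
    (fun O' a b d => sub_mem (hh O' a b d) (mul_mem (a c) d)) hc
  exact ⟨c, b, by rw [hb]; ring⟩

/-- the translate of `X` by a constant point -/
theorem WD.translate (W : WD C L) [IsAlgClosed C] {O : ValuationSubring L} (hC : ∀ c : C, algebraMap C L c ∈ O)
    (hO : O ≠ ⊤) : ∃ (Xa u : L), NiceAt W.D O u ∧ O.valuation Xa = O.valuation u ^ (-2 : ℤ) ∧
      W.D Xa ^ 2 = 4 * (Xa ^ 3 + algebraMap C L W.A * Xa + algebraMap C L W.B) ∧
      ∀ O' : ValuationSubring L, (∀ c : C, algebraMap C L c ∈ O') → O' ≠ ⊤ → O' ≠ O → Xa ∈ O' := by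
  haveI : CharZero L := charZero_of_injective_algebraMap (FaithfulSMul.algebraMap_injective C L)
  by_cases hX : W.X ∈ O
  swap
  · refine ⟨W.X, W.X / W.Y, (W.inf_chart hC hX).1, (W.inf_ord hC hX).1, ?_, ?_⟩
    · rw [W.hDX, ← W.eq]; ring
    · intro O' hC' hO' hne
      by_contra h
      exact hne (W.unique_inf hC' hC h hX)
  obtain ⟨x₀', y₀', hx, hy⟩ := W.exists_pt hC hO hX
  obtain ⟨⟨u, H⟩, huniq⟩ := W.pt_chart hC hx hy
  set X := W.X with hXd
  set Y := W.Y with hYd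
  set A := algebraMap C L W.A with hA
  set B := algebraMap C L W.B with hB
  set x₀ := algebraMap C L x₀' with hx₀
  set y₀ := algebraMap C L y₀' with hy₀
  have heq : Y ^ 2 = X ^ 3 + A * X + B := W.eq
  have hYO : Y ∈ O := W.Y_reg O hC hO hX
  have hcu : ∀ O' : ValuationSubring L, (∀ c : C, algebraMap C L c ∈ O') → x₀ ∈ O' ∧ y₀ ∈ O' ∧ A ∈ O' ∧ B ∈ O' :=
    fun O' h => ⟨h _, h _, h _, h _⟩
  obtain ⟨hx₀O, hy₀O, hAO, hBO⟩ := hcu O hC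
  have h2O : ∀ n : ℕ, (n : L) ∈ O := fun n => natCast_mem O n
  -- the constant point lies on the curve
  have heq₀ : y₀ ^ 2 = x₀ ^ 3 + A * x₀ + B := by
    have h2 : algebraMap C L (y₀' ^ 2 - (x₀' ^ 3 + W.A * x₀' + W.B)) =
        (X - x₀) * (X ^ 2 + X * x₀ + x₀ ^ 2 + A) - (Y - y₀) * (Y + y₀) := by
      simp only [map_sub, map_add, map_mul, map_pow]
      linear_combination heq
    have hlt : O.valuation (algebraMap C L (y₀' ^ 2 - (x₀' ^ 3 + W.A * x₀' + W.B))) < 1 := by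
      rw [h2]
      apply Valuation.map_sub_lt
      · exact val_mul_lt hx (add_mem (add_mem (add_mem (pow_mem hX _) (mul_mem hX hx₀O)) (pow_mem hx₀O _)) hAO)
      · exact val_mul_lt hy (add_mem hYO hy₀O)
    by_contra hne
    have hne' : y₀' ^ 2 - (x₀' ^ 3 + W.A * x₀' + W.B) ≠ 0 := by
      intro h0
      apply hne
      have := congrArg (algebraMap C L) h0
      simp only [map_sub, map_add, map_mul, map_pow, map_zero] at this
      exact sub_eq_zero.mp this
    rw [val_const hC hne'] at hlt
    exact lt_irrefl _ hlt
  have hd0 : X - x₀ ≠ 0 := by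
    intro h
    apply W.tr
    rw [← hXd, sub_eq_zero.mp h]
    exact isAlgebraic_algebraMap _
  set q := (Y + y₀) / (X - x₀) with hq
  have e1 : q * (X - x₀) = Y + y₀ := by rw [hq]; field_simp
  have e2 : q * (Y - y₀) = X ^ 2 + X * x₀ + x₀ ^ 2 + A := by
    apply mul_right_cancel₀ hd0
    linear_combination (Y - y₀) * e1 + heq - heq₀
  set Xa := q ^ 2 - X - x₀ with hXa
  have hDq : W.D q = X - Xa := by
    have h1 := congrArg W.D e1
    rw [Derivation.leibniz, map_sub, map_add, W.hDX, W.hDY, hx₀, hy₀, Derivation.map_algebraMap,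
      Derivation.map_algebraMap, smul_eq_mul, smul_eq_mul] at h1
    apply mul_right_cancel₀ hd0
    clear_value q
    linear_combination h1 - e2 + q * e1
  have hDXa : W.D Xa = -2 * (Y + q * (Xa - X)) := by
    rw [hXa, map_sub, map_sub, Derivation.leibniz_pow, hDq, W.hDX, hx₀, Derivation.map_algebraMap, ← hXa]
    simp only [smul_eq_mul, nsmul_eq_mul]
    push_cast
    ring
  have ode : W.D Xa ^ 2 = 4 * (Xa ^ 3 + A * Xa + B) := by
    rw [hDXa]
    clear_value q
    rw [hXa]
    linear_combination (-4) * ((q * e1 - e2) * (Xa - X) - heq)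
  -- one of the two derivatives is a unit
  have hq1 : O.valuation q = O.valuation u ^ (-1 : ℤ) := by
    have hdord : ∀ z : L, O.valuation z < 1 → O.valuation (W.D z) = 1 → O.valuation z = O.valuation u := by
      intro z hz hD
      have hz0 : z ≠ 0 := by rintro rfl; simp at hD
      obtain ⟨n, hn⟩ := H.ord z hz0
      have hn0 : n ≠ 0 := by rintro rfl; rw [hn] at hz; simp at hz
      have := H.dord n hn0 hn
      rw [hD, eq_comm, H.zpow_eq_one] at this
      rw [hn, show n = 1 by omega, zpow_one]
    have h2v : O.valuation (2 : L) = 1 := by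
      have := val_const (L := L) hC (show (2 : C) ≠ 0 by norm_num)
      rwa [map_ofNat] at this
    rcases (mem_iff_val.mp hYO).lt_or_eq with hYm | hYu
    · have hd : O.valuation (3 * X ^ 2 + A) = 1 := by
        have h3 : (3 : L) ∈ O := by exact_mod_cast natCast_mem O 3
        have h27 : (27 : L) ∈ O := by exact_mod_cast natCast_mem O 27
        have h4 : (4 : L) ∈ O := by exact_mod_cast natCast_mem O 4
        have hmem : 3 * X ^ 2 + A ∈ O := add_mem (mul_mem h3 (pow_mem hX _)) hAO
        by_contra hne
        have hlt := lt_of_le_of_ne (mem_iff_val.mp hmem) hne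
        have hid : algebraMap C L (4 * W.A ^ 3 + 27 * W.B ^ 2) =
            Y * (Y * (27 * (B - X ^ 3 - A * X)))
            + (3 * X ^ 2 + A) * ((3 * X ^ 2 + A) * (3 * X ^ 2 + 4 * A)) := by
          simp only [map_add, map_mul, map_pow, map_ofNat]
          linear_combination (-27) * (B - X ^ 3 - A * X) * heq
        have := val_const (L := L) hC W.disc
        rw [hid] at this
        have hlt2 := val_add_lt (val_mul_lt hYm (b := (Y * (27 * (B - X ^ 3 - A * X))))
            (mul_mem hYO (mul_mem h27 (sub_mem (sub_mem hBO (pow_mem hX _)) (mul_mem hAO hX)))))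
          (val_mul_lt hlt (b := ((3 * X ^ 2 + A) * (3 * X ^ 2 + 4 * A)))
            (mul_mem hmem (add_mem (mul_mem h3 (pow_mem hX _)) (mul_mem h4 hAO))))
        rw [this] at hlt2
        exact lt_irrefl _ hlt2
      have hu := hdord (Y - y₀) hy (by rw [map_sub, W.hDY, hy₀, Derivation.map_algebraMap, sub_zero]; exact hd)
      have hnum : O.valuation (X ^ 2 + X * x₀ + x₀ ^ 2 + A) = 1 := by
        have : X ^ 2 + X * x₀ + x₀ ^ 2 + A = (3 * X ^ 2 + A) + (X - x₀) * (-2 * X - x₀) := by ring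
        rw [this]
        apply val_eq_one_add hd
        exact val_mul_lt hx (sub_mem (mul_mem (neg_mem (by exact_mod_cast h2O 2)) hX) hx₀O)
      rw [← e2, map_mul, hu] at hnum
      rw [zpow_neg, zpow_one]
      exact eq_inv_of_mul_eq_one_left hnum
    · have hu := hdord (X - x₀) hx (by rw [map_sub, W.hDX, hx₀, Derivation.map_algebraMap, sub_zero, map_mul, h2v, hYu, one_mul])
      have hnum : O.valuation (Y + y₀) = 1 := by
        have : Y + y₀ = 2 * Y + - (Y - y₀) := by ring
        rw [this]
        apply val_eq_one_add (by rw [map_mul, h2v, hYu, one_mul])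
        rwa [Valuation.map_neg]
      rw [← e1, map_mul, hu] at hnum
      rw [zpow_neg, zpow_one]
      exact eq_inv_of_mul_eq_one_left hnum
  refine ⟨Xa, u, H, ?_, ode, ?_⟩
  · have h1 : O.valuation (q ^ 2) = O.valuation u ^ (-2 : ℤ) := by
      rw [map_pow, hq1, ← zpow_natCast, ← zpow_mul]; rfl
    have : Xa = q ^ 2 + -(X + x₀) := by rw [hXa]; ring
    rw [this, Valuation.map_add_eq_of_lt_left, h1]
    rw [Valuation.map_neg, h1]
    apply lt_of_le_of_lt (mem_iff_val.mp (add_mem hX hx₀O))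
    rw [← zpow_zero (O.valuation u), H.zpow_lt]; norm_num
  · intro O' hC' hO' hne
    obtain ⟨hx₀O', hy₀O', hAO', hBO'⟩ := hcu O' hC'
    by_cases hX' : X ∈ O'
    · have hqO : q ∈ O' := by
        rcases (mem_iff_val.mp (sub_mem hX' hx₀O')).lt_or_eq with h1 | h1
        · rcases (mem_iff_val.mp (sub_mem (W.Y_reg O' hC' hO' hX') hy₀O')).lt_or_eq with h2 | h2
          · exfalso
            apply hne
            exact le_antisymm ((W.pt_chart hC' h1 h2).2 O hC hx hy) (huniq O' hC' h1 h2)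
          · rw [mem_iff_val]
            have : O'.valuation q = O'.valuation (q * (Y - y₀)) := by rw [map_mul, h2, mul_one]
            rw [this, e2, ← mem_iff_val]
            exact (add_mem (add_mem (add_mem (pow_mem hX' _) (mul_mem hX' hx₀O')) (pow_mem hx₀O' _)) hAO')
        · rw [mem_iff_val]
          have : O'.valuation q = O'.valuation (q * (X - x₀)) := by rw [map_mul, h1, mul_one]
          rw [this, e1, ← mem_iff_val]
          exact add_mem (W.Y_reg O' hC' hO' hX') hy₀O'
      exact sub_mem (sub_mem (pow_mem hqO 2) hX') hx₀O'
    · obtain ⟨h1, h2, h3, h4⟩ := WD.inf_vals hC' W.eq hX'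
      have hX0 : X ≠ 0 := by rintro h; apply hX'; rw [h]; exact zero_mem O'
      have hXi : X⁻¹ ∈ O' := (O'.mem_or_inv_mem X).resolve_left hX'
      have hXi1 : O'.valuation X⁻¹ < 1 := by
        refine lt_of_le_of_ne (mem_iff_val.mp hXi) ?_
        intro h
        apply hX'
        rw [mem_iff_val]
        rw [map_inv₀, inv_eq_one] at h
        exact h.le
      have hYX : Y * X⁻¹ ^ 2 ∈ O' := by
        apply mem_of_integral
        apply IsIntegral.of_pow (n := 2) (by norm_num)
        have h5 : (Y * X⁻¹ ^ 2) ^ 2 = X⁻¹ + A * X⁻¹ ^ 3 + B * X⁻¹ ^ 4 := by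
          rw [mul_pow, heq]; field_simp
        rw [h5]
        have : X⁻¹ + A * X⁻¹ ^ 3 + B * X⁻¹ ^ 4 ∈ O' :=
          add_mem (add_mem hXi (mul_mem hAO' (pow_mem hXi _))) (mul_mem hBO' (pow_mem hXi _))
        exact isIntegral_algebraMap (R := O') (A := L) (x := ⟨_, this⟩)
      have hu1 : O'.valuation ((1 - x₀ * X⁻¹)) = 1 := by
        rw [sub_eq_add_neg]
        apply val_eq_one_add (map_one _)
        rw [Valuation.map_neg, mul_comm]; exact val_mul_lt hXi1 hx₀O'
      have h2' : (2 : L) ∈ O' := by exact_mod_cast natCast_mem O' 2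
      have h6 : Xa * (1 - x₀ * X⁻¹) ^ 2 = 2 * y₀ * (Y * X⁻¹ ^ 2) + x₀ + (x₀ ^ 2 + A) * X⁻¹ + (A * x₀ + 2 * B) * X⁻¹ ^ 2 := by
        have h7 : Xa * (X - x₀) ^ 2 = 2 * y₀ * Y + x₀ * X ^ 2 + (x₀ ^ 2 + A) * X + (A * x₀ + 2 * B) := by
          rw [hXa]
          linear_combination (q * (X - x₀) + Y + y₀) * e1 + heq + heq₀
        have h8 : (1 - x₀ * X⁻¹) = (X - x₀) * X⁻¹ := by field_simp
        rw [h8, mul_pow, ← mul_assoc, h7]; field_simp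
      rw [mem_iff_val]
      have : O'.valuation Xa = O'.valuation (Xa * (1 - x₀ * X⁻¹) ^ 2) := by rw [map_mul, map_pow, hu1, one_pow, mul_one]
      rw [this, h6, ← mem_iff_val]
      exact add_mem (add_mem (add_mem (mul_mem (mul_mem h2' hy₀O') hYX) hx₀O')
        (mul_mem (add_mem (pow_mem hx₀O' 2) hAO') hXi))
        (mul_mem (add_mem (mul_mem hAO' hx₀O') (mul_mem h2' hBO')) (pow_mem hXi 2))

theorem WD.lambda (W W' : WD C L) [IsAlgClosed C] (hA : W.A = W'.A) (hB : W.B = W'.B) (hA0 : W.A ≠ 0) (hB0 : W.B ≠ 0) :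
    W.D W'.X = 2 * W'.Y ∨ W.D W'.X = -(2 * W'.Y) := by
  haveI : CharZero L := charZero_of_injective_algebraMap (FaithfulSMul.algebraMap_injective C L)
  obtain ⟨lam, hlam⟩ := W.eta W'.eq W'.disc
  obtain ⟨O, hC, hX'⟩ := W'.exists_inf
  obtain ⟨Xa, u, H, hv, ode, hreg⟩ := W.translate hC (ne_top_of_not_mem hX')
  have hu := H.unif_eq (W'.inf_chart hC hX').1
  obtain ⟨γ, β, hγ⟩ := W'.two_pole hC hX' (h := Xa) (fun O' a b d => hreg O' a b (by rintro rfl; exact hX' d))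
    (by rw [hv, hu])
  have hγ0 : γ ≠ 0 := by
    rintro rfl
    have : Xa ∈ O := by rw [hγ]; simpa using hC β
    rw [mem_iff_val, hv, H.zpow_le_one] at this
    omega
  have hD : W.D Xa = algebraMap C L γ * (algebraMap C L lam * (2 * W'.Y)) := by
    rw [hγ, map_add, Derivation.leibniz, Derivation.map_algebraMap, Derivation.map_algebraMap, hlam]
    simp
  rw [hD, hγ] at ode
  have heq := W'.eq
  set g := algebraMap C L γ
  have h1 : (γ ^ 2 * lam ^ 2 - γ ^ 3 = 0) ∧ 3 * γ ^ 2 * β = 0 ∧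
      γ ^ 2 * lam ^ 2 * W.A - 3 * γ * β ^ 2 - W.A * γ = 0 ∧ γ ^ 2 * lam ^ 2 * W.B - β ^ 3 - W.A * β - W.B = 0 := by
    let p : C[X] := Polynomial.C (γ ^ 2 * lam ^ 2 - γ ^ 3) * Polynomial.X ^ 3 + Polynomial.C (-(3 * γ ^ 2 * β)) * Polynomial.X ^ 2
      + Polynomial.C (γ ^ 2 * lam ^ 2 * W.A - 3 * γ * β ^ 2 - W.A * γ) * Polynomial.X +
        Polynomial.C (γ ^ 2 * lam ^ 2 * W.B - β ^ 3 - W.A * β - W.B)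
    have hp : p = 0 := by
      apply transcendental_iff_injective.mp W'.tr
      simp only [p, map_add, map_mul, map_sub, map_pow, map_neg, aeval_C, aeval_X, map_zero, map_ofNat]
      rw [← hA, ← hB] at heq
      linear_combination (1/4) * ode - g ^ 2 * (algebraMap C L lam) ^ 2 * heq
    have c3 := congrArg (fun p => p.coeff 3) hp
    have c2 := congrArg (fun p => p.coeff 2) hp
    have c1 := congrArg (fun p => p.coeff 1) hp
    have c0 := congrArg (fun p => p.coeff 0) hp
    simp only [p, coeff_add, coeff_C_mul, coeff_X_pow, coeff_X, coeff_C, coeff_zero] at c3 c2 c1 c0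
    norm_num at c3 c2 c1 c0
    refine ⟨c3, ?_, c1, c0⟩
    simpa using c2
  obtain ⟨h3, h2, h1, h0⟩ := h1
  have hβ : β = 0 := by
    rcases mul_eq_zero.mp h2 with h | h
    · exfalso; rcases mul_eq_zero.mp h with h | h
      · norm_num at h
      · exact hγ0 (pow_eq_zero_iff (by norm_num) |>.mp h)
    · exact h
  subst hβ
  have e1 : lam ^ 2 = γ := by
    apply mul_left_cancel₀ (pow_ne_zero 2 hγ0); linear_combination h3
  have e2 : γ * γ = 1 := by
    apply mul_left_cancel₀ (mul_ne_zero hγ0 hA0)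
    rw [e1] at h1; linear_combination h1
  have e3 : γ * (γ * γ) = 1 := by
    apply mul_left_cancel₀ hB0
    rw [e1] at h0; linear_combination h0
  rw [e2, mul_one] at e3
  rw [e3] at e1
  rcases (by have h : (lam - 1) * (lam + 1) = 0 := by linear_combination e1
             rcases mul_eq_zero.mp h with h | h
             · exact Or.inl (sub_eq_zero.mp h)
             · exact Or.inr (eq_neg_of_add_eq_zero_left h) : lam = 1 ∨ lam = -1) with h | h
  · left; rw [hlam, h]; simp
  · right; rw [hlam, h]; simp
end
end CrBir
end

section
namespace CrBir
open Polynomial IntermediateField.algebraAdjoinAdjoin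

/-- the five quadrics of the elliptic normal quintic -/
structure Quint {R : Type*} [CommRing R] (e f g h : R) : Prop where
  q0 : 1 - g * h + e * f = 0
  q1 : g * g - e + f * h = 0
  q2 : e * e - f * g + h = 0
  q3 : f * f - e * h + g = 0
  q4 : h * h - f + g * e = 0

theorem quint_of {R : Type*} [Field R] {x w ρ : R} (eq : w ^ 2 + w = x ^ 3 - x ^ 2) (hρ : ρ ^ 5 = cf x w)
    (h0 : ρ ≠ 0) : Quint ρ (-x / ρ) (w / ρ ^ 2) ((w + x ^ 2) / ρ ^ 3) := by
  unfold cf at hρ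
  constructor
  · field_simp
    linear_combination (1 - x) * hρ - eq
  · field_simp
    linear_combination eq - hρ
  · field_simp
    linear_combination hρ
  · field_simp
    linear_combination 0 * hρ
  · field_simp
    linear_combination (x + w) * hρ - x * eq

section
variable {C L : Type*} [Field C] [Field L] [Algebra C L] [CharZero C]

theorem quint_mem [CharZero L] {e f g h : L} (Q : Quint e f g h) (hD : 15 * (g + h) + 5 * (e + f) + 14 ≠ 0) (S : Subfield L)
    (h1 : (5 * (g + h) + 4) / (15 * (g + h) + 5 * (e + f) + 14) ∈ S)
    (h2 : ((g - h) + (e - f)) / (15 * (g + h) + 5 * (e + f) + 14) ∈ S) : e ∈ S ∧ f ∈ S ∧ g ∈ S ∧ h ∈ S := by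
  obtain ⟨q0, q1, q2, q3, q4⟩ := Q
  set d := 15 * (g + h) + 5 * (e + f) + 14 with hd
  have nS : ∀ n : ℕ, (n : L) ∈ S := fun n => natCast_mem S n
  have n2 : (2 : L) ∈ S := by exact_mod_cast nS 2
  have n4 : (4 : L) ∈ S := by exact_mod_cast nS 4
  have n5 : (5 : L) ∈ S := by exact_mod_cast nS 5
  have n7 : (7 : L) ∈ S := by exact_mod_cast nS 7
  have n11 : (11 : L) ∈ S := by exact_mod_cast nS 11
  have n14 : (14 : L) ∈ S := by exact_mod_cast nS 14
  have n15 : (15 : L) ∈ S := by exact_mod_cast nS 15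
  set ξ := (5 * (g + h) + 4) / d with hξ
  set υ := ((g - h) + (e - f)) / d with hυ
  have e1 : ξ * d = 5 * (g + h) + 4 := by rw [hξ]; field_simp
  have e2 : υ * d = (g - h) + (e - f) := by rw [hυ]; field_simp
  have e3 : ξ ^ 2 * d * 11 = 20 * (g + h) - 5 * (e + f) + 9 := by
    apply mul_right_cancel₀ hD
    have : ξ ^ 2 * d * 11 * d = (ξ * d) ^ 2 * 11 := by ring
    rw [this, e1]
    linear_combination 50 * q0 + (-25) * q1 + 25 * q2 + 25 * q3 + (-25) * q4
  have e4 : ξ * υ * d * 11 = (g - h) + 6 * (e - f) := by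
    apply mul_right_cancel₀ hD
    have : ξ * υ * d * 11 * d = (ξ * d) * (υ * d) * 11 := by ring
    rw [this, e1, e2]
    linear_combination 40 * q1 + (-30) * q2 + 30 * q3 + (-40) * q4
  have hdS : d ∈ S := by
    have : d⁻¹ = (7 * ξ - 11 * ξ ^ 2 - 1) / 5 := by
      rw [eq_div_iff (by norm_num), inv_mul_eq_iff_eq_mul₀ hD]
      clear_value ξ
      linear_combination (-7) * e1 + e3 + hd
    rw [← inv_inv d, this]
    exact inv_mem (div_mem (sub_mem (sub_mem (mul_mem n7 h1) (mul_mem n11 (pow_mem h1 2))) (one_mem S)) n5)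
  have hp : g + h ∈ S := by
    have : g + h = (ξ * d - 4) / 5 := by rw [e1]; ring
    rw [this]; exact div_mem (sub_mem (mul_mem h1 hdS) n4) n5
  have hq : e + f ∈ S := by
    have : e + f = (d - 15 * (g + h) - 14) / 5 := by rw [hd]; ring
    rw [this]; exact div_mem (sub_mem (sub_mem hdS (mul_mem n15 hp)) n14) n5
  have hm : e - f ∈ S := by
    have : e - f = (ξ * υ * d * 11 - υ * d) / 5 := by rw [e4, e2]; ring
    rw [this]; exact div_mem (sub_mem (mul_mem (mul_mem (mul_mem h1 h2) hdS) n11) (mul_mem h2 hdS)) n5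
  have hdd : g - h ∈ S := by
    have : g - h = υ * d - (e - f) := by rw [e2]; ring
    rw [this]; exact sub_mem (mul_mem h2 hdS) hm
  refine ⟨?_, ?_, ?_, ?_⟩
  · have : e = ((e + f) + (e - f)) / 2 := by ring
    rw [this]; exact div_mem (add_mem hq hm) n2
  · have : f = ((e + f) - (e - f)) / 2 := by ring
    rw [this]; exact div_mem (sub_mem hq hm) n2
  · have : g = ((g + h) + (g - h)) / 2 := by ring
    rw [this]; exact div_mem (add_mem hp hdd) n2
  · have : h = ((g + h) - (g - h)) / 2 := by ring
    rw [this]; exact div_mem (sub_mem hp hdd) n2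

theorem quint_D_ne [CharZero L] {e f g h : L} (Q : Quint e f g h) :
    15 * (g + h) + 5 * (e + f) + 14 ≠ 0 := by
  obtain ⟨q0, q1, q2, q3, q4⟩ := Q
  intro hD
  have hp : g + h = -4 / 5 := by
    have : (5 * (g + h) + 4) ^ 2 = 0 := by
      linear_combination (1/11) * (50 * q0 + (-25) * q1 + 25 * q2 + 25 * q3 + (-25) * q4) + (1/11) * (20*(g+h)-5*(e+f)+9) * hD
    have := pow_eq_zero_iff (by norm_num) |>.mp this
    linear_combination (1/5) * this
  have hq : e + f = -2 / 5 := by linear_combination (1/5) * hD - 3 * hp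
  obtain rfl : h = -4 / 5 - g := by linear_combination hp
  obtain rfl : f = -2 / 5 - e := by linear_combination hq
  have h1 : ((e - (-2 / 5 - e)) + (g - (-4 / 5 - g))) * (e - (-2 / 5 - e)) = 44 / 25 := by linear_combination 2 * (q2 + q3)
  have h2 : ((e - (-2 / 5 - e)) + (g - (-4 / 5 - g))) * (g - (-4 / 5 - g)) = -44 / 25 := by linear_combination 2 * (q1 + q4)
  have h3 : ((e - (-2 / 5 - e)) + (g - (-4 / 5 - g))) ^ 2 = 0 := by linear_combination h1 + h2
  rw [pow_eq_zero_iff (by norm_num)] at h3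
  rw [h3] at h1
  norm_num at h1

theorem curve_WD [IsAlgClosed C] {x w e : L} (tr : Transcendental C x) (eq : w ^ 2 + w = x ^ 3 - x ^ 2)
    (hρ : e ^ 5 = cf x w) (gen : IntermediateField.adjoin C {x, w, e} = ⊤) :
    ∃ W : WD C L, W.A = -496/1875 ∧ W.B = -40016/421875 ∧ W.D x = 2 * (2 * w + 1) := by
  haveI : CharZero L := charZero_of_injective_algebraMap (FaithfulSMul.algebraMap_injective C L)
  have hx0 : x ≠ 0 := by rintro rfl; exact tr isAlgebraic_zero
  have he0 : e ≠ 0 := by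
    rintro rfl
    exact cf_ne eq hx0 (by rw [← hρ]; norm_num)
  have Q := quint_of eq hρ he0
  have hD := quint_D_ne Q
  set f := -x / e with hf
  set g := w / e ^ 2 with hg
  set h := (w + x ^ 2) / e ^ 3 with hh
  have hxe : x = -e * f := by rw [hf]; field_simp
  have hwe : w = e ^ 2 * g := by rw [hg]; field_simp
  clear_value f g h
  have hmem := quint_mem Q hD
  obtain ⟨q0, q1, q2, q3, q4⟩ := id Q
  set d := 15 * (g + h) + 5 * (e + f) + 14 with hd
  set ξ := (5 * (g + h) + 4) / d with hξ
  set υ := ((g - h) + (e - f)) / d with hυ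
  have hwei : (125/484) * υ ^ 2 = ξ ^ 3 - (128/121) * ξ ^ 2 + (43/121) * ξ - 19/484 := by
    have hid : (125/484) * ((g - h) + (e - f)) ^ 2 * d = (5 * (g + h) + 4) ^ 3 - (128/121) * (5 * (g + h) + 4) ^ 2 * d + (43/121) * (5 * (g + h) + 4) * d ^ 2 - (19/484) * d ^ 3 := by
      rw [hd]
      linear_combination (250/121) * q0 + (-125/121 - 250/121 * e + 1000/121 * g + 1125/121 * h) * q1 + (875/121 + 750/121 * e + 1625/121 * f + 1000/121 * g + 1750/121 * h) * q2 + (875/121 + 1625/121 * e + 750/121 * f + 1750/121 * g + 750/121 * h) * q3 + (-125/121 - 250/121 * e - 250/121 * f + 1125/121 * g + 1000/121 * h) * q4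
    rw [hξ, hυ]
    clear_value d
    field_simp
    linear_combination 484 * 121 * hid
  have hwei2 : ((484/125) * υ) ^ 2 = ((484/125) * ξ - 512/375) ^ 3 + algebraMap C L (-496/1875) * ((484/125) * ξ - 512/375) + algebraMap C L (-40016/421875) := by
    simp only [map_div₀, map_neg, map_ofNat]
    linear_combination (484/125)^3 * hwei
  have hrat : ∀ (S : Subfield L) (q : ℚ), (q : L) ∈ S := fun S q => SubfieldClass.ratCast_mem _ q
  have hmem2 : ∀ S : Subfield L, (484/125) * ξ - 512/375 ∈ S → (484/125) * υ ∈ S → x ∈ S ∧ w ∈ S ∧ e ∈ S := by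
    intro S h1 h2
    have hξS : ξ ∈ S := by
      have : ξ = (((484/125) * ξ - 512/375) + ((512/375 : ℚ) : L)) * ((125/484 : ℚ) : L) := by push_cast; ring
      rw [this]; exact mul_mem (add_mem h1 (hrat _ _)) (hrat _ _)
    have hυS : υ ∈ S := by
      have : υ = ((484/125) * υ) * ((125/484 : ℚ) : L) := by push_cast; ring
      rw [this]; exact mul_mem h2 (hrat _ _)
    obtain ⟨h1, h2, h3, h4⟩ := hmem S hξS hυS
    exact ⟨by rw [hxe]; exact mul_mem (neg_mem h1) h2, by rw [hwe]; exact mul_mem (pow_mem h1 2) h3, h1⟩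
  obtain ⟨W, hX, hY, hA, hB⟩ := exists_WD (C := C) (L := L) hwei2 (by norm_num) (by
      intro halg
      apply tr
      obtain ⟨c, hc⟩ := const_of_alg halg
      have hυa : IsAlgebraic C ((484/125) * υ) := by
        apply IsAlgebraic.of_pow (n := 2) (by norm_num)
        rw [hwei2, ← hc, ← map_pow, ← map_mul, ← map_add, ← map_add]
        exact isAlgebraic_algebraMap _
      obtain ⟨c', hc'⟩ := const_of_alg hυa
      obtain ⟨⟨a, ha⟩, -, -⟩ := hmem2 (algebraMap C L).fieldRange ⟨c, hc⟩ ⟨c', hc'⟩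
      rw [← ha]; exact isAlgebraic_algebraMap _)
    (by
      rw [eq_top_iff, ← gen, IntermediateField.adjoin_le_iff]
      obtain ⟨h1, h2, h3⟩ := hmem2 (IntermediateField.adjoin C {(484/125) * ξ - 512/375, (484/125) * υ}).toSubfield
        (IntermediateField.subset_adjoin C _ (by simp)) (IntermediateField.subset_adjoin C _ (by simp))
      rintro z (rfl | rfl | rfl)
      · exact h1
      · exact h2
      · exact h3)
  refine ⟨W, hA, hB, ?_⟩
  obtain ⟨c, hc⟩ := W.eta (x := x - 1/3) (y := w + 1/2) (a := -1/3) (b := 19/108)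
    (by rw [short_w eq]; simp only [map_div₀, map_neg, map_one, map_ofNat]) (by norm_num)
  have hq : ∀ q : ℚ, W.D (q : L) = 0 := fun q => by
    have : (q : L) = algebraMap C L (q : C) := by simp
    rw [this]; exact W.D.map_algebraMap _
  set c' := algebraMap C L c with hc'
  have hDx : W.D x = c' * (2 * w + 1) := by
    have h1 := hq (1/3)
    push_cast at h1
    rw [map_sub, h1] at hc
    linear_combination hc
  have h2w : 2 * w + 1 ≠ 0 := by
    intro h0
    have : w = ((-1/2 : ℚ) : L) := by push_cast; linear_combination (1/2) * h0
    apply tr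
    have h1 : (4 * (x^3 - x^2) + 1 : L) = 0 := by rw [← eq, this]; push_cast; ring
    refine ⟨4 * (Polynomial.X ^ 3 - Polynomial.X ^ 2) + 1, ?_, ?_⟩
    · intro h
      have := congrArg (Polynomial.eval 0) h
      simp at this
    · simp only [map_add, map_mul, map_sub, map_pow, aeval_X, map_one, map_ofNat]; exact h1
  have hDw : W.D w = c' * (3 * x ^ 2 - 2 * x) := by
    have h1 := congrArg W.D eq
    simp only [map_add, map_sub, Derivation.leibniz_pow, hDx, smul_eq_mul, nsmul_eq_mul] at h1
    push_cast at h1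
    apply mul_left_cancel₀ h2w
    linear_combination h1
  have hDe : W.D e = c' * (4/5 * e - g ^ 2) := by
    have h1 := congrArg W.D hρ
    simp only [cf, map_neg, map_add, Derivation.leibniz, Derivation.leibniz_pow, hDx, hDw, smul_eq_mul, nsmul_eq_mul] at h1
    push_cast at h1
    apply mul_left_cancel₀ (pow_ne_zero 4 he0)
    have h2 : e ^ 4 * g ^ 2 = w ^ 2 := by rw [hwe]; ring
    unfold cf at hρ
    linear_combination (1/5) * h1 - (4/5) * c' * hρ + c' * h2 + (3/5) * c' * eq
  have hDf : W.D f = c' * (h ^ 2 - 4/5 * f) := by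
    have h1 := congrArg W.D hxe
    rw [hDx] at h1
    simp only [map_neg, Derivation.leibniz, smul_eq_mul, neg_mul, hDe] at h1
    apply mul_left_cancel₀ he0
    rw [hwe] at h1
    linear_combination h1 + c' * (-q0 - g * q2 - e * q4)
  have hDg : W.D g = c' * (f ^ 2 + 2/5 * g) := by
    have h1 := congrArg W.D hwe
    rw [hDw] at h1
    simp only [Derivation.leibniz, Derivation.leibniz_pow, smul_eq_mul, nsmul_eq_mul, hDe] at h1
    push_cast at h1
    apply mul_left_cancel₀ (pow_ne_zero 2 he0)
    rw [hxe] at h1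
    linear_combination -h1 + c' * 2 * e * (g * q1 + h * q2 + e * q3 - q4)
  have hDh : W.D h = c' * (-e ^ 2 - 2/5 * h) := by
    have h0 : h = f * g - e ^ 2 := by linear_combination q2
    have h1 := congrArg W.D h0
    simp only [map_sub, Derivation.leibniz, Derivation.leibniz_pow, smul_eq_mul, nsmul_eq_mul, hDe, hDf, hDg] at h1
    push_cast at h1
    linear_combination h1 + c' * (e * q1 + 2/5 * q2 + f * q3 + g * q4)
  have hn : ∀ n : ℕ, W.D (n : L) = 0 := fun n => by have := hq n; simpa using this
  have h4 := hn 4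
  have h5 := hn 5
  have h14 := hn 14
  have h15 := hn 15
  push_cast at h4 h5 h14 h15
  have hDξ : W.D ξ = c' * υ := by
    have e1 : ξ * d = 5 * (g + h) + 4 := by rw [hξ]; field_simp
    have h1 := congrArg W.D e1
    simp only [hd, map_add, Derivation.leibniz, smul_eq_mul, hDe, hDf, hDg, hDh, h4, h5, h14, h15] at h1
    rw [← hd] at h1
    apply mul_left_cancel₀ (pow_ne_zero 2 hD)
    have e2 : d ^ 2 * (c' * υ) = c' * ((g - h) + (e - f)) * d := by rw [hυ]; field_simp
    rw [e2]
    have e3 : d ^ 2 * W.D ξ = d * (d * W.D ξ) := by ring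
    have e4 : d * W.D ξ = c' * (5 * (f ^ 2 + 2/5 * g + (-e ^ 2 - 2/5 * h)) - ξ * (15 * (f ^ 2 + 2/5 * g + (-e ^ 2 - 2/5 * h)) + 5 * ((4/5 * e - g ^ 2) + (h ^ 2 - 4/5 * f)))) := by
      linear_combination h1
    have e5 : d * (d * W.D ξ) = c' * (5 * (f ^ 2 + 2/5 * g + (-e ^ 2 - 2/5 * h)) * d - (ξ * d) * (15 * (f ^ 2 + 2/5 * g + (-e ^ 2 - 2/5 * h)) + 5 * ((4/5 * e - g ^ 2) + (h ^ 2 - 4/5 * f)))) := by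
      rw [e4]; ring
    rw [e3, e5, e1, hd]
    linear_combination c' * ((30 + 25 * e + 25 * g + 25 * h) * q1 + (10 - 25 * e - 25 * f + 25 * h) * q2 + (-10 + 25 * e + 25 * f - 25 * g) * q3 + (-30 - 25 * f - 25 * g - 25 * h) * q4)
  have hc2 : c' = 2 := by
    have h1 := W.hDX
    rw [hX, hY] at h1
    have ha := hq (484/125)
    have hb := hq (512/375)
    push_cast at ha hb
    rw [map_sub, Derivation.leibniz, ha, hb, hDξ] at h1
    simp only [smul_eq_mul] at h1
    have hY0 := W.Yne
    rw [hY] at hY0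
    apply mul_right_cancel₀ hY0
    linear_combination h1
  rw [hDx, hc2]

end
end CrBir
end

section
namespace CrBir
open Polynomial IntermediateField.algebraAdjoinAdjoin

section
variable {L : Type*} [Field L]

theorem cf_inf {O : ValuationSubring L} {x w : L} (eq : w ^ 2 + w = x ^ 3 - x ^ 2) (hx : x ∉ O) :
    1 < O.valuation x ∧ O.valuation x < O.valuation w ∧ O.valuation (cf x w) = O.valuation (w / x) ^ 5 ∧
      1 < O.valuation (w / x) := by
  have hx1 : 1 < O.valuation x := by rwa [mem_iff_val, not_le] at hx
  have h3 : O.valuation (x ^ 3 - x ^ 2) = O.valuation x ^ 3 := by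
    have hh : O.valuation (x ^ 2) < O.valuation (x ^ 3) := by
      rw [map_pow, map_pow]; exact pow_lt_pow_right₀ hx1 (by norm_num)
    rw [Valuation.map_sub_eq_of_lt_left _ hh, map_pow]
  have hw1 : 1 < O.valuation w := by
    by_contra hw
    rw [not_lt] at hw
    have hwO : w ∈ O := mem_iff_val.mpr hw
    have : O.valuation (x ^ 3 - x ^ 2) ≤ 1 := by
      rw [← eq]; exact mem_iff_val.mp (add_mem (pow_mem hwO 2) hwO)
    rw [h3] at this
    exact absurd (one_lt_pow₀ hx1 (by norm_num)) (not_lt.mpr this)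
  have h2 : O.valuation w ^ 2 = O.valuation x ^ 3 := by
    rw [← h3, ← eq]
    have hh : O.valuation w < O.valuation (w ^ 2) := by
      rw [map_pow]; exact lt_self_pow₀ hw1 (by norm_num)
    rw [Valuation.map_add_eq_of_lt_left _ hh, map_pow]
  have hxw : O.valuation x < O.valuation w := by
    apply lt_of_pow_lt_pow_left₀ 2 zero_le
    rw [h2]; exact pow_lt_pow_right₀ hx1 (by norm_num)
  have hx0 : O.valuation x ≠ 0 := (zero_lt_one.trans hx1).ne'
  have hw0 : O.valuation w ≠ 0 := (zero_lt_one.trans hw1).ne'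
  refine ⟨hx1, hxw, ?_, ?_⟩
  · have e1 : cf x w = -((w + x ^ 2) + x * w) := by unfold cf; ring
    have hlt : O.valuation (w + x ^ 2) < O.valuation (x * w) := by
      apply Valuation.map_add_lt
      · rw [map_mul]; exact lt_mul_of_one_lt_left (zero_lt_one.trans hw1) hx1
      · rw [map_mul, map_pow, sq]; exact mul_lt_mul_of_pos_left hxw (zero_lt_one.trans hx1)
    rw [e1, Valuation.map_neg, Valuation.map_add_eq_of_lt_right _ hlt, map_mul, map_div₀, div_pow,
      eq_div_iff (pow_ne_zero 5 hx0)]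
    have e2 : O.valuation x * O.valuation w * O.valuation x ^ 5 = O.valuation x ^ 3 * O.valuation x ^ 3 * O.valuation w := by
      simp only [← map_pow, ← map_mul]; congr 1; ring
    have e3 : O.valuation w ^ 2 * O.valuation w ^ 2 * O.valuation w = O.valuation w ^ 5 := by
      simp only [← map_pow, ← map_mul]; congr 1; ring
    rw [e2, ← h2, e3]
  · rw [map_div₀]; exact (one_lt_div₀ (zero_lt_one.trans hx1)).mpr hxw

theorem div5_cf (O : ValuationSubring L) {x w : L} (eq : w ^ 2 + w = x ^ 3 - x ^ 2) (h0 : cf x w ≠ 0) :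
    Div5 O (cf x w) := by
  by_cases hx : x ∈ O
  · have hw : w ∈ O := by
      by_contra hw
      have hw1 : 1 < O.valuation w := by rwa [mem_iff_val, not_le] at hw
      have h1 : O.valuation (w ^ 2 + w) ≤ 1 := by
        rw [eq]; exact mem_iff_val.mp (sub_mem (pow_mem hx 3) (pow_mem hx 2))
      have hh : O.valuation w < O.valuation (w ^ 2) := by
        rw [map_pow]; exact lt_self_pow₀ hw1 (by norm_num)
      rw [Valuation.map_add_eq_of_lt_left _ hh, map_pow] at h1
      exact absurd (one_lt_pow₀ hw1 (by norm_num)) (not_lt.mpr h1)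
    have hf : cf x w ∈ O := by
      unfold cf; exact neg_mem (add_mem (add_mem hw (pow_mem hx 2)) (mul_mem hx hw))
    have hw' : -1 - w ∈ O := sub_mem (neg_mem (one_mem _)) hw
    have hf' : cf x (-1 - w) ∈ O := by
      unfold cf; exact neg_mem (add_mem (add_mem hw' (pow_mem hx 2)) (mul_mem hx hw'))
    rcases (mem_iff_val.mp hf).lt_or_eq with hlt | h
    swap
    · exact Div5.unit h
    have hx1 : O.valuation x < 1 := by
      have h1 : O.valuation (x ^ 5) < 1 := by
        have : x ^ 5 = -(cf x w * cf x (-1 - w)) := by rw [cf_mul eq]; ring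
        rw [this, Valuation.map_neg]
        exact val_mul_lt hlt hf'
      rw [map_pow] at h1
      by_contra hge
      exact absurd h1 (not_lt.mpr (one_le_pow₀ (not_lt.mp hge)))
    have hw1 : O.valuation w < 1 := by
      have : w = -(cf x w + (x * (x + w))) := by unfold cf; ring
      rw [this, Valuation.map_neg]
      exact val_add_lt hlt (val_mul_lt hx1 (add_mem hx hw))
    have hfb : O.valuation (cf x (-1 - w)) = 1 := by
      have : cf x (-1 - w) = 1 + (w + x * (1 + w - x)) := by unfold cf; ring
      rw [this]
      exact val_eq_one_add (map_one _) (val_add_lt hw1 (val_mul_lt hx1 (sub_mem (add_mem (one_mem _) hw) hx)))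
    have hx0 : x ≠ 0 := by
      rintro rfl
      have := cf_mul eq
      rcases mul_eq_zero.mp (this.trans (by ring)) with h | h
      · exact h0 h
      · rw [h, map_zero] at hfb; exact zero_ne_one hfb
    refine ⟨x, hx0, ?_⟩
    have := congrArg O.valuation (cf_mul eq)
    rw [map_mul, hfb, mul_one, Valuation.map_neg, map_pow] at this
    exact this
  · obtain ⟨-, -, h, h1⟩ := cf_inf eq hx
    refine ⟨w / x, ?_, h⟩
    intro h2; rw [h2, map_zero] at h1
    exact absurd h1 (not_lt.mpr zero_le)

end

section
variable {C L : Type*} [Field C] [Field L] [Algebra C L] [CharZero C]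

/-- the Weierstrass data of the curve `w²+w=x³-x²` -/
theorem exists_WD_w {x w : L} (tr : Transcendental C x) (eq : w ^ 2 + w = x ^ 3 - x ^ 2) :
    ∃ W : WD C (IntermediateField.adjoin C {x, w}), (W.X : L) = x - 1/3 ∧ (W.Y : L) = w + 1/2 := by
  haveI : CharZero L := charZero_of_injective_algebraMap (FaithfulSMul.algebraMap_injective C L)
  have htr : Transcendental C (x - 1/3) := by
    intro h
    apply tr
    have h2 : IsAlgebraic C (1/3 : L) := by
      have : (1/3 : L) = algebraMap C L (1/3) := by simp only [map_div₀, map_one, map_ofNat]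
      rw [this]; exact isAlgebraic_algebraMap _
    simpa using h.add h2
  obtain ⟨W, h1, h2, -⟩ := exists_WD_sub (C := C) (X := x - 1/3) (Y := w + 1/2) (A := -1/3) (B := 19/108)
    (by rw [short_w eq]; simp only [map_div₀, map_neg, map_one, map_ofNat]) (by norm_num) htr
  have hE : IntermediateField.adjoin C {x - 1/3, w + 1/2} = IntermediateField.adjoin C {x, w} := by
    have hr : ∀ (S : IntermediateField C L) (q : ℚ), (q : L) ∈ S := fun S q => SubfieldClass.ratCast_mem _ q
    apply le_antisymm
    · rw [IntermediateField.adjoin_le_iff]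
      have hx : x ∈ IntermediateField.adjoin C {x, w} := IntermediateField.subset_adjoin _ _ (by simp)
      have hw : w ∈ IntermediateField.adjoin C {x, w} := IntermediateField.subset_adjoin _ _ (by simp)
      rintro z (rfl | rfl)
      · exact sub_mem hx (by simpa using hr _ (1/3))
      · exact add_mem hw (by simpa using hr _ (1/2))
    · rw [IntermediateField.adjoin_le_iff]
      have hx : x - 1/3 ∈ IntermediateField.adjoin C {x - 1/3, w + 1/2} := IntermediateField.subset_adjoin _ _ (by simp)
      have hw : w + 1/2 ∈ IntermediateField.adjoin C {x - 1/3, w + 1/2} := IntermediateField.subset_adjoin _ _ (by simp)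
      rintro z (rfl | rfl)
      · have := add_mem hx (by simpa using hr _ (1/3) : (1/3 : L) ∈ _)
        simpa using this
      · have := sub_mem hw (by simpa using hr _ (1/2) : (1/2 : L) ∈ _)
        simpa using this
  revert W
  rw [hE]
  intro W h1 h2
  exact ⟨W, h1, h2⟩

theorem not_fifth [IsAlgClosed C] {x w ρ : L} (tr : Transcendental C x) (eq : w ^ 2 + w = x ^ 3 - x ^ 2)
    {c : C} (hc : c ≠ 0) (hρ : ρ ^ 5 = algebraMap C L c * cf x w) : ρ ∉ IntermediateField.adjoin C {x, w} := by
  intro hmem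
  haveI : CharZero L := charZero_of_injective_algebraMap (FaithfulSMul.algebraMap_injective C L)
  obtain ⟨W, hX, hY⟩ := exists_WD_w tr eq
  let E := IntermediateField.adjoin C {x, w}
  haveI : CharZero E := charZero_of_injective_algebraMap (FaithfulSMul.algebraMap_injective C E)
  have hx : x ∈ E := IntermediateField.subset_adjoin _ _ (by simp)
  have hw : w ∈ E := IntermediateField.subset_adjoin _ _ (by simp)
  let x' : E := ⟨x, hx⟩
  let w' : E := ⟨w, hw⟩
  let ρ' : E := ⟨ρ, hmem⟩
  have hX' : W.X = x' - algebraMap C E (1/3) := by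
    apply Subtype.ext; rw [hX]; simp only [map_div₀, map_one, map_ofNat]; rfl
  have hY' : W.Y = w' + algebraMap C E (1/2) := by
    apply Subtype.ext; rw [hY]; simp only [map_div₀, map_one, map_ofNat]; rfl
  have eq' : w' ^ 2 + w' = x' ^ 3 - x' ^ 2 := Subtype.ext eq
  have hρ' : ρ' ^ 5 = algebraMap C E c * cf x' w' := Subtype.ext hρ
  obtain ⟨O, hC, hO⟩ := W.exists_inf
  have hx' : x' ∉ O := by
    intro h; apply hO; rw [hX']; exact sub_mem h (hC _)
  obtain ⟨h1, h2, h3, h4⟩ := cf_inf eq' hx'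
  have vX : O.valuation W.X = O.valuation x' := by
    rw [hX', Valuation.map_sub_eq_of_lt_left]; exact lt_of_le_of_lt (mem_iff_val.mp (hC _)) h1
  have vY : O.valuation W.Y = O.valuation w' := by
    rw [hY', Valuation.map_add_eq_of_lt_left]; exact lt_of_le_of_lt (mem_iff_val.mp (hC _)) (h1.trans h2)
  have vρ : O.valuation ρ' = O.valuation (w' / x') := by
    have : O.valuation ρ' ^ 5 = O.valuation (w' / x') ^ 5 := by
      rw [← map_pow, hρ', map_mul, val_const hC hc, one_mul, h3]
    exact (pow_left_inj₀ zero_le zero_le (by norm_num)).mp this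
  have hreg : W.Reg ρ' := by
    intro O' hC' _ hX1
    have hxO : x' ∈ O' := by
      have : x' = W.X + algebraMap C E (1/3) := by rw [hX']; ring
      rw [this]; exact add_mem hX1 (hC' _)
    have hwO : w' ∈ O' := by
      have h0 : W.Y ∈ O' := W.Y_reg O' hC' ‹_› hX1
      have : w' = W.Y - algebraMap C E (1/2) := by rw [hY']; ring
      rw [this]; exact sub_mem h0 (hC' _)
    rw [mem_iff_val]
    by_contra hgt
    rw [not_le] at hgt
    have h5 := one_lt_pow₀ hgt (n := 5) (by norm_num)
    rw [← map_pow, hρ'] at h5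
    refine absurd h5 (not_lt.mpr (mem_iff_val.mp (mul_mem (hC' _) ?_)))
    unfold cf; exact neg_mem (add_mem (add_mem hwO (pow_mem hxO 2)) (mul_mem hxO hwO))
  obtain ⟨c₀, hc₀⟩ := W.simple_pole hC hO hreg (by
    rw [vρ, map_div₀ O.valuation W.X, vX, vY, map_div₀, zpow_neg_one, inv_div])
  rw [← vρ, ← hc₀] at h4
  exact absurd h4 (not_lt.mpr (mem_iff_val.mp (hC _)))

end

theorem descent {F M : Type*} [Field F] [Field M] [Algebra F M] (A : IntermediateField F M) (B : Subfield M)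
    (hAB : A.toSubfield ≤ B) {θ : M} {n : ℕ} (hn : n.Prime) (hθ : θ ^ n ∈ A) (hB : ∀ b ∈ B, b ^ n ≠ θ ^ n)
    {a : M} (ha : a ∈ IntermediateField.adjoin A {θ}) (haB : a ∈ B) : a ∈ A := by
  let c : A := ⟨θ ^ n, hθ⟩
  have hm : (X ^ n - C c : A[X]).Monic := monic_X_pow_sub_C _ hn.ne_zero
  have hIntg : IsIntegral A θ := ⟨X ^ n - C c, hm, by simp [c]⟩
  have ha' : a ∈ (IntermediateField.adjoin A {θ}).toSubalgebra := ha
  rw [IntermediateField.adjoin_simple_toSubalgebra_of_isAlgebraic hIntg.isAlgebraic, Algebra.adjoin_singleton_eq_range_aeval] at ha'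
  obtain ⟨p, rfl⟩ := ha'
  have hp : aeval θ (p %ₘ (X ^ n - C c)) = aeval θ p := by
    conv_rhs => rw [← modByMonic_add_div p (X ^ n - C c)]
    simp [c]
  set p' := p %ₘ (X ^ n - C c) with hp'
  have hdeg : p'.natDegree < n := by
    have := natDegree_modByMonic_lt p hm (by
      intro h; have := congrArg natDegree h; rw [natDegree_X_pow_sub_C] at this; simp at this; exact hn.ne_zero this)
    rwa [natDegree_X_pow_sub_C] at this
  let i : A →+* B := (A.toSubfield.subtype).codRestrict B (fun z => hAB z.2)
  let q : B[X] := p'.map i - C ⟨_, haB⟩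
  have hirr : Irreducible (X ^ n - C (⟨θ ^ n, hAB hθ⟩ : B)) := by
    apply X_pow_sub_C_irreducible_of_prime hn
    intro b hb
    exact hB b b.2 (congrArg Subtype.val hb)
  have hmin : minpoly B θ = X ^ n - C (⟨θ ^ n, hAB hθ⟩ : B) := by
    symm
    apply minpoly.eq_of_irreducible_of_monic hirr
    · simp; exact sub_self _
    · exact monic_X_pow_sub_C _ hn.ne_zero
  have hq0 : q = 0 := by
    by_contra hq
    have := natDegree_le_natDegree <| minpoly.degree_le_of_ne_zero B θ hq (by
      simp only [q, map_sub, aeval_C, aeval_map_algebraMap]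
      rw [aeval_def, eval₂_map]
      change eval₂ (algebraMap A M) θ p' - aeval θ p = 0
      rw [← hp, aeval_def, sub_self])
    rw [hmin, natDegree_X_pow_sub_C] at this
    have h2 : q.natDegree ≤ p'.natDegree := by
      rw [natDegree_sub_C]
      exact natDegree_map_le
    omega
  have := congrArg (fun q : B[X] => ((q.coeff 0 : B) : M)) hq0
  simp only [q, coeff_sub, coeff_map, coeff_C_zero, coeff_zero] at this
  have h3 : ((p'.coeff 0 : A) : M) = aeval θ p := by
    have h4 : ((i (p'.coeff 0) - ⟨_, haB⟩ : B) : M) = ((p'.coeff 0 : A) : M) - aeval θ p := rfl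
    rw [h4] at this
    exact sub_eq_zero.mp this
  change aeval θ p ∈ A
  rw [← h3]; exact (p'.coeff 0).2

theorem tr_alg_mem {F M : Type*} [Field F] [Field M] [Algebra F M] {τ a : M} (tr : Transcendental F τ)
    (ha : a ∈ IntermediateField.adjoin F {τ}) (halg : IsAlgebraic F a) : ∃ c : F, algebraMap F M c = a := by
  let e := RatFunc.algEquivOfTranscendental τ tr
  by_contra hcon
  have h1 : Transcendental F (e.symm ⟨a, ha⟩) := by
    apply RatFunc.transcendental_of_ne_C
    rintro ⟨c, hc⟩
    apply hcon
    refine ⟨c, ?_⟩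
    have : e (RatFunc.C c) = ⟨a, ha⟩ := by rw [← hc]; simp
    have h2 : e (RatFunc.C c) = algebraMap F _ c := by
      rw [← e.commutes]; rfl
    rw [h2] at this
    exact congrArg Subtype.val this
  apply h1
  have h2 : IsAlgebraic F (⟨a, ha⟩ : IntermediateField.adjoin F {τ}) := by
    rw [← isAlgebraic_algebraMap_iff (A := M) (FaithfulSMul.algebraMap_injective _ _)]
    exact halg
  exact h2.algHom e.symm.toAlgHom

theorem not_half {C L : Type*} [Field C] [Field L] [Algebra C L] [CharZero C] {x w : L} (tr : Transcendental C x)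
    (eq : w ^ 2 + w = x ^ 3 - x ^ 2) : w + 1/2 ∉ IntermediateField.adjoin C {x} := by
  intro hmem
  haveI : CharZero L := charZero_of_injective_algebraMap (FaithfulSMul.algebraMap_injective C L)
  obtain ⟨W, hX, hY⟩ := exists_WD_w tr eq
  apply W.Y_not_mem
  have h5 : IntermediateField.adjoin C {x} ≤ IntermediateField.lift (IntermediateField.adjoin C {W.X}) := by
    rw [IntermediateField.lift_adjoin, IntermediateField.adjoin_le_iff]
    rintro z rfl
    have h6 : (W.X : L) ∈ IntermediateField.adjoin C (Subtype.val '' {W.X}) :=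
      IntermediateField.subset_adjoin _ _ (by simp)
    have h7 := add_mem h6 (SubfieldClass.ratCast_mem _ (1/3 : ℚ))
    have : (W.X : L) + ((1/3 : ℚ) : L) = z := by rw [hX]; push_cast; ring
    rw [this] at h7
    exact h7
  have h7 := h5 hmem
  rw [← hY] at h7
  exact IntermediateField.mem_lift _ |>.mp h7

section
variable {F C M : Type*} [Field F] [Field C] [Field M] [Algebra F M] [Algebra F C] [Algebra C M]
  [IsScalarTower F C M] [CharZero F] [CharZero C]

theorem adj_sub (F C : Type*) {M : Type*} [Field F] [Field C] [Field M] [Algebra F M] [Algebra F C] [Algebra C M]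
    [IsScalarTower F C M] (s : Set M) :
    (IntermediateField.adjoin F s).toSubfield ≤ (IntermediateField.adjoin C s).toSubfield := by
  have : IntermediateField.adjoin F s ≤ (IntermediateField.adjoin C s).restrictScalars F := by
    rw [IntermediateField.adjoin_le_iff]
    exact IntermediateField.subset_adjoin C s
  exact this

theorem mem_adjA {F M : Type*} [Field F] [Field M] [Algebra F M] (A : IntermediateField F M) (T : Set M) {z : M}
    (hz : z ∈ A) : z ∈ IntermediateField.adjoin A T :=
  (IntermediateField.adjoin A T).algebraMap_mem ⟨z, hz⟩

theorem mem_adj2 {F M : Type*} [Field F] [Field M] [Algebra F M] (A : IntermediateField F M) {S T : Set M}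
    (h : ∀ z ∈ S, z ∈ IntermediateField.adjoin A T) {a : M} (ha : a ∈ IntermediateField.adjoin F S) :
    a ∈ IntermediateField.adjoin A T := by
  have : IntermediateField.adjoin F S ≤ (IntermediateField.adjoin A T).restrictScalars F := by
    rw [IntermediateField.adjoin_le_iff]; exact h
  exact this ha

theorem level3 [IsAlgClosed C] {x w r : M} (tr : Transcendental C x) (eq : w ^ 2 + w = x ^ 3 - x ^ 2) {c : F} (hc : c ≠ 0)
    (hr : r ^ 5 = algebraMap F M c * cf x w) {a : M} (ha : a ∈ IntermediateField.adjoin F {x, w, r})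
    (hC : ∃ z : C, algebraMap C M z = a) : a ∈ IntermediateField.adjoin F {x, w} := by
  obtain ⟨z, rfl⟩ := hC
  have hxA : x ∈ IntermediateField.adjoin F {x, w} := IntermediateField.subset_adjoin _ _ (by simp)
  have hwA : w ∈ IntermediateField.adjoin F {x, w} := IntermediateField.subset_adjoin _ _ (by simp)
  apply descent (IntermediateField.adjoin F {x, w}) (IntermediateField.adjoin C {x, w}).toSubfield (adj_sub F C _)
    (θ := r) (n := 5) (by norm_num)
  · rw [hr]; unfold cf
    exact mul_mem (IntermediateField.algebraMap_mem _ _) (neg_mem (add_mem (add_mem hwA (pow_mem hxA 2)) (mul_mem hxA hwA)))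
  · intro b hb h
    refine not_fifth (C := C) tr eq (c := algebraMap F C c) (by simpa using hc) (ρ := b) ?_ hb
    rw [h, hr, ← IsScalarTower.algebraMap_apply]
  · refine mem_adj2 _ ?_ ha
    intro z hz
    rcases hz with h | h | h
    · rw [h]; exact mem_adjA _ _ hxA
    · rw [h]; exact mem_adjA _ _ hwA
    · rw [h]; exact IntermediateField.subset_adjoin _ _ (by simp)
  · exact IntermediateField.algebraMap_mem _ z

theorem level2 {x w : M} (tr : Transcendental C x) (eq : w ^ 2 + w = x ^ 3 - x ^ 2)
    {a : M} (ha : a ∈ IntermediateField.adjoin F {x, w})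
    (hC : ∃ z : C, algebraMap C M z = a) : a ∈ IntermediateField.adjoin F {x} := by
  obtain ⟨z, rfl⟩ := hC
  haveI : CharZero M := charZero_of_injective_algebraMap (FaithfulSMul.algebraMap_injective F M)
  have hxA : x ∈ IntermediateField.adjoin F {x} := IntermediateField.subset_adjoin _ _ (by simp)
  have sq : (w + 1/2) ^ 2 = x ^ 3 - x ^ 2 + ((1/4 : ℚ) : M) := by rw [← eq]; push_cast; ring
  apply descent (IntermediateField.adjoin F {x}) (IntermediateField.adjoin C {x}).toSubfield (adj_sub F C _)
    (θ := w + 1/2) (n := 2) (by norm_num)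
  · rw [sq]
    exact add_mem (sub_mem (pow_mem hxA 3) (pow_mem hxA 2)) (SubfieldClass.ratCast_mem _ _)
  · intro b hb h
    apply not_half tr eq
    rcases sq_eq_sq_iff_eq_or_eq_neg.mp h with h | h
    · rw [← h]; exact hb
    · have : w + 1/2 = -b := by rw [h]; ring
      rw [this]; exact neg_mem (show b ∈ IntermediateField.adjoin C {x} from hb)
  · refine mem_adj2 _ ?_ ha
    intro z hz
    rcases hz with h | h
    · rw [h]; exact mem_adjA _ _ hxA
    · have h6 : w + 1/2 ∈ IntermediateField.adjoin (IntermediateField.adjoin F {x}) {w + 1/2} :=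
        IntermediateField.subset_adjoin _ _ (by simp)
      have h7 := sub_mem h6 (SubfieldClass.ratCast_mem _ (1/2 : ℚ))
      have : (w + 1/2) - ((1/2 : ℚ) : M) = w := by push_cast; ring
      rw [this] at h7
      rw [h]; exact h7
  · exact IntermediateField.algebraMap_mem _ z

theorem relclosed [Algebra.IsAlgebraic F C] [IsAlgClosed C] {x w r : M}
    (tr : Transcendental F x) (eq : w ^ 2 + w = x ^ 3 - x ^ 2) {c : F} (hc : c ≠ 0)
    (hr : r ^ 5 = algebraMap F M c * cf x w) {a : M} (ha : a ∈ IntermediateField.adjoin F {x, w, r})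
    (hC : ∃ z : C, algebraMap C M z = a) : ∃ c : F, algebraMap F M c = a := by
  have trC : Transcendental C x := fun h => tr (h.restrictScalars F)
  refine tr_alg_mem tr (level2 trC eq (level3 trC eq hc hr ha hC) hC) ?_
  obtain ⟨z, rfl⟩ := hC
  exact (Algebra.IsAlgebraic.isAlgebraic z).algebraMap

end
end CrBir
end

section
namespace CrBir
open Polynomial IntermediateField.algebraAdjoinAdjoin

theorem deriv_w {C L : Type*} [Field C] [Field L] [Algebra C L] (D : Derivation C L L) {x w : L}
    (eq : w ^ 2 + w = x ^ 3 - x ^ 2) (h0 : 2 * w + 1 ≠ 0) (hD : D x = 2 * (2 * w + 1)) : D w = 2 * (3 * x ^ 2 - 2 * x) := by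
  have h1 := congrArg D eq
  simp only [map_add, map_sub, Derivation.leibniz_pow, hD, smul_eq_mul, nsmul_eq_mul] at h1
  push_cast at h1
  apply mul_left_cancel₀ h0
  linear_combination h1

theorem deriv_third {C L : Type*} [Field C] [Field L] [Algebra C L] (D : Derivation C L L) {x₁ w₁ x₂ w₂ : L}
    (eq₁ : w₁ ^ 2 + w₁ = x₁ ^ 3 - x₁ ^ 2) (eq₂ : w₂ ^ 2 + w₂ = x₂ ^ 3 - x₂ ^ 2)
    (h1 : 2 * w₁ + 1 ≠ 0) (h2 : 2 * w₂ + 1 ≠ 0)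
    (hD₁ : D x₁ = 2 * (2 * w₁ + 1)) (hD₂ : D x₂ = 2 * (2 * w₂ + 1)) (hne : x₁ ≠ x₂) :
    D (((w₂ + 1 + w₁) / (x₂ - x₁)) ^ 2 + 1 - x₁ - x₂) = 0 := by
  have hd : x₂ - x₁ ≠ 0 := sub_ne_zero.mpr hne.symm
  have hw₁ := deriv_w D eq₁ h1 hD₁
  have hw₂ := deriv_w D eq₂ h2 hD₂
  set m := (w₂ + 1 + w₁) / (x₂ - x₁) with hm
  have hmd : m * (x₂ - x₁) = w₂ + 1 + w₁ := by rw [hm]; field_simp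
  clear_value m
  have hDm := congrArg D hmd
  simp only [map_add, map_sub, Derivation.leibniz, Derivation.map_one_eq_zero, smul_eq_mul, hw₁, hw₂, hD₁, hD₂] at hDm
  have hms : m * (w₂ - w₁) = x₁ ^ 2 + x₁ * x₂ + x₂ ^ 2 - x₁ - x₂ := by
    apply mul_left_cancel₀ hd
    linear_combination (w₂ - w₁) * hmd + eq₂ - eq₁
  have hDm2 : D m = 2 * (x₂ - x₁) := by
    apply mul_left_cancel₀ hd
    linear_combination hDm - 4 * hms
  simp only [map_add, map_sub, Derivation.leibniz_pow, Derivation.map_one_eq_zero, smul_eq_mul, nsmul_eq_mul, hD₁, hD₂, hDm2]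
  push_cast
  linear_combination 4 * hmd

theorem cf_line {L : Type*} [Field L] {x₁ x₂ x₃ m n : L} (e1 : x₁ + x₂ + x₃ = 1 + m ^ 2)
    (e2 : x₁ * x₂ + x₁ * x₃ + x₂ * x₃ = -(2 * m * n + m)) (e3 : x₁ * x₂ * x₃ = n ^ 2 + n) :
    cf x₁ (m * x₁ + n) * cf x₂ (m * x₂ + n) * cf x₃ (m * x₃ + n) = -n ^ 5 := by
  have key : ∀ a b c : L, (a * x₁ ^ 2 + b * x₁ + c) * (a * x₂ ^ 2 + b * x₂ + c) * (a * x₃ ^ 2 + b * x₃ + c) =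
      a ^ 3 * (n ^ 2 + n) ^ 2 + a ^ 2 * b * (-(2 * m * n + m)) * (n ^ 2 + n) + a ^ 2 * c * ((-(2 * m * n + m)) ^ 2 - 2 * (1 + m ^ 2) * (n ^ 2 + n))
      + a * b ^ 2 * (1 + m ^ 2) * (n ^ 2 + n) + a * b * c * ((1 + m ^ 2) * (-(2 * m * n + m)) - 3 * (n ^ 2 + n)) + a * c ^ 2 * ((1 + m ^ 2) ^ 2 - 2 * (-(2 * m * n + m)))
      + b ^ 3 * (n ^ 2 + n) + b ^ 2 * c * (-(2 * m * n + m)) + b * c ^ 2 * (1 + m ^ 2) + c ^ 3 := by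
    intro a b c
    rw [← e1, ← e2, ← e3]; ring
  have h := key (1 + m) (m + n) n
  unfold cf
  have e : ∀ x : L, -(m * x + n + x ^ 2 + x * (m * x + n)) = -((1 + m) * x ^ 2 + (m + n) * x + n) := by intro x; ring
  rw [e, e, e]
  linear_combination -h

section
variable {F M : Type*} [Field F] [Field M] [Algebra F M]

theorem compare (Z : IntermediateField F M) (hcl : ∀ a ∈ Z, IsAlgebraic F a → ∃ c : F, algebraMap F M c = a)
    {x₁ w₁ x₂ w₂ : M} (hx₁ : x₁ ∈ Z) (hw₁ : w₁ ∈ Z) (hx₂ : x₂ ∈ Z) (hw₂ : w₂ ∈ Z) (n₁ : x₁ ≠ 0) (n₂ : x₂ ≠ 0)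
    (eq₁ : w₁ ^ 2 + w₁ = x₁ ^ 3 - x₁ ^ 2) (eq₂ : w₂ ^ 2 + w₂ = x₂ ^ 3 - x₂ ^ 2)
    (heq : x₁ = x₂ → w₁ = w₂)
    (hne : x₁ ≠ x₂ → IsAlgebraic F (((w₂ + 1 + w₁) / (x₂ - x₁)) ^ 2 + 1 - x₁ - x₂)) :
    ∃ u : F, u ≠ 0 ∧ (∀ O : ValuationSubring F, Div5 O u) ∧ ∃ z ∈ Z, z ≠ 0 ∧ cf x₂ w₂ = z ^ 5 * cf x₁ w₁ * algebraMap F M u := by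
  have eq₁' : (-1 - w₁) ^ 2 + (-1 - w₁) = x₁ ^ 3 - x₁ ^ 2 := by linear_combination eq₁
  have c₁ := cf_ne eq₁ n₁
  have c₂ := cf_ne eq₂ n₂
  have c₁' := cf_ne eq₁' n₁
  by_cases hx : x₁ = x₂
  · have hw := heq hx
    subst hx; subst hw
    exact ⟨1, one_ne_zero, fun O => Div5.unit (map_one _), 1, one_mem _, one_ne_zero, by simp⟩
  have halg := hne hx
  have hd : x₂ - x₁ ≠ 0 := sub_ne_zero.mpr (Ne.symm hx)
  set m := (w₂ + 1 + w₁) / (x₂ - x₁) with hm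
  have hmd : m * (x₂ - x₁) = w₂ + 1 + w₁ := by rw [hm]; field_simp
  have hmZ : m ∈ Z := div_mem (add_mem (add_mem hw₂ (one_mem _)) hw₁) (sub_mem hx₂ hx₁)
  clear_value m
  set x₃ := m ^ 2 + 1 - x₁ - x₂ with hx₃
  have hx₃Z : x₃ ∈ Z := sub_mem (sub_mem (add_mem (pow_mem hmZ 2) (one_mem _)) hx₁) hx₂
  set n := w₂ - m * x₂ with hn
  have hnZ : n ∈ Z := sub_mem hw₂ (mul_mem hmZ hx₂)
  have l2 : m * x₂ + n = w₂ := by rw [hn]; ring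
  have l1 : m * x₁ + n = -1 - w₁ := by rw [hn]; linear_combination -hmd
  clear_value n
  have e1 : x₁ + x₂ + x₃ = 1 + m ^ 2 := by rw [hx₃]; ring
  clear_value x₃
  rw [← l1] at eq₁'
  rw [← l2] at eq₂
  have e2 : x₁ * x₂ + x₁ * x₃ + x₂ * x₃ = -(2 * m * n + m) := by
    have : x₃ = 1 + m ^ 2 - x₁ - x₂ := by linear_combination e1
    rw [this]
    apply mul_left_cancel₀ hd
    linear_combination eq₂ - eq₁'
  have e3 : x₁ * x₂ * x₃ = n ^ 2 + n := by
    linear_combination x₁ * e2 - eq₁' - x₁ ^ 2 * e1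
  have eq₃ : (m * x₃ + n) ^ 2 + (m * x₃ + n) = x₃ ^ 3 - x₃ ^ 2 := by
    linear_combination -e3 + x₃ * e2 - x₃ ^ 2 * e1
  obtain ⟨X, hX⟩ := hcl x₃ hx₃Z halg
  obtain ⟨W, hW⟩ := hcl (m * x₃ + n) (add_mem (mul_mem hmZ hx₃Z) hnZ) (by
    refine ⟨Polynomial.X ^ 2 + Polynomial.X - Polynomial.C (X ^ 3 - X ^ 2), ?_, ?_⟩
    · intro h
      have := congrArg (fun p => p.coeff 2) h
      simp [-map_sub, -map_pow, coeff_X, coeff_C] at this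
    · simp [eq₃, hX])
  have hprod := cf_line e1 e2 e3
  rw [l1, l2] at hprod
  have eqF : W ^ 2 + W = X ^ 3 - X ^ 2 := by
    apply (algebraMap F M).injective
    simp only [map_add, map_sub, map_pow, hX, hW, eq₃]
  have hcF : algebraMap F M (cf X W) = cf x₃ (m * x₃ + n) := by rw [cf_map, hX, hW]
  have hm1 := cf_mul eq₁
  by_cases hc₃ : cf X W = 0
  · -- the third point is the torsion point: use the opposite line
    have hX0 : X = 0 := by
      by_contra h; exact cf_ne eqF h hc₃
    have hW0 : W = 0 := by
      unfold cf at hc₃; rw [hX0] at hc₃; simpa using hc₃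
    have hx30 : x₃ = 0 := by rw [← hX, hX0, map_zero]
    have hn0 : n = 0 := by
      have := hW
      rw [hW0, hx30, map_zero, mul_zero, zero_add] at this
      exact this.symm
    have hprod' := cf_line (x₁ := x₁) (x₂ := x₂) (x₃ := x₃) (m := -m) (n := -1 - n) (by rw [e1]; ring) (by rw [e2]; ring) (by rw [e3]; ring)
    have l1' : -m * x₁ + (-1 - n) = w₁ := by linear_combination -l1
    have l2' : -m * x₂ + (-1 - n) = -1 - w₂ := by linear_combination -l2
    rw [l1', l2', hx30, hn0] at hprod'
    have h7 : cf (0 : M) (-m * 0 + (-1 - 0)) = 1 := by unfold cf; ring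
    rw [h7] at hprod'
    have hm2 := cf_mul (x := x₂) (w := w₂) (by rw [← l2]; exact eq₂)
    refine ⟨1, one_ne_zero, fun O => Div5.unit (map_one _), -x₂, neg_mem hx₂, neg_ne_zero.mpr n₂, ?_⟩
    rw [map_one]
    have h8 : cf x₁ w₁ * cf x₂ (-1 - w₂) = 1 := by linear_combination hprod'
    linear_combination (cf x₁ w₁) * hm2 - cf x₂ w₂ * h8
  · have hn0 : n ≠ 0 := by
      rintro rfl
      rw [← hcF] at hprod
      have h1 := mul_ne_zero (mul_ne_zero c₁' c₂) ((_root_.map_ne_zero (algebraMap F M)).mpr hc₃)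
      rw [hprod] at h1
      simp at h1
    refine ⟨(cf X W)⁻¹, inv_ne_zero hc₃, fun O => (div5_cf O eqF hc₃).inv, n / x₁, div_mem hnZ hx₁,
      div_ne_zero hn0 n₁, ?_⟩
    rw [map_inv₀, hcF]
    have h3 : cf x₃ (m * x₃ + n) ≠ 0 := by rw [← hcF]; exact (_root_.map_ne_zero (algebraMap F M)).mpr hc₃
    field_simp
    linear_combination (-cf x₁ w₁) * hprod + (cf x₂ w₂ * cf x₃ (m * x₃ + n)) * hm1

end
end CrBir
end

section
namespace CrBir
open Polynomial IntermediateField.algebraAdjoinAdjoin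

section
variable {C L : Type*} [Field C] [Field L] [Algebra C L] [CharZero C]

theorem WD.deriv_zero (W : WD C L) (D : Derivation C L L) (hX : D W.X = 0) (z : L) : D z = 0 := by
  haveI : CharZero L := charZero_of_injective_algebraMap (FaithfulSMul.algebraMap_injective C L)
  have hY : D W.Y = 0 := by
    have h1 := congrArg D W.eq
    simp only [map_add, Derivation.leibniz_pow, Derivation.leibniz, Derivation.map_algebraMap, hX, smul_eq_mul, nsmul_eq_mul, smul_zero, mul_zero, add_zero] at h1
    have h2 := W.Yne
    simpa [h2] using h1
  have hz : z ∈ IntermediateField.adjoin C {W.X, W.Y} := by rw [W.gen]; trivial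
  induction hz using IntermediateField.adjoin_induction with
  | mem x hx =>
    rcases hx with rfl | rfl
    · exact hX
    · exact hY
  | algebraMap x => simp
  | add x y hx hy h1 h2 => simp [h1, h2]
  | inv x hx h1 => rw [Derivation.leibniz_inv, h1, smul_zero]
  | mul x y hx hy h1 h2 => simp [h1, h2]

theorem WD.lambda_all (W W' : WD C L) [IsAlgClosed C] (hA : W.A = W'.A) (hB : W.B = W'.B) (hA0 : W.A ≠ 0) (hB0 : W.B ≠ 0) :
    (∀ z, W.D z = W'.D z) ∨ (∀ z, W.D z = - W'.D z) := by
  rcases W.lambda W' hA hB hA0 hB0 with h | h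
  · left; intro z
    have := W'.deriv_zero (W.D - W'.D) (by rw [Derivation.sub_apply, h, W'.hDX, sub_self]) z
    rw [Derivation.sub_apply] at this
    exact sub_eq_zero.mp this
  · right; intro z
    have := W'.deriv_zero (W.D + W'.D) (by rw [Derivation.add_apply, h, W'.hDX]; ring) z
    rw [Derivation.add_apply] at this
    exact eq_neg_of_add_eq_zero_left this

theorem two_curves [IsAlgClosed C] {x₁ w₁ e₁ x₂ w₂ e₂ : L} (tr₁ : Transcendental C x₁) (eq₁ : w₁ ^ 2 + w₁ = x₁ ^ 3 - x₁ ^ 2)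
    (hρ₁ : e₁ ^ 5 = cf x₁ w₁) (gen₁ : IntermediateField.adjoin C {x₁, w₁, e₁} = ⊤)
    (tr₂ : Transcendental C x₂) (eq₂ : w₂ ^ 2 + w₂ = x₂ ^ 3 - x₂ ^ 2)
    (hρ₂ : e₂ ^ 5 = cf x₂ w₂) (gen₂ : IntermediateField.adjoin C {x₂, w₂, e₂} = ⊤) :
    ∃ w, (w = w₂ ∨ w = -1 - w₂) ∧ (x₁ = x₂ → w₁ = w) ∧
      (x₁ ≠ x₂ → ∃ c : C, algebraMap C L c = ((w + 1 + w₁) / (x₂ - x₁)) ^ 2 + 1 - x₁ - x₂) := by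
  haveI : CharZero L := charZero_of_injective_algebraMap (FaithfulSMul.algebraMap_injective C L)
  obtain ⟨W₁, hA₁, hB₁, hD₁⟩ := curve_WD tr₁ eq₁ hρ₁ gen₁
  obtain ⟨W₂, hA₂, hB₂, hD₂⟩ := curve_WD tr₂ eq₂ hρ₂ gen₂
  have key : ∀ {x w : L}, Transcendental C x → w ^ 2 + w = x ^ 3 - x ^ 2 → 2 * w + 1 ≠ 0 := by
    intro x w tr eq h
    apply tr
    refine ⟨4 * (Polynomial.X ^ 3 - Polynomial.X ^ 2) + 1, ?_, ?_⟩
    · intro h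
      have := congrArg (fun p => p.coeff 0) h
      simp at this
    · simp only [map_add, map_mul, map_sub, map_pow, aeval_X, map_one, map_ofNat]
      rw [← eq]; linear_combination (2 * w + 1) * h
  have n1 := key tr₁ eq₁
  have n2 := key tr₂ eq₂
  have main : ∀ w, w ^ 2 + w = x₂ ^ 3 - x₂ ^ 2 → W₁.D x₂ = 2 * (2 * w + 1) → (x₁ = x₂ → w₁ = w) ∧
      (x₁ ≠ x₂ → ∃ c : C, algebraMap C L c = ((w + 1 + w₁) / (x₂ - x₁)) ^ 2 + 1 - x₁ - x₂) := by
    intro w eq h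
    refine ⟨?_, ?_⟩
    · rintro rfl
      rw [h] at hD₁
      linear_combination -hD₁ / 4
    · intro hne
      exact W₁.ker (deriv_third W₁.D eq₁ eq n1 (key tr₂ eq) hD₁ h hne)
  rcases W₁.lambda_all W₂ (hA₁.trans hA₂.symm) (hB₁.trans hB₂.symm) (by rw [hA₁]; norm_num) (by rw [hB₁]; norm_num) with h | h
  · exact ⟨w₂, Or.inl rfl, main w₂ eq₂ (by rw [h, hD₂])⟩
  · exact ⟨-1 - w₂, Or.inr rfl, main _ (by linear_combination eq₂) (by rw [h, hD₂]; ring)⟩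
end

section
variable {F C M : Type*} [Field F] [Field C] [Field M] [Algebra F C] [Algebra C M] [Algebra F M] [IsScalarTower F C M]
  [CharZero F] [CharZero C]

theorem exists_rho [IsAlgClosed C] {x w r : M} {s : F} (hs : s ≠ 0) (hr : r ^ 5 = algebraMap F M s * cf x w) :
    ∃ e : M, e ^ 5 = cf x w ∧ IntermediateField.adjoin C {x, w, e} = IntermediateField.adjoin C {x, w, r} := by
  obtain ⟨σ, hσ⟩ := IsAlgClosed.exists_pow_nat_eq (algebraMap F C s) (n := 5) (by norm_num)
  have hσ0 : σ ≠ 0 := by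
    rintro rfl
    apply hs
    apply (algebraMap F C).injective
    rw [← hσ]; norm_num
  have h0 : algebraMap C M σ ≠ 0 := (_root_.map_ne_zero _).mpr hσ0
  have h5 : algebraMap C M σ ^ 5 = algebraMap F M s := by
    rw [← map_pow, hσ, ← IsScalarTower.algebraMap_apply]
  refine ⟨r / algebraMap C M σ, ?_, ?_⟩
  · rw [div_pow, hr, h5]
    rw [mul_div_cancel_left₀]
    rw [← h5]; exact pow_ne_zero _ h0
  · apply le_antisymm
    · rw [IntermediateField.adjoin_le_iff]
      rintro z (rfl | rfl | rfl)
      · exact IntermediateField.subset_adjoin _ _ (by simp)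
      · exact IntermediateField.subset_adjoin _ _ (by simp)
      · exact div_mem (IntermediateField.subset_adjoin _ _ (by simp)) (IntermediateField.algebraMap_mem _ σ)
    · rw [IntermediateField.adjoin_le_iff]
      rintro z (rfl | rfl | rfl)
      · exact IntermediateField.subset_adjoin _ _ (by simp)
      · exact IntermediateField.subset_adjoin _ _ (by simp)
      · have h6 : z / algebraMap C M σ ∈ IntermediateField.adjoin C {x, w, z / algebraMap C M σ} :=
          IntermediateField.subset_adjoin _ _ (by simp)
        have h7 := mul_mem h6 (IntermediateField.algebraMap_mem _ σ)
        rwa [div_mul_cancel₀ _ h0] at h7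

theorem curves_ambient [IsAlgClosed C] {x₁ w₁ e₁ x₂ w₂ e₂ : M} (tr₁ : Transcendental C x₁) (eq₁ : w₁ ^ 2 + w₁ = x₁ ^ 3 - x₁ ^ 2)
    (hρ₁ : e₁ ^ 5 = cf x₁ w₁) 
    (tr₂ : Transcendental C x₂) (eq₂ : w₂ ^ 2 + w₂ = x₂ ^ 3 - x₂ ^ 2)
    (hρ₂ : e₂ ^ 5 = cf x₂ w₂) (L : IntermediateField C M) (gen₁ : IntermediateField.adjoin C {x₁, w₁, e₁} = L) (gen₂ : IntermediateField.adjoin C {x₂, w₂, e₂} = L) :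
    ∃ w, (w = w₂ ∨ w = -1 - w₂) ∧ (x₁ = x₂ → w₁ = w) ∧
      (x₁ ≠ x₂ → ∃ c : C, algebraMap C M c = ((w + 1 + w₁) / (x₂ - x₁)) ^ 2 + 1 - x₁ - x₂) := by
  have m₁ : ∀ z ∈ ({x₁, w₁, e₁} : Set M), z ∈ L := fun z hz => gen₁ ▸ IntermediateField.subset_adjoin _ _ hz
  have m₂ : ∀ z ∈ ({x₂, w₂, e₂} : Set M), z ∈ L := fun z hz => gen₂ ▸ IntermediateField.subset_adjoin _ _ hz
  have top : ∀ (a b c : L), IntermediateField.adjoin C {(a : M), (b : M), (c : M)} = L → IntermediateField.adjoin C {a, b, c} = ⊤ := by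
    intro a b c h
    apply IntermediateField.lift_injective L
    rw [IntermediateField.lift_adjoin, IntermediateField.lift_top]
    simpa [Set.image_insert_eq] using h
  have trL : ∀ a : L, Transcendental C (a : M) → Transcendental C a := fun a h h' => h (h'.algebraMap (A := M))
  obtain ⟨w, hw, h1, h2⟩ := two_curves (C := C) (L := L) (x₁ := ⟨x₁, m₁ _ (by simp)⟩) (w₁ := ⟨w₁, m₁ _ (by simp)⟩) (e₁ := ⟨e₁, m₁ _ (by simp)⟩)
    (x₂ := ⟨x₂, m₂ _ (by simp)⟩) (w₂ := ⟨w₂, m₂ _ (by simp)⟩) (e₂ := ⟨e₂, m₂ _ (by simp)⟩) (trL _ tr₁) (by ext; exact eq₁) (by ext; exact hρ₁) (top _ _ _ gen₁)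
    (trL _ tr₂) (by ext; exact eq₂) (by ext; exact hρ₂) (top _ _ _ gen₂)
  refine ⟨w, ?_, ?_, ?_⟩
  · rcases hw with rfl | rfl
    · left; rfl
    · right; rfl
  · intro h
    have := h1 (by ext; exact h)
    rw [← this]
  · intro h
    obtain ⟨c, hc⟩ := h2 (fun h' => h (congrArg Subtype.val h'))
    exact ⟨c, congrArg Subtype.val hc⟩

theorem F3 [Algebra.IsAlgebraic F C] [IsAlgClosed C] {x₁ w₁ r₁ x₂ w₂ r₂ : M} {s₁ s₂ : F} (hs₁ : s₁ ≠ 0) (hs₂ : s₂ ≠ 0)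
    (tr₁ : Transcendental F x₁) (eq₁ : w₁ ^ 2 + w₁ = x₁ ^ 3 - x₁ ^ 2) (hr₁ : r₁ ^ 5 = algebraMap F M s₁ * cf x₁ w₁)
    (tr₂ : Transcendental F x₂) (eq₂ : w₂ ^ 2 + w₂ = x₂ ^ 3 - x₂ ^ 2) (hr₂ : r₂ ^ 5 = algebraMap F M s₂ * cf x₂ w₂)
    (Z : IntermediateField F M) (hZ₁ : IntermediateField.adjoin F {x₁, w₁, r₁} = Z) (hZ₂ : IntermediateField.adjoin F {x₂, w₂, r₂} = Z) :
    (∀ O : ValuationSubring F, Div5 O (s₁ * s₂)) ∨ (∀ O : ValuationSubring F, Div5 O (s₂ * s₁⁻¹)) := by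
  have trC : ∀ {x : M}, Transcendental F x → Transcendental C x := fun tr h => tr (h.restrictScalars F)
  have m₁ : ∀ z ∈ ({x₁, w₁, r₁} : Set M), z ∈ Z := fun z hz => hZ₁ ▸ IntermediateField.subset_adjoin _ _ hz
  have m₂ : ∀ z ∈ ({x₂, w₂, r₂} : Set M), z ∈ Z := fun z hz => hZ₂ ▸ IntermediateField.subset_adjoin _ _ hz
  have n₁ : x₁ ≠ 0 := by rintro rfl; exact tr₁ isAlgebraic_zero
  have n₂ : x₂ ≠ 0 := by rintro rfl; exact tr₂ isAlgebraic_zero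
  have c₁ := cf_ne eq₁ n₁
  have c₂ := cf_ne eq₂ n₂
  have a₁ : algebraMap F M s₁ ≠ 0 := (_root_.map_ne_zero _).mpr hs₁
  have a₂ : algebraMap F M s₂ ≠ 0 := (_root_.map_ne_zero _).mpr hs₂
  have hr₁0 : r₁ ≠ 0 := by
    rintro rfl
    exact mul_ne_zero a₁ c₁ (by rw [← hr₁]; norm_num)
  have hr₂0 : r₂ ≠ 0 := by
    rintro rfl
    exact mul_ne_zero a₂ c₂ (by rw [← hr₂]; norm_num)
  obtain ⟨e₁, he₁, hg₁⟩ := exists_rho (C := C) hs₁ hr₁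
  obtain ⟨e₂, he₂, hg₂⟩ := exists_rho (C := C) hs₂ hr₂
  have heq : IntermediateField.adjoin C {x₁, w₁, r₁} = IntermediateField.adjoin C {x₂, w₂, r₂} := by
    apply le_antisymm
    · rw [IntermediateField.adjoin_le_iff]
      intro z hz
      exact adj_sub F C _ (show z ∈ (IntermediateField.adjoin F {x₂, w₂, r₂}) by rw [hZ₂]; exact m₁ z hz)
    · rw [IntermediateField.adjoin_le_iff]
      intro z hz
      exact adj_sub F C _ (show z ∈ (IntermediateField.adjoin F {x₁, w₁, r₁}) by rw [hZ₁]; exact m₂ z hz)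
  have hclC : ∀ a ∈ Z, (∃ c : C, algebraMap C M c = a) → ∃ c : F, algebraMap F M c = a := by
    intro a ha hC
    exact relclosed (C := C) tr₁ eq₁ hs₁ hr₁ (by rw [hZ₁]; exact ha) hC
  have hcl : ∀ a ∈ Z, IsAlgebraic F a → ∃ c : F, algebraMap F M c = a := by
    intro a ha halg
    exact hclC a ha (const_of_alg (halg.extendScalars (FaithfulSMul.algebraMap_injective F C)))
  obtain ⟨w, hw, h1, h2⟩ := curves_ambient (trC tr₁) eq₁ he₁ (trC tr₂) eq₂ he₂ _ (hg₁.trans heq) hg₂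
  have hwZ : w ∈ Z := by
    rcases hw with rfl | rfl
    · exact m₂ _ (by simp)
    · exact sub_mem (neg_mem (one_mem _)) (m₂ _ (by simp))
  have eq₂' : w ^ 2 + w = x₂ ^ 3 - x₂ ^ 2 := by
    rcases hw with rfl | rfl
    · exact eq₂
    · linear_combination eq₂
  obtain ⟨u, hu0, hu, z, hz, hz0, hzz⟩ := compare Z hcl (m₁ _ (by simp)) (m₁ _ (by simp)) (m₂ x₂ (by simp)) hwZ n₁ n₂ eq₁ eq₂' h1
    (fun h => by
      obtain ⟨c, hc⟩ := h2 h
      rw [← hc]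
      exact (Algebra.IsAlgebraic.isAlgebraic c).algebraMap)
  have au : algebraMap F M u ≠ 0 := (_root_.map_ne_zero _).mpr hu0
  have fifth : ∀ y ∈ Z, ∀ g : F, y ^ 5 = algebraMap F M g → ∃ c : F, c ^ 5 = g := by
    intro y hy g hg
    obtain ⟨c, rfl⟩ := hcl y hy (IsAlgebraic.of_pow (n := 5) (by norm_num) (by rw [hg]; exact isAlgebraic_algebraMap g))
    exact ⟨c, (algebraMap F M).injective (by rw [← hg, map_pow])⟩
  rcases hw with rfl | rfl
  · right
    obtain ⟨c, hc⟩ := fifth (r₂ / (z * r₁)) (div_mem (m₂ _ (by simp)) (mul_mem hz (m₁ _ (by simp)))) (s₂ * s₁⁻¹ * u) (by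
      rw [div_pow, mul_pow, hr₁, hr₂, hzz, map_mul, map_mul, map_inv₀]
      field_simp)
    intro O
    have h3 : s₂ * s₁⁻¹ = c ^ 5 * u⁻¹ := by rw [hc]; field_simp
    rw [h3]
    have hc0 : c ≠ 0 := by
      rintro rfl
      have : s₂ * s₁⁻¹ * u ≠ 0 := by positivity
      exact this (by rw [← hc]; norm_num)
    exact (Div5.pow5 O hc0).mul (hu O).inv
  · left
    have hm := cf_mul eq₂
    obtain ⟨c, hc⟩ := fifth (-(r₂ * z * r₁ / x₂)) (neg_mem (div_mem (mul_mem (mul_mem (m₂ _ (by simp)) hz) (m₁ _ (by simp))) (m₂ _ (by simp)))) (s₁ * s₂ * u⁻¹) (by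
      rw [neg_pow, div_pow, mul_pow, mul_pow, hr₁, hr₂, map_mul, map_mul, map_inv₀]
      field_simp
      rw [hzz] at hm
      linear_combination (-1 : M) * hm)
    intro O
    have h3 : s₁ * s₂ = c ^ 5 * u := by rw [hc]; field_simp
    rw [h3]
    have hc0 : c ≠ 0 := by
      rintro rfl
      have : s₁ * s₂ * u⁻¹ ≠ 0 := by positivity
      exact this (by rw [← hc]; norm_num)
    exact (Div5.pow5 O hc0).mul (hu O)
end
end CrBir
end

section
namespace CrBir
open Polynomial IntermediateField.algebraAdjoinAdjoin
universe u v

theorem NU.alg_of_simple {k : Type v} {Z K κ : Type u} [Field k] [Field Z] [Field K] [Field κ] [Algebra k Z] [Algebra K κ]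
    (H : NU k Z) (ψ : Z →+* κ) {τ : κ} (hk : ∀ c : k, ψ (algebraMap k Z c) ∈ (algebraMap K κ).fieldRange)
    (gen : ∀ z, ψ z ∈ IntermediateField.adjoin K {τ}) (z : Z) : IsAlgebraic K (ψ z) := by
  let M := AlgebraicClosure κ
  let C := algebraicClosure K M
  haveI : IsAlgClosed C := (algebraicClosure.isAlgClosure K M).isAlgClosed
  have h := H C M ((algebraMap κ M).comp ψ) (algebraMap κ M τ) ?_ ?_ z
  · obtain ⟨c, hc⟩ := h
    have h2 : IsAlgebraic K (algebraMap κ M (ψ z)) := by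
      have : (c : M) = algebraMap κ M (ψ z) := hc
      rw [← this]
      exact mem_algebraicClosure_iff.mp c.2
    exact (isAlgebraic_algebraMap_iff (algebraMap κ M).injective).mp h2
  · intro c
    obtain ⟨a, ha⟩ := hk c
    refine ⟨algebraMap K C a, ?_⟩
    rw [RingHom.comp_apply, ← ha, ← IsScalarTower.algebraMap_apply, ← IsScalarTower.algebraMap_apply]
  · intro z
    have h1 : ∀ y ∈ IntermediateField.adjoin K {τ}, algebraMap κ M y ∈ (IntermediateField.adjoin C {algebraMap κ M τ}).toSubfield := by
      apply hom_mem_of_gen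
      · intro c
        rw [← IsScalarTower.algebraMap_apply, IsScalarTower.algebraMap_apply K C M]
        exact IntermediateField.algebraMap_mem _ _
      · rintro y rfl
        exact IntermediateField.subset_adjoin _ _ rfl
    exact h1 _ (gen z)

theorem NU.in_simple {k : Type v} {Z K κ : Type u} [Field k] [Field Z] [Field K] [Field κ] [Algebra k Z] [Algebra K κ]
    (H : NU k Z) (ψ : Z →+* κ) {τ : κ} (hk : ∀ c : k, ψ (algebraMap k Z c) ∈ (algebraMap K κ).fieldRange)
    (tr : Transcendental K τ) (gen : ∀ z, ψ z ∈ IntermediateField.adjoin K {τ}) (z : Z) : ∃ c, algebraMap K κ c = ψ z :=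
  tr_alg_mem tr (gen z) (H.alg_of_simple ψ hk gen z)

theorem Z_le {k : Type v} {κ : Type u} [Field k] [Field κ] [Algebra k κ] {Z₁ Z₂ : IntermediateField k κ} (H : NU k Z₁) {τ : κ}
    (tr : Transcendental Z₂ τ) (gen : IntermediateField.adjoin Z₂ {τ} = ⊤) : Z₁ ≤ Z₂ := by
  intro z hz
  obtain ⟨c, hc⟩ := H.in_simple (K := Z₂) (algebraMap Z₁ κ) (fun c => ⟨algebraMap k Z₂ c, rfl⟩) tr (by rw [gen]; simp) ⟨z, hz⟩
  have : (c : κ) = z := hc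
  rw [← this]; exact c.2

section
variable {F C M : Type*} [Field F] [Field C] [Field M] [Algebra F C] [Algebra C M] [Algebra F M] [IsScalarTower F C M]
  [CharZero F] [CharZero C]

theorem F1a [Algebra.IsAlgebraic F C] [IsAlgClosed C] {x w r : M} {s : F} (hs : s ≠ 0)
    (tr : Transcendental F x) (eq : w ^ 2 + w = x ^ 3 - x ^ 2) (hr : r ^ 5 = algebraMap F M s * cf x w)
    {l : List M} (hl0 : Pi5 l ≠ 0) (hl : ∀ z ∈ l, z ∈ IntermediateField.adjoin F {x, w, r}) {x₁ w₁ r₁ : M}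
    (hx₁ : x₁ ∈ IntermediateField.adjoin F {x, w, r}) (hw₁ : w₁ ∈ IntermediateField.adjoin F {x, w, r})
    (hr₁ : r₁ ∈ IntermediateField.adjoin F {x, w, r}) (h0 : x₁ ≠ 0) (eq₁ : w₁ ^ 2 + w₁ = x₁ ^ 3 - x₁ ^ 2)
    {j : ℕ} (hj : j = 1 ∨ j = 2) (h5 : r₁ ^ 5 = Pi5 l ^ j * cf x₁ w₁) :
    ∀ z ∈ l, ∃ c : F, algebraMap F M c = z := by
  obtain ⟨e, he, hg⟩ := exists_rho (C := C) hs hr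
  let L := IntermediateField.adjoin C {x, w, e}
  have up : ∀ z ∈ IntermediateField.adjoin F {x, w, r}, z ∈ L := by
    intro z hz
    show z ∈ IntermediateField.adjoin C {x, w, e}
    rw [hg]; exact adj_sub F C _ hz
  have m : ∀ z ∈ ({x, w, e} : Set M), z ∈ L := fun z hz => IntermediateField.subset_adjoin _ _ hz
  obtain ⟨W, -⟩ := curve_WD (C := C) (L := L) (x := ⟨x, m _ (by simp)⟩) (w := ⟨w, m _ (by simp)⟩) (e := ⟨e, m _ (by simp)⟩)
    (fun h => tr ((h.algebraMap (A := M)).restrictScalars F)) (by ext; exact eq) (by ext; exact he) (by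
      apply IntermediateField.lift_injective L
      rw [IntermediateField.lift_adjoin, IntermediateField.lift_top]
      simp [Set.image_insert_eq, L])
  obtain ⟨l', hl'⟩ : ∃ l' : List L, l'.map (algebraMap L M) = l := by
    refine ⟨l.attach.map (fun z => ⟨z.1, up _ (hl _ z.2)⟩), ?_⟩
    rw [List.map_map]
    exact List.attach_map_subtype_val l
  have hP : Pi5 l = algebraMap L M (Pi5 l') := by rw [← hl', ← Pi5_map]
  have hP0 : Pi5 l' ≠ 0 := by rintro h; apply hl0; rw [hP, h, map_zero]
  have key := W.list l' (by
    intro O _ _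
    have eqL : (⟨w₁, up _ hw₁⟩ : L) ^ 2 + ⟨w₁, up _ hw₁⟩ = ⟨x₁, up _ hx₁⟩ ^ 3 - ⟨x₁, up _ hx₁⟩ ^ 2 := by ext; exact eq₁
    have hc := cf_ne eqL (fun h => h0 (congrArg Subtype.val h))
    have h5L : (⟨r₁, up _ hr₁⟩ : L) ^ 5 = Pi5 l' ^ j * cf ⟨x₁, up _ hx₁⟩ ⟨w₁, up _ hw₁⟩ := by
      apply (algebraMap L M).injective
      rw [map_mul, map_pow, map_pow, ← hP, cf_map]
      exact h5
    have hr0 : (⟨r₁, up _ hr₁⟩ : L) ≠ 0 := by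
      intro h
      rw [h] at h5L
      exact mul_ne_zero (pow_ne_zero _ hP0) hc (by rw [← h5L]; norm_num)
    have hd := Div5.pow5 O hr0
    rw [h5L] at hd
    exact (hd.of_mul (div5_cf O eqL hc)).of_pow hj) hP0
  intro z hz
  rw [← hl'] at hz
  obtain ⟨z', hz', rfl⟩ := List.mem_map.mp hz
  obtain ⟨c, hc⟩ := key z' hz'
  refine relclosed (C := C) tr eq hs hr (hl _ (hl' ▸ hz)) ⟨c, ?_⟩
  rw [← hc, ← IsScalarTower.algebraMap_apply]
end

section
variable {k : Type v} [Field k] {F' κ : Type u} [Field F'] [Field κ] [Algebra k F'] [Algebra k κ] [CharZero k]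

theorem tr_transport {φ φ' : F' →ₐ[k] κ} {x : κ} (tr : Transcendental φ.fieldRange x) (h : ∀ z, φ' z ∈ φ.fieldRange)
    {M : Type*} [Field M] [Algebra κ M] [Algebra F' M] (hM : ∀ z, algebraMap F' M z = algebraMap κ M (φ' z)) :
    Transcendental F' (algebraMap κ M x) := by
  rintro ⟨p, hp0, hp⟩
  apply tr
  let f : F' →+* φ.fieldRange := (φ' : F' →+* κ).codRestrict φ.fieldRange.toSubfield h
  refine ⟨p.map f, (Polynomial.map_ne_zero_iff f.injective).mpr hp0, ?_⟩
  apply (algebraMap κ M).injective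
  rw [map_zero, ← hp, aeval_def, eval₂_map, hom_eval₂, aeval_def]
  congr 1
  ext z
  exact (hM z).symm

theorem Z_adjoin {j : ℕ} {s : F'} (D : CData k F' κ j s) {φ' : F' →ₐ[k] κ} (h : ∀ z, D.φ z ∈ φ'.fieldRange)
    {M : Type*} [Field M] [Algebra κ M] [Algebra F' M] (hM : ∀ z, algebraMap F' M z = algebraMap κ M (φ' z)) :
    ∀ z ∈ D.Z, algebraMap κ M z ∈ IntermediateField.adjoin F' {algebraMap κ M D.x, algebraMap κ M D.w, algebraMap κ M D.r} := by
  have := hom_mem_of_gen (k := k) (algebraMap κ M) (IntermediateField.adjoin F' {algebraMap κ M D.x, algebraMap κ M D.w, algebraMap κ M D.r}).toSubfield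
    (s := Set.range D.φ ∪ {D.x, D.w, D.r}) (fun c => by
      have : algebraMap κ M (algebraMap k κ c) = algebraMap F' M (algebraMap k F' c) := by rw [hM, AlgHom.commutes]
      rw [this]
      exact IntermediateField.algebraMap_mem _ _) (by
      rintro z (⟨y, rfl⟩ | rfl | rfl | rfl)
      · obtain ⟨y', hy'⟩ := h y
        have hy'' : φ' y' = D.φ y := hy'
        rw [← hy'', ← hM]
        exact IntermediateField.algebraMap_mem _ _
      · exact IntermediateField.subset_adjoin _ _ (by simp)
      · exact IntermediateField.subset_adjoin _ _ (by simp)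
      · exact IntermediateField.subset_adjoin _ _ (by simp))
  exact this

theorem F1 {j₁ j₂ : ℕ} (hj : j₁ = 1 ∨ j₁ = 2) {l : List F'} (hl : IntermediateField.adjoin k {z | z ∈ l} = ⊤)
    (hs : Pi5 l ≠ 0) (D₁ : CData k F' κ j₁ (Pi5 l)) (D₂ : CData k F' κ j₂ (Pi5 l)) (hZ : D₁.Z ≤ D₂.Z) (z : F') : D₁.φ z ∈ D₂.φ.fieldRange := by
  letI : Algebra F' κ := (D₂.φ : F' →+* κ).toAlgebra
  let M := AlgebraicClosure κ
  let C := algebraicClosure F' M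
  haveI : IsAlgClosed C := (algebraicClosure.isAlgClosure F' M).isAlgClosed
  haveI : CharZero F' := charZero_of_injective_algebraMap (FaithfulSMul.algebraMap_injective k F')
  haveI : CharZero C := charZero_of_injective_algebraMap (FaithfulSMul.algebraMap_injective F' C)
  have hM : ∀ z, algebraMap F' M z = algebraMap κ M (D₂.φ z) := fun z => IsScalarTower.algebraMap_apply F' κ M z
  have hin := Z_adjoin D₂ (φ' := D₂.φ) (fun z => ⟨z, rfl⟩) hM
  have hmap : Pi5 (l.map ((algebraMap κ M).comp (D₁.φ : F' →+* κ))) = algebraMap κ M (D₁.φ (Pi5 l)) := by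
    rw [← Pi5_map]; rfl
  have key := F1a (F := F') (C := C) (M := M) (x := algebraMap κ M D₂.x) (w := algebraMap κ M D₂.w) (r := algebraMap κ M D₂.r)
    (s := Pi5 l ^ j₂) (pow_ne_zero _ hs) (tr_transport D₂.tr (fun z => ⟨z, rfl⟩) hM)
    (by simp only [← map_pow, ← map_add, ← map_sub, D₂.eq])
    (by rw [hM, ← cf_map, ← map_mul, ← map_pow, D₂.hr, map_pow D₂.φ])
    (l := l.map ((algebraMap κ M).comp (D₁.φ : F' →+* κ)))
    (by rw [hmap]; simpa using hs)
    (by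
      intro z hz
      obtain ⟨y, hy, rfl⟩ := List.mem_map.mp hz
      exact hin _ (hZ (D₁.φ_mem y)))
    (hin _ (hZ D₁.x_mem)) (hin _ (hZ D₁.w_mem)) (hin _ (hZ D₁.r_mem))
    (by simpa using D₁.x_ne)
    (by simp only [← map_pow, ← map_add, ← map_sub, D₁.eq]) hj
    (by rw [hmap, ← cf_map, ← map_pow, ← map_pow, ← map_mul, D₁.hr])
  have hz : z ∈ IntermediateField.adjoin k {z | z ∈ l} := by rw [hl]; trivial
  refine hom_mem_of_gen (D₁.φ : F' →+* κ) D₂.φ.fieldRange.toSubfield ?_ ?_ z hz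
  · intro c
    exact ⟨algebraMap k F' c, by simp⟩
  · intro y hy
    obtain ⟨c, hc⟩ := key _ (List.mem_map_of_mem hy)
    refine ⟨c, (algebraMap κ M).injective ?_⟩
    exact (hM c).symm.trans hc

theorem F_main {l : List F'} (hl : IntermediateField.adjoin k {z | z ∈ l} = ⊤)
    (hs : Pi5 l ≠ 0) (D₁ : CData k F' κ 2 (Pi5 l)) (D₂ : CData k F' κ 1 (Pi5 l)) {τ₁ τ₂ : κ}
    (tr₁ : Transcendental D₁.Z τ₁) (gen₁ : IntermediateField.adjoin D₁.Z {τ₁} = ⊤)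
    (tr₂ : Transcendental D₂.Z τ₂) (gen₂ : IntermediateField.adjoin D₂.Z {τ₂} = ⊤) :
    ∃ θ : F' ≃ₐ[k] F', ∃ a, (a = 2 ∨ a = 3) ∧ ∀ O : ValuationSubring F', Div5 O (θ (Pi5 l) * Pi5 l ^ a) := by
  have n₁ := CData.nu (Or.inr rfl) hl hs D₁
  have n₂ := CData.nu (Or.inl rfl) hl hs D₂
  have hZ : D₁.Z = D₂.Z := le_antisymm (Z_le n₁ tr₂ gen₂) (Z_le n₂ tr₁ gen₁)
  have h12 := F1 (Or.inr rfl) hl hs D₁ D₂ hZ.le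
  have h21 := F1 (Or.inl rfl) hl hs D₂ D₁ hZ.ge
  have hR : D₂.φ.fieldRange = D₁.φ.fieldRange := le_antisymm (by rintro _ ⟨y, rfl⟩; exact h21 y) (by rintro _ ⟨y, rfl⟩; exact h12 y)
  let e₁ := AlgEquiv.ofInjectiveField D₁.φ
  let θ' : F' →ₐ[k] F' := (e₁.symm : D₁.φ.range →ₐ[k] F').comp (D₂.φ.codRestrict D₁.φ.range h21)
  have hθ' : ∀ z, D₁.φ (θ' z) = D₂.φ z := by
    intro z
    have := e₁.apply_symm_apply (D₂.φ.codRestrict D₁.φ.range h21 z)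
    exact congrArg Subtype.val this
  have hsurj : Function.Surjective θ' := by
    intro z
    obtain ⟨y, hy⟩ := h12 z
    refine ⟨y, D₁.φ.toRingHom.injective ?_⟩
    exact (hθ' y).trans hy
  let θ : F' ≃ₐ[k] F' := AlgEquiv.ofBijective θ' ⟨θ'.toRingHom.injective, hsurj⟩
  have hθ : ∀ z, D₁.φ (θ z) = D₂.φ z := hθ'
  refine ⟨θ, ?_⟩
  letI : Algebra F' κ := (D₁.φ : F' →+* κ).toAlgebra
  let M := AlgebraicClosure κ
  let C := algebraicClosure F' M
  haveI : IsAlgClosed C := (algebraicClosure.isAlgClosure F' M).isAlgClosed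
  haveI : CharZero F' := charZero_of_injective_algebraMap (FaithfulSMul.algebraMap_injective k F')
  haveI : CharZero C := charZero_of_injective_algebraMap (FaithfulSMul.algebraMap_injective F' C)
  have hM : ∀ z, algebraMap F' M z = algebraMap κ M (D₁.φ z) := fun z => IsScalarTower.algebraMap_apply F' κ M z
  have in₁ := Z_adjoin D₁ (φ' := D₁.φ) (fun z => ⟨z, rfl⟩) hM
  have in₂ := Z_adjoin D₂ (φ' := D₁.φ) h21 hM
  have hθs : θ (Pi5 l) ≠ 0 := by simpa using hs
  have key := F3 (F := F') (C := C) (M := M) (x₁ := algebraMap κ M D₁.x) (w₁ := algebraMap κ M D₁.w) (r₁ := algebraMap κ M D₁.r)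
    (x₂ := algebraMap κ M D₂.x) (w₂ := algebraMap κ M D₂.w) (r₂ := algebraMap κ M D₂.r) (s₁ := Pi5 l ^ 2) (s₂ := θ (Pi5 l))
    (pow_ne_zero _ hs) hθs (tr_transport D₁.tr (fun z => ⟨z, rfl⟩) hM)
    (by simp only [← map_pow, ← map_add, ← map_sub, D₁.eq])
    (by rw [hM, ← cf_map, ← map_mul, ← map_pow, D₁.hr, map_pow D₁.φ])
    (tr_transport D₂.tr h12 hM)
    (by simp only [← map_pow, ← map_add, ← map_sub, D₂.eq])
    (by rw [hM, hθ, ← cf_map, ← map_mul, ← map_pow, D₂.hr, pow_one]) _ rfl (by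
      apply le_antisymm
      · rw [IntermediateField.adjoin_le_iff]
        rintro z (rfl | rfl | rfl)
        · exact in₁ _ (hZ ▸ D₂.x_mem)
        · exact in₁ _ (hZ ▸ D₂.w_mem)
        · exact in₁ _ (hZ ▸ D₂.r_mem)
      · rw [IntermediateField.adjoin_le_iff]
        rintro z (rfl | rfl | rfl)
        · exact in₂ _ (hZ ▸ D₁.x_mem)
        · exact in₂ _ (hZ ▸ D₁.w_mem)
        · exact in₂ _ (hZ ▸ D₁.r_mem))
  rcases key with h | h
  · refine ⟨2, Or.inl rfl, fun O => ?_⟩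
    rw [mul_comm]; exact h O
  · refine ⟨3, Or.inr rfl, fun O => ?_⟩
    have := (h O).mul (Div5.pow5 O hs)
    have e : θ (Pi5 l) * (Pi5 l ^ 2)⁻¹ * Pi5 l ^ 5 = θ (Pi5 l) * Pi5 l ^ 3 := by field_simp
    rwa [e] at this
end
end CrBir
end

section
namespace CrBir
open Polynomial IntermediateField.algebraAdjoinAdjoin
universe u v

/-- a place of `L` trivial on `k` -/
structure Place (k : Type v) (L : Type u) [Field k] [Field L] [Algebra k L] where
  O : ValuationSubring L
  hk : ∀ c : k, algebraMap k L c ∈ O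

section
variable {k : Type v} {L : Type u} [Field k] [Field L] [Algebra k L]

def Place.Res (P : Place k L) : Type u := IsLocalRing.ResidueField P.O

noncomputable instance (P : Place k L) : Field P.Res := inferInstanceAs (Field (IsLocalRing.ResidueField P.O))

noncomputable def Place.rd (P : Place k L) : P.O →+* P.Res := IsLocalRing.residue P.O

noncomputable instance (P : Place k L) : Algebra k P.Res :=
  (P.rd.comp ((algebraMap k L).codRestrict P.O P.hk)).toAlgebra

theorem Place.rd_alg (P : Place k L) (c : k) : P.rd ⟨algebraMap k L c, P.hk c⟩ = algebraMap k P.Res c := rfl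

theorem Place.rd_surj (P : Place k L) : Function.Surjective P.rd := IsLocalRing.residue_surjective

theorem Place.rd_eq_zero (P : Place k L) {a : P.O} : P.rd a = 0 ↔ P.O.valuation a < 1 := by
  rw [← ValuationSubring.valuation_lt_one_iff]
  exact IsLocalRing.residue_eq_zero_iff a

theorem Place.rd_ne_zero (P : Place k L) {a : P.O} : P.rd a ≠ 0 ↔ P.O.valuation a = 1 := by
  rw [Ne, P.rd_eq_zero, not_lt]
  exact ⟨fun h => le_antisymm (P.O.valuation_le_one a) h, fun h => h.ge⟩

theorem Place.inv_mem (P : Place k L) {a : P.O} (h : P.rd a ≠ 0) : (a : L)⁻¹ ∈ P.O := by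
  rw [P.rd_ne_zero] at h
  rw [← ValuationSubring.valuation_le_one_iff, map_inv₀, h, inv_one]

theorem Place.rd_inv (P : Place k L) {a : P.O} (h : P.rd a ≠ 0) : P.rd ⟨(a : L)⁻¹, P.inv_mem h⟩ = (P.rd a)⁻¹ := by
  apply eq_inv_of_mul_eq_one_left
  rw [← map_mul, ← map_one P.rd]
  congr 1
  ext
  have : (a : L) ≠ 0 := by
    intro h0
    apply h
    have : a = 0 := by ext; exact h0
    rw [this, map_zero]
  exact inv_mul_cancel₀ this

/-- image in the residue field of a subfield -/
noncomputable def Place.img (P : Place k L) (E : IntermediateField k L) : IntermediateField k P.Res where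
  carrier := {y | ∃ a : P.O, (a : L) ∈ E ∧ P.rd a = y}
  mul_mem' := by rintro _ _ ⟨a, ha, rfl⟩ ⟨b, hb, rfl⟩; exact ⟨a * b, mul_mem ha hb, map_mul _ _ _⟩
  add_mem' := by rintro _ _ ⟨a, ha, rfl⟩ ⟨b, hb, rfl⟩; exact ⟨a + b, add_mem ha hb, map_add _ _ _⟩
  algebraMap_mem' := by intro c; exact ⟨⟨algebraMap k L c, P.hk c⟩, E.algebraMap_mem c, rfl⟩
  inv_mem' := by
    rintro _ ⟨a, ha, rfl⟩
    by_cases h : P.rd a = 0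
    · exact ⟨0, zero_mem _, by rw [h, inv_zero, map_zero]⟩
    · exact ⟨⟨(a : L)⁻¹, P.inv_mem h⟩, E.inv_mem ha, P.rd_inv h⟩

theorem Place.mem_img (P : Place k L) {E : IntermediateField k L} {y : P.Res} :
    y ∈ P.img E ↔ ∃ a : P.O, (a : L) ∈ E ∧ P.rd a = y := Iff.rfl

theorem Place.img_mono (P : Place k L) {E E' : IntermediateField k L} (h : E ≤ E') : P.img E ≤ P.img E' := by
  rintro _ ⟨a, ha, rfl⟩; exact ⟨a, h ha, rfl⟩

theorem Place.img_top (P : Place k L) : P.img ⊤ = ⊤ := by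
  rw [eq_top_iff]; intro y _; obtain ⟨a, rfl⟩ := P.rd_surj y; exact ⟨a, trivial, rfl⟩

/-- polynomials commute with residues -/
theorem Place.rd_aeval (P : Place k L) {ι : Type*} (a : ι → P.O) (p : MvPolynomial ι k) :
    ∃ h : MvPolynomial.aeval (fun i => (a i : L)) p ∈ P.O, P.rd ⟨_, h⟩ = MvPolynomial.aeval (fun i => P.rd (a i)) p := by
  induction p using MvPolynomial.induction_on with
  | C c => exact ⟨by simpa using P.hk c, by simp [← P.rd_alg]⟩
  | add p q hp hq =>
    obtain ⟨h1, h2⟩ := hp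
    obtain ⟨h3, h4⟩ := hq
    refine ⟨by rw [map_add]; exact add_mem h1 h3, ?_⟩
    rw [map_add (MvPolynomial.aeval fun i => P.rd (a i)), ← h2, ← h4, ← map_add P.rd]
    congr 1; ext; exact map_add _ _ _
  | mul_X p i hp =>
    obtain ⟨h1, h2⟩ := hp
    refine ⟨by rw [map_mul, MvPolynomial.aeval_X]; exact mul_mem h1 (a i).2, ?_⟩
    rw [map_mul (MvPolynomial.aeval fun i => P.rd (a i)), MvPolynomial.aeval_X (fun i => P.rd (a i)), ← h2, ← map_mul P.rd]
    congr 1; ext; simp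

theorem Place.algInd (P : Place k L) {ι : Type*} (a : ι → P.O) (h : AlgebraicIndependent k (fun i => P.rd (a i))) :
    AlgebraicIndependent k (fun i => (a i : L)) ∧ ∀ z ∈ IntermediateField.adjoin k (Set.range (fun i => (a i : L))), z ∈ P.O := by
  have key : ∀ p : MvPolynomial ι k, p ≠ 0 → MvPolynomial.aeval (fun i => (a i : L)) p ∈ P.O ∧ (MvPolynomial.aeval (fun i => (a i : L)) p)⁻¹ ∈ P.O
      ∧ MvPolynomial.aeval (fun i => (a i : L)) p ≠ 0 := by
    intro p hp
    obtain ⟨h1, h2⟩ := P.rd_aeval a p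
    have h3 : P.rd ⟨_, h1⟩ ≠ 0 := by
      rw [h2]; intro h0; exact hp (h.eq_zero_of_aeval_eq_zero _ h0)
    refine ⟨h1, P.inv_mem h3, fun h4 => h3 ?_⟩
    have : (⟨_, h1⟩ : P.O) = 0 := by ext; exact h4
    rw [this, map_zero]
  constructor
  · rw [algebraicIndependent_iff]
    intro p hp
    by_contra h0
    exact (key p h0).2.2 hp
  · intro z hz
    rw [IntermediateField.mem_adjoin_range_iff] at hz
    obtain ⟨p, q, rfl⟩ := hz
    by_cases hq : q = 0
    · rw [hq, map_zero, div_zero]; exact zero_mem _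
    · rw [div_eq_mul_inv]
      exact mul_mem (P.rd_aeval a p).1 (key q hq).2.1

theorem mem_of_alg_sub {O : ValuationSubring L} {E : IntermediateField k L} (hE : ∀ z ∈ E, z ∈ O) {z : L} (h : IsAlgebraic E z) : z ∈ O := by
  apply mem_of_integral
  have h := h.isIntegral
  let f : E →+* O := ⟨⟨⟨fun z => ⟨z, hE z z.2⟩, rfl⟩, fun _ _ => rfl⟩, rfl, fun _ _ => rfl⟩
  obtain ⟨p, hp, hpz⟩ := h
  refine ⟨p.map f, hp.map _, ?_⟩
  rw [eval₂_map]
  exact hpz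

/-- (D) -/
theorem Place.le_of_trdeg (P : Place k L) (E : IntermediateField k L) (hfin : Algebra.trdeg k E < Cardinal.aleph0)
    (h : Algebra.trdeg k E ≤ Algebra.trdeg k (P.img E)) : ∀ a ∈ E, a ∈ P.O := by
  obtain ⟨ι, y, hy⟩ := exists_isTranscendenceBasis' k (P.img E)
  have hex : ∀ i, ∃ a : P.O, (a : L) ∈ E ∧ P.rd a = y i := fun i => (y i).2
  choose a haE har using hex
  have h1 : AlgebraicIndependent k (fun i => P.rd (a i)) := by
    have := hy.1.map' (f := (P.img E).val) (RingHom.injective _)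
    convert this using 1
    ext i; exact har i
  obtain ⟨h2, h3⟩ := P.algInd a h1
  have h4 : AlgebraicIndependent k (fun i => (⟨a i, haE i⟩ : E)) := h2.of_comp E.val
  have hcard := hy.cardinalMk_eq_trdeg
  have hle := h4.cardinalMk_le_trdeg
  haveI : Finite ι := by
    rw [← Cardinal.lt_aleph0_iff_finite]
    exact lt_of_le_of_lt hle hfin
  have h5 := h4.isTranscendenceBasis_of_trdeg_le_of_finite (by rw [hcard]; exact h)
  have h6 := h5.isAlgebraic_field
  intro z hz
  have h7 := (h6.isAlgebraic (⟨z, hz⟩ : E)).algebraMap (A := L)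
  let E' := IntermediateField.adjoin k (Set.range (fun i => (⟨a i, haE i⟩ : E)))
  have hE' : ∀ z ∈ E', (z : L) ∈ P.O := by
    intro z hz
    apply h3
    have : (z : L) ∈ IntermediateField.lift E' := (IntermediateField.mem_lift z).mpr hz
    rw [IntermediateField.lift_adjoin] at this
    convert this using 2
    ext; simp
  have h8 : IsAlgebraic (IntermediateField.lift E') z := by
    obtain ⟨p, hp0, hp⟩ := h7
    let f : E' →+* IntermediateField.lift E' := ((algebraMap E L).comp (algebraMap E' E)).codRestrict (IntermediateField.lift E').toSubfield
      (fun w => (IntermediateField.mem_lift _).mpr w.2)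
    refine ⟨p.map f, (Polynomial.map_ne_zero_iff f.injective).mpr hp0, ?_⟩
    rw [aeval_def, eval₂_map]
    exact hp
  refine mem_of_alg_sub ?_ h8
  intro w hw
  obtain ⟨w', hw', rfl⟩ := hw
  exact hE' w' hw'
end
end CrBir
end

section
namespace CrBir
open Polynomial IntermediateField.algebraAdjoinAdjoin
universe u v

section
variable {k : Type v} {M : Type u} [Field k] [Field M] [Algebra k M] (W : Place k M)
  {Kb : Type*} [Field Kb] [Algebra Kb M] {C : Type*} [Field C] [Algebra C W.Res]

def Gd (Kb : Type*) [Field Kb] [Algebra Kb M] (S : Subfield W.Res) (g z : M) : Prop :=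
  ∃ c : Kb, c ≠ 0 ∧ ∃ n : ℤ, ∃ e : W.O, W.rd e ∈ S ∧ W.rd e ≠ 0 ∧ z = algebraMap Kb M c * g ^ n * e

variable {W}

theorem coe_ne_of_rd {e : W.O} (h : W.rd e ≠ 0) : (e : M) ≠ 0 := by
  intro h0; apply h; have : e = 0 := by ext; exact h0
  rw [this, map_zero]

theorem Gd.mul {S : Subfield W.Res} {g z z' : M} (hg : g ≠ 0) (h : Gd W Kb S g z) (h' : Gd W Kb S g z') : Gd W Kb S g (z * z') := by
  obtain ⟨c, hc, n, e, he, he0, rfl⟩ := h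
  obtain ⟨c', hc', n', e', he', he0', rfl⟩ := h'
  refine ⟨c * c', mul_ne_zero hc hc', n + n', e * e', by rw [map_mul]; exact mul_mem he he', by rw [map_mul]; exact mul_ne_zero he0 he0', ?_⟩
  rw [zpow_add₀ hg, map_mul]; push_cast; ring

theorem Gd.inv {S : Subfield W.Res} {g z : M} (h : Gd W Kb S g z) : Gd W Kb S g z⁻¹ := by
  obtain ⟨c, hc, n, e, he, he0, rfl⟩ := h
  refine ⟨c⁻¹, inv_ne_zero hc, -n, ⟨(e : M)⁻¹, W.inv_mem he0⟩, by rw [W.rd_inv he0]; exact inv_mem he,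
    by rw [W.rd_inv he0]; exact inv_ne_zero he0, ?_⟩
  rw [zpow_neg, map_inv₀]
  simp only [mul_inv]

theorem Gd.const {S : Subfield W.Res} {g : M} {c : Kb} (hc : c ≠ 0) : Gd W Kb S g (algebraMap Kb M c) :=
  ⟨c, hc, 0, 1, by rw [map_one]; exact one_mem _, by rw [map_one]; exact one_ne_zero, by simp⟩

theorem Gd.poly [IsAlgClosed Kb] {S : Subfield W.Res} {g u : M} (hg : g ≠ 0) (h : ∀ a : Kb, Gd W Kb S g (u - algebraMap Kb M a))
    (p : Kb[X]) (hp : p ≠ 0) : Gd W Kb S g (aeval u p) := by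
  have h1 := (IsAlgClosed.splits p).eq_prod_roots
  rw [h1]
  rw [map_mul, aeval_C]
  refine Gd.mul hg (Gd.const (leadingCoeff_ne_zero.mpr hp)) ?_
  induction p.roots using Multiset.induction_on with
  | empty => simpa using Gd.const (W := W) (S := S) (g := g) (one_ne_zero (α := Kb))
  | cons a s ih =>
    rw [Multiset.map_cons, Multiset.prod_cons, map_mul]
    refine Gd.mul hg ?_ ih
    simpa using h a

theorem Gd.res {S : Subfield W.Res} {g : M}
    (hg : ∀ c : Kb, c ≠ 0 → ∀ n : ℤ, W.O.valuation (algebraMap Kb M c * g ^ n) = 1 → ∃ e : W.O, (e : M) = algebraMap Kb M c * g ^ n ∧ W.rd e ∈ S)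
    (z : W.O) (h : Gd W Kb S g z) : W.rd z ∈ S := by
  by_cases h0 : W.rd z = 0
  · rw [h0]; exact zero_mem _
  obtain ⟨c, hc, n, e, he, he0, hz⟩ := h
  have h1 := W.rd_ne_zero.mp h0
  have h2 := W.rd_ne_zero.mp he0
  rw [hz, map_mul, h2, mul_one] at h1
  obtain ⟨e', he', hr⟩ := hg c hc n h1
  have : z = e' * e := by ext; rw [hz]; push_cast; rw [he']
  rw [this, map_mul]
  exact mul_mem hr he

theorem B0_core [IsAlgClosed Kb] [CharZero Kb] {S : Subfield W.Res} {g u : M} (hg0 : g ≠ 0)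
    (hg : ∀ c : Kb, c ≠ 0 → ∀ n : ℤ, W.O.valuation (algebraMap Kb M c * g ^ n) = 1 → ∃ e : W.O, (e : M) = algebraMap Kb M c * g ^ n ∧ W.rd e ∈ S)
    (h : ∀ a : Kb, Gd W Kb S g (u - algebraMap Kb M a)) (z : W.O) (hz : (z : M) ∈ IntermediateField.adjoin Kb {u}) : W.rd z ∈ S := by
  obtain ⟨p, q, hq, hz⟩ := mem_adjoin_simple_div hz
  by_cases hp : p = 0
  · have : z = 0 := by ext; rw [hz, hp, map_zero, zero_div]; rfl
    rw [this, map_zero]; exact zero_mem _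
  · apply Gd.res hg
    rw [hz, div_eq_mul_inv]
    refine Gd.mul hg0 (Gd.poly hg0 h p hp) (Gd.inv (Gd.poly hg0 h q ?_))
    rintro rfl
    exact hq (map_zero _)

/-- `1+ε` times a constant or power of g -/
theorem Gd.one_add {S : Subfield W.Res} {g y ε : M} (hy : Gd W Kb S g y) (hg : g ≠ 0) (hε : W.O.valuation ε < 1) : Gd W Kb S g (y * (1 + ε)) := by
  refine Gd.mul hg hy ⟨1, one_ne_zero, 0, 1 + ⟨ε, mem_iff_val.mpr hε.le⟩, ?_, ?_, ?_⟩
  · rw [map_add, map_one, W.rd_eq_zero.mpr hε, add_zero]; exact one_mem _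
  · rw [map_add, map_one, W.rd_eq_zero.mpr hε, add_zero]; exact one_ne_zero
  · simp

theorem Gd.add_of_lt {S : Subfield W.Res} {g y y' : M} (hy : Gd W Kb S g y) (hy0 : y ≠ 0) (hg : g ≠ 0) (hε : W.O.valuation y' < W.O.valuation y) :
    Gd W Kb S g (y + y') := by
  have : y + y' = y * (1 + y' / y) := by field_simp
  rw [this]
  apply Gd.one_add hy hg
  rw [map_div₀]
  exact (div_lt_one₀ (val_pos hy0)).mpr hε

theorem B0 [IsAlgClosed Kb] [CharZero Kb] (hC : ∀ z : W.O, (z : M) ∈ (algebraMap Kb M).fieldRange → W.rd z ∈ (algebraMap C W.Res).fieldRange) (u : M) :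
    ∃ ξ, ∀ z : W.O, (z : M) ∈ IntermediateField.adjoin Kb {u} → W.rd z ∈ IntermediateField.adjoin C {ξ} := by
  have hS : ∀ ξ : W.Res, ∀ y ∈ (algebraMap C W.Res).fieldRange, y ∈ IntermediateField.adjoin C {ξ} := by
    rintro ξ _ ⟨c, rfl⟩; exact (IntermediateField.adjoin C {ξ}).algebraMap_mem c
  have hg1 : ∀ S : Subfield W.Res, (algebraMap C W.Res).fieldRange ≤ S → ∀ c : Kb, c ≠ 0 → ∀ n : ℤ, W.O.valuation (algebraMap Kb M c * 1 ^ n) = 1 →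
      ∃ e : W.O, (e : M) = algebraMap Kb M c * 1 ^ n ∧ W.rd e ∈ S := by
    intro S hS c hc n hn
    rw [one_zpow, mul_one] at *
    exact ⟨⟨_, mem_iff_val.mpr hn.le⟩, rfl, hS (hC _ ⟨c, rfl⟩)⟩
  by_cases hu : u ∈ (algebraMap Kb M).fieldRange
  · refine ⟨0, fun z hz => hS _ _ (hC z ?_)⟩
    obtain ⟨p, q, -, hz⟩ := mem_adjoin_simple_div hz
    obtain ⟨c, rfl⟩ := hu
    rw [hz, aeval_algebraMap_apply, aeval_algebraMap_apply, ← map_div₀]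
    exact ⟨_, rfl⟩
  have hua : ∀ a : Kb, u - algebraMap Kb M a ≠ 0 := fun a h => hu ⟨a, (sub_eq_zero.mp h).symm⟩
  by_cases h2 : ∃ a : Kb, ∀ c : Kb, W.O.valuation (u - algebraMap Kb M a) ≠ W.O.valuation (algebraMap Kb M c)
  · obtain ⟨a, ha⟩ := h2
    refine ⟨0, ?_⟩
    apply B0_core (S := (IntermediateField.adjoin C {(0 : W.Res)}).toSubfield) (g := u - algebraMap Kb M a) (hua a)
    · have hpow : ∀ n : ℕ, n ≠ 0 → ∀ c : Kb, W.O.valuation (u - algebraMap Kb M a) ^ n ≠ W.O.valuation (algebraMap Kb M c) := by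
        intro n hn c h
        obtain ⟨d, rfl⟩ := IsAlgClosed.exists_pow_nat_eq c (Nat.pos_of_ne_zero hn)
        rw [map_pow, map_pow] at h
        exact ha d ((pow_left_inj₀ (zero_le) (zero_le) hn).mp h)
      intro c hc n hn
      have hvc : W.O.valuation (algebraMap Kb M c) ≠ 0 := by simpa using hc
      by_cases hn0 : n = 0
      · subst hn0
        rw [zpow_zero, mul_one] at *
        exact ⟨⟨_, mem_iff_val.mpr hn.le⟩, rfl, hS _ _ (hC _ ⟨c, rfl⟩)⟩
      · exfalso
        rw [map_mul, map_zpow₀] at hn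
        obtain ⟨j, rfl | rfl⟩ := n.eq_nat_or_neg
        · apply hpow j (by simpa using hn0) c⁻¹
          rw [zpow_natCast] at hn
          rw [map_inv₀, map_inv₀]
          exact eq_inv_of_mul_eq_one_right hn
        · apply hpow j (by simpa using hn0) c
          rw [zpow_neg, zpow_natCast] at hn
          rw [eq_inv_of_mul_eq_one_left hn, inv_inv]
    · intro b
      have e1 : u - algebraMap Kb M b = (u - algebraMap Kb M a) + algebraMap Kb M (a - b) := by rw [map_sub]; ring
      have hgg : Gd W Kb (IntermediateField.adjoin C {(0 : W.Res)}).toSubfield (u - algebraMap Kb M a) (u - algebraMap Kb M a) :=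
        ⟨1, one_ne_zero, 1, 1, by rw [map_one]; exact one_mem _, by rw [map_one]; exact one_ne_zero, by simp⟩
      rcases lt_trichotomy (W.O.valuation (algebraMap Kb M (a - b))) (W.O.valuation (u - algebraMap Kb M a)) with h | h | h
      · rw [e1]; exact Gd.add_of_lt hgg (hua a) (hua a) h
      · exact absurd h.symm (ha _)
      · rw [e1, add_comm]
        have hab : a - b ≠ 0 := by intro h0; rw [h0, map_zero, map_zero] at h; exact absurd h (not_lt.mpr zero_le)
        exact Gd.add_of_lt (Gd.const hab) ((_root_.map_ne_zero _).mpr hab) (hua a) h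
  · push Not at h2
    have key : ∀ a : Kb, ∃ c : Kb, c ≠ 0 ∧ ∃ e : W.O, u - algebraMap Kb M a = algebraMap Kb M c * e ∧ W.rd e ≠ 0 := by
      intro a
      obtain ⟨c, hc⟩ := h2 a
      have hc0 : c ≠ 0 := by
        rintro rfl
        rw [map_zero, map_zero] at hc
        exact hua a ((map_eq_zero _).mp hc)
      have hc1 : algebraMap Kb M c ≠ 0 := by simpa using hc0
      have hv : W.O.valuation ((u - algebraMap Kb M a) / algebraMap Kb M c) = 1 := by
        rw [map_div₀, hc, div_self]; simpa using hc0
      refine ⟨c, hc0, ⟨_, mem_iff_val.mpr hv.le⟩, ?_, W.rd_ne_zero.mpr hv⟩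
      field_simp
    by_cases h3 : ∃ a c : Kb, c ≠ 0 ∧ ∃ e : W.O, u - algebraMap Kb M a = algebraMap Kb M c * e ∧ W.rd e ≠ 0 ∧ W.rd e ∉ (algebraMap C W.Res).fieldRange
    · obtain ⟨a, c, hc, e, he, he0, hec⟩ := h3
      refine ⟨W.rd e, ?_⟩
      apply B0_core (S := (IntermediateField.adjoin C {W.rd e}).toSubfield) (g := 1) one_ne_zero (hg1 _ (hS _))
      intro b
      have hc1 : algebraMap Kb M c ≠ 0 := by simpa using hc
      have e1 : u - algebraMap Kb M b = algebraMap Kb M (a - b) + algebraMap Kb M c * e := by rw [← he, map_sub]; ring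
      rcases lt_or_ge (W.O.valuation (algebraMap Kb M c)) (W.O.valuation (algebraMap Kb M (a - b))) with h | h
      · rw [e1]
        have hab : a - b ≠ 0 := by intro h0; rw [h0, map_zero, map_zero] at h; exact absurd h (not_lt.mpr zero_le)
        refine Gd.add_of_lt (Gd.const hab) ((_root_.map_ne_zero _).mpr hab) one_ne_zero ?_
        rw [map_mul, W.rd_ne_zero.mp he0, mul_one]; exact h
      · have hv : W.O.valuation (algebraMap Kb M ((a - b) / c)) ≤ 1 := by
          rw [map_div₀, map_div₀]
          exact (div_le_one₀ (val_pos hc1)).mpr h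
        let d : W.O := ⟨_, mem_iff_val.mpr hv⟩
        have hd : W.rd d ∈ (algebraMap C W.Res).fieldRange := hC d ⟨_, rfl⟩
        refine ⟨c, hc, 0, d + e, ?_, ?_, ?_⟩
        · rw [map_add]; exact add_mem (hS _ _ hd) (IntermediateField.mem_adjoin_simple_self C _)
        · rw [map_add]
          intro h0
          apply hec
          rw [eq_neg_of_add_eq_zero_right h0]
          exact neg_mem hd
        · rw [e1, zpow_zero, mul_one]
          have : ((d + e : W.O) : M) = algebraMap Kb M (a - b) / algebraMap Kb M c + e := by
            rw [← map_div₀]; rfl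
          rw [this]
          field_simp
    · push Not at h3
      refine ⟨0, ?_⟩
      apply B0_core (S := (IntermediateField.adjoin C {(0 : W.Res)}).toSubfield) (g := 1) one_ne_zero (hg1 _ (hS _))
      intro a
      obtain ⟨c, hc, e, he, he0⟩ := key a
      exact ⟨c, hc, 0, e, hS _ _ (h3 a c hc e he he0), he0, by rw [he, zpow_zero, mul_one]⟩
end
end CrBir
end

section
namespace CrBir
open Polynomial IntermediateField.algebraAdjoinAdjoin
universe u v

section
variable {k : Type v} [Field k]

theorem Place.exists_dom {L M : Type*} [Field L] [Field M] [Algebra k L] [Algebra k M] [Algebra L M] [IsScalarTower k L M] (P : Place k L) :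
    ∃ W : Place k M, (∀ a : L, algebraMap L M a ∈ W.O ↔ a ∈ P.O) ∧
      ∃ jr : P.Res →+* W.Res, ∀ (a : P.O) (b : W.O), (b : M) = algebraMap L M a → jr (P.rd a) = W.rd b := by
  let f : P.O →+* M := (algebraMap L M).comp P.O.subtype
  have hf : Function.Injective f := (algebraMap L M).injective.comp Subtype.val_injective
  let I : Ideal f.range := (IsLocalRing.maximalIdeal P.O).map f.rangeRestrict
  have hI : I ≠ ⊤ := by
    intro h
    have h1 : (1 : f.range) ∈ I := by rw [h]; trivial
    rw [Ideal.mem_map_iff_of_surjective _ f.rangeRestrict_surjective] at h1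
    obtain ⟨a, ha, h1⟩ := h1
    have : a = 1 := by
      apply hf
      rw [map_one]
      exact congrArg Subtype.val h1
    rw [this] at ha
    exact (Ideal.ne_top_iff_one _).mp (IsLocalRing.maximalIdeal.isMaximal P.O).ne_top ha
  obtain ⟨B, hB1, hB2⟩ := Ideal.image_subset_nonunits_valuationSubring I hI
  have h1 : ∀ a : P.O, algebraMap L M a ∈ B := fun a => hB1 ⟨a, rfl⟩
  have h2 : ∀ a : P.O, P.O.valuation a < 1 → B.valuation (algebraMap L M a) < 1 := by
    intro a ha
    rw [← ValuationSubring.mem_nonunits_iff]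
    apply hB2
    refine ⟨f.rangeRestrict a, Ideal.mem_map_of_mem _ ?_, rfl⟩
    exact (P.O.valuation_lt_one_iff a).mpr ha
  let W : Place k M := ⟨B, fun c => by rw [IsScalarTower.algebraMap_apply k L M]; exact h1 ⟨_, P.hk c⟩⟩
  refine ⟨W, ?_, ?_⟩
  · intro a
    refine ⟨fun h => ?_, fun h => h1 ⟨a, h⟩⟩
    by_contra h3
    rw [mem_iff_val, not_le] at h3
    have ha : a ≠ 0 := by rintro rfl; rw [map_zero] at h3; exact absurd h3 (not_lt.mpr zero_le)
    have h4 : P.O.valuation a⁻¹ < 1 := by rw [map_inv₀]; exact inv_lt_one_of_one_lt₀ h3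
    have h5 := h2 ⟨a⁻¹, mem_iff_val.mpr h4.le⟩ h4
    rw [mem_iff_val] at h
    simp only [map_inv₀] at h5
    rw [inv_lt_one₀ (val_pos (by simpa using ha))] at h5
    exact absurd h (not_le.mpr h5)
  · let g : P.O →+* W.O := f.codRestrict W.O h1
    haveI : IsLocalHom g := by
      constructor
      intro a ha
      by_contra h
      have h6 : P.O.valuation a < 1 := (P.O.valuation_lt_one_iff a).mp ((IsLocalRing.mem_maximalIdeal a).mpr h)
      have h7 := h2 a h6
      have h8 : B.valuation (algebraMap L M a) = 1 := (B.valuation_eq_one_iff (g a)).mp ha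
      exact absurd h7 (by rw [h8]; exact lt_irrefl _)
    refine ⟨IsLocalRing.ResidueField.map g, ?_⟩
    intro a b hb
    have : b = g a := by ext; exact hb
    rw [this]
    exact IsLocalRing.ResidueField.map_residue g a

theorem Place.res_algClosed {M : Type u} [Field M] [Algebra k M] [IsAlgClosed M] (W : Place k M) : IsAlgClosed W.Res := by
  apply IsAlgClosed.of_exists_root
  intro p hp hirr
  obtain ⟨q, hq, hdeg, hmon⟩ := Polynomial.lifts_and_degree_eq_and_monic (f := W.rd) (p := p)
    (by rw [Polynomial.lifts_iff_coeff_lifts]; intro n; exact W.rd_surj _) hp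
  have hd : (q.map (algebraMap W.O M)).degree ≠ 0 := by
    rw [degree_map_eq_of_injective (Subtype.val_injective : Function.Injective (algebraMap W.O M)), hdeg]
    exact (degree_pos_of_irreducible hirr).ne'
  obtain ⟨z, hz⟩ := IsAlgClosed.exists_root _ hd
  have hzO : z ∈ W.O := by
    apply mem_of_integral
    refine ⟨q, hmon, ?_⟩
    rw [← eval_map]; exact hz
  refine ⟨W.rd ⟨z, hzO⟩, ?_⟩
  rw [← hq, eval_map, eval₂_hom]
  have : eval ⟨z, hzO⟩ q = 0 := by
    apply (Subtype.val_injective : Function.Injective (algebraMap W.O M))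
    change algebraMap W.O M (eval ⟨z, hzO⟩ q) = 0
    rw [← eval₂_hom, ← eval_map]
    exact hz
  rw [this, map_zero]

/-- residues of algebraic elements are algebraic -/
theorem Place.rd_algebraic {M : Type u} [Field M] [Algebra k M] (W : Place k M) (K₂ : Subfield M) (T : Subfield W.Res)
    (hT : ∀ a : W.O, (a : M) ∈ K₂ → W.rd a ∈ T) (z : W.O) (h : IsAlgebraic K₂ (z : M)) : IsAlgebraic T (W.rd z) := by
  obtain ⟨p, hp0, hp⟩ := h
  obtain ⟨i, hi, hmax⟩ := Finset.exists_max_image p.support (fun i => W.O.valuation (p.coeff i : M)) (Polynomial.support_nonempty.mpr hp0)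
  have hci : (p.coeff i : M) ≠ 0 := by simpa using mem_support_iff.mp hi
  have hle : ∀ j, W.O.valuation ((p.coeff j : M) / p.coeff i) ≤ 1 := by
    intro j
    rw [map_div₀]
    refine (div_le_one₀ (val_pos hci)).mpr ?_
    by_cases hj : j ∈ p.support
    · exact hmax j hj
    · rw [notMem_support_iff.mp hj]; simp
  let q : T[X] := ∑ j ∈ p.support, Polynomial.monomial j ⟨W.rd ⟨(p.coeff j : M) / p.coeff i, mem_iff_val.mpr (hle j)⟩,
    hT _ (div_mem (p.coeff j).2 (p.coeff i).2)⟩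
  refine ⟨q, ?_, ?_⟩
  · intro h0
    have h1 : q.coeff i = 0 := by rw [h0, coeff_zero]
    simp only [q, finset_sum_coeff, coeff_monomial] at h1
    rw [Finset.sum_ite_eq' p.support i, if_pos hi] at h1
    have h2 := congrArg Subtype.val h1
    simp only [div_self hci] at h2
    exact one_ne_zero (α := W.Res) ((map_one W.rd).symm.trans h2)
  · have h1 : ∑ j ∈ p.support, (⟨(p.coeff j : M) / p.coeff i, mem_iff_val.mpr (hle j)⟩ : W.O) * z ^ j = 0 := by
      ext
      push_cast
      rw [aeval_eq_sum_range' (Nat.lt_succ_self _)] at hp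
      have h3 : ∑ j ∈ p.support, (p.coeff j : M) * (z : M) ^ j = 0 := by
        rw [← hp, Finset.sum_subset (fun j hj => Finset.mem_range.mpr (Nat.lt_succ_of_le (le_natDegree_of_mem_supp j hj)))]
        · rfl
        · intro j _ hj
          rw [notMem_support_iff.mp hj]; simp
      have h4 : ∀ j, (p.coeff j : M) / p.coeff i * (z : M) ^ j = ((p.coeff j : M) * (z : M) ^ j) / p.coeff i := fun j => by ring
      simp only [h4]
      rw [← Finset.sum_div, h3, zero_div]
    have h2 := congrArg W.rd h1
    rw [map_sum, map_zero] at h2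
    rw [← h2]
    simp only [q, map_sum, aeval_monomial, map_mul, map_pow]
    rfl

/-- (B) -/
theorem Place.B [CharZero k] {L Z : Type u} [Field L] [Algebra k L] [Field Z] [Algebra k Z] (P : Place k L) (K₂ K₁ : IntermediateField k L) (w : L)
    (hle : ∀ z ∈ K₁, z ∈ IntermediateField.adjoin K₂ {w}) (H : NU k Z) (ψ : Z →+* P.Res)
    (hψk : ∀ c, ψ (algebraMap k Z c) = algebraMap k P.Res c) (hψ : ∀ z, ψ z ∈ P.img K₁) (z : Z) : IsAlgebraic (P.img K₂) (ψ z) := by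
  let M := AlgebraicClosure L
  haveI : CharZero L := charZero_of_injective_algebraMap (algebraMap k L).injective
  obtain ⟨W, hW, jr, hjr⟩ := P.exists_dom (M := M)
  haveI := W.res_algClosed
  let K₂' : Subfield M := K₂.toSubfield.map (algebraMap L M)
  let T : Subfield W.Res := (P.img K₂).toSubfield.map jr
  let Kb := algebraicClosure K₂' M
  let C := algebraicClosure T W.Res
  haveI : IsAlgClosed Kb := (algebraicClosure.isAlgClosure K₂' M).isAlgClosed
  haveI : IsAlgClosed C := (algebraicClosure.isAlgClosure T W.Res).isAlgClosed
  have hT : ∀ a : W.O, (a : M) ∈ K₂' → W.rd a ∈ T := by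
    rintro a ⟨b, hb, hba⟩
    have hbO : b ∈ P.O := (hW b).mp (by rw [hba]; exact a.2)
    exact ⟨P.rd ⟨b, hbO⟩, ⟨⟨b, hbO⟩, hb, rfl⟩, hjr ⟨b, hbO⟩ a hba.symm⟩
  obtain ⟨ξ, hξ⟩ := B0 (W := W) (Kb := Kb) (C := C) (by
    rintro a ⟨b, hb⟩
    have h1 : IsAlgebraic K₂' (a : M) := by rw [← hb]; exact mem_algebraicClosure_iff.mp b.2
    exact ⟨⟨W.rd a, mem_algebraicClosure_iff.mpr (W.rd_algebraic K₂' T hT a h1)⟩, rfl⟩) (algebraMap L M w)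
  have hfin := H C W.Res (jr.comp ψ) ξ ?_ ?_ z
  · obtain ⟨c, hc⟩ := hfin
    have h1 : IsAlgebraic T (jr (ψ z)) := by
      have : (c : W.Res) = jr (ψ z) := hc
      rw [← this]; exact mem_algebraicClosure_iff.mp c.2
    let e : P.img K₂ →+* T := (jr.comp (algebraMap (P.img K₂) P.Res)).codRestrict T (fun y => ⟨y, y.2, rfl⟩)
    have he : Function.Surjective e := by
      rintro ⟨_, y, hy, rfl⟩
      exact ⟨⟨y, hy⟩, rfl⟩
    obtain ⟨p, hp0, hp⟩ := h1
    obtain ⟨q, rfl⟩ := Polynomial.map_surjective e he p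
    refine ⟨q, ?_, ?_⟩
    · rintro rfl; exact hp0 (Polynomial.map_zero _)
    · apply jr.injective
      rw [map_zero, ← hp, aeval_def, aeval_def, eval₂_map, hom_eval₂]
      rfl
  · intro c
    have h1 : jr (ψ (algebraMap k Z c)) ∈ T := by
      rw [hψk]
      exact ⟨_, (P.img K₂).algebraMap_mem c, rfl⟩
    exact ⟨algebraMap T C ⟨_, h1⟩, rfl⟩
  · intro z
    obtain ⟨a, ha, haz⟩ := hψ z
    have haW : algebraMap L M a ∈ W.O := (hW a).mpr a.2
    have : (jr.comp ψ) z = W.rd ⟨_, haW⟩ := by rw [RingHom.comp_apply, ← haz]; exact hjr a _ rfl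
    rw [this]
    apply hξ
    obtain ⟨p, q, -, hpq⟩ := mem_adjoin_simple_div (hle a ha)
    let e : K₂ →+* Kb := (algebraMap K₂' Kb).comp (((algebraMap L M).comp (algebraMap K₂ L)).codRestrict K₂' (fun y => ⟨y, y.2, rfl⟩))
    have hpoly : ∀ p : K₂[X], algebraMap L M (aeval w p) ∈ IntermediateField.adjoin Kb {algebraMap L M w} := by
      intro p
      have : algebraMap L M (aeval w p) = aeval (algebraMap L M w) (p.map e) := by
        rw [aeval_def, aeval_def, eval₂_map, hom_eval₂]
        rfl
      rw [this]
      have h1 := (aeval (IntermediateField.AdjoinSimple.gen Kb (algebraMap L M w)) (p.map e)).2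
      rwa [IntermediateField.AdjoinSimple.coe_aeval_gen_apply] at h1
    change algebraMap L M a ∈ _
    rw [hpq, map_div₀]
    exact div_mem (hpoly p) (hpoly q)
end
end CrBir
end

section
namespace CrBir
open Polynomial IntermediateField.algebraAdjoinAdjoin
universe u v

section
variable {k : Type v} {L : Type u} [Field k] [Field L] [Algebra k L]

/-- transcendence degree of a simple extension is at most one -/
theorem trd_simple_le' {E : Type*} {L : Type*} [Field E] [Field L] [Algebra E L] {τ : L} (gen : IntermediateField.adjoin E {τ} = ⊤) : Algebra.trdeg E L ≤ 1 := by
  haveI : Algebra.IsAlgebraic (Algebra.adjoin E {τ}) L := by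
    constructor
    intro z
    have hz : z ∈ IntermediateField.adjoin E {τ} := by rw [gen]; trivial
    rw [IntermediateField.mem_adjoin_simple_iff] at hz
    obtain ⟨p, q, rfl⟩ := hz
    have h : ∀ p : E[X], IsAlgebraic (Algebra.adjoin E {τ}) (aeval τ p) := by
      intro p
      have : aeval τ p ∈ Algebra.adjoin E {τ} := aeval_mem_adjoin_singleton E τ
      exact isAlgebraic_algebraMap (⟨_, this⟩ : Algebra.adjoin E {τ})
    rw [div_eq_mul_inv]
    exact (h p).mul (h q).inv
  have := Algebra.IsAlgebraic.trdeg_le_cardinalMk E (A := L) {τ}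
  simpa using this

theorem trd_simple_tr' {E : Type*} {L : Type*} [Field E] [Field L] [Algebra E L] {τ : L} (tr : Transcendental E τ)
    (gen : IntermediateField.adjoin E {τ} = ⊤) : Algebra.trdeg E L = 1 := by
  apply le_antisymm (trd_simple_le' gen)
  have h : AlgebraicIndependent E (fun _ : Unit => τ) := (algebraicIndependent_unique_type_iff).mpr tr
  have := h.lift_cardinalMk_le_trdeg
  simpa using this

variable {E E' : IntermediateField k L} {τ : L}

theorem trd_simple_tr (tr : Transcendental E τ)
    (gen : IntermediateField.adjoin E {τ} = ⊤) : Algebra.trdeg k L = Algebra.trdeg k E + 1 := by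
  rw [← trd_simple_tr' tr gen, _root_.trdeg_add_eq]

theorem trd_simple_le (gen : IntermediateField.adjoin E {τ} = ⊤) : Algebra.trdeg k L ≤ Algebra.trdeg k E + 1 := by
  rw [← _root_.trdeg_add_eq k E (A := L)]
  gcongr
  exact trd_simple_le' gen

theorem trd_alg' (k : Type*) (E L : Type u) [Field k] [Field E] [Field L] [Algebra k E] [Algebra k L] [Algebra E L] [IsScalarTower k E L]
    [Algebra.IsAlgebraic E L] : Algebra.trdeg k L = Algebra.trdeg k E := by
  rw [← _root_.trdeg_add_eq k E (A := L), _root_.trdeg_eq_zero (R := E), add_zero] 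

theorem trd_alg (h : ∀ z : L, IsAlgebraic E z) : Algebra.trdeg k L = Algebra.trdeg k E := by
  haveI : Algebra.IsAlgebraic E L := ⟨h⟩
  exact trd_alg' k E L

theorem trd_mono (h : E ≤ E') : Algebra.trdeg k E ≤ Algebra.trdeg k E' :=
  _root_.trdeg_le_of_injective (IntermediateField.inclusion h) (IntermediateField.inclusion_injective h)

theorem trd_le_top (E : IntermediateField k L) : Algebra.trdeg k E ≤ Algebra.trdeg k L :=
  _root_.trdeg_le_of_injective E.val (RingHom.injective _)

theorem alg_of_simple_alg (h : IsAlgebraic E τ) (gen : IntermediateField.adjoin E {τ} = ⊤) (z : L) : IsAlgebraic E z := by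
  haveI := IntermediateField.isAlgebraic_adjoin_simple h.isIntegral
  have hz : z ∈ IntermediateField.adjoin E {τ} := by rw [gen]; trivial
  exact (Algebra.IsAlgebraic.isAlgebraic (R := E) (⟨z, hz⟩ : IntermediateField.adjoin E {τ})).algebraMap (A := L)

/-- if all of E' is algebraic over E then trdeg E' ≤ trdeg E -/
theorem trd_le_of_alg (h : ∀ z ∈ E', IsAlgebraic E z) : Algebra.trdeg k E' ≤ Algebra.trdeg k E := by
  let B := (algebraicClosure E L).restrictScalars k
  have h1 : E' ≤ B := fun z hz => mem_algebraicClosure_iff.mpr (h z hz)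
  refine (trd_mono h1).trans ?_
  have : Algebra.trdeg k (algebraicClosure E L) = Algebra.trdeg k E := by
    exact trd_alg' k E _
  exact this.le

/-- residues of a subfield contained in O -/
theorem Place.trd_img (P : Place k L) (E : IntermediateField k L) (h : ∀ z ∈ E, z ∈ P.O) : Algebra.trdeg k (P.img E) = Algebra.trdeg k E := by
  let f : E →ₐ[k] P.img E := 
    { toFun := fun z => ⟨P.rd ⟨z, h z z.2⟩, ⟨z, h z z.2⟩, z.2, rfl⟩
      map_one' := by ext; exact map_one P.rd
      map_mul' := fun a b => by ext; exact map_mul P.rd ⟨a, h a a.2⟩ ⟨b, h b b.2⟩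
      map_zero' := by ext; exact map_zero P.rd
      map_add' := fun a b => by ext; exact map_add P.rd ⟨a, h a a.2⟩ ⟨b, h b b.2⟩
      commutes' := fun c => rfl }
  have hf : Function.Bijective f := by
    refine ⟨RingHom.injective _, ?_⟩
    rintro ⟨_, a, ha, rfl⟩
    exact ⟨⟨a, ha⟩, rfl⟩
  exact (AlgEquiv.ofBijective f hf).trdeg_eq.symm

/-- Lemma V, second form -/
theorem Place.V [CharZero k] (P : Place k L) (K₁ : IntermediateField k L) {t : P.O} (trt : Transcendental K₁ (t : L)) (gent : IntermediateField.adjoin K₁ {(t : L)} = ⊤)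
    (Z : IntermediateField k P.Res) (H : NU k Z) {τ : P.Res} (trτ : Transcendental Z τ) (genτ : IntermediateField.adjoin Z {τ} = ⊤)
    (hfin : Algebra.trdeg k L < Cardinal.aleph0) (hn : Algebra.trdeg k L = Algebra.trdeg k P.Res + 1)
    (hres : IntermediateField.adjoin (P.img K₁) {P.rd t} = ⊤) (hK₁ : ∃ z ∈ K₁, z ∉ P.O) :
    Transcendental (P.img K₁) (P.rd t) ∧ ∀ (K₂ : IntermediateField k L) (w : L), (∀ z ∈ K₁, z ∈ IntermediateField.adjoin K₂ {w}) →
      Algebra.trdeg k K₂ + 2 ≤ Algebra.trdeg k L → ∀ z ∈ K₂, z ∈ P.O := by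
  have h1 := trd_simple_tr trt gent
  have h2 := trd_simple_tr trτ genτ
  have h3 := trd_simple_le hres
  have h4 : ¬ (Algebra.trdeg k K₁ ≤ Algebra.trdeg k (P.img K₁)) := by
    intro h
    obtain ⟨z, hz, hzO⟩ := hK₁
    exact hzO (P.le_of_trdeg K₁ (lt_of_le_of_lt (trd_le_top K₁) hfin) h z hz)
  have htr : Transcendental (P.img K₁) (P.rd t) := by
    intro halg
    apply h4
    have h5 := trd_alg (alg_of_simple_alg halg hres)
    rw [← h5]
    rw [h1] at hn hfin
    exact (Cardinal.add_one_inj.mp hn).le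
  refine ⟨htr, ?_⟩
  have hZ := Z_le H htr hres
  intro K₂ w hw hK₂
  apply P.le_of_trdeg K₂ (lt_of_le_of_lt (trd_le_top K₂) hfin)
  have h5 := P.B K₂ K₁ w hw H (algebraMap Z P.Res) (fun c => rfl) (fun z => hZ z.2)
  have h6 : Algebra.trdeg k Z ≤ Algebra.trdeg k (P.img K₂) := trd_le_of_alg (fun z hz => h5 ⟨z, hz⟩)
  refine le_trans ?_ h6
  rw [hn, h2] at hK₂ hfin
  obtain ⟨a, ha⟩ := Cardinal.lt_aleph0.mp (lt_of_le_of_lt (le_self_add.trans le_self_add) hfin)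
  obtain ⟨b, hb⟩ := Cardinal.lt_aleph0.mp (lt_of_le_of_lt (le_self_add.trans hK₂) hfin)
  rw [ha, hb] at hK₂ ⊢
  norm_cast at hK₂ ⊢
  omega
end
end CrBir
end

section
namespace CrBir
open Polynomial IntermediateField.algebraAdjoinAdjoin
universe u v

section
variable {k : Type v} {L : Type u} [Field k] [Field L] [Algebra k L]

/-- transport of a place by an automorphism -/
def Place.map (P : Place k L) (σ : L ≃ₐ[k] L) : Place k L where
  O := P.O.comap (σ.symm : L →+* L)
  hk := fun c => by
    rw [ValuationSubring.mem_comap]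
    simpa using P.hk c

theorem Place.mem_map (P : Place k L) (σ : L ≃ₐ[k] L) {z : L} : z ∈ (P.map σ).O ↔ σ.symm z ∈ P.O := Iff.rfl

theorem Place.map_mem (P : Place k L) (σ : L ≃ₐ[k] L) {z : L} : σ z ∈ (P.map σ).O ↔ z ∈ P.O := by
  rw [P.mem_map, AlgEquiv.symm_apply_apply]

noncomputable def Place.mapO (P : Place k L) (σ : L ≃ₐ[k] L) : P.O ≃+* (P.map σ).O where
  toFun := fun a => ⟨σ a, (P.map_mem σ).mpr a.2⟩
  invFun := fun a => ⟨σ.symm a, a.2⟩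
  left_inv := fun a => by ext; simp
  right_inv := fun a => by ext; simp
  map_mul' := fun a b => by ext; simp
  map_add' := fun a b => by ext; simp

theorem Place.coe_mapO (P : Place k L) (σ : L ≃ₐ[k] L) (a : P.O) : ((P.mapO σ a : (P.map σ).O) : L) = σ a := rfl

noncomputable def Place.mapRes (P : Place k L) (σ : L ≃ₐ[k] L) : P.Res ≃ₐ[k] (P.map σ).Res :=
  AlgEquiv.ofRingEquiv (f := IsLocalRing.ResidueField.mapEquiv (P.mapO σ)) (fun c => by
    rw [← P.rd_alg, ← (P.map σ).rd_alg]
    change IsLocalRing.ResidueField.map _ (IsLocalRing.residue _ _) = _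
    rw [IsLocalRing.ResidueField.map_residue]
    change (P.map σ).rd _ = _
    congr 1
    ext
    simp [P.coe_mapO])

theorem Place.mapRes_rd (P : Place k L) (σ : L ≃ₐ[k] L) (a : P.O) : P.mapRes σ (P.rd a) = (P.map σ).rd (P.mapO σ a) := by
  change IsLocalRing.ResidueField.map _ (IsLocalRing.residue _ _) = _
  rw [IsLocalRing.ResidueField.map_residue]
  rfl

theorem val_le_iff {O : ValuationSubring L} {a b : L} (hb : b ≠ 0) : O.valuation a ≤ O.valuation b ↔ a / b ∈ O := by
  rw [mem_iff_val, map_div₀, div_le_one₀ (val_pos hb)]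

theorem val_lt_one_iff' {O : ValuationSubring L} {a : L} (ha : a ≠ 0) : O.valuation a < 1 ↔ a⁻¹ ∉ O := by
  rw [mem_iff_val, map_inv₀, not_le, one_lt_inv₀ (val_pos ha)]

theorem Place.val_map_lt (P : Place k L) (σ : L ≃ₐ[k] L) {a : L} : (P.map σ).O.valuation (σ a) < 1 ↔ P.O.valuation a < 1 := by
  by_cases ha : a = 0
  · subst ha; simp
  · rw [val_lt_one_iff' ha, val_lt_one_iff' (by simpa using ha), ← map_inv₀, P.map_mem]

/-- `h` generates the maximal ideal -/
def Gen (O : ValuationSubring L) (h : L) : Prop := h ≠ 0 ∧ O.valuation h < 1 ∧ ∀ z, O.valuation z < 1 → O.valuation z ≤ O.valuation h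

theorem Gen.map {P : Place k L} {h : L} (H : Gen P.O h) (σ : L ≃ₐ[k] L) : Gen (P.map σ).O (σ h) := by
  refine ⟨by simpa using H.1, (P.val_map_lt σ).mpr H.2.1, ?_⟩
  intro z hz
  obtain ⟨y, rfl⟩ := σ.surjective z
  have h1 := H.2.2 y ((P.val_map_lt σ).mp hz)
  rw [val_le_iff H.1] at h1
  rw [val_le_iff (by simpa using H.1), ← map_div₀, P.map_mem]
  exact h1

theorem Gen.not_fifth {O : ValuationSubring L} {h : L} (H : Gen O h) {b : ℕ} (hb : b < 5) (hb0 : b ≠ 0) (w : L) :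
    O.valuation h ^ b ≠ O.valuation w ^ 5 := by
  intro h1
  have h2 : O.valuation h ^ b < 1 := pow_lt_one₀ zero_le H.2.1 hb0
  rw [h1] at h2
  have h3 : O.valuation w < 1 := by
    by_contra h3
    exact absurd h2 (not_lt.mpr (one_le_pow₀ (not_lt.mp h3)))
  have h4 := pow_le_pow_left₀ zero_le (H.2.2 w h3) 5
  rw [← h1] at h4
  exact absurd h4 (not_le.mpr (pow_lt_pow_right_of_lt_one₀ (val_pos H.1) H.2.1 hb))

theorem alg_of_trd_le {E : IntermediateField k L} (h : Algebra.trdeg k L ≤ Algebra.trdeg k E) (hfin : Algebra.trdeg k L < Cardinal.aleph0) (z : L) :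
    IsAlgebraic E z := by
  have h1 := _root_.trdeg_add_eq k E (A := L)
  have h2 : Algebra.trdeg E L = 0 := by
    obtain ⟨a, ha⟩ := Cardinal.lt_aleph0.mp hfin
    obtain ⟨b, hb⟩ := Cardinal.lt_aleph0.mp (lt_of_le_of_lt (trd_le_top E) hfin)
    obtain ⟨c, hc⟩ := Cardinal.lt_aleph0.mp (lt_of_le_of_lt (le_add_self.trans h1.le) hfin)
    rw [ha, hb] at h
    rw [ha, hb, hc] at h1
    rw [hc]
    norm_cast at h1 h ⊢
    omega
  exact (_root_.trdeg_eq_zero_iff.mp h2).isAlgebraic z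

theorem NU_eta [CharZero k] (l : List L) (η : L) (hη : Pi5 l ^ 5 * η ^ 25 = -1)
    (halg : ∀ z : L, IsAlgebraic (IntermediateField.adjoin k {z | z ∈ l}) z) : NU k L := by
  intro C M _ _ _ _ _ ψ ξ hk hξ z
  haveI : CharZero L := charZero_of_injective_algebraMap (FaithfulSMul.algebraMap_injective k L)
  haveI : CharZero M := charZero_of_injective_ringHom ψ.injective
  haveI : CharZero C := (algebraMap C M).charZero_iff (algebraMap C M).injective |>.mpr inferInstance
  by_cases hξt : Transcendental C ξ
  · obtain ⟨E, W, hWξ⟩ := exists_WD_of_tr hξt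
    have hξE : ∀ z ∈ IntermediateField.adjoin C {ξ}, z ∈ E := by
      intro z hz
      apply (IntermediateField.adjoin_le_iff.mpr _) hz
      rw [Set.singleton_subset_iff, ← hWξ]; exact W.X.2
    let φE : L →+* E := ψ.codRestrict E.toSubfield (fun z => hξE _ (hξ _))
    have hp0 : Pi5 l ≠ 0 := by
      intro h; rw [h] at hη; norm_num at hη
    have hη0 : η ≠ 0 := by
      rintro rfl; norm_num at hη
    have hlist := W.list (l.map φE) (by
        intro O hC hO
        rw [← Pi5_map]
        refine ⟨(φE η)⁻¹, inv_ne_zero ((_root_.map_ne_zero _).mpr hη0), ?_⟩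
        have h1 := congrArg φE hη
        rw [map_mul, map_pow, map_pow, map_neg, map_one] at h1
        have h2 := congrArg O.valuation h1
        rw [map_mul, Valuation.map_neg, map_one] at h2
        have h3 : O.valuation (φE η) ≠ 0 := (_root_.map_ne_zero _).mpr ((_root_.map_ne_zero _).mpr hη0)
        rw [map_inv₀]
        apply (pow_left_inj₀ zero_le zero_le (n := 5) (by norm_num)).mp
        rw [map_pow, map_pow] at h2
        rw [← pow_mul, inv_pow]
        exact eq_inv_of_mul_eq_one_left h2) (by
        rw [← Pi5_map]; exact (_root_.map_ne_zero _).mpr hp0)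
    have hgen : ∀ y ∈ IntermediateField.adjoin k {z | z ∈ l}, ψ y ∈ (algebraMap C M).fieldRange := by
      apply hom_mem_of_gen ψ _ hk
      intro y hy
      obtain ⟨c, hc⟩ := hlist _ (List.mem_map_of_mem hy)
      exact ⟨c, congrArg Subtype.val hc⟩
    let S := IntermediateField.adjoin k {z | z ∈ l}
    apply mem_range_of_alg_sub (S.toSubfield.map ψ)
    · rintro _ ⟨y, hy, rfl⟩
      exact hgen y hy
    · obtain ⟨p, hp0, hp⟩ := halg z
      let f : S →+* S.toSubfield.map ψ := (ψ.comp (algebraMap S L)).codRestrict _ (fun x => ⟨x, x.2, rfl⟩)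
      refine ⟨p.map f, (Polynomial.map_ne_zero_iff f.injective).mpr hp0, ?_⟩
      have hf : (algebraMap (S.toSubfield.map ψ) M).comp f = ψ.comp (algebraMap S L) := rfl
      rw [aeval_def, eval₂_map, hf, ← hom_eval₂, ← aeval_def, hp, map_zero]
  · apply mem_range_of_alg
    have h1 := hξ z
    haveI := IntermediateField.isAlgebraic_adjoin_simple (not_not.mp hξt : IsAlgebraic C ξ).isIntegral
    exact (Algebra.IsAlgebraic.isAlgebraic (R := C) (⟨_, h1⟩ : IntermediateField.adjoin C {ξ})).algebraMap (A := M)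

section T
variable [CharZero k] {E : IntermediateField k L} {y : L} (tr : Transcendental E y) (gen : IntermediateField.adjoin E {y} = ⊤)

theorem poly_mem {O : ValuationSubring L} (hE : ∀ z ∈ E, z ∈ O) (hy : y ∈ O) (p : E[X]) : aeval y p ∈ O := by
  rw [aeval_eq_sum_range]
  refine sum_mem fun i _ => ?_
  rw [Algebra.smul_def]
  exact mul_mem (hE _ (p.coeff i).2) (pow_mem hy i)

/-- Bezout: coprime polynomials are not both in the maximal ideal -/
theorem not_both_lt {O : ValuationSubring L} (hE : ∀ z ∈ E, z ∈ O) (hy : y ∈ O) {p q : E[X]} (h : IsCoprime p q)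
    (hp : O.valuation (aeval y p) < 1) : O.valuation (aeval y q) = 1 := by
  apply le_antisymm (mem_iff_val.mp (poly_mem hE hy q))
  by_contra hq
  rw [not_le] at hq
  obtain ⟨a, b, hab⟩ := h
  have h1 := congrArg (aeval y) hab
  rw [map_add, map_mul, map_mul, map_one] at h1
  have h2 := congrArg O.valuation h1
  rw [map_one] at h2
  have h3 : O.valuation (aeval y a * aeval y p + aeval y b * aeval y q) < 1 := by
    apply val_add_lt
    · rw [map_mul]; exact mul_lt_one_of_nonneg_of_lt_one_right (mem_iff_val.mp (poly_mem hE hy a)) zero_le hp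
    · rw [map_mul]; exact mul_lt_one_of_nonneg_of_lt_one_right (mem_iff_val.mp (poly_mem hE hy b)) zero_le hq
  rw [h2] at h3
  exact lt_irrefl _ h3

theorem bez {E : Type*} [Field E] (p q : E[X]) (hq : q ≠ 0) : ∃ g p' q' a b : E[X], p = g * p' ∧ q = g * q' ∧ a * p + b * q = g ∧ a * p' + b * q' = 1 := by
  classical
  obtain ⟨p', hp'⟩ := EuclideanDomain.gcd_dvd_left p q
  obtain ⟨q', hq'⟩ := EuclideanDomain.gcd_dvd_right p q
  have h := EuclideanDomain.gcd_eq_gcd_ab p q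
  set g := EuclideanDomain.gcd p q with hg
  have hg0 : g ≠ 0 := by intro h0; rw [h0, zero_mul] at hq'; exact hq hq'
  refine ⟨g, p', q', EuclideanDomain.gcdA p q, EuclideanDomain.gcdB p q, hp', hq', by rw [h]; ring, ?_⟩
  apply mul_left_cancel₀ hg0
  generalize EuclideanDomain.gcdA p q = A at *
  generalize EuclideanDomain.gcdB p q = B at *
  clear_value g
  rw [mul_one]
  calc g * (A * p' + B * q') = (g * p') * A + (g * q') * B := by ring
    _ = p * A + q * B := by rw [← hp', ← hq']
    _ = g := h.symm

theorem exists_coprime_rep (gen : IntermediateField.adjoin E {y} = ⊤) (z : L) :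
    ∃ p q : E[X], IsCoprime p q ∧ aeval y q ≠ 0 ∧ z * aeval y q = aeval y p := by
  have hz : z ∈ IntermediateField.adjoin E {y} := by rw [gen]; trivial
  haveI : CharZero L := charZero_of_injective_algebraMap (FaithfulSMul.algebraMap_injective k L)
  obtain ⟨p, q, hq, h⟩ := mem_adjoin_simple_div hz
  have hq0 : q ≠ 0 := by rintro rfl; simp at hq
  obtain ⟨g, p', q', a, b, hp', hq', -, hab⟩ := bez p q hq0
  rw [hq', map_mul] at hq
  refine ⟨p', q', ⟨a, b, hab⟩, right_ne_zero_of_mul hq, ?_⟩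
  have := left_ne_zero_of_mul hq
  have := right_ne_zero_of_mul hq
  rw [h, hp', hq', map_mul, map_mul]
  field_simp

/-- squarefree polynomial value is zero or generates -/
theorem gen_of_sep (gen : IntermediateField.adjoin E {y} = ⊤) {O : ValuationSubring L} (hE : ∀ z ∈ E, z ∈ O) (hy : y ∈ O) {f : E[X]} (hf : f.Separable)
    (hf0 : aeval y f ≠ 0) (h : O.valuation (aeval y f) < 1) : Gen O (aeval y f) := by
  refine ⟨hf0, h, ?_⟩
  intro z hz
  obtain ⟨p, q, hc, hq0, hpq⟩ := exists_coprime_rep gen z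
  have hp : O.valuation (aeval y p) < 1 := by
    rw [← hpq, map_mul]
    exact mul_lt_one_of_nonneg_of_lt_one_left zero_le hz (mem_iff_val.mp (poly_mem hE hy q))
  have hq := not_both_lt hE hy hc hp
  have hzp : O.valuation z = O.valuation (aeval y p) := by rw [← hpq, map_mul, hq, mul_one]
  rw [hzp]
  have hf1 : f ≠ 0 := by rintro rfl; simp at hf0
  obtain ⟨g, p', f', a, b, hp', hf', hg, -⟩ := bez p f hf1
  have hg1 : O.valuation (aeval y g) < 1 := by
    rw [← hg, map_add, map_mul, map_mul]
    apply val_add_lt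
    · rw [map_mul]; exact mul_lt_one_of_nonneg_of_lt_one_right (mem_iff_val.mp (poly_mem hE hy a)) zero_le hp
    · rw [map_mul]; exact mul_lt_one_of_nonneg_of_lt_one_right (mem_iff_val.mp (poly_mem hE hy b)) zero_le h
  rw [hf'] at hf
  have h2 := not_both_lt hE hy hf.isCoprime hg1
  rw [hf', hp', map_mul, map_mul, map_mul, map_mul, h2, mul_one]
  exact mul_le_of_le_one_right' (mem_iff_val.mp (poly_mem hE hy p'))

theorem sep25 {E : Type*} [Field E] [CharZero E] (c : E) (hc : c ≠ 0) : (1 + Polynomial.C c * Polynomial.X ^ 25 : E[X]).Separable := by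
  refine ⟨1, - Polynomial.C (1/25) * Polynomial.X, ?_⟩
  simp only [derivative_add, derivative_one, derivative_C_mul, derivative_X_pow]
  have : (Polynomial.C (1/25 : E)) * Polynomial.C ((25 : ℕ) : E) = 1 := by
    rw [← Polynomial.C_mul]; norm_num
  linear_combination (- Polynomial.X ^ 25 * Polynomial.C c) * this

theorem T2 (gen : IntermediateField.adjoin E {y} = ⊤) (tr : Transcendental E y) {p : E} (hp : p ≠ 0) {O : ValuationSubring L} (hE : ∀ z ∈ E, z ∈ O) :
    Div5 O ((p : L) * (1 + (p : L) ^ 5 * y ^ 25)) ∨ Gen O ((p : L) * (1 + (p : L) ^ 5 * y ^ 25)) := by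
  have hpL : (p : L) ≠ 0 := by simpa using hp
  haveI : CharZero E := charZero_of_injective_algebraMap (FaithfulSMul.algebraMap_injective k E)
  have hv : O.valuation (p : L) = 1 := by
    apply le_antisymm (mem_iff_val.mp (hE _ p.2))
    have := mem_iff_val.mp (hE _ (inv_mem p.2))
    rw [map_inv₀] at this
    exact (inv_le_one₀ (val_pos hpL)).mp this
  by_cases hy : y ∈ O
  · have e1 : 1 + (p : L) ^ 5 * y ^ 25 = aeval y (1 + Polynomial.C (p ^ 5) * Polynomial.X ^ 25 : E[X]) := by
      simp
    have hne : aeval y (1 + Polynomial.C (p ^ 5) * Polynomial.X ^ 25 : E[X]) ≠ 0 := by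
      intro h0
      have h1 := transcendental_iff.mp tr _ h0
      exact (sep25 (p ^ 5) (pow_ne_zero 5 hp)).ne_zero h1
    rcases (mem_iff_val.mp (poly_mem hE hy (1 + Polynomial.C (p ^ 5) * Polynomial.X ^ 25 : E[X]))).lt_or_eq with h | h
    · right
      have := gen_of_sep gen hE hy (sep25 (p ^ 5) (pow_ne_zero 5 hp)) hne h
      rw [← e1] at this
      unfold Gen at this ⊢
      rw [map_mul, hv, one_mul]
      exact ⟨mul_ne_zero hpL this.1, this.2⟩
    · left
      apply Div5.unit
      rw [map_mul, hv, one_mul, e1, h]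
  · left
    have h1 : 1 < O.valuation y := by rwa [mem_iff_val, not_le] at hy
    have hy0 : y ≠ 0 := by rintro rfl; exact hy (zero_mem _)
    have h2 : O.valuation ((p : L) ^ 5 * y ^ 25) = O.valuation (y ^ 5) ^ 5 := by
      rw [map_mul, map_pow, hv, one_pow, one_mul, map_pow, map_pow, ← pow_mul]
    refine ⟨y ^ 5, pow_ne_zero 5 hy0, ?_⟩
    rw [map_mul, hv, one_mul, val_one_add_of_gt, h2]
    rw [h2]
    exact one_lt_pow₀ (by rw [map_pow]; exact one_lt_pow₀ h1 (by norm_num)) (by norm_num)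
end T
end
end CrBir
end

section
namespace CrBir
open Polynomial IntermediateField.algebraAdjoinAdjoin
universe u v

section
variable {k : Type v} {L : Type u} [Field k] [Field L] [Algebra k L] [CharZero k]

theorem exists_O0 {E : IntermediateField k L} {y : L} (tr : Transcendental E y) (f : E[X]) (hf : f.natDegree ≠ 0) :
    ∃ P : Place k L, (∀ z ∈ E, z ∈ P.O) ∧ y ∈ P.O ∧ P.O.valuation (aeval y f) < 1 := by
  let A : Subring L := (Algebra.adjoin E {y}).toSubring
  have hfA : aeval y f ∈ A := aeval_mem_adjoin_singleton E y
  let I : Ideal A := Ideal.span {⟨_, hfA⟩}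
  have hI : I ≠ ⊤ := by
    intro h
    rw [Ideal.span_singleton_eq_top] at h
    obtain ⟨b, hb⟩ := isUnit_iff_exists_inv.mp h
    have hb2 : (b : L) ∈ Algebra.adjoin E {y} := b.2
    rw [Algebra.adjoin_singleton_eq_range_aeval] at hb2
    obtain ⟨g, hg⟩ := hb2
    have h1 : aeval y f * aeval y g = 1 := by
      have hg' : aeval y g = (b : L) := hg
      rw [hg']
      exact congrArg Subtype.val hb
    have h2 : f * g = 1 := by
      apply transcendental_iff_injective.mp tr
      rw [map_mul, h1, map_one]
    exact hf (natDegree_eq_zero_of_isUnit (IsUnit.of_mul_eq_one _ h2))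
  obtain ⟨B, hB1, hB2⟩ := Ideal.image_subset_nonunits_valuationSubring I hI
  have hE : ∀ z ∈ E, z ∈ B := fun z hz => hB1 ((Algebra.adjoin E {y}).algebraMap_mem ⟨z, hz⟩)
  refine ⟨⟨B, fun c => hE _ (E.algebraMap_mem c)⟩, hE, hB1 (Algebra.subset_adjoin rfl), ?_⟩
  rw [← ValuationSubring.mem_nonunits_iff]
  exact hB2 ⟨⟨_, hfA⟩, Ideal.subset_span rfl, rfl⟩

/-- residue map on a subfield contained in `O` -/
noncomputable def Place.rdE (P : Place k L) (E : IntermediateField k L) (h : ∀ z ∈ E, z ∈ P.O) : E →ₐ[k] P.Res :=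
    { toFun := fun z => P.rd ⟨z, h z z.2⟩
      map_one' := map_one P.rd
      map_mul' := fun a b => map_mul P.rd ⟨a, h a a.2⟩ ⟨b, h b b.2⟩
      map_zero' := map_zero P.rd
      map_add' := fun a b => map_add P.rd ⟨a, h a a.2⟩ ⟨b, h b b.2⟩
      commutes' := fun c => rfl }

theorem Place.rdE_apply (P : Place k L) (E : IntermediateField k L) (h : ∀ z ∈ E, z ∈ P.O) (z : E) : P.rdE E h z = P.rd ⟨z, h z z.2⟩ := rfl

theorem Place.img_eq (P : Place k L) (E : IntermediateField k L) (h : ∀ z ∈ E, z ∈ P.O) : P.img E = (P.rdE E h).fieldRange := by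
  ext y
  constructor
  · rintro ⟨a, ha, rfl⟩; exact ⟨⟨a, ha⟩, rfl⟩
  · rintro ⟨a, rfl⟩; exact ⟨⟨a, h a a.2⟩, a.2, rfl⟩

theorem isAlgebraic_mono {E E' : IntermediateField k L} (h : E ≤ E') {z : L} (hz : IsAlgebraic E z) : IsAlgebraic E' z := by
  letI : Algebra E E' := (IntermediateField.inclusion h).toRingHom.toAlgebra
  haveI : IsScalarTower E E' L := IsScalarTower.of_algebraMap_eq (fun _ => rfl)
  exact hz.tower_top E'

theorem T_lemma {E : IntermediateField k L} {y : L} (tr : Transcendental E y) (gen : IntermediateField.adjoin E {y} = ⊤) (hfin : Algebra.trdeg k L < Cardinal.aleph0)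
    (l : List E) (hl : IntermediateField.adjoin k {z | z ∈ l} = ⊤) (hp : Pi5 l ≠ 0) (θ : L ≃ₐ[k] L) (a : ℕ) (ha : a = 2 ∨ a = 3) {s : L}
    (hs : s = ((Pi5 l : E) : L) * (1 + ((Pi5 l : E) : L) ^ 5 * y ^ 25)) (h : ∀ O : ValuationSubring L, Div5 O (θ s * s ^ a)) : False := by
  let f : E[X] := 1 + Polynomial.C (Pi5 l ^ 5) * Polynomial.X ^ 25
  have hfd : f.natDegree = 25 := by
    have : Pi5 l ^ 5 ≠ 0 := pow_ne_zero 5 hp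
    simp only [f]
    compute_degree!
  have hpL : ((Pi5 l : E) : L) ≠ 0 := by simpa using hp
  have hfy : aeval y f = 1 + ((Pi5 l : E) : L) ^ 5 * y ^ 25 := by simp [f]
  obtain ⟨P, hE, hy, hv⟩ := exists_O0 tr f (by rw [hfd]; norm_num)
  have htr := trd_simple_tr tr gen
  have htrE := P.trd_img E hE
  have htr2 : Algebra.trdeg k P.Res ≤ Algebra.trdeg k (P.img E) := by
    by_contra hcon
    rw [htrE] at hcon
    have h1 : Algebra.trdeg k (⊤ : IntermediateField k L) ≤ Algebra.trdeg k (P.img ⊤) := by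
      rw [P.img_top, IntermediateField.topEquiv.trdeg_eq, IntermediateField.topEquiv.trdeg_eq, htr]
      rw [not_le] at hcon
      exact Cardinal.add_one_le_of_lt hcon
    have h2 := P.le_of_trdeg ⊤ (by rw [IntermediateField.topEquiv.trdeg_eq]; exact hfin) h1 (aeval y f)⁻¹ trivial
    have hf0 : aeval y f ≠ 0 := by
      intro h0
      have h3 := transcendental_iff.mp tr _ h0
      rw [h3] at hfd
      simp at hfd
    exact (val_lt_one_iff' hf0).mp hv h2
  have hfinE : Algebra.trdeg k E < Cardinal.aleph0 := lt_of_le_of_lt (trd_le_top E) hfin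
  have hfinR : Algebra.trdeg k P.Res < Cardinal.aleph0 := by
    refine lt_of_le_of_lt htr2 ?_
    rw [htrE]; exact hfinE
  have halg := alg_of_trd_le htr2 hfinR
  -- residue field is NU
  have hNU : NU k P.Res := by
    apply NU_eta (l.map (P.rdE E hE)) (P.rd ⟨y, hy⟩)
    · have e1 : Pi5 (l.map (P.rdE E hE)) = P.rd ⟨((Pi5 l : E) : L), hE _ (Pi5 l : E).2⟩ := by
        rw [← P.rdE_apply E hE]
        exact (Pi5_map (P.rdE E hE : E →+* P.Res) l).symm
      rw [e1]
      apply eq_neg_of_add_eq_zero_right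
      rw [← map_pow, ← map_pow, ← map_mul, ← map_one P.rd, ← map_add, P.rd_eq_zero]
      rw [hfy] at hv
      exact hv
    · intro z
      have hle : P.img E ≤ IntermediateField.adjoin k {z | z ∈ l.map (P.rdE E hE)} := by
        rw [P.img_eq E hE]
        rintro _ ⟨w, rfl⟩
        have hw : w ∈ IntermediateField.adjoin k {z | z ∈ l} := by rw [hl]; trivial
        apply hom_mem_of_gen (P.rdE E hE : E →+* P.Res) (IntermediateField.adjoin k {z | z ∈ l.map (P.rdE E hE)}).toSubfield _ _ w hw
        · intro c
          have : (P.rdE E hE : E →+* P.Res) (algebraMap k E c) = algebraMap k P.Res c := (P.rdE E hE).commutes c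
          rw [this]
          exact (IntermediateField.adjoin k {z | z ∈ l.map (P.rdE E hE)}).algebraMap_mem c
        · intro w hw
          exact IntermediateField.subset_adjoin _ _ (List.mem_map_of_mem hw)
      exact isAlgebraic_mono hle (halg z)
  have hgen : Gen P.O s := by
    have hf0 : aeval y f ≠ 0 := by
      intro h0
      have h3 := transcendental_iff.mp tr _ h0
      rw [h3] at hfd
      simp at hfd
    have := gen_of_sep gen hE hy (sep25 (Pi5 l ^ 5) (pow_ne_zero 5 hp)) hf0 hv
    have hv1 : P.O.valuation ((Pi5 l : E) : L) = 1 := by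
      apply le_antisymm (mem_iff_val.mp (hE _ (Pi5 l : E).2))
      have := mem_iff_val.mp (hE _ (inv_mem (Pi5 l : E).2))
      rw [map_inv₀] at this
      exact (inv_le_one₀ (val_pos hpL)).mp this
    have e2 : aeval y (1 + Polynomial.C (Pi5 l ^ 5) * Polynomial.X ^ 25 : E[X]) = 1 + ((Pi5 l : E) : L) ^ 5 * y ^ 25 := hfy
    rw [e2] at this
    rw [hs]
    unfold Gen at this ⊢
    rw [map_mul, hv1, one_mul]
    exact ⟨mul_ne_zero hpL this.1, this.2⟩
  let Q := P.map θ
  have hQres : NU k Q.Res := hNU.of_equiv (P.mapRes θ)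
  have hEQ : ∀ z ∈ E, z ∈ Q.O := by
    apply Q.le_of_trdeg E hfinE
    have h1 := Q.B E ⊤ y (fun z _ => by rw [gen]; trivial) hQres (RingHom.id _) (fun c => rfl) (fun z => by rw [Q.img_top]; trivial)
    have h2 : Algebra.trdeg k Q.Res ≤ Algebra.trdeg k (Q.img E) := by
      rw [← IntermediateField.topEquiv.trdeg_eq]
      exact trd_le_of_alg (fun z _ => h1 z)
    refine le_trans ?_ h2
    rw [← (P.mapRes θ).trdeg_eq, ← htrE]
    exact trd_le_top _
  have hg2 : Gen Q.O (θ s) := hgen.map θ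
  obtain ⟨w, hw0, hw⟩ := h Q.O
  rcases T2 gen tr hp hEQ with h1 | h1
  · rw [← hs] at h1
    obtain ⟨w', hw0', hw'⟩ := Div5.of_mul ⟨w, hw0, hw⟩ (h1.pow a)
    exact hg2.not_fifth (b := 1) (by norm_num) (by norm_num) w' (by rw [pow_one]; exact hw')
  · rw [← hs] at h1
    have h3 : Q.O.valuation s = Q.O.valuation (θ s) := le_antisymm (hg2.2.2 _ h1.2.1) (h1.2.2 _ hg2.2.1)
    rw [map_mul, map_pow, h3] at hw
    refine hg2.not_fifth (b := 1 + a) (by omega) (by omega) w ?_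
    rw [← hw, pow_add, pow_one]
end
end CrBir
end

section
namespace CrBir
open Polynomial IntermediateField.algebraAdjoinAdjoin
universe u v

/-- residue fields of the type we count -/
def HasP (k : Type v) (F' κ : Type u) [Field k] [Field F'] [Field κ] [Algebra k F'] [Algebra k κ] (j : ℕ) (s : F') : Prop :=
  ∃ D : CData k F' κ j s, ∃ τ : κ, Transcendental D.Z τ ∧ IntermediateField.adjoin D.Z {τ} = ⊤

/-- the parameter `s` is good -/
structure GoodS (k : Type v) (F' : Type u) [Field k] [Field F'] [Algebra k F'] (s : F') : Prop where
  ne : s ≠ 0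
  nu : ∀ (κ : Type u) [Field κ] [Algebra k κ] (j : ℕ) (_ : j = 1 ∨ j = 2) (D : CData k F' κ j s), NU k D.Z
  inc : ∀ (κ : Type u) [Field κ] [Algebra k κ], HasP k F' κ 2 s → HasP k F' κ 1 s → False

section
variable {k : Type v} [Field k] [CharZero k]

theorem exists_list {E : Type u} [Field E] [Algebra k E] (l : List E) :
    ∃ l' : List E, Pi5 l' ≠ 0 ∧ IntermediateField.adjoin k {z | z ∈ l'} = IntermediateField.adjoin k {z | z ∈ l} := by
  haveI : CharZero E := charZero_of_injective_algebraMap (FaithfulSMul.algebraMap_injective k E)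
  induction l with
  | nil => exact ⟨[], by simp [Pi5], rfl⟩
  | cons z l ih =>
    obtain ⟨l', h1, h2⟩ := ih
    have key : ∀ z' : E, IntermediateField.adjoin k {z'} = IntermediateField.adjoin k {z} →
        IntermediateField.adjoin k {w | w ∈ z' :: l'} = IntermediateField.adjoin k {w | w ∈ z :: l} := by
      intro z' hz'
      have e : ∀ (a : E) (m : List E), {w | w ∈ a :: m} = {a} ∪ {w | w ∈ m} := by
        intro a m; ext w; simp
      rw [e, e, IntermediateField.adjoin_union, IntermediateField.adjoin_union, h2, hz']
    by_cases h : 1 + Pi5 l' ^ 5 * z ^ 25 = 0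
    · refine ⟨(2 * z) :: l', ?_, key _ ?_⟩
      · simp only [Pi5]
        refine mul_ne_zero h1 ?_
        intro h3
        have : ((2:E) ^ 25 - 1) = 0 := by linear_combination 2 ^ 25 * h - h3
        norm_num at this
      · apply le_antisymm
        · rw [IntermediateField.adjoin_simple_le_iff]
          exact mul_mem (ofNat_mem _ 2) (IntermediateField.mem_adjoin_simple_self k z)
        · rw [IntermediateField.adjoin_simple_le_iff]
          have h4 : z = 2 * z / 2 := by field_simp
          have h5 : 2 * z / 2 ∈ IntermediateField.adjoin k {2 * z} :=
            div_mem (IntermediateField.mem_adjoin_simple_self k (2 * z)) (ofNat_mem _ 2)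
          rwa [← h4] at h5
    · exact ⟨z :: l', mul_ne_zero h1 h, key _ rfl⟩

variable {L : Type u} [Field L] [Algebra k L]

theorem exists_goodS {E : IntermediateField k L} {y : L} (tr : Transcendental E y) (gen : IntermediateField.adjoin E {y} = ⊤)
    (hfin : Algebra.trdeg k L < Cardinal.aleph0) (hfg : (⊤ : IntermediateField k E).FG) : ∃ s : L, GoodS k L s := by
  obtain ⟨T, hT⟩ := hfg
  obtain ⟨l, hp, hl⟩ := exists_list (k := k) T.toList
  have hl' : IntermediateField.adjoin k {z | z ∈ l} = ⊤ := by rw [hl, ← hT]; congr 1; ext; simp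
  let l₂ : List L := y :: l.map (algebraMap E L)
  have hs : Pi5 l₂ = ((Pi5 l : E) : L) * (1 + ((Pi5 l : E) : L) ^ 5 * y ^ 25) := by
    have := Pi5_map (algebraMap E L) l
    simp only [l₂, Pi5, ← this]
    rfl
  have hpL : ((Pi5 l : E) : L) ≠ 0 := by simpa using hp
  have hne : Pi5 l₂ ≠ 0 := by
    rw [hs]
    refine mul_ne_zero hpL ?_
    intro h0
    apply tr
    refine ⟨1 + Polynomial.C (Pi5 l ^ 5) * Polynomial.X ^ 25, ?_, ?_⟩
    · intro h
      have := congrArg (fun p => p.coeff 25) h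
      simp [coeff_one, -map_pow] at this
      exact hp this
    · rw [← h0]; simp
  have hgen : IntermediateField.adjoin k {z | z ∈ l₂} = ⊤ := by
    have h1 : ∀ z : E, (z : L) ∈ IntermediateField.adjoin k {z | z ∈ l₂} := by
      intro z
      have hz : z ∈ IntermediateField.adjoin k {z | z ∈ l} := by rw [hl']; trivial
      refine hom_mem_of_gen (algebraMap E L) (IntermediateField.adjoin k {z | z ∈ l₂}).toSubfield ?_ ?_ z hz
      · intro c; exact (IntermediateField.adjoin k {z | z ∈ l₂}).algebraMap_mem c
      · intro w hw
        exact IntermediateField.subset_adjoin _ _ (List.mem_cons_of_mem _ (List.mem_map_of_mem hw))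
    rw [eq_top_iff]
    intro z _
    have hz : z ∈ IntermediateField.adjoin E {y} := by rw [gen]; trivial
    refine hom_mem_of_gen (RingHom.id L) (IntermediateField.adjoin k {z | z ∈ l₂}).toSubfield ?_ ?_ z hz
    · intro c; exact h1 c
    · rintro w rfl
      exact IntermediateField.subset_adjoin _ _ (List.mem_cons_self)
  refine ⟨Pi5 l₂, hne, fun κ _ _ j hj D => D.nu hj hgen hne, ?_⟩
  rintro κ _ _ ⟨D₁, τ₁, t1, g1⟩ ⟨D₂, τ₂, t2, g2⟩
  obtain ⟨θ, a, ha, h⟩ := F_main hgen hne D₁ D₂ t1 g1 t2 g2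
  exact T_lemma tr gen hfin l hl' hp θ a ha hs h
end
end CrBir
end

section
namespace CrBir
open Polynomial IntermediateField.algebraAdjoinAdjoin
universe u v

section
variable {k : Type v} {L : Type u} [Field k] [Field L] [Algebra k L]

theorem Place.ext' {P Q : Place k L} (h : ∀ z, z ∈ P.O ↔ z ∈ Q.O) : P = Q := by
  obtain ⟨O, hO⟩ := P
  obtain ⟨O', hO'⟩ := Q
  have : O = O' := SetLike.ext h
  subst this
  rfl

noncomputable instance : MulAction (L ≃ₐ[k] L) (Place k L) where
  smul σ P := P.map σ
  one_smul P := Place.ext' (fun z => Iff.rfl)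
  mul_smul σ τ P := Place.ext' (fun z => Iff.rfl)

theorem Place.smul_def (σ : L ≃ₐ[k] L) (P : Place k L) : σ • P = P.map σ := rfl

/-- fractions of `R` with denominator a unit of `O` -/
def locSub (R : Subalgebra k L) (O : ValuationSubring L) : Subalgebra k L where
  carrier := {z | ∃ a ∈ R, ∃ b ∈ R, O.valuation b = 1 ∧ z * b = a}
  mul_mem' := by
    rintro z w ⟨a, ha, b, hb, h1, h2⟩ ⟨a', ha', b', hb', h1', h2'⟩
    refine ⟨a * a', mul_mem ha ha', b * b', mul_mem hb hb', by rw [map_mul, h1, h1', one_mul], ?_⟩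
    rw [← h2, ← h2']; ring
  add_mem' := by
    rintro z w ⟨a, ha, b, hb, h1, h2⟩ ⟨a', ha', b', hb', h1', h2'⟩
    refine ⟨a * b' + a' * b, add_mem (mul_mem ha hb') (mul_mem ha' hb), b * b', mul_mem hb hb', by rw [map_mul, h1, h1', one_mul], ?_⟩
    rw [← h2, ← h2']; ring
  algebraMap_mem' := fun c => ⟨algebraMap k L c, R.algebraMap_mem c, 1, one_mem _, map_one _, mul_one _⟩

theorem mem_locSub {R : Subalgebra k L} {O : ValuationSubring L} {z : L} :
    z ∈ locSub R O ↔ ∃ a ∈ R, ∃ b ∈ R, O.valuation b = 1 ∧ z * b = a := Iff.rfl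

theorem le_locSub (R : Subalgebra k L) (O : ValuationSubring L) : R ≤ locSub R O :=
  fun z hz => ⟨z, hz, 1, one_mem _, map_one _, mul_one _⟩

theorem locSub_trans {A R : Subalgebra k L} {O : ValuationSubring L} (h : A ≤ locSub R O) : locSub A O ≤ locSub R O := by
  rintro z ⟨a, ha, b, hb, h1, h2⟩
  obtain ⟨a1, ha1, a2, ha2, v2, ea⟩ := h ha
  obtain ⟨b1, hb1, b2, hb2, w2, eb⟩ := h hb
  refine ⟨a1 * b2, mul_mem ha1 hb2, b1 * a2, mul_mem hb1 ha2, ?_, ?_⟩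
  · rw [← eb, map_mul, map_mul, h1, w2, v2, one_mul, one_mul]
  · rw [← ea, ← eb, ← h2]; ring

/-- the set of places that we count -/
def SR (Q : Place k L → Prop) (R : Subalgebra k L) : Set (Place k L) :=
  {P | P.O ≠ ⊤ ∧ Q P ∧ (∀ z ∈ R, z ∈ P.O) ∧ ∀ z ∈ P.O, z ∈ locSub R P.O}

theorem noeth_of_loc {R : Subalgebra k L} {O : ValuationSubring L} [IsNoetherianRing R] (hR : ∀ z ∈ R, z ∈ O)
    (hO : ∀ z ∈ O, z ∈ locSub R O) : IsNoetherianRing O := by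
  let f : R →+* O :=
    { toFun := fun z => ⟨z, hR z z.2⟩, map_one' := rfl, map_mul' := fun _ _ => rfl, map_zero' := rfl, map_add' := fun _ _ => rfl }
  have hinj : ∀ I J : Ideal O, I.comap f ≤ J.comap f → I ≤ J := by
    intro I J h z hz
    obtain ⟨a, ha, b, hb, h1, h2⟩ := hO z z.2
    have e1 : z * f ⟨b, hb⟩ = f ⟨a, ha⟩ := Subtype.ext h2
    have h3 : (⟨a, ha⟩ : R) ∈ I.comap f := by
      rw [Ideal.mem_comap, ← e1]; exact I.mul_mem_right _ hz
    have h4 := h h3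
    rw [Ideal.mem_comap, ← e1] at h4
    have hu : IsUnit (f ⟨b, hb⟩) := (ValuationSubring.valuation_eq_one_iff O _).mpr h1
    exact (Ideal.mul_unit_mem_iff_mem _ hu).mp h4
  rw [isNoetherianRing_iff, isNoetherian_iff']
  let e : Ideal O ↪o Ideal R :=
    { toFun := fun I => I.comap f
      inj' := fun I J h => le_antisymm (hinj _ _ (le_of_eq h)) (hinj _ _ (le_of_eq h.symm))
      map_rel_iff' := fun {I J} => ⟨hinj I J, fun h => Ideal.comap_mono h⟩ }
  haveI : WellFoundedGT (Ideal R) := inferInstance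
  exact e.wellFoundedGT

theorem arch_of_noeth {O : ValuationSubring L} [IsNoetherianRing O] {d r : L} (hd : d ≠ 0) (hdO : d ∈ O) (hr : O.valuation r < 1) :
    ∃ N : ℕ, O.valuation (r ^ N) ≤ O.valuation d := by
  by_contra hcon
  push Not at hcon
  have hrO : r ∈ O := mem_iff_val.mpr hr.le
  let I : Ideal O := Ideal.span {⟨r, hrO⟩}
  have hI : I ≠ ⊤ := by
    intro h
    rw [Ideal.span_singleton_eq_top, ValuationSubring.valuation_eq_one_iff] at h
    exact hr.ne h
  have h := Ideal.iInf_pow_eq_bot_of_isDomain I hI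
  have h2 : (⟨d, hdO⟩ : O) ∈ ⨅ i : ℕ, I ^ i := by
    rw [Ideal.mem_iInf]
    intro N
    rw [Ideal.span_singleton_pow, Ideal.mem_span_singleton]
    have hN := hcon N
    have hr0 : r ^ N ≠ 0 := by
      intro h0; rw [h0, map_zero] at hN; exact not_lt_zero' hN
    have h3 := (val_le_iff hr0).mp hN.le
    refine ⟨⟨_, h3⟩, Subtype.ext ?_⟩
    change d = r ^ N * (d / r ^ N)
    field_simp
  rw [h] at h2
  exact hd (congrArg Subtype.val (Ideal.mem_bot.mp h2))

theorem finite_div (Q : Place k L → Prop) (R : Subalgebra k L) [IsNoetherianRing R] {d : L} (hd : d ∈ R) (hd0 : d ≠ 0) :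
    {P | P ∈ SR Q R ∧ P.O.valuation d < 1}.Finite := by
  let I : Ideal R := Ideal.span {⟨d, hd⟩}
  have hfin : I.minimalPrimes.Finite := Ideal.finite_minimalPrimes_of_isNoetherianRing R I
  let pr : Place k L → Set L := fun P => {z | z ∈ R ∧ P.O.valuation z < 1}
  apply Set.Finite.of_finite_image (f := pr)
  · apply (hfin.image (fun p : Ideal R => Subtype.val '' (p : Set R))).subset
    rintro _ ⟨P, ⟨⟨hP1, hP2, hP3, hP4⟩, hPd⟩, rfl⟩
    haveI := noeth_of_loc hP3 hP4
    let f : R →+* P.O :=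
      { toFun := fun z => ⟨z, hP3 z z.2⟩, map_one' := rfl, map_mul' := fun _ _ => rfl, map_zero' := rfl, map_add' := fun _ _ => rfl }
    let p : Ideal R := (IsLocalRing.maximalIdeal P.O).comap f
    have hp : ∀ z : R, z ∈ p ↔ P.O.valuation (z : L) < 1 := by
      intro z
      rw [Ideal.mem_comap]
      exact ValuationSubring.valuation_lt_one_iff P.O (f z)
    refine ⟨p, ⟨⟨inferInstance, ?_⟩, ?_⟩, ?_⟩
    · rw [Ideal.span_singleton_le_iff_mem, hp]; exact hPd
    · rintro q ⟨hq1, hq2⟩ hqp r hr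
      rw [Ideal.span_singleton_le_iff_mem] at hq2
      rw [hp] at hr
      obtain ⟨N, hN⟩ := arch_of_noeth hd0 (hP3 d hd) hr
      rw [val_le_iff hd0] at hN
      obtain ⟨a, ha, b, hb, h1, h2⟩ := hP4 _ hN
      have h3 : r ^ N * ⟨b, hb⟩ = (⟨d, hd⟩ : R) * ⟨a, ha⟩ := by
        apply Subtype.ext
        change (r : L) ^ N * b = d * a
        rw [← h2]; field_simp
      have h4 : r ^ N * ⟨b, hb⟩ ∈ q := by rw [h3]; exact q.mul_mem_right _ hq2
      rcases hq1.mem_or_mem h4 with h5 | h5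
      · exact hq1.mem_of_pow_mem _ h5
      · exact absurd ((hp _).mp (hqp h5)) (by change ¬ P.O.valuation b < 1; rw [h1]; exact lt_irrefl _)
    · ext z
      constructor
      · rintro ⟨y, hy, rfl⟩; exact ⟨y.2, (hp y).mp hy⟩
      · rintro ⟨h1, h2⟩; exact ⟨⟨z, h1⟩, (hp ⟨z, h1⟩).mpr h2, rfl⟩
  · have key : ∀ P P' : Place k L, P ∈ SR Q R → P' ∈ SR Q R → pr P = pr P' → ∀ z, z ∈ P.O → z ∈ P'.O := by
      rintro P P' ⟨hP1, hP2, hP3, hP4⟩ ⟨hP1', hP2', hP3', hP4'⟩ h z hz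
      obtain ⟨a, ha, b, hb, h1, h2⟩ := hP4 z hz
      have hb' : P'.O.valuation b = 1 := by
        by_contra hne
        have h3 : b ∈ pr P' := ⟨hb, lt_of_le_of_ne (mem_iff_val.mp (hP3' b hb)) hne⟩
        rw [← h] at h3
        exact absurd h3.2 (by rw [h1]; exact lt_irrefl _)
      rw [mem_iff_val]
      have h4 := mem_iff_val.mp (hP3' a ha)
      rwa [← h2, map_mul, hb', mul_one] at h4
    rintro P ⟨hP, _⟩ P' ⟨hP', _⟩ h
    exact Place.ext' (fun z => ⟨key P P' hP hP' h z, key P' P hP' hP h.symm z⟩)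

/-- `Frac R = L` -/
def IsFrac (R : Subalgebra k L) : Prop := ∀ z : L, ∃ a ∈ R, ∃ b ∈ R, b ≠ 0 ∧ z * b = a

theorem isFrac_of_adjoin {G : Set L} (h : IntermediateField.adjoin k G = ⊤) : IsFrac (Algebra.adjoin k G) := by
  intro z
  have hz : z ∈ IntermediateField.adjoin k G := by rw [h]; trivial
  rw [IntermediateField.mem_adjoin_iff_div] at hz
  obtain ⟨r, hr, s, hs, e⟩ := hz
  by_cases h0 : s = 0
  · exact ⟨0, zero_mem _, 1, one_mem _, one_ne_zero, by rw [e, h0, div_zero, zero_mul]⟩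
  · exact ⟨r, hr, s, hs, h0, by rw [e]; field_simp⟩

theorem finite_diff (Q : Place k L → Prop) {G G' : Set L} (hG : G.Finite) (hG' : G'.Finite)
    (h : IsFrac (Algebra.adjoin k G)) (h' : IsFrac (Algebra.adjoin k G')) :
    (SR Q (Algebra.adjoin k G) \ SR Q (Algebra.adjoin k G')).Finite := by
  set R := Algebra.adjoin k G with hR
  set R' := Algebra.adjoin k G' with hR'
  haveI : Algebra.FiniteType k R := ⟨(Subalgebra.fg_top R).mpr ⟨hG.toFinset, by simp [hR]⟩⟩
  haveI : IsNoetherianRing R := Algebra.FiniteType.isNoetherianRing k R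
  choose num hnum den hden hd0 hfr using h
  choose num' hnum' den' hden' hd0' hfr' using h'
  let D : Set L := den '' G' ∪ (fun z => den (den' z)) '' G ∪ (fun z => num (den' z)) '' G
  have hD : D.Finite := ((hG'.image _).union (hG.image _)).union (hG.image _)
  have hn0 : ∀ z, z ≠ 0 → num z ≠ 0 := fun z hz => by rw [← hfr]; exact mul_ne_zero hz (hd0 z)
  have hDR : ∀ d ∈ D, d ∈ R ∧ d ≠ 0 := by
    rintro d ((⟨z, _, rfl⟩ | ⟨z, _, rfl⟩) | ⟨z, _, rfl⟩)
    · exact ⟨hden _, hd0 _⟩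
    · exact ⟨hden _, hd0 _⟩
    · exact ⟨hnum _, hn0 _ (hd0' _)⟩
  have hU : (⋃ d ∈ D, {P | P ∈ SR Q R ∧ P.O.valuation d < 1}).Finite :=
    hD.biUnion (fun d hd => finite_div Q R (hDR d hd).1 (hDR d hd).2)
  refine hU.subset ?_
  rintro P ⟨hP, hP'⟩
  by_contra hcon
  simp only [Set.mem_iUnion, not_exists, Set.mem_setOf_eq, not_and] at hcon
  obtain ⟨hP1, hP2, hP3, hP4⟩ := hP
  have hv : ∀ d ∈ D, P.O.valuation d = 1 := fun d hd => by
    have h1 := hcon d hd ⟨hP1, hP2, hP3, hP4⟩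
    exact le_antisymm (mem_iff_val.mp (hP3 d (hDR d hd).1)) (not_lt.mp h1)
  apply hP'
  refine ⟨hP1, hP2, ?_, ?_⟩
  · let B : Subalgebra k L := { P.O.toSubring with algebraMap_mem' := P.hk }
    have : R' ≤ B := by
      rw [hR', Algebra.adjoin_le_iff]
      intro z hz
      change z ∈ P.O
      rw [mem_iff_val]
      have h1 := hv (den z) (Or.inl (Or.inl ⟨z, hz, rfl⟩))
      have h2 := mem_iff_val.mp (hP3 _ (hnum z))
      rwa [← hfr z, map_mul, h1, mul_one] at h2
    exact fun z hz => this hz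
  · have h1 : R ≤ locSub R' P.O := by
      rw [hR, Algebra.adjoin_le_iff]
      intro z hz
      refine ⟨num' z, hnum' z, den' z, hden' z, ?_, hfr' z⟩
      have h1 := hv (den (den' z)) (Or.inl (Or.inr ⟨z, hz, rfl⟩))
      have h2 := hv (num (den' z)) (Or.inr ⟨z, hz, rfl⟩)
      rwa [← hfr, map_mul, h1, mul_one] at h2
    exact fun z hz => locSub_trans h1 (hP4 z hz)

theorem val_map_eq (P : Place k L) (σ : L ≃ₐ[k] L) {a : L} : (P.map σ).O.valuation (σ a) = 1 ↔ P.O.valuation a = 1 := by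
  have h1 := P.val_map_lt σ (a := a)
  have h2 := P.map_mem σ (z := a)
  rw [mem_iff_val, mem_iff_val] at h2
  constructor
  · intro h; exact le_antisymm (h2.mp h.le) (not_lt.mp (fun h3 => (h1.mpr h3).ne h))
  · intro h; exact le_antisymm (h2.mpr h.le) (not_lt.mp (fun h3 => (h1.mp h3).ne h))

theorem smul_SR_sub (Q : Place k L → Prop) (hQ : ∀ P (σ : L ≃ₐ[k] L), Q P → Q (P.map σ)) (σ : L ≃ₐ[k] L) {R R' : Subalgebra k L}
    (h : ∀ z, z ∈ R ↔ σ z ∈ R') {P : Place k L} (hP : P ∈ SR Q R) : P.map σ ∈ SR Q R' := by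
  obtain ⟨hP1, hP2, hP3, hP4⟩ := hP
  refine ⟨?_, hQ P σ hP2, ?_, ?_⟩
  · intro h0
    apply hP1
    rw [eq_top_iff]
    intro z _
    rw [← P.map_mem σ, h0]
    trivial
  · intro z hz
    obtain ⟨y, rfl⟩ := σ.surjective z
    exact (P.map_mem σ).mpr (hP3 y ((h y).mpr hz))
  · intro z hz
    obtain ⟨y, rfl⟩ := σ.surjective z
    obtain ⟨a, ha, b, hb, h1, h2⟩ := hP4 y ((P.map_mem σ).mp hz)
    exact ⟨σ a, (h a).mp ha, σ b, (h b).mp hb, (val_map_eq P σ).mpr h1, by rw [← map_mul, h2]⟩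

open Pointwise

theorem smul_SR (Q : Place k L → Prop) (hQ : ∀ P (σ : L ≃ₐ[k] L), Q P → Q (P.map σ)) (σ : L ≃ₐ[k] L) {R R' : Subalgebra k L}
    (h : ∀ z, z ∈ R ↔ σ z ∈ R') : σ • SR Q R = SR Q R' := by
  apply Set.Subset.antisymm
  · rintro _ ⟨P, hP, rfl⟩
    exact smul_SR_sub Q hQ σ h hP
  · intro P hP
    rw [Set.mem_smul_set_iff_inv_smul_mem]
    refine smul_SR_sub Q hQ σ⁻¹ (fun z => ?_) hP
    rw [h]
    change _ ↔ σ (σ.symm z) ∈ R'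
    rw [AlgEquiv.apply_symm_apply]

theorem finite_diff_smul (Q : Place k L → Prop) (hQ : ∀ P (σ : L ≃ₐ[k] L), Q P → Q (P.map σ)) {G : Set L} (hG : G.Finite)
    (hgen : IntermediateField.adjoin k G = ⊤) (σ : L ≃ₐ[k] L) :
    (SR Q (Algebra.adjoin k G) \ σ • SR Q (Algebra.adjoin k G)).Finite := by
  have e : (Algebra.adjoin k G).map (σ : L →ₐ[k] L) = Algebra.adjoin k (σ '' G) := AlgHom.map_adjoin _ _
  have e2 : σ • SR Q (Algebra.adjoin k G) = SR Q (Algebra.adjoin k (σ '' G)) := by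
    apply smul_SR Q hQ
    intro z
    rw [← e, Subalgebra.mem_map]
    constructor
    · intro hz; exact ⟨z, hz, rfl⟩
    · rintro ⟨y, hy, h⟩
      have : y = z := σ.injective h
      rwa [← this]
  rw [e2]
  have hf := isFrac_of_adjoin hgen
  refine finite_diff Q hG (hG.image _) hf ?_
  intro z
  obtain ⟨y, rfl⟩ := σ.surjective z
  obtain ⟨a, ha, b, hb, h0, h1⟩ := hf y
  rw [← e]
  exact ⟨σ a, ⟨a, ha, rfl⟩, σ b, ⟨b, hb, rfl⟩, by simpa using h0, by rw [← map_mul, h1]⟩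
end

section
open Pointwise
/-- relative size of commensurable sets -/
noncomputable def dset {X : Type*} (A B : Set X) : ℤ := (A \ B).ncard - (B \ A).ncard

theorem dset_add {X : Type*} {A B D : Set X} (h1 : (A \ B).Finite) (h2 : (B \ A).Finite) (h3 : (B \ D).Finite) (h4 : (D \ B).Finite) :
    dset A D = dset A B + dset B D := by
  have split : ∀ U V : Set X, U.Finite → U.ncard = (U ∩ V).ncard + (U \ V).ncard := fun U V hU => (Set.ncard_inter_add_ncard_sdiff_eq_ncard U V hU).symm
  have h5 : (A \ D).Finite := (h1.union h3).subset (by intro x; simp; tauto)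
  have h6 : (D \ A).Finite := (h2.union h4).subset (by intro x; simp; tauto)
  unfold dset
  rw [split (A \ B) D h1, split (B \ A) D h2, split (B \ D) A h3, split (D \ B) A h4, split (A \ D) B h5, split (D \ A) B h6]
  have e1 : (A \ D) ∩ B = (B \ D) ∩ A := by ext; simp; tauto
  have e2 : (A \ D) \ B = (A \ B) \ D := by ext; simp; tauto
  have e3 : (D \ A) ∩ B = (B \ A) ∩ D := by ext; simp; tauto
  have e4 : (D \ A) \ B = (D \ B) \ A := by ext; simp; tauto
  have e5 : (A \ B) ∩ D = (D \ B) ∩ A := by ext; simp; tauto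
  have e6 : (B \ A) \ D = (B \ D) \ A := by ext; simp; tauto
  rw [e1, e2, e3, e4, e5, e6]
  push_cast
  ring

theorem dset_smul {G X : Type*} [Group G] [MulAction G X] (g : G) (A B : Set X) : dset (g • A) (g • B) = dset A B := by
  unfold dset
  rw [← Set.smul_set_sdiff, ← Set.smul_set_sdiff, Set.ncard_smul_set, Set.ncard_smul_set]

theorem not_surj {G H X : Type*} [Group G] [Group H] [MulAction G X] (S : Set X) (hS : ∀ g : G, (S \ g • S).Finite)
    (ι : H →* G) (h1 : ∀ h : H, ι h • S ⊆ S) (g : G) (hg : g • S ⊆ S) (hg' : ¬ S ⊆ g • S) : ¬ Function.Surjective (Abelianization.map ι) := by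
  intro hsurj
  have hS' : ∀ g g' : G, (g • S \ g' • S).Finite := by
    intro g g'
    have e : g • S \ g' • S = g • (S \ (g⁻¹ * g') • S) := by
      rw [Set.smul_set_sdiff, smul_smul, mul_inv_cancel_left]
    rw [e]
    exact (hS _).smul_set
  have hS1 : ∀ g : G, (g • S \ S).Finite := by
    intro g
    have := hS' g 1
    rwa [one_smul] at this
  let c : G →* Multiplicative ℤ := MonoidHom.mk' (fun g => Multiplicative.ofAdd (dset S (g • S))) (by
    intro a b
    rw [← ofAdd_add]
    congr 1
    rw [dset_add (hS a) (hS1 a) (hS' a (a * b)) (hS' (a * b) a), mul_smul, dset_smul])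
  have hc : c g = 1 := by
    obtain ⟨x, hx⟩ := hsurj (Abelianization.of g)
    obtain ⟨h, rfl⟩ := QuotientGroup.mk_surjective (s := commutator H) x
    have h2 : Abelianization.lift c (Abelianization.of (ι h)) = Abelianization.lift c (Abelianization.of g) := by
      rw [← hx]; rfl
    rw [Abelianization.lift_apply_of, Abelianization.lift_apply_of] at h2
    rw [← h2]
    have h3 : ι h • S = S := by
      apply Set.Subset.antisymm (h1 h)
      have := h1 h⁻¹
      rw [map_inv] at this
      rwa [Set.subset_smul_set_iff]
    change Multiplicative.ofAdd (dset S (ι h • S)) = 1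
    rw [h3]
    simp [dset]
  have hc2 : dset S (g • S) = 0 := hc
  unfold dset at hc2
  rw [Set.sdiff_eq_empty.mpr hg, Set.ncard_empty] at hc2
  have h5 : (S \ g • S).ncard = 0 := by simpa using hc2
  rw [Set.ncard_eq_zero (hS g)] at h5
  exact hg' (Set.sdiff_eq_empty.mp h5)
end
end CrBir
end

section
namespace CrBir
open Polynomial IntermediateField.algebraAdjoinAdjoin
universe u v

section
variable {k : Type v} {L : Type u} [Field k] [Field L] [Algebra k L]

/-- adjoin one element -/
noncomputable def ad (E : IntermediateField k L) (x : L) : IntermediateField k L := (IntermediateField.adjoin E {x}).restrictScalars k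

theorem mem_ad {E : IntermediateField k L} {x z : L} : z ∈ ad E x ↔ z ∈ IntermediateField.adjoin E {x} := Iff.rfl

theorem le_ad (E : IntermediateField k L) (x : L) : E ≤ ad E x := fun z hz => mem_adjA E _ hz

theorem self_ad (E : IntermediateField k L) (x : L) : x ∈ ad E x := IntermediateField.mem_adjoin_simple_self E x

theorem ad_le {E M : IntermediateField k L} {x : L} (h : E ≤ M) (hx : x ∈ M) : ad E x ≤ M := by
  intro z hz
  have hz' : z ∈ IntermediateField.adjoin E {x} := hz
  have := hom_mem_of_gen (RingHom.id L) M.toSubfield (k := E) (s := {x}) ?_ ?_ z hz'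
  · exact this
  · intro c
    exact h c.2
  · rintro y rfl
    exact hx

theorem ad_mono {E M : IntermediateField k L} {x : L} (h : E ≤ M) : ad E x ≤ ad M x := ad_le (h.trans (le_ad M x)) (self_ad M x)

theorem ad_top_iff {E : IntermediateField k L} {x : L} : ad E x = ⊤ ↔ IntermediateField.adjoin E {x} = ⊤ := by
  constructor
  · intro h; rw [eq_top_iff]; intro z _; rw [← mem_ad, h]; trivial
  · intro h; rw [eq_top_iff]; intro z _; rw [mem_ad, h]; trivial

theorem gen_self {F : Type*} [Field F] [Algebra F L] (x : L) :
    IntermediateField.adjoin F {(⟨x, IntermediateField.mem_adjoin_simple_self F x⟩ : IntermediateField.adjoin F {x})} = ⊤ := by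
  rw [eq_top_iff]
  intro z _
  have h := hom_mem_of_gen (RingHom.id L) ((IntermediateField.adjoin F {(⟨x, IntermediateField.mem_adjoin_simple_self F x⟩ : IntermediateField.adjoin F {x})}).toSubfield.map (algebraMap (IntermediateField.adjoin F {x}) L))
    (k := F) (s := {x}) ?_ ?_ z z.2
  · obtain ⟨y, hy, e⟩ := h
    have : y = z := Subtype.ext e
    rw [← this]; exact hy
  · intro c
    exact ⟨algebraMap F _ c, IntermediateField.algebraMap_mem _ c, rfl⟩
  · rintro y rfl
    exact ⟨_, IntermediateField.subset_adjoin _ _ rfl, rfl⟩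

theorem trd_add' (k : Type*) (E M : Type u) [Field k] [Field E] [Field M] [Algebra k E] [Algebra k M] [Algebra E M] [IsScalarTower k E M] :
    Algebra.trdeg k M = Algebra.trdeg k E + Algebra.trdeg E M := (_root_.trdeg_add_eq k E (A := M)).symm

theorem trd_ad_le (E : IntermediateField k L) (x : L) : Algebra.trdeg k (ad E x) ≤ Algebra.trdeg k E + 1 := by
  have h : Algebra.trdeg k (IntermediateField.adjoin E {x}) = Algebra.trdeg k E + Algebra.trdeg E (IntermediateField.adjoin E {x}) :=
    trd_add' k E (IntermediateField.adjoin E {x})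
  have h2 := trd_simple_le' (gen_self (F := E) x)
  change Algebra.trdeg k (IntermediateField.adjoin E {x}) ≤ _
  rw [h]
  gcongr

theorem trd_ad {E : IntermediateField k L} {x : L} (tr : Transcendental E x) : Algebra.trdeg k (ad E x) = Algebra.trdeg k E + 1 := by
  have h : Algebra.trdeg k (IntermediateField.adjoin E {x}) = Algebra.trdeg k E + Algebra.trdeg E (IntermediateField.adjoin E {x}) :=
    trd_add' k E (IntermediateField.adjoin E {x})
  have h2 := trd_simple_tr' (E := E) (τ := (⟨x, IntermediateField.mem_adjoin_simple_self E x⟩ : IntermediateField.adjoin E {x})) ?_ (gen_self (F := E) x)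
  · change Algebra.trdeg k (IntermediateField.adjoin E {x}) = _
    rw [h, h2]
  · intro h3
    exact tr (h3.algebraMap (A := L))

/-- if adjoining `x` increases the degree then `x` is transcendental -/
theorem tr_of_trd {E : IntermediateField k L} {x : L} (h : Algebra.trdeg k E < Algebra.trdeg k (ad E x)) : Transcendental E x := by
  intro hx
  have : Algebra.trdeg k (ad E x) ≤ Algebra.trdeg k E := by
    apply trd_le_of_alg
    intro z hz
    haveI := IntermediateField.isAlgebraic_adjoin_simple hx.isIntegral
    exact (Algebra.IsAlgebraic.isAlgebraic (R := E) (⟨z, hz⟩ : IntermediateField.adjoin E {x})).algebraMap (A := L)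
  exact absurd h (not_lt.mpr this)

theorem alg_sub (E : IntermediateField k L) : ∃ B : IntermediateField k L, E ≤ B ∧ (∀ z, IsAlgebraic E z ↔ z ∈ B) ∧
    (∀ z, IsAlgebraic B z → z ∈ B) := by
  refine ⟨(algebraicClosure E L).restrictScalars k, ?_, ?_, ?_⟩
  · intro z hz
    exact mem_algebraicClosure_iff.mpr (isAlgebraic_algebraMap (⟨z, hz⟩ : E))
  · intro z; exact mem_algebraicClosure_iff.symm
  · intro z hz
    have hz' : IsAlgebraic (algebraicClosure E L) z := hz
    exact mem_algebraicClosure_iff.mpr (hz'.restrictScalars E)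

theorem indep_of_gen {F : Type*} [Field F] [Algebra F L] {n : ℕ} (x : Fin n → L) (h : IntermediateField.adjoin F (Set.range x) = ⊤)
    (hn : Algebra.trdeg F L = n) : AlgebraicIndependent F x := by
  haveI : Algebra.IsAlgebraic (Algebra.adjoin F (Set.range x)) L := by
    constructor
    intro z
    have hz : z ∈ IntermediateField.adjoin F (Set.range x) := by rw [h]; trivial
    rw [IntermediateField.mem_adjoin_iff_div] at hz
    obtain ⟨r, hr, s, hs, rfl⟩ := hz
    have h1 : IsAlgebraic (Algebra.adjoin F (Set.range x)) r := isAlgebraic_algebraMap (⟨r, hr⟩ : Algebra.adjoin F (Set.range x))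
    have h2 : IsAlgebraic (Algebra.adjoin F (Set.range x)) s := isAlgebraic_algebraMap (⟨s, hs⟩ : Algebra.adjoin F (Set.range x))
    rw [div_eq_mul_inv]
    exact h1.mul h2.inv
  exact (Algebra.IsAlgebraic.isTranscendenceBasis_of_lift_le_trdeg_of_finite F x (by rw [hn]; simp)).1

theorem exists_aut {F : Type*} [Field F] [Algebra F L] {n : ℕ} (x y : Fin n → L) (hx : IntermediateField.adjoin F (Set.range x) = ⊤)
    (hy : IntermediateField.adjoin F (Set.range y) = ⊤) (hn : Algebra.trdeg F L = n) : ∃ σ : L ≃ₐ[F] L, ∀ i, σ (x i) = y i := by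
  have ix := indep_of_gen x hx hn
  have iy := indep_of_gen y hy hn
  let ex : L ≃ₐ[F] IntermediateField.adjoin F (Set.range x) := (IntermediateField.topEquiv.symm).trans (IntermediateField.equivOfEq hx.symm)
  let ey : L ≃ₐ[F] IntermediateField.adjoin F (Set.range y) := (IntermediateField.topEquiv.symm).trans (IntermediateField.equivOfEq hy.symm)
  refine ⟨((ex.trans ix.aevalEquivField.symm).trans iy.aevalEquivField).trans ey.symm, fun i => ?_⟩
  have h1 : ex (x i) = ix.aevalEquivField (algebraMap (MvPolynomial (Fin n) F) (FractionRing (MvPolynomial (Fin n) F)) (MvPolynomial.X i)) := by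
    apply Subtype.ext
    rw [ix.aevalEquivField_algebraMap_apply_coe, MvPolynomial.aeval_X]
    rfl
  have h2 : ey (y i) = iy.aevalEquivField (algebraMap (MvPolynomial (Fin n) F) (FractionRing (MvPolynomial (Fin n) F)) (MvPolynomial.X i)) := by
    apply Subtype.ext
    rw [iy.aevalEquivField_algebraMap_apply_coe, MvPolynomial.aeval_X]
    rfl
  simp only [AlgEquiv.trans_apply]
  rw [h1, AlgEquiv.symm_apply_apply, ← h2, AlgEquiv.symm_apply_apply]
end

section
variable {k : Type v} {F' κ Ω : Type u} [Field k] [Field F'] [Field κ] [Field Ω] [Algebra k F'] [Algebra k κ] [Algebra k Ω]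

theorem tr_pull (e : κ →ₐ[k] Ω) {E : IntermediateField k κ} {E' : IntermediateField k Ω} (h : ∀ z ∈ E, e z ∈ E') {x : κ}
    (tr : Transcendental E' (e x)) : Transcendental E x := by
  let f : E →+* E' := ((e : κ →+* Ω).comp (algebraMap E κ)).codRestrict E'.toSubfield (fun z => h z z.2)
  exact Transcendental.of_ringHom_of_comp_eq f (e : κ →+* Ω) tr f.injective rfl

theorem HasP.pull {j : ℕ} {s : F'} (e : κ →ₐ[k] Ω) (D : CData k F' Ω j s) {τ : Ω} (tr : Transcendental D.Z τ) (hr : e.fieldRange = ad D.Z τ) :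
    HasP k F' κ j s := by
  have hm : ∀ z ∈ D.Z, ∃ y, e y = z := fun z hz => by
    have : z ∈ e.fieldRange := by rw [hr]; exact le_ad _ _ hz
    exact this
  have hinj : Function.Injective e := e.toRingHom.injective
  choose! inv hinv using hm
  let φ : F' →ₐ[k] κ :=
    { toFun := fun z => inv (D.φ z)
      map_one' := hinj (by rw [hinv _ (D.φ_mem _), map_one, map_one])
      map_mul' := fun a b => hinj (by rw [map_mul e, hinv _ (D.φ_mem _), hinv _ (D.φ_mem _), hinv _ (D.φ_mem _), map_mul])
      map_zero' := hinj (by rw [hinv _ (D.φ_mem _), map_zero, map_zero])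
      map_add' := fun a b => hinj (by rw [map_add e, hinv _ (D.φ_mem _), hinv _ (D.φ_mem _), hinv _ (D.φ_mem _), map_add])
      commutes' := fun c => hinj (by rw [hinv _ (D.φ_mem _), D.φ.commutes, e.commutes]) }
  have hφ : ∀ z, e (φ z) = D.φ z := fun z => hinv _ (D.φ_mem _)
  have hx := hinv _ D.x_mem
  have hw := hinv _ D.w_mem
  have hr' := hinv _ D.r_mem
  let D' : CData k F' κ j s :=
    { φ := φ, x := inv D.x, w := inv D.w, r := inv D.r
      eq := hinj (by simp only [map_add, map_pow, map_sub, hx, hw]; exact D.eq)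
      hr := hinj (by
        simp only [map_mul, map_pow, hφ, hr']
        rw [D.hr]
        congr 1
        have := cf_map (e : κ →+* Ω) (inv D.x) (inv D.w)
        simp only [RingHom.coe_coe, hx, hw] at this
        exact this.symm)
      tr := by
        refine tr_pull e (E' := D.φ.fieldRange) ?_ (by rw [hx]; exact D.tr)
        rintro _ ⟨z, rfl⟩
        exact ⟨z, (hφ z).symm⟩ }
  have hZ : ∀ z ∈ D'.Z, e z ∈ D.Z := by
    apply hom_mem_of_gen (e : κ →+* Ω) D.Z.toSubfield
    · intro c; rw [RingHom.coe_coe, e.commutes]; exact D.Z.algebraMap_mem c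
    · rintro z (⟨y, rfl⟩ | rfl | rfl | rfl)
      · change e (φ y) ∈ D.Z; rw [hφ]; exact D.φ_mem y
      · change e (inv D.x) ∈ D.Z; rw [hx]; exact D.x_mem
      · change e (inv D.w) ∈ D.Z; rw [hw]; exact D.w_mem
      · change e (inv D.r) ∈ D.Z; rw [hr']; exact D.r_mem
  have hZ' : ∀ z ∈ D.Z, z ∈ D'.Z.toSubfield.map (e : κ →+* Ω) := by
    apply hom_mem_of_gen (RingHom.id Ω) (D'.Z.toSubfield.map (e : κ →+* Ω))
    · intro c; exact ⟨algebraMap k κ c, D'.Z.algebraMap_mem c, e.commutes c⟩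
    · rintro z (⟨y, rfl⟩ | rfl | rfl | rfl)
      · exact ⟨_, D'.φ_mem y, hφ y⟩
      · exact ⟨_, D'.x_mem, hx⟩
      · exact ⟨_, D'.w_mem, hw⟩
      · exact ⟨_, D'.r_mem, hr'⟩
  obtain ⟨τ', hτ⟩ : τ ∈ e.fieldRange := by rw [hr]; exact self_ad _ _
  have hτ : e τ' = τ := hτ
  refine ⟨D', τ', tr_pull e hZ (by rw [hτ]; exact tr), ?_⟩
  rw [eq_top_iff]
  intro z _
  have hz : e z ∈ IntermediateField.adjoin D.Z {τ} := by
    rw [← mem_ad, ← hr]; exact ⟨z, rfl⟩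
  have := hom_mem_of_gen (RingHom.id Ω) ((IntermediateField.adjoin D'.Z {τ'}).toSubfield.map (e : κ →+* Ω)) (k := D.Z) (s := {τ}) ?_ ?_ _ hz
  · obtain ⟨y, hy, e1⟩ := this
    rw [← hinj e1]; exact hy
  · intro c
    obtain ⟨y, hy, e1⟩ := hZ' c c.2
    exact ⟨y, mem_adjA D'.Z _ hy, e1⟩
  · rintro y rfl
    exact ⟨τ', IntermediateField.subset_adjoin _ _ rfl, hτ⟩

theorem HasP.equiv {j : ℕ} {s : F'} (e : κ ≃ₐ[k] Ω) (h : HasP k F' Ω j s) : HasP k F' κ j s := by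
  obtain ⟨D, τ, tr, gen⟩ := h
  refine HasP.pull (e : κ →ₐ[k] Ω) D tr ?_
  rw [ad_top_iff.mpr gen, eq_top_iff]
  intro z _
  obtain ⟨y, rfl⟩ := e.surjective z
  exact ⟨y, rfl⟩

theorem HasP.map {L : Type u} [Field L] [Algebra k L] {j : ℕ} {s : F'} (P : Place k L) (σ : L ≃ₐ[k] L) (h : HasP k F' P.Res j s) : HasP k F' (P.map σ).Res j s :=
  HasP.equiv (P.mapRes σ).symm h

theorem CData.alg_r {j : ℕ} {s : F'} (D : CData k F' κ j s) {B : IntermediateField k κ} (hB : ∀ z, IsAlgebraic B z → z ∈ B)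
    (hφ : ∀ z, D.φ z ∈ B) (hx : D.x ∈ B) : D.Z ≤ B := by
  have hw : D.w ∈ B := by
    apply hB
    refine ⟨Polynomial.X ^ 2 + Polynomial.X - Polynomial.C (⟨D.x, hx⟩ ^ 3 - ⟨D.x, hx⟩ ^ 2), ?_, ?_⟩
    · intro h
      have := congrArg (fun p => p.coeff 2) h
      simp [-map_sub, -map_pow, coeff_X, coeff_C] at this
    · simp [D.eq]
  have hr : D.r ∈ B := by
    apply hB
    have hc : D.φ s ^ j * cf D.x D.w ∈ B := mul_mem (pow_mem (hφ s) j) (neg_mem (add_mem (add_mem hw (pow_mem hx 2)) (mul_mem hx hw)))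
    refine ⟨Polynomial.X ^ 5 - Polynomial.C ⟨_, hc⟩, X_pow_sub_C_ne_zero (by norm_num) _, ?_⟩
    rw [map_sub, map_pow, aeval_X, aeval_C, D.hr]
    exact sub_self _
  unfold CData.Z
  rw [IntermediateField.adjoin_le_iff]
  rintro z (⟨y, rfl⟩ | rfl | rfl | rfl)
  exacts [hφ y, hx, hw, hr]

theorem CData.trd {j : ℕ} {s : F'} (D : CData k F' κ j s) : Algebra.trdeg k D.Z = Algebra.trdeg k F' + 1 := by
  have h1 : Algebra.trdeg k D.φ.fieldRange = Algebra.trdeg k F' := (AlgEquiv.ofInjectiveField D.φ).trdeg_eq.symm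
  rw [← h1, ← trd_ad D.tr]
  apply le_antisymm
  · obtain ⟨B, hB1, hB2, hB3⟩ := alg_sub (ad D.φ.fieldRange D.x)
    apply trd_le_of_alg
    intro z hz
    rw [hB2]
    exact D.alg_r hB3 (fun z => hB1 (le_ad _ _ ⟨z, rfl⟩)) (hB1 (self_ad _ _)) hz
  · apply trd_mono
    refine ad_le ?_ D.x_mem
    rintro _ ⟨z, rfl⟩
    exact D.φ_mem z

theorem HasP.trd {j : ℕ} {s : F'} (h : HasP k F' κ j s) : Algebra.trdeg k κ = Algebra.trdeg k F' + 2 := by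
  obtain ⟨D, τ, tr, gen⟩ := h
  rw [trd_simple_tr tr gen, D.trd, add_assoc, one_add_one_eq_two]
end
end CrBir
end

section
namespace CrBir
open Polynomial IntermediateField.algebraAdjoinAdjoin
universe u v

section
variable {k : Type v} {κ : Type u} [Field k] [Field κ] [Algebra k κ]

theorem mem_of_pow {B : IntermediateField k κ} (hB : ∀ z, IsAlgebraic B z → z ∈ B) {n : ℕ} (hn : 0 < n) {z : κ} (hz : z ^ n ∈ B) : z ∈ B := by
  apply hB
  refine ⟨Polynomial.X ^ n - Polynomial.C ⟨_, hz⟩, X_pow_sub_C_ne_zero hn _, ?_⟩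
  rw [map_sub, map_pow, aeval_X, aeval_C]
  exact sub_self _

theorem mem_of_quad {B : IntermediateField k κ} (hB : ∀ z, IsAlgebraic B z → z ∈ B) {z : κ} (hz : z ^ 2 + z ∈ B) : z ∈ B := by
  apply hB
  refine ⟨Polynomial.X ^ 2 + Polynomial.X - Polynomial.C (⟨_, hz⟩ : B), ?_, ?_⟩
  · intro h
    have := congrArg (fun p => p.coeff 2) h
    simp [coeff_X, coeff_C] at this
  · rw [map_sub, map_add, map_pow, aeval_X, aeval_C]
    exact sub_self _

variable {F' : Type u} [Field F'] [Algebra k F'] {s : F'}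

theorem trd_range (φ : F' →ₐ[k] κ) : Algebra.trdeg k φ.fieldRange = Algebra.trdeg k F' := (AlgEquiv.ofInjectiveField φ).trdeg_eq.symm

/-- transcendence degree bound used repeatedly -/
theorem trd_contra {j : ℕ} (h : HasP k F' κ j s) (hfin : Algebra.trdeg k F' < Cardinal.aleph0) (φ : F' →ₐ[k] κ)
    {B : IntermediateField k κ} (hB : ∀ z ∈ B, IsAlgebraic φ.fieldRange z) {f : κ} (hf : ad B f = ⊤) : False := by
  have h1 := h.trd
  have h2 := trd_le_of_alg hB
  have h3 := trd_simple_le (ad_top_iff.mp hf)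
  rw [trd_range] at h2
  obtain ⟨n, hn⟩ := Cardinal.lt_aleph0.mp hfin
  rw [hn] at h1 h2
  obtain ⟨m, hm⟩ := Cardinal.lt_aleph0.mp (h2.trans_lt (Cardinal.natCast_lt_aleph0))
  rw [h1, hm] at h3
  rw [hm] at h2
  norm_cast at h2 h3
  omega

theorem res_den (hg : GoodS k F' s) (h : HasP k F' κ 2 s) (hfin : Algebra.trdeg k F' < Cardinal.aleph0) (φ : F' →ₐ[k] κ) {e f g : κ}
    (gen : ad (ad (ad φ.fieldRange e) f) g = ⊤) : φ s * (f ^ 2 + g) - (φ s) ^ 2 * e * (f * g - e ^ 2) ≠ 0 := by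
  intro h0
  have hs : φ s ≠ 0 := (_root_.map_ne_zero φ).mpr hg.ne
  have hsM : φ s ∈ φ.fieldRange := ⟨s, rfl⟩
  have h1 : g * (1 - φ s * e * f) = - f ^ 2 - φ s * e ^ 3 := by
    apply mul_left_cancel₀ hs
    linear_combination h0
  have hsE := le_ad φ.fieldRange e hsM
  have hsF := le_ad (ad φ.fieldRange e) f hsE
  have heF := le_ad (ad φ.fieldRange e) f (self_ad φ.fieldRange e)
  have hfF := self_ad (ad φ.fieldRange e) f
  by_cases h2 : 1 - φ s * e * f = 0
  · obtain ⟨B, hB1, hB2, hB3⟩ := alg_sub φ.fieldRange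
    have hf : f ≠ 0 := by rintro rfl; simp at h2
    have he : e ≠ 0 := by rintro rfl; simp at h2
    have h3 : e ^ 5 = - (φ s ^ 3)⁻¹ := by
      rw [h2] at h1
      rw [eq_neg_iff_add_eq_zero]
      field_simp
      linear_combination (φ s ^ 2 * e ^ 2) * h1 + (1 + φ s * e * f) * h2
    have he : e ∈ B := mem_of_pow hB3 (n := 5) (by norm_num) (by rw [h3]; exact neg_mem (inv_mem (pow_mem (hB1 hsM) 3)))
    have hf : f ∈ B := by
      have : f = (φ s * e)⁻¹ := by
        field_simp
        linear_combination - h2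
      rw [this]; exact inv_mem (mul_mem (hB1 hsM) he)
    refine trd_contra h hfin φ (B := B) (fun z hz => (hB2 z).mpr hz) (f := g) ?_
    rw [eq_top_iff, ← gen]
    exact ad_mono (ad_le (ad_le hB1 he) hf)
  · have hg' : g ∈ ad (ad φ.fieldRange e) f := by
      have : g = (- f ^ 2 - φ s * e ^ 3) / (1 - φ s * e * f) := by rw [eq_div_iff h2, h1]
      rw [this]
      exact div_mem (sub_mem (neg_mem (pow_mem hfF 2)) (mul_mem hsF (pow_mem heF 3))) (sub_mem (one_mem _) (mul_mem (mul_mem hsF heF) hfF))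
    have gen' : ad (ad φ.fieldRange e) f = ⊤ := by
      rw [eq_top_iff, ← gen]; exact ad_le le_rfl hg'
    have hk := h.trd
    obtain ⟨n, hn⟩ := Cardinal.lt_aleph0.mp hfin
    have tr : Transcendental (ad φ.fieldRange e) f := by
      apply tr_of_trd
      have h3 := trd_ad_le φ.fieldRange e
      rw [gen', IntermediateField.topEquiv.trdeg_eq, hk]
      refine h3.trans_lt ?_
      rw [trd_range, hn]
      norm_cast
      omega
    obtain ⟨D, τ, trτ, genτ⟩ := h
    have hZ := hg.nu κ 2 (Or.inr rfl) D
    have hle := Z_le hZ tr (ad_top_iff.mp gen')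
    have hal := NU.alg_of_simple (K := φ.fieldRange) (κ := κ) hZ (algebraMap D.Z κ) (τ := e) ?_ ?_
    · have h5 := trd_le_of_alg (E := φ.fieldRange) (E' := D.Z) (fun z hz => hal ⟨z, hz⟩)
      rw [D.trd, trd_range, hn] at h5
      norm_cast at h5
      omega
    · intro c
      exact ⟨algebraMap k _ c, rfl⟩
    · intro z
      exact hle z.2

theorem res_C (hg : GoodS k F' s) (h : HasP k F' κ 2 s) (hfin : Algebra.trdeg k F' < Cardinal.aleph0) (φ : F' →ₐ[k] κ) {a b c f : κ}
    (gen : ad (ad (ad (ad φ.fieldRange a) b) c) f = ⊤)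
    (hn : 1 + φ s ^ 2 * b * c ^ 2 - φ s * (a * b + a ^ 2 * c) = 0)
    (hd : φ s ^ 2 * b * (b - a * c) - φ s * (c - a ^ 3) = 0) : False := by
  have hs : φ s ≠ 0 := (_root_.map_ne_zero φ).mpr hg.ne
  have hsM : φ s ∈ φ.fieldRange := ⟨s, rfl⟩
  obtain ⟨B, hB1, hB2, hB3⟩ := alg_sub φ.fieldRange
  have hsB := hB1 hsM
  have fin : a ∈ B → b ∈ B → c ∈ B → False := by
    intro ha hb hc
    refine trd_contra h hfin φ (B := B) (fun z hz => (hB2 z).mpr hz) (f := f) ?_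
    rw [eq_top_iff, ← gen]
    exact ad_mono (ad_le (ad_le (ad_le hB1 ha) hb) hc)
  by_cases hb : b = 0
  · subst hb
    have hc : c = a ^ 3 := by
      have := mul_left_cancel₀ hs (show φ s * (c - a ^ 3) = φ s * 0 by linear_combination -hd)
      linear_combination this
    have ha : a ^ 5 = (φ s)⁻¹ := by
      field_simp
      rw [hc] at hn
      linear_combination -hn
    have haB : a ∈ B := mem_of_pow hB3 (n := 5) (by norm_num) (by rw [ha]; exact inv_mem hsB)
    exact fin haB (zero_mem _) (by rw [hc]; exact pow_mem haB 3)
  set x := φ s * a * b with hx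
  set w := φ s ^ 2 * b ^ 2 * (φ s * b * c - a ^ 2) with hw
  set r := - φ s * b with hr
  have eqn : w ^ 2 + w = x ^ 3 - x ^ 2 := by
    rw [hw, hx]
    linear_combination (φ s ^ 4 * b ^ 5) * hn + (φ s ^ 3 * a * b ^ 4 - φ s ^ 2 * b ^ 3) * hd
  have hr5 : r ^ 5 = φ s ^ 1 * cf x w := by
    unfold cf
    rw [hw, hx, hr]
    linear_combination (- φ s ^ 3 * b ^ 3) * hd
  have eb : b = - r / φ s := by rw [hr]; field_simp
  have ea : a = x / (φ s * b) := by rw [hx]; field_simp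
  have ec : c = (w / (φ s ^ 2 * b ^ 2) + a ^ 2) / (φ s * b) := by rw [hw]; field_simp; ring
  clear_value x w r
  have back : ∀ M : IntermediateField k κ, φ s ∈ M → x ∈ M → w ∈ M → r ∈ M → a ∈ M ∧ b ∈ M ∧ c ∈ M := by
    intro M h1 h2 h3 h4
    have hb : b ∈ M := by rw [eb]; exact div_mem (neg_mem h4) h1
    have ha : a ∈ M := by rw [ea]; exact div_mem h2 (mul_mem h1 hb)
    have hc : c ∈ M := by
      rw [ec]
      exact div_mem (add_mem (div_mem h3 (mul_mem (pow_mem h1 2) (pow_mem hb 2))) (pow_mem ha 2)) (mul_mem h1 hb)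
    exact ⟨ha, hb, hc⟩
  have trx : Transcendental φ.fieldRange x := by
    intro hxa
    have hxB := (hB2 x).mp hxa
    have hwB : w ∈ B := mem_of_quad hB3 (by rw [eqn]; exact sub_mem (pow_mem hxB 3) (pow_mem hxB 2))
    have hrB : r ∈ B := mem_of_pow hB3 (n := 5) (by norm_num) (by
      rw [hr5]
      exact mul_mem (pow_mem hsB 1) (neg_mem (add_mem (add_mem hwB (pow_mem hxB 2)) (mul_mem hxB hwB))))
    obtain ⟨h1, h2, h3⟩ := back B hsB hxB hwB hrB
    exact fin h1 h2 h3
  let D : CData k F' κ 1 s := { φ := φ, x := x, w := w, r := r, eq := eqn, hr := hr5, tr := trx }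
  have hφD : φ.fieldRange ≤ D.Z := by
    rintro _ ⟨z, rfl⟩
    exact D.φ_mem z
  obtain ⟨h1, h2, h3⟩ := back D.Z (D.φ_mem s) D.x_mem D.w_mem D.r_mem
  have gD : ad D.Z f = ⊤ := by
    rw [eq_top_iff, ← gen]
    exact ad_mono (ad_le (ad_le (ad_le hφD h1) h2) h3)
  refine hg.inc κ h ⟨D, f, ?_, ad_top_iff.mp gD⟩
  apply tr_of_trd
  rw [gD, IntermediateField.topEquiv.trdeg_eq, h.trd, D.trd]
  obtain ⟨n, hn⟩ := Cardinal.lt_aleph0.mp hfin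
  rw [hn]
  norm_cast
  omega
end
end CrBir
end

section
namespace CrBir
open Polynomial IntermediateField.algebraAdjoinAdjoin
universe u v

section
variable {k : Type v} {L : Type u} [Field k] [Field L] [Algebra k L]

theorem rd_gen (P : Place k L) {G : Set L} (hR : ∀ z ∈ Algebra.adjoin k G, z ∈ P.O) (hO : ∀ z ∈ P.O, z ∈ locSub (Algebra.adjoin k G) P.O)
    (M : IntermediateField k P.Res) (h : ∀ g (hg : g ∈ G), P.rd ⟨g, hR g (Algebra.subset_adjoin hg)⟩ ∈ M) : M = ⊤ := by
  have key : ∀ z (hz : z ∈ Algebra.adjoin k G), P.rd ⟨z, hR z hz⟩ ∈ M := by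
    intro z hz
    induction hz using Algebra.adjoin_induction with
    | mem x hx => exact h x hx
    | algebraMap c =>
      have := P.rd_alg c
      rw [this]
      exact M.algebraMap_mem c
    | add x y hx hy h1 h2 => exact add_mem h1 h2
    | mul x y hx hy h1 h2 => exact mul_mem h1 h2
  rw [eq_top_iff]
  intro y _
  obtain ⟨z, rfl⟩ := P.rd_surj y
  obtain ⟨a, ha, b, hb, h1, h2⟩ := hO z z.2
  have hb0 : P.rd ⟨b, hR b hb⟩ ≠ 0 := P.rd_ne_zero.mpr h1
  have : P.rd z = P.rd ⟨a, hR a ha⟩ / P.rd ⟨b, hR b hb⟩ := by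
    rw [eq_div_iff hb0, ← map_mul]
    congr 1
    exact Subtype.ext h2
  rw [this]
  exact div_mem (key a ha) (key b hb)

theorem div_locSub {R : Subalgebra k L} {O : ValuationSubring L} {x y : L} (hx : x ∈ locSub R O) (hy : y ∈ locSub R O) (h : O.valuation y = 1) :
    x / y ∈ locSub R O := by
  rw [div_eq_mul_inv]
  apply mul_mem hx
  obtain ⟨a, ha, b, hb, h1, h2⟩ := hy
  have hy : y ≠ 0 := by rintro rfl; simp at h
  refine ⟨b, hb, a, ha, by rw [← h2, map_mul, h, h1, one_mul], ?_⟩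
  rw [← h2]; field_simp

theorem val_of_inv {O : ValuationSubring L} {y : L} (h0 : y ≠ 0) (h1 : y ∈ O) (h2 : y⁻¹ ∈ O) : O.valuation y = 1 := by
  apply le_antisymm ((mem_iff_val).mp h1)
  have := mem_iff_val.mp h2
  rw [map_inv₀] at this
  have h3 : 0 < O.valuation y := val_pos h0
  exact (inv_le_one₀ h3).mp this

theorem frac_le {G : Set L} {R : Subalgebra k L} {O : ValuationSubring L} (hO : ∀ z ∈ IntermediateField.adjoin k G, z ∈ O)
    (hG : G ⊆ R) : ∀ z ∈ IntermediateField.adjoin k G, z ∈ locSub R O := by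
  intro z hz
  have hle : Algebra.adjoin k G ≤ R := Algebra.adjoin_le hG
  have hle' : ∀ z ∈ Algebra.adjoin k G, z ∈ IntermediateField.adjoin k G := fun z hz => IntermediateField.algebra_adjoin_le_adjoin k G hz
  obtain ⟨r, hr, t, ht, rfl⟩ := IntermediateField.mem_adjoin_iff_div.mp hz
  by_cases h0 : t = 0
  · subst h0; rw [div_zero]; exact zero_mem _
  · refine div_locSub (le_locSub R O (hle hr)) (le_locSub R O (hle ht)) ?_
    exact val_of_inv h0 (hO _ (hle' _ ht)) (hO _ (inv_mem (hle' _ ht)))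

variable [CharZero k]

theorem claim1 {F' : IntermediateField k L} {G0 : Set L} (hG0 : IntermediateField.adjoin k G0 = F') {s : F'} (hgood : GoodS k F' s)
    (hfin : Algebra.trdeg k F' < Cardinal.aleph0) {a b c e f g : L}
    (hf : f * ((s : L) ^ 2 * b * (b - a * c) - s * (c - a ^ 3)) = 1 + (s : L) ^ 2 * b * c ^ 2 - s * (a * b + a ^ 2 * c))
    (he : e = c + a * f) (hg : g = b + a * e) {P : Place k L} (hF : ∀ z ∈ F', z ∈ P.O)
    (hP : P ∈ SR (fun P => HasP k F' P.Res 2 s) (Algebra.adjoin k (G0 ∪ {e, f, g}))) :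
    P ∈ SR (fun P => HasP k F' P.Res 2 s) (Algebra.adjoin k (G0 ∪ {a, b, c})) := by
  obtain ⟨hP1, hP2, hP3, hP4⟩ := hP
  have hP2 : HasP k F' P.Res 2 s := hP2
  have hG0F : ∀ z ∈ G0, z ∈ F' := fun z hz => by rw [← hG0]; exact IntermediateField.subset_adjoin _ _ hz
  have heO : e ∈ P.O := hP3 _ (Algebra.subset_adjoin (by simp))
  have hfO : f ∈ P.O := hP3 _ (Algebra.subset_adjoin (by simp))
  have hgO : g ∈ P.O := hP3 _ (Algebra.subset_adjoin (by simp))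
  have hsO : (s : L) ∈ P.O := hF _ s.2
  set φ := P.rdE F' hF with hφ
  set so : P.O := ⟨s, hsO⟩ with hso
  set eo : P.O := ⟨e, heO⟩ with heo
  set fo : P.O := ⟨f, hfO⟩ with hfo
  set go : P.O := ⟨g, hgO⟩ with hgo
  have hφs : P.rd so = φ s := (P.rdE_apply F' hF s).symm
  have hφG : ∀ z (hz : z ∈ G0), P.rd ⟨z, hF z (hG0F z hz)⟩ ∈ φ.fieldRange := fun z hz => ⟨⟨z, hG0F z hz⟩, P.rdE_apply F' hF _⟩
  have gen1 : ad (ad (ad φ.fieldRange (P.rd eo)) (P.rd fo)) (P.rd go) = ⊤ := by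
    apply rd_gen P hP3 hP4
    rintro z (hz | rfl | rfl | rfl)
    · exact le_ad _ _ (le_ad _ _ (le_ad _ _ (hφG z hz)))
    · exact le_ad _ _ (le_ad _ _ (self_ad _ _))
    · exact le_ad _ _ (self_ad _ _)
    · exact self_ad _ _
  have hden := res_den hgood hP2 hfin φ gen1
  set deno : P.O := so * (fo ^ 2 + go) - so ^ 2 * eo * (fo * go - eo ^ 2) with hdeno
  have hden' : P.rd deno ≠ 0 := by
    rw [hdeno]
    simpa only [map_sub, map_mul, map_add, map_pow, hφs] using hden
  have hvden := P.rd_ne_zero.mp hden'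
  have hden0 : (deno : L) ≠ 0 := by intro h; rw [h] at hvden; simp at hvden
  have hb : b = g - a * e := by rw [hg]; ring
  have hc : c = e - a * f := by rw [he]; ring
  have hden_eq : (deno : L) = s * (f ^ 2 + g) - (s : L) ^ 2 * e * (f * g - e ^ 2) := rfl
  have ha : a * deno = 1 + s * e * f - (s : L) ^ 2 * g * (f * g - e ^ 2) := by
    rw [hb, hc] at hf
    rw [hden_eq]
    linear_combination hf
  have hnumO : 1 + s * e * f - (s : L) ^ 2 * g * (f * g - e ^ 2) ∈ P.O :=
    (1 + so * eo * fo - so ^ 2 * go * (fo * go - eo ^ 2)).2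
  have haO : a ∈ P.O := by
    have : a = (1 + s * e * f - (s : L) ^ 2 * g * (f * g - e ^ 2)) * (deno : L)⁻¹ := by
      rw [← div_eq_mul_inv, eq_div_iff hden0, ha]
    rw [this]
    exact mul_mem hnumO (P.inv_mem hden')
  have hbO : b ∈ P.O := by rw [hb]; exact sub_mem hgO (mul_mem haO heO)
  have hcO : c ∈ P.O := by rw [hc]; exact sub_mem heO (mul_mem haO hfO)
  set ao : P.O := ⟨a, haO⟩ with hao
  set bo : P.O := ⟨b, hbO⟩ with hbo
  set co : P.O := ⟨c, hcO⟩ with hco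
  set d_o : P.O := so ^ 2 * bo * (bo - ao * co) - so * (co - ao ^ 3) with hdo
  set no : P.O := 1 + so ^ 2 * bo * co ^ 2 - so * (ao * bo + ao ^ 2 * co) with hno
  have hfd : fo * d_o = no := Subtype.ext hf
  have heo' : eo = co + ao * fo := Subtype.ext he
  have hgo' : go = bo + ao * eo := Subtype.ext hg
  have hd : P.rd d_o ≠ 0 := by
    intro h0
    have h1 : P.rd no = 0 := by rw [← hfd, map_mul, h0, mul_zero]
    refine res_C hgood hP2 hfin φ (a := P.rd ao) (b := P.rd bo) (c := P.rd co) (f := P.rd fo) ?_ ?_ ?_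
    · have hM1 := self_ad (ad (ad (ad φ.fieldRange (P.rd ao)) (P.rd bo)) (P.rd co)) (P.rd fo)
      have hM2 := le_ad (ad (ad (ad φ.fieldRange (P.rd ao)) (P.rd bo)) (P.rd co)) (P.rd fo) (self_ad _ _)
      have hM3 := le_ad (ad (ad (ad φ.fieldRange (P.rd ao)) (P.rd bo)) (P.rd co)) (P.rd fo) (le_ad _ _ (self_ad _ _))
      have hM4 := le_ad (ad (ad (ad φ.fieldRange (P.rd ao)) (P.rd bo)) (P.rd co)) (P.rd fo) (le_ad _ _ (le_ad _ _ (self_ad _ _)))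
      have hM5 : P.rd eo ∈ ad (ad (ad (ad φ.fieldRange (P.rd ao)) (P.rd bo)) (P.rd co)) (P.rd fo) := by
        rw [heo', map_add, map_mul]; exact add_mem hM2 (mul_mem hM4 hM1)
      apply rd_gen P hP3 hP4
      rintro z (hz | rfl | rfl | rfl)
      · exact le_ad _ _ (le_ad _ _ (le_ad _ _ (le_ad _ _ (hφG z hz))))
      · exact hM5
      · exact hM1
      · change P.rd go ∈ _
        rw [hgo', map_add, map_mul]
        exact add_mem hM3 (mul_mem hM4 hM5)
    · rw [hno] at h1
      simpa only [map_sub, map_mul, map_add, map_pow, map_one, hφs] using h1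
    · rw [hdo] at h0
      simpa only [map_sub, map_mul, map_add, map_pow, map_one, hφs] using h0
  have hvd := P.rd_ne_zero.mp hd
  have hd0 : (d_o : L) ≠ 0 := by intro h; rw [h] at hvd; simp at hvd
  set R := Algebra.adjoin k (G0 ∪ {a, b, c}) with hR
  have hRO : ∀ z ∈ R, z ∈ P.O := by
    intro z hz
    have h1 : R ≤ ({ P.O.toSubring with algebraMap_mem' := P.hk } : Subalgebra k L) := by
      rw [hR]
      apply Algebra.adjoin_le
      rintro z (hz | rfl | rfl | rfl)
      · exact hF z (hG0F z hz)
      · exact haO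
      · exact hbO
      · exact hcO
    exact h1 hz
  refine ⟨hP1, hP2, hRO, ?_⟩
  have hFl : ∀ z ∈ F', z ∈ locSub R P.O := by
    have := frac_le (G := G0) (R := R) (O := P.O) (by rw [hG0]; exact hF) (fun z hz => Algebra.subset_adjoin (Or.inl hz))
    rwa [hG0] at this
  have hsl := hFl _ s.2
  have hal : a ∈ locSub R P.O := le_locSub _ _ (Algebra.subset_adjoin (by simp))
  have hbl : b ∈ locSub R P.O := le_locSub _ _ (Algebra.subset_adjoin (by simp))
  have hcl : c ∈ locSub R P.O := le_locSub _ _ (Algebra.subset_adjoin (by simp))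
  have hdl : (d_o : L) ∈ locSub R P.O := sub_mem (mul_mem (mul_mem (pow_mem hsl 2) hbl) (sub_mem hbl (mul_mem hal hcl)))
    (mul_mem hsl (sub_mem hcl (pow_mem hal 3)))
  have hnl : (no : L) ∈ locSub R P.O := sub_mem (add_mem (one_mem _) (mul_mem (mul_mem (pow_mem hsl 2) hbl) (pow_mem hcl 2)))
    (mul_mem hsl (add_mem (mul_mem hal hbl) (mul_mem (pow_mem hal 2) hcl)))
  have hfl : f ∈ locSub R P.O := by
    have : f = no / d_o := by rw [eq_div_iff hd0]; exact hf
    rw [this]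
    exact div_locSub hnl hdl hvd
  have hel : e ∈ locSub R P.O := by rw [he]; exact add_mem hcl (mul_mem hal hfl)
  have hgl : g ∈ locSub R P.O := by rw [hg]; exact add_mem hbl (mul_mem hal hel)
  intro z hz
  refine locSub_trans (A := Algebra.adjoin k (G0 ∪ {e, f, g})) ?_ (hP4 z hz)
  apply Algebra.adjoin_le
  rintro z (hz | rfl | rfl | rfl)
  exacts [hFl z (hG0F z hz), hel, hfl, hgl]
end
end CrBir
end

section
namespace CrBir
open Polynomial IntermediateField.algebraAdjoinAdjoin
universe u v

section
variable {k : Type v} {L : Type u} [Field k] [Field L] [Algebra k L] [CharZero k]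

theorem exists_center {E : IntermediateField k L} {y : L} (tr : Transcendental E y) (gen : IntermediateField.adjoin E {y} = ⊤)
    {Ω : Type u} [Field Ω] [Algebra k Ω] (ψ : E →ₐ[k] Ω) (c : Ω) (halg : ∃ p : E[X], p ≠ 0 ∧ eval₂ (ψ : E →+* Ω) c p = 0) :
    ∃ P : Place k L, P.O ≠ ⊤ ∧ (∀ z ∈ E, z ∈ P.O) ∧ y ∈ P.O ∧ ∃ θ : P.Res →ₐ[k] Ω,
      (∀ (z : E) (h : (z : L) ∈ P.O), θ (P.rd ⟨z, h⟩) = ψ z) ∧ ∀ h : y ∈ P.O, θ (P.rd ⟨y, h⟩) = c := by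
  have inj : Function.Injective (aeval (R := E) y) := transcendental_iff_injective.mp tr
  let Ψ : E[X] →+* Ω := eval₂RingHom (ψ : E →+* Ω) c
  have hΨC : ∀ z, Ψ (Polynomial.C z) = ψ z := fun z => by simp [Ψ]
  have hΨX : Ψ Polynomial.X = c := by simp [Ψ]
  let O : ValuationSubring L :=
    { carrier := {z | ∃ p q : E[X], Ψ q ≠ 0 ∧ z * aeval y q = aeval y p}
      mul_mem' := by
        rintro z w ⟨p, q, h1, h2⟩ ⟨p', q', h1', h2'⟩
        refine ⟨p * p', q * q', by rw [map_mul]; exact mul_ne_zero h1 h1', ?_⟩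
        rw [map_mul, map_mul, ← h2, ← h2']; ring
      one_mem' := ⟨1, 1, by rw [map_one]; exact one_ne_zero, one_mul _⟩
      add_mem' := by
        rintro z w ⟨p, q, h1, h2⟩ ⟨p', q', h1', h2'⟩
        refine ⟨p * q' + p' * q, q * q', by rw [map_mul]; exact mul_ne_zero h1 h1', ?_⟩
        rw [map_mul, map_add, map_mul, map_mul, ← h2, ← h2']; ring
      zero_mem' := ⟨0, 1, by rw [map_one]; exact one_ne_zero, by simp⟩
      neg_mem' := by
        rintro z ⟨p, q, h1, h2⟩
        exact ⟨-p, q, h1, by rw [map_neg, ← h2]; ring⟩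
      mem_or_inv_mem' := by
        intro z
        obtain ⟨p, q, hpq, hq, e⟩ := exists_coprime_rep gen z
        by_cases h : Ψ q = 0
        · by_cases hz : z = 0
          · left
            rw [hz]
            exact ⟨0, 1, by rw [map_one]; exact one_ne_zero, by simp⟩
          · right
            refine ⟨q, p, ?_, ?_⟩
            · intro h'
              obtain ⟨a, b, hab⟩ := hpq
              have := congrArg Ψ hab
              rw [map_add, map_mul, map_mul, h, h', mul_zero, mul_zero, add_zero, map_one] at this
              exact zero_ne_one this
            · rw [← e]; field_simp
        · left
          exact ⟨p, q, h, e⟩ }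
  have hmem : ∀ z, z ∈ O ↔ ∃ p q : E[X], Ψ q ≠ 0 ∧ z * aeval y q = aeval y p := fun z => Iff.rfl
  have hEO : ∀ z ∈ E, z ∈ O := fun z hz => ⟨Polynomial.C ⟨z, hz⟩, 1, by rw [map_one]; exact one_ne_zero, by rw [map_one, aeval_C, mul_one]; rfl⟩
  have hyO : y ∈ O := ⟨Polynomial.X, 1, by rw [map_one]; exact one_ne_zero, by rw [map_one, aeval_X, mul_one]⟩
  have hrep : ∀ z : O, ∃ p q : E[X], Ψ q ≠ 0 ∧ (z : L) * aeval y q = aeval y p := fun z => z.2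
  choose p q hq hz using hrep
  have key : ∀ (z : O) (p' q' : E[X]), Ψ q' ≠ 0 → (z : L) * aeval y q' = aeval y p' → Ψ (p z) / Ψ (q z) = Ψ p' / Ψ q' := by
    intro z p' q' h1 h2
    have : p z * q' = p' * q z := by
      apply inj
      rw [map_mul, map_mul, ← h2, ← hz]; ring
    rw [div_eq_div_iff (hq z) h1, ← map_mul, ← map_mul, this]
  let θ : O →+* Ω :=
    { toFun := fun z => Ψ (p z) / Ψ (q z)
      map_one' := by
        rw [key 1 1 1 (by rw [map_one]; exact one_ne_zero) (one_mul _), map_one, div_one]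
      map_zero' := by
        rw [key 0 0 1 (by rw [map_one]; exact one_ne_zero) (by simp), map_zero, zero_div]
      map_mul' := by
        intro z w
        rw [key (z * w) (p z * p w) (q z * q w) (by rw [map_mul]; exact mul_ne_zero (hq z) (hq w)) ?_, map_mul, map_mul, div_mul_div_comm]
        rw [map_mul, map_mul, ← hz, ← hz]
        push_cast
        ring
      map_add' := by
        intro z w
        rw [key (z + w) (p z * q w + q z * p w) (q z * q w) (by rw [map_mul]; exact mul_ne_zero (hq z) (hq w)) ?_, map_mul, map_add, map_mul, map_mul, div_add_div _ _ (hq z) (hq w)]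
        rw [map_mul, map_add, map_mul, map_mul, ← hz, ← hz]
        push_cast
        ring }
  have hθE : ∀ (z : E) (h : (z : L) ∈ O), θ ⟨z, h⟩ = ψ z := by
    intro z h
    change Ψ _ / Ψ _ = _
    rw [key ⟨z, h⟩ (Polynomial.C z) 1 (by rw [map_one]; exact one_ne_zero) (by rw [map_one, aeval_C, mul_one]; rfl), map_one, div_one, hΨC]
  have hθy : ∀ h : y ∈ O, θ ⟨y, h⟩ = c := by
    intro h
    change Ψ _ / Ψ _ = _
    rw [key ⟨y, h⟩ Polynomial.X 1 (by rw [map_one]; exact one_ne_zero) (by rw [map_one, aeval_X, mul_one]), map_one, div_one, hΨX]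
  haveI : IsLocalHom θ := by
    constructor
    intro z hu
    have h0 : θ z ≠ 0 := hu.ne_zero
    have hp : Ψ (p z) ≠ 0 := fun h => h0 (by change Ψ _ / Ψ _ = _; rw [h, zero_div])
    have hz0 : (z : L) ≠ 0 := by
      intro h
      apply hp
      have := hz z
      rw [h, zero_mul] at this
      have h2 : p z = 0 := inj (by rw [← this, map_zero])
      rw [h2, map_zero]
    have hinv : (z : L)⁻¹ ∈ O := ⟨q z, p z, hp, by rw [← hz]; field_simp⟩
    refine ⟨⟨z, ⟨_, hinv⟩, ?_, ?_⟩, rfl⟩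
    · exact Subtype.ext (mul_inv_cancel₀ hz0)
    · exact Subtype.ext (inv_mul_cancel₀ hz0)
  let P : Place k L := ⟨O, fun c => hEO _ (E.algebraMap_mem c)⟩
  have hl : ∀ z : P.O, IsLocalRing.ResidueField.lift θ (P.rd z) = θ z := fun z => rfl
  refine ⟨P, ?_, hEO, hyO, { IsLocalRing.ResidueField.lift θ with commutes' := ?_ }, ?_, ?_⟩
  · intro htop
    obtain ⟨p0, h1, h2⟩ := halg
    have h2 : Ψ p0 = 0 := h2
    have hne : aeval y p0 ≠ 0 := fun h => h1 (inj (by rw [h, map_zero]))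
    have hm : (aeval y p0)⁻¹ ∈ P.O := by rw [htop]; trivial
    obtain ⟨p', q', h3, h4⟩ := hm
    have : q' = p0 * p' := by
      apply inj
      rw [map_mul, ← h4]; field_simp
    rw [this, map_mul, h2, zero_mul] at h3
    exact h3 rfl
  · intro c
    rw [← P.rd_alg c]
    refine (hl _).trans ((hθE (algebraMap k E c) _).trans (ψ.commutes c))
  · intro z h
    exact (hl _).trans (hθE z h)
  · intro h
    exact (hl _).trans (hθy h)

/-- local rings of divisors not contracted -/
theorem loc_of (P : Place k L) {G : Set L} {y : L} (hE : ∀ z ∈ IntermediateField.adjoin k G, z ∈ P.O) (hy : y ∈ P.O)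
    (gen : ad (IntermediateField.adjoin k G) y = ⊤) {R : Subalgebra k L} (hG : G ⊆ R) (hyR : y ∈ R) : ∀ z ∈ P.O, z ∈ locSub R P.O := by
  intro z hzO
  have hEl := frac_le hE hG
  have hpol : ∀ p : (IntermediateField.adjoin k G)[X], aeval y p ∈ locSub R P.O := by
    intro p
    rw [aeval_eq_sum_range]
    refine sum_mem (fun i _ => ?_)
    rw [Algebra.smul_def]
    exact mul_mem (hEl _ (p.coeff i).2) (pow_mem (le_locSub R P.O hyR) i)
  obtain ⟨p, q, hpq, hq, e⟩ := exists_coprime_rep (ad_top_iff.mp gen) z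
  have hv : P.O.valuation (aeval y q) = 1 := by
    by_contra hne
    have hlt : P.O.valuation (aeval y q) < 1 := lt_of_le_of_ne (mem_iff_val.mp (poly_mem hE hy q)) hne
    have h1 := not_both_lt hE hy hpq.symm hlt
    rw [← e, map_mul] at h1
    have hz1 := mem_iff_val.mp hzO
    have : P.O.valuation z * P.O.valuation (aeval y q) < 1 := mul_lt_one_of_nonneg_of_lt_one_right hz1 zero_le hlt
    rw [h1] at this
    exact lt_irrefl _ this
  have : z = aeval y p / aeval y q := by rw [eq_div_iff hq, e]
  rw [this]
  exact div_locSub (hpol p) (hpol q) hv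
end
end CrBir
end

section
namespace CrBir
open Polynomial IntermediateField.algebraAdjoinAdjoin
universe u v

theorem ext_hom0 {A L Ω : Type*} [Field A] [Field L] [Field Ω] [Algebra A L] [Algebra A Ω] {y : L} {η : Ω}
    (tr : Transcendental A y) (tr' : Transcendental A η) :
    ∃ ψ : IntermediateField.adjoin A {y} →ₐ[A] Ω, ψ ⟨y, IntermediateField.mem_adjoin_simple_self A y⟩ = η := by
  refine ⟨((IntermediateField.adjoin A {η}).val.comp (RatFunc.algEquivOfTranscendental η tr').toAlgHom).comp
    (RatFunc.algEquivOfTranscendental y tr).symm.toAlgHom, ?_⟩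
  have h1 : (RatFunc.algEquivOfTranscendental y tr).symm ⟨y, IntermediateField.mem_adjoin_simple_self A y⟩ = RatFunc.X := by
    rw [AlgEquiv.symm_apply_eq]
    exact Subtype.ext (RatFunc.algEquivOfTranscendental_X y tr).symm
  change (((RatFunc.algEquivOfTranscendental η tr') ((RatFunc.algEquivOfTranscendental y tr).symm _) : IntermediateField.adjoin A {η}) : Ω) = η
  rw [h1]
  exact RatFunc.algEquivOfTranscendental_X η tr'

section
variable {k : Type v} {L Ω : Type u} [Field k] [Field L] [Field Ω] [Algebra k L] [Algebra k Ω]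

theorem ext_hom {A : IntermediateField k L} (ψ0 : A →ₐ[k] Ω) {y : L} {η : Ω} (tr : Transcendental A y)
    (tr' : Transcendental ψ0.fieldRange η) : ∃ ψ : ad A y →ₐ[k] Ω, (∀ z : A, ψ ⟨z, le_ad A y z.2⟩ = ψ0 z) ∧ ψ ⟨y, self_ad A y⟩ = η ∧
      ψ.fieldRange = ad ψ0.fieldRange η := by
  letI : Algebra A Ω := (ψ0 : A →+* Ω).toAlgebra
  haveI : IsScalarTower k A Ω := IsScalarTower.of_algebraMap_eq (fun c => (ψ0.commutes c).symm)
  have tr'' : Transcendental A η := by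
    let f : A →+* ψ0.fieldRange := (ψ0 : A →+* Ω).codRestrict ψ0.fieldRange.toSubfield (fun z => ⟨z, rfl⟩)
    exact Transcendental.of_ringHom_of_comp_eq f (RingHom.id Ω) tr' f.injective rfl
  obtain ⟨ψ, hψ⟩ := ext_hom0 tr tr''
  have hA : ∀ z : A, ψ ⟨z, le_ad A y z.2⟩ = ψ0 z := fun z => ψ.commutes z
  refine ⟨ψ.restrictScalars k, hA, hψ, ?_⟩
  apply le_antisymm
  · rintro _ ⟨z, rfl⟩
    have := hom_mem_of_gen (ψ : IntermediateField.adjoin A {y} →+* Ω) (ad ψ0.fieldRange η).toSubfield (k := A) (s := {(⟨y, IntermediateField.mem_adjoin_simple_self A y⟩ : IntermediateField.adjoin A {y})}) ?_ ?_ z ?_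
    · exact this
    · intro c
      change ψ (algebraMap A _ c) ∈ ad ψ0.fieldRange η
      rw [ψ.commutes]
      exact le_ad _ _ ⟨c, rfl⟩
    · rintro w rfl
      change ψ _ ∈ ad ψ0.fieldRange η
      rw [hψ]; exact self_ad _ _
    · rw [gen_self]; trivial
  · apply ad_le
    · rintro _ ⟨z, rfl⟩
      exact ⟨⟨z, le_ad A y z.2⟩, hA z⟩
    · exact ⟨⟨y, self_ad A y⟩, hψ⟩

end

section
variable {k : Type v} {F' M Ω : Type u} [Field k] [Field F'] [Field M] [Field Ω] [Algebra k F'] [Algebra k Ω]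

theorem tr_range [Algebra F' M] (φ : F' →ₐ[k] Ω) (g : M →+* Ω) (hg : ∀ z, g (algebraMap F' M z) = φ z) {x : M} (tr : Transcendental F' x) :
    Transcendental φ.fieldRange (g x) := by
  rintro ⟨p, hp, h0⟩
  let f : φ.fieldRange ≃ₐ[k] F' := (AlgEquiv.ofInjectiveField φ).symm
  have hf : ∀ z, φ (f z) = z := fun z => congrArg Subtype.val ((AlgEquiv.ofInjectiveField φ).apply_symm_apply z)
  apply tr
  refine ⟨p.map (f : φ.fieldRange →+* F'), (Polynomial.map_ne_zero_iff f.injective).mpr hp, ?_⟩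
  apply g.injective
  rw [map_zero, ← h0, aeval_def, eval₂_map, hom_eval₂, aeval_def]
  congr 1
  ext z
  exact (hg _).trans (hf z)

variable [CharZero k] [Algebra k M] [Algebra F' M] [IsScalarTower k F' M] [Algebra M Ω] [IsScalarTower k M Ω] 

theorem model_core [IsAlgClosed M] {x0 : M} (trx : Transcendental F' x0) {τ : Ω} (trτ : Transcendental M τ)
    (genτ : IntermediateField.adjoin M {τ} = ⊤) {s : F'} (hs0 : s ≠ 0) (hfin : Algebra.trdeg k F' < Cardinal.aleph0) :
    ∃ (D : CData k F' Ω 2 s) (e f g : Ω), 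
      1 + D.φ s * e * f - D.φ s ^ 2 * g * (f * g - e ^ 2) = 0 ∧ D.φ s * (f ^ 2 + g) - D.φ s ^ 2 * e * (f * g - e ^ 2) = 0 ∧
      1 - D.φ s * e * f ≠ 0 ∧ e ∈ D.Z ∧ f ∈ D.Z ∧ g ∈ D.Z ∧
      (∀ B : IntermediateField k Ω, D.φ.fieldRange ≤ B → e ∈ B → f ∈ B → g ∈ B → D.Z ≤ B) ∧
      Transcendental D.Z τ ∧ Transcendental (ad D.φ.fieldRange τ) (g - τ * e) := by
  haveI : CharZero M := charZero_of_injective_algebraMap (algebraMap k M).injective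
  obtain ⟨y, hy⟩ := IsAlgClosed.exists_pow_nat_eq (1 + 4 * (x0 ^ 3 - x0 ^ 2)) (n := 2) (by norm_num)
  set w0 : M := (y - 1) / 2 with hw0
  have eq0 : w0 ^ 2 + w0 = x0 ^ 3 - x0 ^ 2 := by
    rw [hw0]; field_simp; linear_combination hy
  obtain ⟨r0, hr0⟩ := IsAlgClosed.exists_pow_nat_eq ((algebraMap F' M s) ^ 2 * cf x0 w0) (n := 5) (by norm_num)
  let ι : M →ₐ[k] Ω := IsScalarTower.toAlgHom k M Ω
  let φ : F' →ₐ[k] Ω := ι.comp (IsScalarTower.toAlgHom k F' M)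
  have hφ : ∀ z, φ z = ι (algebraMap F' M z) := fun z => rfl
  let D : CData k F' Ω 2 s :=
    { φ := φ, x := ι x0, w := ι w0, r := ι r0
      eq := by rw [← map_pow, ← map_pow, ← map_pow, ← map_add, ← map_sub, eq0]
      hr := by
        rw [← map_pow, hr0, map_mul, map_pow, hφ]
        congr 1
        exact cf_map (ι : M →+* Ω) x0 w0
      tr := tr_range φ (ι : M →+* Ω) (fun z => rfl) trx }
  have hDx : D.x = ι x0 := rfl
  have hDw : D.w = ι w0 := rfl
  have hDr : D.r = ι r0 := rfl
  have hDφ : ∀ z, D.φ z = ι (algebraMap F' M z) := fun z => rfl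
  have hZM : D.Z ≤ ι.fieldRange := by
    unfold CData.Z
    rw [IntermediateField.adjoin_le_iff]
    rintro z (⟨y, rfl⟩ | rfl | rfl | rfl)
    · exact ⟨_, rfl⟩
    · exact ⟨_, rfl⟩
    · exact ⟨_, rfl⟩
    · exact ⟨_, rfl⟩
  have trZ : Transcendental D.Z τ := by
    let i : ι.fieldRange ≃ₐ[k] M := (AlgEquiv.ofInjectiveField ι).symm
    have hi : ∀ z, ι (i z) = z := fun z => congrArg Subtype.val ((AlgEquiv.ofInjectiveField ι).apply_symm_apply z)
    let f : D.Z →+* M := (i : ι.fieldRange →+* M).comp ((IntermediateField.inclusion hZM : D.Z →ₐ[k] ι.fieldRange) : D.Z →+* ι.fieldRange)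
    refine Transcendental.of_ringHom_of_comp_eq f (RingHom.id Ω) trτ f.injective ?_
    ext z
    exact hi _
  have hS : D.φ s ≠ 0 := (_root_.map_ne_zero D.φ).mpr hs0
  have hx := D.x_ne
  have hcf := cf_ne D.eq hx
  have hr : D.r ≠ 0 := by
    intro h
    have := D.hr
    rw [h, zero_pow (by norm_num)] at this
    exact mul_ne_zero (pow_ne_zero 2 hS) hcf this.symm
  have hsZ := D.φ_mem s
  refine ⟨D, D.r / D.φ s, - D.x / D.r, D.w / D.r ^ 2, ?_, ?_, ?_, div_mem D.r_mem hsZ, div_mem (neg_mem D.x_mem) D.r_mem,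
    div_mem D.w_mem (pow_mem D.r_mem 2), ?_, trZ, ?_⟩
  · have h1 : 1 + D.φ s * (D.r / D.φ s) * (-D.x / D.r) - D.φ s ^ 2 * (D.w / D.r ^ 2) * (-D.x / D.r * (D.w / D.r ^ 2) - (D.r / D.φ s) ^ 2)
      = (D.r ^ 5 * (1 - D.x + D.w) + D.φ s ^ 2 * D.x * D.w ^ 2) / D.r ^ 5 := by field_simp; ring
    rw [h1, D.hr]
    have h2 : D.φ s ^ 2 * cf D.x D.w * (1 - D.x + D.w) + D.φ s ^ 2 * D.x * D.w ^ 2 = 0 := by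
      unfold cf
      linear_combination (- D.φ s ^ 2) * D.eq
    rw [h2, zero_div]
  · have h1 : D.φ s * ((-D.x / D.r) ^ 2 + D.w / D.r ^ 2) - D.φ s ^ 2 * (D.r / D.φ s) * (-D.x / D.r * (D.w / D.r ^ 2) - (D.r / D.φ s) ^ 2)
      = (D.r ^ 5 - D.φ s ^ 2 * cf D.x D.w) / (D.φ s * D.r ^ 2) := by unfold cf; field_simp; ring
    rw [h1, D.hr, sub_self, zero_div]
  · have h1 : 1 - D.φ s * (D.r / D.φ s) * (-D.x / D.r) = 1 + D.x := by field_simp; ring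
    rw [h1]
    intro h
    apply D.tr
    have : D.x = algebraMap D.φ.fieldRange Ω (-1) := by rw [map_neg, map_one]; linear_combination h
    rw [this]
    exact isAlgebraic_algebraMap _
  · intro B hB he hf hg
    have hsB : D.φ s ∈ B := hB ⟨s, rfl⟩
    have hrB : D.r ∈ B := by
      have : D.r = D.φ s * (D.r / D.φ s) := by field_simp
      rw [this]; exact mul_mem hsB he
    have hxB : D.x ∈ B := by
      have : D.x = - (D.r * (- D.x / D.r)) := by field_simp
      rw [this]; exact neg_mem (mul_mem hrB hf)
    have hwB : D.w ∈ B := by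
      have : D.w = D.r ^ 2 * (D.w / D.r ^ 2) := by field_simp
      rw [this]; exact mul_mem (pow_mem hrB 2) hg
    unfold CData.Z
    rw [IntermediateField.adjoin_le_iff]
    rintro z (⟨y, rfl⟩ | rfl | rfl | rfl)
    exacts [hB ⟨y, rfl⟩, hxB, hwB, hrB]
  · intro hal
    obtain ⟨B, hB1, hB2, hB3⟩ := alg_sub (ad D.φ.fieldRange τ)
    have hφB : D.φ.fieldRange ≤ B := (le_ad _ _).trans hB1
    have hsB : D.φ s ∈ B := hφB ⟨s, rfl⟩
    have hd : Algebra.trdeg M Ω = (1 : ℕ) := by rw [trd_simple_tr' trτ genτ, Nat.cast_one]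
    have g1 : IntermediateField.adjoin M (Set.range ![τ]) = ⊤ := by rw [Matrix.range_cons, Matrix.range_empty, Set.union_empty, genτ]
    have g2 : IntermediateField.adjoin M (Set.range ![τ + 1]) = ⊤ := by
      rw [Matrix.range_cons, Matrix.range_empty, Set.union_empty, eq_top_iff, ← genτ, IntermediateField.adjoin_le_iff]
      rintro z rfl
      have := sub_mem (IntermediateField.mem_adjoin_simple_self M (z + 1)) (one_mem (IntermediateField.adjoin M {z + 1}))
      rwa [add_sub_cancel_right] at this
    obtain ⟨ρ0, hρ0⟩ := exists_aut ![τ] ![τ + 1] g1 g2 hd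
    have hρτ : ρ0 τ = τ + 1 := hρ0 0
    have hρM : ∀ z : M, ρ0 (ι z) = ι z := fun z => ρ0.commutes z
    let ρ : Ω →ₐ[k] Ω := (ρ0.restrictScalars k : Ω ≃ₐ[k] Ω)
    have hρ : ∀ z, ρ z = ρ0 z := fun z => rfl
    have hρE : ∀ z ∈ ad D.φ.fieldRange τ, ρ z ∈ ad D.φ.fieldRange τ := by
      intro z hz
      have hle : ad D.φ.fieldRange τ ≤ (ad D.φ.fieldRange τ).comap ρ := by
        apply ad_le
        · rintro _ ⟨y, rfl⟩
          change ρ (D.φ y) ∈ ad D.φ.fieldRange τ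
          rw [hρ, hDφ, hρM]
          exact le_ad _ _ ⟨y, rfl⟩
        · change ρ τ ∈ ad D.φ.fieldRange τ
          rw [hρ, hρτ]
          exact add_mem (self_ad _ _) (one_mem _)
      exact hle hz
    have hρB : ∀ z ∈ B, ρ z ∈ B := by
      intro z hz
      rw [← hB2] at hz ⊢
      by_contra hne
      exact tr_pull ρ hρE hne hz
    have hβ := (hB2 _).mp hal
    have hβ' := hρB _ hβ
    have he : D.r / D.φ s ∈ B := by
      have h1 : ρ (D.w / D.r ^ 2 - τ * (D.r / D.φ s)) = D.w / D.r ^ 2 - (τ + 1) * (D.r / D.φ s) := by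
        rw [hρ]
        simp only [map_sub, map_mul, map_div₀, map_pow, hρτ, hDr, hDw, hDφ, hρM]
      rw [h1] at hβ'
      have h2 := sub_mem hβ hβ'
      have h3 : D.w / D.r ^ 2 - τ * (D.r / D.φ s) - (D.w / D.r ^ 2 - (τ + 1) * (D.r / D.φ s)) = D.r / D.φ s := by ring
      rwa [h3] at h2
    have hrB : D.r ∈ B := by
      have : D.r = D.φ s * (D.r / D.φ s) := by field_simp
      rw [this]; exact mul_mem hsB he
    have hAB : cf D.x D.w ∈ B := by
      have : cf D.x D.w = D.r ^ 5 / D.φ s ^ 2 := by rw [D.hr]; field_simp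
      rw [this]; exact div_mem (pow_mem hrB 5) (pow_mem hsB 2)
    have hx5 : D.x ^ 5 - 2 * cf D.x D.w * D.x ^ 2 + cf D.x D.w * D.x + (cf D.x D.w - cf D.x D.w ^ 2) = 0 := by
      unfold cf
      linear_combination (- (1 + D.x) ^ 2) * D.eq
    have hxB : D.x ∈ B := by
      apply hB3
      set A : B := ⟨_, hAB⟩ with hA
      refine ⟨Polynomial.X ^ 5 - Polynomial.C (2 * A) * Polynomial.X ^ 2 + Polynomial.C A * Polynomial.X + Polynomial.C (A - A ^ 2), ?_, ?_⟩
      · intro h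
        have := congrArg (fun p => p.coeff 5) h
        simp [-map_sub, -map_mul, -map_pow, coeff_X, coeff_C, coeff_X_pow] at this
      · have hA' : algebraMap B Ω A = cf D.x D.w := rfl
        simp only [map_add, map_sub, map_mul, map_pow, aeval_X, aeval_C, hA', map_ofNat]
        exact hx5
    have hZB : ad D.Z τ ≤ B := ad_le (D.alg_r hB3 (fun z => hφB ⟨z, rfl⟩) hxB) (hB1 (self_ad _ _))
    have t1 := trd_mono hZB
    have t2 := trd_le_of_alg (E := ad D.φ.fieldRange τ) (E' := B) (fun z hz => (hB2 z).mpr hz)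
    have t3 := trd_ad_le D.φ.fieldRange τ
    rw [trd_ad trZ, D.trd] at t1
    rw [trd_range] at t3
    have t4 := t1.trans (t2.trans t3)
    obtain ⟨n, hn⟩ := Cardinal.lt_aleph0.mp hfin
    rw [hn] at t4
    norm_cast at t4
    omega
end

end CrBir
end

section
namespace CrBir
open Polynomial IntermediateField.algebraAdjoinAdjoin
universe u v

section
variable {k : Type v} [Field k] [CharZero k]

theorem exists_model (F' : Type u) [Field F'] [Algebra k F'] {s : F'} (hs0 : s ≠ 0) (hfin : Algebra.trdeg k F' < Cardinal.aleph0) :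
    ∃ (Ω : Type u) (_ : Field Ω) (_ : Algebra k Ω) (D : CData k F' Ω 2 s) (τ e f g : Ω),
      1 + D.φ s * e * f - D.φ s ^ 2 * g * (f * g - e ^ 2) = 0 ∧ D.φ s * (f ^ 2 + g) - D.φ s ^ 2 * e * (f * g - e ^ 2) = 0 ∧
      1 - D.φ s * e * f ≠ 0 ∧ e ∈ D.Z ∧ f ∈ D.Z ∧ g ∈ D.Z ∧
      (∀ B : IntermediateField k Ω, D.φ.fieldRange ≤ B → e ∈ B → f ∈ B → g ∈ B → D.Z ≤ B) ∧
      Transcendental D.Z τ ∧ Transcendental (ad D.φ.fieldRange τ) (g - τ * e) := by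
  obtain ⟨M, _, _, g⟩ : ∃ (M : Type u) (_ : Field M) (_ : IsAlgClosed M), Nonempty (RatFunc F' →+* M) :=
    ⟨AlgebraicClosure (RatFunc F'), inferInstance, inferInstance, ⟨algebraMap _ _⟩⟩
  obtain ⟨g⟩ := g
  letI : Algebra F' M := (g.comp (algebraMap F' (RatFunc F'))).toAlgebra
  letI : Algebra k M := ((algebraMap F' M).comp (algebraMap k F')).toAlgebra
  haveI : IsScalarTower k F' M := IsScalarTower.of_algebraMap_eq (fun _ => rfl)
  have t1 : Transcendental F' (g RatFunc.X) := by
    letI : Algebra (RatFunc F') M := g.toAlgebra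
    haveI : IsScalarTower F' (RatFunc F') M := IsScalarTower.of_algebraMap_eq (fun _ => rfl)
    exact (transcendental_algebraMap_iff (algebraMap (RatFunc F') M).injective).mpr (RatFunc.transcendental_of_ne_C _ (fun ⟨c, h⟩ => by have := congrArg RatFunc.intDegree h; simp at this))
  obtain ⟨Ω, _, _, τ, t2, t3⟩ : ∃ (Ω : Type u) (_ : Field Ω) (_ : Algebra M Ω) (τ : Ω), Transcendental M τ ∧ IntermediateField.adjoin M {τ} = ⊤ :=
    ⟨RatFunc M, inferInstance, inferInstance, RatFunc.X, RatFunc.transcendental_of_ne_C _ (fun ⟨c, h⟩ => by have := congrArg RatFunc.intDegree h; simp at this), RatFunc.adjoin_X⟩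
  letI : Algebra k Ω := ((algebraMap M Ω).comp (algebraMap k M)).toAlgebra
  haveI : IsScalarTower k M Ω := IsScalarTower.of_algebraMap_eq (fun _ => rfl)
  obtain ⟨D, e, f, g, h⟩ := model_core (k := k) t1 t2 t3 hs0 hfin
  exact ⟨Ω, inferInstance, inferInstance, D, τ, e, f, g, h⟩

end

section
variable {k : Type v} {L : Type u} [Field k] [Field L] [Algebra k L]

theorem ad_adjoin (G : Set L) (x : L) : ad (IntermediateField.adjoin k G) x = IntermediateField.adjoin k (insert x G) := by
  apply le_antisymm
  · apply ad_le
    · exact IntermediateField.adjoin.mono _ _ _ (Set.subset_insert _ _)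
    · exact IntermediateField.subset_adjoin _ _ (Set.mem_insert _ _)
  · rw [IntermediateField.adjoin_le_iff]
    rintro z (rfl | hz)
    · exact self_ad _ _
    · exact le_ad _ _ (IntermediateField.subset_adjoin _ _ hz)

theorem adjoin_sub_O (P : Place k L) {G : Set L} (h : ∀ z ∈ G, z ∈ P.O) : ∀ z ∈ Algebra.adjoin k G, z ∈ P.O := by
  intro z hz
  have h1 : Algebra.adjoin k G ≤ ({ P.O.toSubring with algebraMap_mem' := P.hk } : Subalgebra k L) := Algebra.adjoin_le h
  exact h1 hz

variable [CharZero k]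

theorem claim2 {F' : IntermediateField k L} {G0 : Set L} (hG0 : IntermediateField.adjoin k G0 = F') {s : F'} (hs0 : s ≠ 0)
    (hfin : Algebra.trdeg k F' < Cardinal.aleph0) {a b c e f g : L}
    (tra : Transcendental F' a) (trb : Transcendental (ad F' a) b) (trc : Transcendental (ad (ad F' a) b) c)
    (gen : ad (ad (ad F' a) b) c = ⊤)
    (hf : f * ((s : L) ^ 2 * b * (b - a * c) - s * (c - a ^ 3)) = 1 + (s : L) ^ 2 * b * c ^ 2 - s * (a * b + a ^ 2 * c))
    (he : e = c + a * f) (hg : g = b + a * e) :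
    ∃ P, P ∈ SR (fun P => HasP k F' P.Res 2 s) (Algebra.adjoin k (G0 ∪ {a, b, c})) ∧
      P ∉ SR (fun P => HasP k F' P.Res 2 s) (Algebra.adjoin k (G0 ∪ {e, f, g})) := by
  have hG0F : ∀ z ∈ G0, z ∈ F' := fun z hz => by rw [← hG0]; exact IntermediateField.subset_adjoin _ _ hz
  obtain ⟨Ω, _, _, D, τ, e₁, f₁, g₁, hnum, hden, hne, he₁, hf₁, hg₁, hZgen, trτ, trβ⟩ := exists_model (k := k) F' hs0 hfin
  obtain ⟨n, hn⟩ := Cardinal.lt_aleph0.mp hfin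
  set S := D.φ s with hS
  have hSne : S ≠ 0 := (_root_.map_ne_zero D.φ).mpr hs0
  set β := g₁ - τ * e₁ with hβ
  set γ := e₁ - τ * f₁ with hγ
  have hSZ : S ∈ D.Z := D.φ_mem s
  have trφτ : Transcendental D.φ.fieldRange τ := by
    intro h
    refine trτ (isAlgebraic_mono ?_ h)
    rintro _ ⟨z, rfl⟩
    exact D.φ_mem z
  obtain ⟨ψ1, h11, h12, h13⟩ := ext_hom D.φ tra trφτ
  obtain ⟨ψ2, h21, h22, h23⟩ := ext_hom ψ1 trb (by rw [h13]; exact trβ)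
  have hφZ : D.φ.fieldRange ≤ D.Z := by
    rintro _ ⟨z, rfl⟩
    exact D.φ_mem z
  have hτW := self_ad D.Z τ
  have hβW : β ∈ ad D.Z τ := sub_mem (le_ad _ _ hg₁) (mul_mem hτW (le_ad _ _ he₁))
  have hγW : γ ∈ ad D.Z τ := sub_mem (le_ad _ _ he₁) (mul_mem hτW (le_ad _ _ hf₁))
  have hle : ad ψ2.fieldRange γ ≤ ad D.Z τ := by
    rw [h23, h13]
    exact ad_le (ad_le (ad_mono hφZ) hβW) hγW
  have halg : IsAlgebraic ψ2.fieldRange γ := by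
    by_contra htr
    have t1 := trd_mono hle
    rw [trd_ad htr, trd_ad trτ, D.trd, h23, h13, trd_ad trβ, trd_ad trφτ, trd_range, hn] at t1
    norm_cast at t1
    omega
  have halg' : ∃ p : (ad (ad F' a) b)[X], p ≠ 0 ∧ eval₂ (ψ2 : ad (ad F' a) b →+* Ω) γ p = 0 := by
    letI : Algebra (ad (ad F' a) b) Ω := (ψ2 : ad (ad F' a) b →+* Ω).toAlgebra
    by_contra hcon
    have ht : Transcendental (ad (ad F' a) b) γ := fun ⟨p, hp, h0⟩ => hcon ⟨p, hp, h0⟩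
    exact tr_range ψ2 (RingHom.id Ω) (fun z => rfl) ht halg
  obtain ⟨P, hPtop, hEO, hcO, θ, hθE, hθc⟩ := exists_center trc (ad_top_iff.mp gen) ψ2 γ halg'
  have haE : a ∈ ad (ad F' a) b := le_ad _ _ (self_ad _ _)
  have hbE : b ∈ ad (ad F' a) b := self_ad _ _
  have hFE : ∀ z ∈ F', z ∈ ad (ad F' a) b := fun z hz => le_ad _ _ (le_ad _ _ hz)
  have haO := hEO a haE
  have hbO := hEO b hbE
  have hsO := hEO _ (hFE _ s.2)
  have hθF : ∀ (z : L) (hz : z ∈ F'), θ (P.rd ⟨z, hEO z (hFE z hz)⟩) = D.φ ⟨z, hz⟩ := by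
    intro z hz
    have := hθE ⟨z, hFE z hz⟩ (hEO z (hFE z hz))
    rw [this]
    exact (h21 ⟨z, le_ad _ _ hz⟩).trans (h11 ⟨z, hz⟩)
  set so : P.O := ⟨s, hsO⟩ with hso
  set ao : P.O := ⟨a, haO⟩ with hao
  set bo : P.O := ⟨b, hbO⟩ with hbo
  set co : P.O := ⟨c, hcO⟩ with hco
  have ts : θ (P.rd so) = S := hθF s s.2
  have ta : θ (P.rd ao) = τ := by
    have := hθE ⟨a, haE⟩ haO
    rw [this]
    exact (h21 ⟨a, self_ad _ _⟩).trans h12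
  have tb : θ (P.rd bo) = β := by
    have := hθE ⟨b, hbE⟩ hbO
    rw [this]
    exact h22
  have tc : θ (P.rd co) = γ := hθc hcO
  set d_o : P.O := so ^ 2 * bo * (bo - ao * co) - so * (co - ao ^ 3) with hdo
  set no : P.O := 1 + so ^ 2 * bo * co ^ 2 - so * (ao * bo + ao ^ 2 * co) with hno
  have td : θ (P.rd d_o) = S ^ 2 * β * (β - τ * γ) - S * (γ - τ ^ 3) := by
    rw [hdo]
    simp only [map_sub, map_mul, map_add, map_pow, ts, ta, tb, tc]
  have tn : θ (P.rd no) = 1 + S ^ 2 * β * γ ^ 2 - S * (τ * β + τ ^ 2 * γ) := by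
    rw [hno]
    simp only [map_sub, map_mul, map_add, map_pow, map_one, ts, ta, tb, tc]
  have hdne : θ (P.rd d_o) ≠ 0 := by
    rw [td]
    intro h0
    apply trτ
    set S' : D.Z := ⟨S, hSZ⟩
    set e' : D.Z := ⟨e₁, he₁⟩
    set f' : D.Z := ⟨f₁, hf₁⟩
    set g' : D.Z := ⟨g₁, hg₁⟩
    refine ⟨Polynomial.C (S' ^ 2 * g' ^ 2 - S' * e') + Polynomial.C (- 3 * S' ^ 2 * e' * g' + S' * f') * Polynomial.X
      + Polynomial.C (S' ^ 2 * (f' * g' + 2 * e' ^ 2)) * Polynomial.X ^ 2 + Polynomial.C (S' * (1 - S' * e' * f')) * Polynomial.X ^ 3, ?_, ?_⟩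
    · intro h
      have h3 := congrArg (fun p => p.coeff 3) h
      simp only [coeff_add, coeff_C_mul, coeff_X_pow, coeff_C, coeff_X, coeff_zero] at h3
      norm_num at h3
      have h4 := congrArg (algebraMap D.Z Ω) (show S' * (1 - S' * e' * f') = 0 by
        rcases h3 with h3 | h3
        · rw [h3, zero_mul]
        · rw [h3, mul_zero])
      have h5 : S * (1 - S * e₁ * f₁) = 0 := h4
      exact mul_ne_zero hSne hne h5
    · have q1 : algebraMap D.Z Ω S' = S := rfl
      have q2 : algebraMap D.Z Ω e' = e₁ := rfl
      have q3 : algebraMap D.Z Ω f' = f₁ := rfl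
      have q4 : algebraMap D.Z Ω g' = g₁ := rfl
      simp only [map_add, map_sub, map_mul, map_pow, map_neg, map_one, aeval_X, aeval_C, q1, q2, q3, q4, map_ofNat]
      rw [hβ, hγ] at h0
      linear_combination h0
  have hdr : P.rd d_o ≠ 0 := fun h => hdne (by rw [h, map_zero])
  have hdL : (d_o : L) ≠ 0 := by
    intro h
    have h2 := P.rd_ne_zero.mp hdr
    rw [h] at h2; simp at h2
  have hfO : f ∈ P.O := by
    have : f = no * (d_o : L)⁻¹ := by
      rw [← div_eq_mul_inv, eq_div_iff hdL]; exact hf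
    rw [this]
    exact mul_mem no.2 (P.inv_mem hdr)
  have heO : e ∈ P.O := by rw [he]; exact add_mem hcO (mul_mem haO hfO)
  have hgO : g ∈ P.O := by rw [hg]; exact add_mem hbO (mul_mem haO heO)
  set fo : P.O := ⟨f, hfO⟩ with hfo
  set eo : P.O := ⟨e, heO⟩ with heo
  set go : P.O := ⟨g, hgO⟩ with hgo
  have hfd : fo * d_o = no := Subtype.ext hf
  have heo' : eo = co + ao * fo := Subtype.ext he
  have hgo' : go = bo + ao * eo := Subtype.ext hg
  have tf : θ (P.rd fo) = f₁ := by
    apply mul_right_cancel₀ hdne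
    rw [← map_mul, ← map_mul, hfd, tn, td, hβ, hγ]
    linear_combination hnum - τ * hden
  have te : θ (P.rd eo) = e₁ := by
    rw [heo', map_add, map_add, map_mul, map_mul, tc, ta, tf, hγ]; ring
  have tg : θ (P.rd go) = g₁ := by
    rw [hgo', map_add, map_add, map_mul, map_mul, tb, ta, te, hβ]; ring
  have hRO : ∀ z ∈ Algebra.adjoin k (G0 ∪ {a, b, c}), z ∈ P.O := by
    apply adjoin_sub_O
    rintro z (hz | rfl | rfl | rfl)
    exacts [hEO z (hFE z (hG0F z hz)), haO, hbO, hcO]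
  have hE : ad (ad F' a) b = IntermediateField.adjoin k (insert b (insert a G0)) := by
    rw [← hG0, ad_adjoin, ad_adjoin]
  have hloc : ∀ z ∈ P.O, z ∈ locSub (Algebra.adjoin k (G0 ∪ {a, b, c})) P.O := by
    apply loc_of P (G := insert b (insert a G0)) (y := c)
    · rw [← hE]; exact hEO
    · exact hcO
    · rw [← hE]; exact gen
    · rintro z (rfl | rfl | hz)
      · exact Algebra.subset_adjoin (by simp)
      · exact Algebra.subset_adjoin (by simp)
      · exact Algebra.subset_adjoin (Or.inl hz)
    · exact Algebra.subset_adjoin (by simp)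
  refine ⟨P, ⟨hPtop, ?_, hRO, hloc⟩, ?_⟩
  · refine HasP.pull θ D trτ ?_
    apply le_antisymm
    · have htop : (ad D.Z τ).comap θ = ⊤ := by
        apply rd_gen P hRO hloc
        rintro z (hz | rfl | rfl | rfl)
        · change θ _ ∈ ad D.Z τ
          rw [hθF z (hG0F z hz)]
          exact le_ad _ _ (D.φ_mem _)
        · change θ _ ∈ ad D.Z τ
          rw [ta]; exact hτW
        · change θ _ ∈ ad D.Z τ
          rw [tb]; exact hβW
        · change θ _ ∈ ad D.Z τ
          rw [tc]; exact hγW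
      rintro _ ⟨z, rfl⟩
      have : z ∈ (ad D.Z τ).comap θ := by rw [htop]; trivial
      exact this
    · apply ad_le
      · apply hZgen
        · rintro _ ⟨z, rfl⟩
          exact ⟨_, hθF z z.2⟩
        · exact ⟨_, te⟩
        · exact ⟨_, tf⟩
        · exact ⟨_, tg⟩
      · exact ⟨_, ta⟩
  · rintro ⟨-, -, hR', hloc'⟩
    have htop : D.Z.comap θ = ⊤ := by
      apply rd_gen P hR' hloc'
      rintro z (hz | rfl | rfl | rfl)
      · change θ _ ∈ D.Z
        rw [hθF z (hG0F z hz)]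
        exact D.φ_mem _
      · change θ _ ∈ D.Z
        rw [te]; exact he₁
      · change θ _ ∈ D.Z
        rw [tf]; exact hf₁
      · change θ _ ∈ D.Z
        rw [tg]; exact hg₁
    have h1 : P.rd ao ∈ D.Z.comap θ := by rw [htop]; trivial
    have h2 : θ (P.rd ao) ∈ D.Z := h1
    rw [ta] at h2
    exact trτ (isAlgebraic_algebraMap (⟨τ, h2⟩ : D.Z))
end
end CrBir
end

section
namespace CrBir
open Polynomial IntermediateField.algebraAdjoinAdjoin
universe u v

section
variable {k : Type v} {L : Type u} [Field k] [Field L] [Algebra k L]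

theorem alg_sub_trd (E : IntermediateField k L) : ∃ B : IntermediateField k L, E ≤ B ∧ (∀ z, IsAlgebraic E z → z ∈ B) ∧
    Algebra.trdeg k B ≤ Algebra.trdeg k E := by
  obtain ⟨B, h1, h2, -⟩ := alg_sub E
  exact ⟨B, h1, fun z => (h2 z).mp, trd_le_of_alg (fun z hz => (h2 z).mpr hz)⟩

theorem den_ne {F' : IntermediateField k L} {s : L} (hsF : s ∈ F') (hs0 : s ≠ 0) (hfin : Algebra.trdeg k F' < Cardinal.aleph0)
    (htr : Algebra.trdeg k L = Algebra.trdeg k F' + 3) {a e f g : L}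
    (gen : ∀ M : IntermediateField k L, F' ≤ M → a ∈ M → e ∈ M → f ∈ M → g ∈ M → M = ⊤)
    (hnum : 1 + s * e * f - s ^ 2 * g * (f * g - e ^ 2) = 0) (hden : s * (f ^ 2 + g) - s ^ 2 * e * (f * g - e ^ 2) = 0) : False := by
  obtain ⟨n, hn⟩ := Cardinal.lt_aleph0.mp hfin
  have hden' : (f ^ 2 + g) - s * e * (f * g - e ^ 2) = 0 := by
    apply mul_left_cancel₀ hs0
    linear_combination hden
  have fin : ∀ M : IntermediateField k L, M = ⊤ → Algebra.trdeg k M ≤ ((n + 2 : ℕ) : Cardinal) → False := by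
    intro M hM h
    rw [hM, IntermediateField.topEquiv.trdeg_eq, htr, hn] at h
    norm_cast at h
    omega
  by_cases h1 : 1 - s * e * f = 0
  · have he5 : s ^ 3 * e ^ 5 + 1 = 0 := by
      have h2 : f ^ 2 + s * e ^ 3 = 0 := by linear_combination hden' - g * h1
      linear_combination s ^ 2 * e ^ 2 * h2 + (1 + s * e * f) * h1
    have halg : IsAlgebraic F' e := by
      refine ⟨Polynomial.C ((⟨s, hsF⟩ : F') ^ 3) * Polynomial.X ^ 5 + Polynomial.C 1, ?_, ?_⟩
      · intro h
        have := congrArg (fun p => p.coeff 0) h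
        simp at this
      · have q1 : algebraMap F' L ⟨s, hsF⟩ = s := rfl
        simp only [map_add, map_mul, map_pow, map_one, aeval_X, aeval_C, q1]
        exact he5
    obtain ⟨B, hB1, hB2, hB3⟩ := alg_sub_trd F'
    have heB := hB2 e halg
    have he0 : e ≠ 0 := by rintro rfl; simp at h1
    have hfB : f ∈ B := by
      have : f = (s * e)⁻¹ := by
        apply eq_inv_of_mul_eq_one_right
        linear_combination - h1
      rw [this]
      exact inv_mem (mul_mem (hB1 hsF) heB)
    refine fin (ad (ad B g) a) (gen _ ?_ ?_ ?_ ?_ ?_) ?_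
    · exact hB1.trans ((le_ad _ _).trans (le_ad _ _))
    · exact self_ad _ _
    · exact le_ad _ _ (le_ad _ _ heB)
    · exact le_ad _ _ (le_ad _ _ hfB)
    · exact le_ad _ _ (self_ad _ _)
    · refine (trd_ad_le _ _).trans ?_
      refine (add_le_add_left ((trd_ad_le _ _).trans (add_le_add_left hB3 1)) 1).trans ?_
      rw [hn]; norm_cast
  · have hq : 1 - s ^ 3 * e ^ 5 - s * e * f - 2 * s ^ 2 * e ^ 2 * f ^ 2 - s ^ 2 * f ^ 5 = 0 := by
      have hgg : g * (1 - s * e * f) + (f ^ 2 + s * e ^ 3) = 0 := by linear_combination hden'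
      linear_combination (1 - s * e * f) ^ 2 * hnum + (s ^ 2 * f * (g * (1 - s * e * f) - (f ^ 2 + s * e ^ 3)) - s ^ 2 * e ^ 2 * (1 - s * e * f)) * hgg
    have halg : IsAlgebraic (ad F' e) f := by
      set S' : ad F' e := ⟨s, le_ad _ _ hsF⟩
      set e' : ad F' e := ⟨e, self_ad _ _⟩
      refine ⟨Polynomial.C (1 - S' ^ 3 * e' ^ 5) + Polynomial.C (- S' * e') * Polynomial.X + Polynomial.C (- 2 * S' ^ 2 * e' ^ 2) * Polynomial.X ^ 2
        + Polynomial.C (- S' ^ 2) * Polynomial.X ^ 5, ?_, ?_⟩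
      · intro h
        have h3 := congrArg (fun p => p.coeff 5) h
        simp only [coeff_add, coeff_C_mul, coeff_X_pow, coeff_C, coeff_X, coeff_zero] at h3
        norm_num at h3
        exact hs0 (congrArg Subtype.val h3)
      · have q1 : algebraMap (ad F' e) L S' = s := rfl
        have q2 : algebraMap (ad F' e) L e' = e := rfl
        simp only [map_add, map_sub, map_mul, map_pow, map_neg, map_one, aeval_X, aeval_C, q1, q2, map_ofNat]
        linear_combination hq
    obtain ⟨B, hB1, hB2, hB3⟩ := alg_sub_trd (ad F' e)
    have hfB := hB2 f halg
    have heB := hB1 (self_ad _ _)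
    have hFB := (le_ad F' e).trans hB1
    have hgB : g ∈ B := by
      have : g = - (f ^ 2 + s * e ^ 3) / (1 - s * e * f) := by
        rw [eq_div_iff h1]
        linear_combination hden'
      rw [this]
      exact div_mem (neg_mem (add_mem (pow_mem hfB 2) (mul_mem (hFB hsF) (pow_mem heB 3)))) (sub_mem (one_mem _) (mul_mem (mul_mem (hFB hsF) heB) hfB))
    refine fin (ad B a) (gen _ ?_ ?_ ?_ ?_ ?_) ?_
    · exact hFB.trans (le_ad _ _)
    · exact self_ad _ _
    · exact le_ad _ _ heB
    · exact le_ad _ _ hfB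
    · exact le_ad _ _ hgB
    · refine (trd_ad_le _ _).trans ?_
      refine (add_le_add_left (hB3.trans (trd_ad_le _ _)) 1).trans ?_
      rw [hn]; norm_cast

variable [CharZero k]

/-- application of Lemma V to our places -/
theorem V_app {F' : IntermediateField k L} {s : F'} (hgood : GoodS k F' s) (hfin : Algebra.trdeg k F' < Cardinal.aleph0)
    (htr : Algebra.trdeg k L = Algebra.trdeg k F' + 3) (P : Place k L) (hP : HasP k F' P.Res 2 s) (K₁ : IntermediateField k L) {t : L} (htO : t ∈ P.O)
    (trt : Transcendental K₁ t) (gent : ad K₁ t = ⊤) (hres : ad (P.img K₁) (P.rd ⟨t, htO⟩) = ⊤) (hK₁ : ∃ z ∈ K₁, z ∉ P.O) :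
    Transcendental (P.img K₁) (P.rd ⟨t, htO⟩) ∧ ∀ (K₂ : IntermediateField k L) (w : L), K₁ ≤ ad K₂ w →
      Algebra.trdeg k K₂ + 2 ≤ Algebra.trdeg k L → ∀ z ∈ K₂, z ∈ P.O := by
  obtain ⟨D, τ, trτ, genτ⟩ := id hP
  obtain ⟨n, hn⟩ := Cardinal.lt_aleph0.mp hfin
  have hfinL : Algebra.trdeg k L < Cardinal.aleph0 := by
    rw [htr, hn]
    exact_mod_cast Cardinal.natCast_lt_aleph0 (n := n + 3)
  refine P.V K₁ (t := ⟨t, htO⟩) trt (ad_top_iff.mp gent) D.Z (hgood.nu _ 2 (Or.inr rfl) D) trτ genτ hfinL ?_ (ad_top_iff.mp hres) hK₁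
  rw [htr, HasP.trd hP, hn]
  norm_cast

theorem F_le {F' : IntermediateField k L} {G0 : Set L} (hG0 : IntermediateField.adjoin k G0 = F') {s : F'} (hgood : GoodS k F' s)
    (hfin : Algebra.trdeg k F' < Cardinal.aleph0) {a b c : L}
    (tra : Transcendental F' a) (trb : Transcendental (ad F' a) b) (trc : Transcendental (ad (ad F' a) b) c)
    (gen : ad (ad (ad F' a) b) c = ⊤) (htr : Algebra.trdeg k L = Algebra.trdeg k F' + 3) {P : Place k L}
    (hP : P ∈ SR (fun P => HasP k F' P.Res 2 s) (Algebra.adjoin k (G0 ∪ {a, b, c}))) : ∀ z ∈ F', z ∈ P.O := by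
  have hG0F : ∀ z ∈ G0, z ∈ F' := fun z hz => by rw [← hG0]; exact IntermediateField.subset_adjoin _ _ hz
  obtain ⟨hP1, hP2, hP3, hP4⟩ := hP
  have hFE : ∀ z ∈ F', z ∈ ad (ad F' a) b := fun z hz => le_ad _ _ (le_ad _ _ hz)
  by_cases hK : ∃ z ∈ ad (ad F' a) b, z ∉ P.O
  · have hcO : c ∈ P.O := hP3 _ (Algebra.subset_adjoin (by simp))
    have := (V_app hgood hfin htr P hP2 (ad (ad F' a) b) hcO trc gen ?_ hK).2 (ad F' a) b le_rfl ?_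
    · exact fun z hz => this z (le_ad _ _ hz)
    · apply rd_gen P hP3 hP4
      rintro z (hz | rfl | rfl | rfl)
      · exact le_ad _ _ (P.mem_img.mpr ⟨_, hFE z (hG0F z hz), rfl⟩)
      · exact le_ad _ _ (P.mem_img.mpr ⟨_, le_ad _ _ (self_ad _ _), rfl⟩)
      · exact le_ad _ _ (P.mem_img.mpr ⟨_, self_ad _ _, rfl⟩)
      · exact self_ad _ _
    · rw [trd_ad tra, htr, add_assoc]
      norm_num
  · push Not at hK
    exact fun z hz => hK z (hFE z hz)

open Pointwise in
theorem step_g {F' : IntermediateField k L} {G0 : Set L} (hG0 : IntermediateField.adjoin k G0 = F') {s : F'} (hgood : GoodS k F' s)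
    (hfin : Algebra.trdeg k F' < Cardinal.aleph0) {a b c : L}
    (tra : Transcendental F' a) (trb : Transcendental (ad F' a) b) (trc : Transcendental (ad (ad F' a) b) c)
    (gen : ad (ad (ad F' a) b) c = ⊤) (htr : Algebra.trdeg k L = Algebra.trdeg k F' + 3)
    {S : Set (Place k L)} (hS : S = SR (fun P => HasP k F' P.Res 2 s) (Algebra.adjoin k (G0 ∪ {a, b, c}))) :
    ∃ σ : L ≃ₐ[k] L, σ • S ⊆ S ∧ ¬ S ⊆ σ • S := by
  obtain ⟨n, hn⟩ := Cardinal.lt_aleph0.mp hfin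
  have hG0F : ∀ z ∈ G0, z ∈ F' := fun z hz => by rw [← hG0]; exact IntermediateField.subset_adjoin _ _ hz
  have hs0 : s ≠ 0 := hgood.ne
  have hsL : (s : L) ≠ 0 := fun h => hs0 (Subtype.ext h)
  have hsF : (s : L) ∈ F' := s.2
  have hsa : (s : L) ∈ ad F' a := le_ad _ _ hsF
  have haa : a ∈ ad F' a := self_ad _ _
  have hd : (s : L) ^ 2 * b * (b - a * c) - s * (c - a ^ 3) ≠ 0 := by
    intro h0
    have ha0 : a ≠ 0 := by
      rintro rfl
      exact tra (isAlgebraic_zero)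
    by_cases h1 : (s : L) ^ 2 * a * b + s = 0
    · apply trb
      have : b = - (s : L) / (s ^ 2 * a) := by
        rw [eq_div_iff (mul_ne_zero (pow_ne_zero _ hsL) ha0)]
        linear_combination h1
      have hb : b ∈ ad F' a := by rw [this]; exact div_mem (neg_mem hsa) (mul_mem (pow_mem hsa 2) haa)
      exact isAlgebraic_algebraMap (⟨b, hb⟩ : ad F' a)
    · apply trc
      have : c = ((s : L) ^ 2 * b ^ 2 + s * a ^ 3) / ((s : L) ^ 2 * a * b + s) := by
        rw [eq_div_iff h1]
        linear_combination - h0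
      have hs' := le_ad (ad F' a) b hsa
      have ha' := le_ad (ad F' a) b haa
      have hb' := self_ad (ad F' a) b
      have hc : c ∈ ad (ad F' a) b := by
        rw [this]
        exact div_mem (add_mem (mul_mem (pow_mem hs' 2) (pow_mem hb' 2)) (mul_mem hs' (pow_mem ha' 3)))
          (add_mem (mul_mem (mul_mem (pow_mem hs' 2) ha') hb') hs')
      exact isAlgebraic_algebraMap (⟨c, hc⟩ : ad (ad F' a) b)
  obtain ⟨f, hf⟩ : ∃ f : L, f * ((s : L) ^ 2 * b * (b - a * c) - s * (c - a ^ 3)) = 1 + (s : L) ^ 2 * b * c ^ 2 - s * (a * b + a ^ 2 * c) :=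
    ⟨_, div_mul_cancel₀ _ hd⟩
  obtain ⟨e, he⟩ : ∃ e, e = c + a * f := ⟨_, rfl⟩
  obtain ⟨g, hg⟩ : ∃ g, g = b + a * e := ⟨_, rfl⟩
  have hb : b = g - a * e := by rw [hg]; ring
  have hc : c = e - a * f := by rw [he]; ring
  have ha : a * (s * (f ^ 2 + g) - (s : L) ^ 2 * e * (f * g - e ^ 2)) = 1 + s * e * f - (s : L) ^ 2 * g * (f * g - e ^ 2) := by
    have hf' := hf
    rw [hb, hc] at hf'
    linear_combination hf'
  have gen1 : ∀ M : IntermediateField k L, F' ≤ M → a ∈ M → b ∈ M → c ∈ M → M = ⊤ := by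
    intro M h1 h2 h3 h4
    rw [eq_top_iff, ← gen]
    exact ad_le (ad_le (ad_le h1 h2) h3) h4
  have gen2 : ∀ M : IntermediateField k L, F' ≤ M → a ∈ M → e ∈ M → f ∈ M → g ∈ M → M = ⊤ := by
    intro M h1 h2 h3 h4 h5
    refine gen1 M h1 h2 ?_ ?_
    · rw [hb]; exact sub_mem h5 (mul_mem h2 h3)
    · rw [hc]; exact sub_mem h3 (mul_mem h2 h4)
  have hden : s * (f ^ 2 + g) - (s : L) ^ 2 * e * (f * g - e ^ 2) ≠ 0 := by
    intro h0
    refine den_ne hsF hsL hfin htr gen2 ?_ h0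
    rw [← ha, h0, mul_zero]
  have gen3 : ∀ M : IntermediateField k L, F' ≤ M → e ∈ M → f ∈ M → g ∈ M → M = ⊤ := by
    intro M h1 h2 h3 h4
    refine gen2 M h1 ?_ h2 h3 h4
    rw [← eq_div_iff hden] at ha
    rw [ha]
    have hs := h1 hsF
    have hq := sub_mem (mul_mem h3 h4) (pow_mem h2 2)
    exact div_mem (sub_mem (add_mem (one_mem _) (mul_mem (mul_mem hs h2) h3)) (mul_mem (mul_mem (pow_mem hs 2) h4) hq))
      (sub_mem (mul_mem hs (add_mem (pow_mem h3 2) h4)) (mul_mem (mul_mem (pow_mem hs 2) h2) hq))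
  have htr3 : Algebra.trdeg F' L = (3 : ℕ) := by
    have h1 := trd_add' k F' L
    rw [htr, hn] at h1
    have h2 : Algebra.trdeg F' L < Cardinal.aleph0 := by
      refine lt_of_le_of_lt (b := ((n + 3 : ℕ) : Cardinal)) ?_ (Cardinal.natCast_lt_aleph0)
      push_cast
      rw [h1]
      exact le_add_self
    obtain ⟨q, hq⟩ := Cardinal.lt_aleph0.mp h2
    rw [hq] at h1 ⊢
    norm_cast at h1 ⊢
    omega
  have gx : ∀ x y z : L, (∀ M : IntermediateField k L, F' ≤ M → x ∈ M → y ∈ M → z ∈ M → M = ⊤) →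
      IntermediateField.adjoin F' (Set.range ![x, y, z]) = ⊤ := by
    intro x y z h
    have hm : ∀ i, (![x, y, z] i) ∈ IntermediateField.adjoin F' (Set.range ![x, y, z]) := fun i => IntermediateField.subset_adjoin _ _ ⟨i, rfl⟩
    have := h ((IntermediateField.adjoin F' (Set.range ![x, y, z])).restrictScalars k) (fun z hz => mem_adjA F' _ hz) (hm 0) (hm 1) (hm 2)
    rw [eq_top_iff]
    intro w _
    have hw : w ∈ (IntermediateField.adjoin F' (Set.range ![x, y, z])).restrictScalars k := by rw [this]; trivial
    exact hw
  have gen4 : ∀ M : IntermediateField k L, F' ≤ M → e ∈ M → f ∈ M → g ∈ M → M = ⊤ := gen3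
  obtain ⟨σ₁, hσ₁⟩ := exists_aut ![a, b, c] ![e, f, g] (gx _ _ _ gen1) (gx _ _ _ gen3) htr3
  let σ : L ≃ₐ[k] L := σ₁.restrictScalars k
  have hσF : ∀ z ∈ F', σ z = z := fun z hz => σ₁.commutes ⟨z, hz⟩
  have hσa : σ a = e := hσ₁ 0
  have hσb : σ b = f := hσ₁ 1
  have hσc : σ c = g := hσ₁ 2
  have hR : ∀ z, z ∈ Algebra.adjoin k (G0 ∪ {a, b, c}) ↔ σ z ∈ Algebra.adjoin k (G0 ∪ {e, f, g}) := by
    have e1 : (Algebra.adjoin k (G0 ∪ {a, b, c})).map (σ : L →ₐ[k] L) = Algebra.adjoin k (σ '' (G0 ∪ {a, b, c})) := AlgHom.map_adjoin _ _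
    have e2 : σ '' (G0 ∪ {a, b, c}) = G0 ∪ {e, f, g} := by
      rw [Set.image_union, Set.image_insert_eq, Set.image_insert_eq, Set.image_singleton, hσa, hσb, hσc]
      congr 1
      ext z
      constructor
      · rintro ⟨w, hw, rfl⟩
        rw [hσF w (hG0F w hw)]; exact hw
      · intro hz
        exact ⟨z, hz, hσF z (hG0F z hz)⟩
    rw [e2] at e1
    intro z
    rw [← e1]
    constructor
    · intro hz; exact ⟨z, hz, rfl⟩
    · rintro ⟨w, hw, hwz⟩
      have : w = z := σ.injective hwz
      rw [← this]; exact hw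
  have hsm := smul_SR (fun P : Place k L => HasP k F' P.Res 2 s) (fun P σ h => HasP.map P σ h) σ hR
  refine ⟨σ, ?_, ?_⟩
  · rw [hS]
    rintro _ ⟨P, hP, rfl⟩
    have h2 : σ • P ∈ SR (fun P => HasP k F' P.Res 2 s) (Algebra.adjoin k (G0 ∪ {e, f, g})) := by
      rw [← hsm]; exact ⟨P, hP, rfl⟩
    refine claim1 hG0 hgood hfin hf he hg ?_ h2
    intro z hz
    have h3 := F_le hG0 hgood hfin tra trb trc gen htr hP z hz
    have h4 := (P.map_mem σ (z := z)).mpr h3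
    rw [hσF z hz] at h4
    exact h4
  · rw [hS, hsm]
    intro hsub
    obtain ⟨P, hP1, hP2⟩ := claim2 hG0 hs0 hfin tra trb trc gen hf he hg
    exact hP2 (hsub hP1)
end
end CrBir
end

section
namespace CrBir
open Polynomial IntermediateField.algebraAdjoinAdjoin
universe u v

section
variable {k : Type v} {L : Type u} [Field k] [Field L] [Algebra k L] [CharZero k]

theorem step_iota {F' : IntermediateField k L} {G0 : Set L} (hG0 : IntermediateField.adjoin k G0 = F') {s : F'} (hgood : GoodS k F' s)
    (hfin : Algebra.trdeg k F' < Cardinal.aleph0) {a b c : L}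
    (tra : Transcendental F' a) (trb : Transcendental (ad F' a) b) (trc : Transcendental (ad (ad F' a) b) c)
    (gen : ad (ad (ad F' a) b) c = ⊤) (htr : Algebra.trdeg k L = Algebra.trdeg k F' + 3)
    (σ : L ≃ₐ[k] L) (hσK : ∀ z ∈ ad (ad F' a) b, σ z ∈ ad (ad F' a) b) (hσc : σ c = c) {P : Place k L}
    (hP : P ∈ SR (fun P => HasP k F' P.Res 2 s) (Algebra.adjoin k (G0 ∪ {a, b, c}))) :
    P.map σ ∈ SR (fun P => HasP k F' P.Res 2 s) (Algebra.adjoin k (G0 ∪ {a, b, c})) := by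
  obtain ⟨n, hn⟩ := Cardinal.lt_aleph0.mp hfin
  have hG0F : ∀ z ∈ G0, z ∈ F' := fun z hz => by rw [← hG0]; exact IntermediateField.subset_adjoin _ _ hz
  have hR : ∀ z, z ∈ Algebra.adjoin k (G0 ∪ {a, b, c}) ↔ σ z ∈ Algebra.adjoin k (σ '' (G0 ∪ {a, b, c})) := by
    have e1 : (Algebra.adjoin k (G0 ∪ {a, b, c})).map (σ : L →ₐ[k] L) = Algebra.adjoin k (σ '' (G0 ∪ {a, b, c})) := AlgHom.map_adjoin _ _
    intro z
    rw [← e1]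
    constructor
    · intro hz; exact ⟨z, hz, rfl⟩
    · rintro ⟨w, hw, hwz⟩
      have : w = z := σ.injective hwz
      rw [← this]; exact hw
  have hP' := smul_SR_sub (fun P : Place k L => HasP k F' P.Res 2 s) (fun P σ h => HasP.map P σ h) σ hR hP
  clear hP hR
  revert hP'
  generalize P.map σ = P'
  rintro ⟨hP1, hP2, hP3, hP4⟩
  have hP2 : HasP k F' P'.Res 2 s := hP2
  have hcO : c ∈ P'.O := hP3 _ (Algebra.subset_adjoin ⟨c, by simp, hσc⟩)
  have hFE : ∀ z ∈ F', z ∈ ad (ad F' a) b := fun z hz => le_ad _ _ (le_ad _ _ hz)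
  have haE : a ∈ ad (ad F' a) b := le_ad _ _ (self_ad _ _)
  have hbE : b ∈ ad (ad F' a) b := self_ad _ _
  have hE : ad (ad F' a) b = IntermediateField.adjoin k (insert b (insert a G0)) := by
    rw [← hG0, ad_adjoin, ad_adjoin]
  by_cases hK : ∃ z ∈ ad (ad F' a) b, z ∉ P'.O
  · have hres : ad (P'.img (ad (ad F' a) b)) (P'.rd ⟨c, hcO⟩) = ⊤ := by
      apply rd_gen P' hP3 hP4
      rintro _ ⟨z, (hz | rfl | rfl | rfl), rfl⟩
      · exact le_ad _ _ (P'.mem_img.mpr ⟨_, hσK z (hFE z (hG0F z hz)), rfl⟩)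
      · exact le_ad _ _ (P'.mem_img.mpr ⟨_, hσK z haE, rfl⟩)
      · exact le_ad _ _ (P'.mem_img.mpr ⟨_, hσK z hbE, rfl⟩)
      · have : (⟨σ z, hP3 _ (Algebra.subset_adjoin ⟨z, by simp, rfl⟩)⟩ : P'.O) = ⟨z, hcO⟩ := Subtype.ext hσc
        rw [this]
        exact self_ad _ _
    obtain ⟨trr, hV⟩ := V_app hgood hfin htr P' hP2 (ad (ad F' a) b) hcO trc gen hres hK
    have hA := hV (ad F' a) b le_rfl (by rw [trd_ad tra, htr, add_assoc]; norm_num)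
    have hB := hV (ad F' b) a (ad_le (ad_le ((le_ad _ _).trans (le_ad _ _)) (self_ad _ _)) (le_ad _ _ (self_ad _ _))) (by
      refine (add_le_add_left (trd_ad_le _ _) 2).trans ?_
      rw [htr, add_assoc]; norm_num)
    have haO := hA a (self_ad _ _)
    have hbO := hB b (self_ad _ _)
    have hFO : ∀ z ∈ F', z ∈ P'.O := fun z hz => hA z (le_ad _ _ hz)
    have trc' : Transcendental (ad F' a) c := fun h => trc (isAlgebraic_mono (le_ad _ _) h)
    have trr' : Transcendental (P'.img (ad F' a)) (P'.rd ⟨c, hcO⟩) := fun h => trr (isAlgebraic_mono (P'.img_mono (le_ad _ _)) h)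
    have hEO : ∀ z ∈ ad (ad F' a) c, z ∈ P'.O := by
      have h1 : Algebra.trdeg k (ad (ad F' a) c) = ((n + 2 : ℕ) : Cardinal) := by
        rw [trd_ad trc', trd_ad tra, hn]; norm_cast
      refine P'.le_of_trdeg _ (by rw [h1]; exact Cardinal.natCast_lt_aleph0) ?_
      have h2 : ad (P'.img (ad F' a)) (P'.rd ⟨c, hcO⟩) ≤ P'.img (ad (ad F' a) c) :=
        ad_le (P'.img_mono (le_ad _ _)) (P'.mem_img.mpr ⟨_, self_ad _ _, rfl⟩)
      refine le_trans (le_of_eq ?_) (trd_mono h2)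
      rw [trd_ad trr', trd_ad trc', P'.img_eq _ hA, trd_range]
    refine ⟨hP1, hP2, ?_, ?_⟩
    · apply adjoin_sub_O
      rintro z (hz | rfl | rfl | rfl)
      exacts [hFO z (hG0F z hz), haO, hbO, hcO]
    · have hE' : ad (ad F' a) c = IntermediateField.adjoin k (insert c (insert a G0)) := by
        rw [← hG0, ad_adjoin, ad_adjoin]
      apply loc_of P' (G := insert c (insert a G0)) (y := b)
      · rw [← hE']; exact hEO
      · exact hbO
      · rw [← hE', eq_top_iff, ← gen]
        exact ad_le (ad_mono (le_ad _ _)) (le_ad _ _ (self_ad _ _))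
      · rintro z (rfl | rfl | hz)
        · exact Algebra.subset_adjoin (by simp)
        · exact Algebra.subset_adjoin (by simp)
        · exact Algebra.subset_adjoin (Or.inl hz)
      · exact Algebra.subset_adjoin (by simp)
  · push Not at hK
    refine ⟨hP1, hP2, ?_, ?_⟩
    · apply adjoin_sub_O
      rintro z (hz | rfl | rfl | rfl)
      exacts [hK z (hFE z (hG0F z hz)), hK _ haE, hK _ hbE, hcO]
    · apply loc_of P' (G := insert b (insert a G0)) (y := c)
      · rw [← hE]; exact hK
      · exact hcO
      · rw [← hE]; exact gen
      · rintro z (rfl | rfl | hz)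
        · exact Algebra.subset_adjoin (by simp)
        · exact Algebra.subset_adjoin (by simp)
        · exact Algebra.subset_adjoin (Or.inl hz)
      · exact Algebra.subset_adjoin (by simp)

theorem trd_fin_adjoin {k : Type v} {L : Type u} [Field k] [Field L] [Algebra k L] {G : Set L} (hG : G.Finite) :
    Algebra.trdeg k (IntermediateField.adjoin k G) < Cardinal.aleph0 := by
  induction G, hG using Set.Finite.induction_on with
  | empty =>
    rw [IntermediateField.adjoin_empty]
    haveI : Algebra.IsAlgebraic k (⊥ : IntermediateField k L) := ⟨fun z => by
      obtain ⟨c, hc⟩ := IntermediateField.mem_bot.mp z.2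
      have : z = algebraMap k _ c := Subtype.ext hc.symm
      rw [this]; exact isAlgebraic_algebraMap c⟩
    rw [_root_.trdeg_eq_zero]
    exact Cardinal.aleph0_pos
  | insert _ _ ih =>
    rw [← ad_adjoin]
    refine lt_of_le_of_lt (trd_ad_le _ _) ?_
    exact Cardinal.add_lt_aleph0 ih Cardinal.one_lt_aleph0

theorem exists_goodS_ad {F'' F' : IntermediateField k L} {y : L} {G1 : Set L} (hfinG : G1.Finite) (hG1 : IntermediateField.adjoin k G1 = F'')
    (hF' : F' = ad F'' y) (hfin : Algebra.trdeg k F' < Cardinal.aleph0) (try' : Transcendental F'' y) : ∃ s : F', GoodS k F' s := by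
  have hle : F'' ≤ F' := by rw [hF']; exact le_ad _ _
  have hy : y ∈ F' := by rw [hF']; exact self_ad _ _
  have hGF : ∀ z ∈ G1, z ∈ F' := fun z hz => hle (by rw [← hG1]; exact IntermediateField.subset_adjoin _ _ hz)
  have himg : F'.val '' (F'.val ⁻¹' G1) = G1 := by
    apply Set.image_preimage_eq_of_subset
    intro z hz
    exact ⟨⟨z, hGF z hz⟩, rfl⟩
  have hmap : (IntermediateField.adjoin k (F'.val ⁻¹' G1)).map F'.val = F'' := by
    rw [IntermediateField.adjoin_map, himg, hG1]
  have hfin2 : (F'.val ⁻¹' G1).Finite := hfinG.preimage (Subtype.val_injective.injOn)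
  refine exists_goodS (E := IntermediateField.adjoin k (F'.val ⁻¹' G1)) (y := ⟨y, hy⟩) ?_ ?_ hfin ?_
  · refine tr_pull F'.val (E' := F'') ?_ try'
    intro z hz
    rw [← hmap]
    exact ⟨z, hz, rfl⟩
  · rw [← ad_top_iff, eq_top_iff]
    have h1 : F' ≤ (ad (IntermediateField.adjoin k (F'.val ⁻¹' G1)) ⟨y, hy⟩).map F'.val := by
      conv_lhs => rw [hF']
      apply ad_le
      · conv_lhs => rw [← hmap]
        exact IntermediateField.map_mono _ (le_ad _ _)
      · exact ⟨_, self_ad _ _, rfl⟩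
    intro z _
    obtain ⟨w, hw, hwz⟩ := h1 z.2
    have : w = z := Subtype.ext hwz
    rw [← this]; exact hw
  · rw [IntermediateField.fg_top_iff, IntermediateField.essFiniteType_iff]
    exact IntermediateField.fg_adjoin_of_finite hfin2

/-- the main theorem in an internal form -/
theorem main_internal {F'' F' : IntermediateField k L} {y a b c : L} {G1 : Set L} (hfinG : G1.Finite) (hG1 : IntermediateField.adjoin k G1 = F'')
    (hF' : F' = ad F'' y) (try' : Transcendental F'' y)
    (tra : Transcendental F' a) (trb : Transcendental (ad F' a) b) (trc : Transcendental (ad (ad F' a) b) c)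
    (gen : ad (ad (ad F' a) b) c = ⊤) {H : Type*} [Group H] (ι : H →* (L ≃ₐ[k] L))
    (hK : ∀ h, ∀ z ∈ ad (ad F' a) b, ι h z ∈ ad (ad F' a) b) (hc : ∀ h, ι h c = c) :
    ¬ Function.Surjective (Abelianization.map ι) := by
  have hfin : Algebra.trdeg k F'' < Cardinal.aleph0 := by rw [← hG1]; exact trd_fin_adjoin hfinG
  obtain ⟨n, hn⟩ := Cardinal.lt_aleph0.mp hfin
  have hG0 : IntermediateField.adjoin k (insert y G1) = F' := by rw [hF', ← hG1, ad_adjoin]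
  have hn' : Algebra.trdeg k F' = ((n + 1 : ℕ) : Cardinal) := by
    rw [hF', trd_ad try', hn]; norm_cast
  have hfin' : Algebra.trdeg k F' < Cardinal.aleph0 := by rw [hn']; exact Cardinal.natCast_lt_aleph0
  have htr : Algebra.trdeg k L = Algebra.trdeg k F' + 3 := by
    rw [← IntermediateField.topEquiv.trdeg_eq, ← gen, trd_ad trc, trd_ad trb, trd_ad tra, hn']
    norm_cast
  obtain ⟨s, hgood⟩ : ∃ s : F', GoodS k F' s := exists_goodS_ad hfinG hG1 hF' hfin' try'
  have hfG : (insert y G1 ∪ {a, b, c}).Finite := (hfinG.insert y).union (by simp)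
  have hgG : IntermediateField.adjoin k (insert y G1 ∪ {a, b, c}) = ⊤ := by
    rw [eq_top_iff, ← gen, ← hG0]
    have hsub := IntermediateField.subset_adjoin k (insert y G1 ∪ {a, b, c})
    refine ad_le (ad_le (ad_le (IntermediateField.adjoin.mono _ _ _ Set.subset_union_left) ?_) ?_) ?_
    · exact hsub (by simp)
    · exact hsub (by simp)
    · exact hsub (by simp)
  obtain ⟨g, hg1, hg2⟩ := step_g hG0 hgood hfin' tra trb trc gen htr rfl
  refine not_surj _ (fun g => finite_diff_smul _ (fun P σ h => HasP.map P σ h) hfG hgG g) ι ?_ g hg1 hg2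
  rintro h _ ⟨P, hP, rfl⟩
  exact step_iota hG0 hgood hfin' tra trb trc gen htr (ι h) (hK h) (hc h) hP
end
end CrBir
end

section
namespace CrBir
open Polynomial IntermediateField.algebraAdjoinAdjoin

section

theorem tr_of_indep {F L ι : Type*} [Field F] [Field L] [Algebra F L] {X : ι → L} (hX : AlgebraicIndependent F X) {s : Set ι} {i : ι}
    (hi : i ∉ s) : Transcendental (IntermediateField.adjoin F (X '' s)) (X i) := by
  intro h
  have h1 := hX.transcendental_adjoin hi
  exact h1 ((IsFractionRing.isAlgebraic_iff (Algebra.adjoin F (X '' s)) (IntermediateField.adjoin F (X '' s)) L).mpr h)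

theorem tr_of_indep' {k F L ι : Type*} [Field k] [CharZero k] [Field F] [Field L] [Algebra k F] [Algebra k L] [Algebra F L] [IsScalarTower k F L]
    {X : ι → L} (hX : AlgebraicIndependent F X) {s : Set ι} {i : ι} (hi : i ∉ s) {E : IntermediateField k L} {G : Set L}
    (hE : E = IntermediateField.adjoin k G) (hG : ∀ z ∈ G, z ∈ Set.range (algebraMap F L) ∨ z ∈ X '' s) : Transcendental E (X i) := by
  intro h
  refine tr_of_indep hX hi ?_
  refine isAlgebraic_mono (E' := (IntermediateField.adjoin F (X '' s)).restrictScalars k) ?_ h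
  rw [hE, IntermediateField.adjoin_le_iff]
  intro z hz
  rcases hG z hz with ⟨w, rfl⟩ | hz
  · exact IntermediateField.algebraMap_mem _ w
  · exact IntermediateField.subset_adjoin F _ hz

theorem tr_range' {k K L : Type*} [Field k] [Field K] [Field L] [Algebra k K] [Algebra k L] [Algebra K L] (φ : K →ₐ[k] L)
    (hφ : ∀ z, algebraMap K L z = φ z) {t : L} (tr : Transcendental K t) : Transcendental φ.fieldRange t := by
  rintro ⟨p, hp, h0⟩
  let f : φ.fieldRange ≃ₐ[k] K := (AlgEquiv.ofInjectiveField φ).symm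
  have hf : ∀ z, φ (f z) = z := fun z => congrArg Subtype.val ((AlgEquiv.ofInjectiveField φ).apply_symm_apply z)
  apply tr
  refine ⟨p.map (f : φ.fieldRange →+* K), (Polynomial.map_ne_zero_iff f.injective).mpr hp, ?_⟩
  rw [← h0, aeval_def, eval₂_map, aeval_def]
  congr 1
  ext z
  exact (hφ _).trans (hf z)

theorem main_final (k F K K' : Type*) [Field k] [Field F] [Field K] [Field K'] [CharZero k]
    [Algebra k F] [Algebra F K] [Algebra k K] [IsScalarTower k F K]
    [Algebra K K'] [Algebra k K'] [IsScalarTower k K K']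
    (hFG : (⊤ : IntermediateField k F).FG)
    (m : ℕ) (x : Fin (m + 3) → K) (hx : AlgebraicIndependent F x)
    (hxgen : IntermediateField.adjoin F (Set.range x) = ⊤)
    (t : K') (ht : Transcendental K t) (htgen : IntermediateField.adjoin K {t} = ⊤)
    (ι : (K ≃ₐ[k] K) →* (K' ≃ₐ[k] K'))
    (hι : ∀ σ, (∀ a : K, ι σ (algebraMap K K' a) = algebraMap K K' (σ a)) ∧ ι σ t = t) :
    ¬ Function.Surjective (Abelianization.map ι) := by
  letI : Algebra F K' := ((algebraMap K K').comp (algebraMap F K)).toAlgebra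
  haveI : IsScalarTower F K K' := IsScalarTower.of_algebraMap_eq (fun _ => rfl)
  haveI : IsScalarTower k F K' := IsScalarTower.of_algebraMap_eq (fun c => by
    rw [IsScalarTower.algebraMap_apply k K K', IsScalarTower.algebraMap_apply k F K]; rfl)
  obtain ⟨T, hT⟩ := hFG
  let X : Fin (m + 3) → K' := fun i => algebraMap K K' (x i)
  have hX : AlgebraicIndependent F X := hx.map' (f := IsScalarTower.toAlgHom F K K') (algebraMap K K').injective
  let j : K →ₐ[k] K' := IsScalarTower.toAlgHom k K K'
  let s1 : Set (Fin (m + 3)) := {i | (i : ℕ) < m}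
  let iy : Fin (m + 3) := ⟨m, by omega⟩
  let ia : Fin (m + 3) := ⟨m + 1, by omega⟩
  let ib : Fin (m + 3) := ⟨m + 2, by omega⟩
  let G1 : Set K' := algebraMap F K' '' (T : Set F) ∪ X '' s1
  let F'' := IntermediateField.adjoin k G1
  have e1 : ad F'' (X iy) = IntermediateField.adjoin k (insert (X iy) G1) := ad_adjoin _ _
  have e2 : ad (ad F'' (X iy)) (X ia) = IntermediateField.adjoin k (insert (X ia) (insert (X iy) G1)) := by rw [e1, ad_adjoin]
  have e3 : ad (ad (ad F'' (X iy)) (X ia)) (X ib) = IntermediateField.adjoin k (insert (X ib) (insert (X ia) (insert (X iy) G1))) := by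
    rw [e2, ad_adjoin]
  have hsplit : ∀ i : Fin (m + 3), i ∈ s1 ∨ i = iy ∨ i = ia ∨ i = ib := by
    intro i
    have h1 := i.2
    have : (i : ℕ) < m ∨ (i : ℕ) = m ∨ (i : ℕ) = m + 1 ∨ (i : ℕ) = m + 2 := by omega
    rcases this with h | h | h | h
    · exact Or.inl h
    · exact Or.inr (Or.inl (Fin.ext h))
    · exact Or.inr (Or.inr (Or.inl (Fin.ext h)))
    · exact Or.inr (Or.inr (Or.inr (Fin.ext h)))
  have hK : ad (ad (ad F'' (X iy)) (X ia)) (X ib) = j.fieldRange := by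
    rw [e3]
    set B := IntermediateField.adjoin k (insert (X ib) (insert (X ia) (insert (X iy) G1))) with hB
    have hsub := IntermediateField.subset_adjoin k (insert (X ib) (insert (X ia) (insert (X iy) G1)))
    apply le_antisymm
    · rw [hB, IntermediateField.adjoin_le_iff]
      rintro z (rfl | rfl | rfl | ⟨w, hw, rfl⟩ | ⟨i, hi, rfl⟩)
      exacts [⟨x ib, rfl⟩, ⟨x ia, rfl⟩, ⟨x iy, rfl⟩, ⟨algebraMap F K w, rfl⟩, ⟨x i, rfl⟩]
    · rintro _ ⟨z, rfl⟩
      have hFB : ∀ c : F, algebraMap F K' c ∈ B.toSubfield := by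
        intro c
        refine hom_mem_of_gen (k := k) (algebraMap F K') B.toSubfield (s := (T : Set F)) ?_ ?_ c (by rw [hT]; trivial)
        · intro d
          rw [← IsScalarTower.algebraMap_apply k F K']
          exact B.algebraMap_mem d
        · intro z hz
          exact hsub (Or.inr (Or.inr (Or.inr (Or.inl ⟨z, hz, rfl⟩))))
      refine hom_mem_of_gen (k := F) (algebraMap K K') B.toSubfield (s := Set.range x) ?_ ?_ z (by rw [hxgen]; trivial)
      · intro c; exact hFB c
      · rintro _ ⟨i, rfl⟩
        rcases hsplit i with h | rfl | rfl | rfl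
        · exact hsub (Or.inr (Or.inr (Or.inr (Or.inr ⟨i, h, rfl⟩))))
        · exact hsub (Or.inr (Or.inr (Or.inl rfl)))
        · exact hsub (Or.inr (Or.inl rfl))
        · exact hsub (Or.inl rfl)
  have try' : Transcendental F'' (X iy) := by
    refine tr_of_indep' hX (s := s1) (by simp [s1, iy]) rfl ?_
    rintro z (⟨w, hw, rfl⟩ | hz)
    exacts [Or.inl ⟨w, rfl⟩, Or.inr hz]
  have tra : Transcendental (ad F'' (X iy)) (X ia) := by
    refine tr_of_indep' hX (s := insert iy s1) (by simp [s1, iy, ia]) e1 ?_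
    rintro z (rfl | ⟨w, hw, rfl⟩ | ⟨i, hi, rfl⟩)
    exacts [Or.inr ⟨iy, Or.inl rfl, rfl⟩, Or.inl ⟨w, rfl⟩, Or.inr ⟨i, Or.inr hi, rfl⟩]
  have trb : Transcendental (ad (ad F'' (X iy)) (X ia)) (X ib) := by
    refine tr_of_indep' hX (s := insert ia (insert iy s1)) (by simp [s1, iy, ia, ib]) e2 ?_
    rintro z (rfl | rfl | ⟨w, hw, rfl⟩ | ⟨i, hi, rfl⟩)
    exacts [Or.inr ⟨ia, Or.inl rfl, rfl⟩, Or.inr ⟨iy, Or.inr (Or.inl rfl), rfl⟩, Or.inl ⟨w, rfl⟩, Or.inr ⟨i, Or.inr (Or.inr hi), rfl⟩]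
  have trc : Transcendental (ad (ad (ad F'' (X iy)) (X ia)) (X ib)) t := by
    rw [hK]
    exact tr_range' j (fun _ => rfl) ht
  have gen : ad (ad (ad (ad F'' (X iy)) (X ia)) (X ib)) t = ⊤ := by
    rw [hK, eq_top_iff]
    intro z _
    refine hom_mem_of_gen (k := K) (RingHom.id K') (ad j.fieldRange t).toSubfield (s := {t}) ?_ ?_ z (by rw [htgen]; trivial)
    · intro c
      exact le_ad j.fieldRange t ⟨c, rfl⟩
    · rintro _ rfl
      exact self_ad j.fieldRange _
  have hfin : G1.Finite := (T.finite_toSet.image _).union (s1.toFinite.image _)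
  refine main_internal hfin rfl rfl try' tra trb trc gen ι ?_ (fun h => (hι h).2)
  rw [hK]
  rintro h _ ⟨z, rfl⟩
  exact ⟨h z, ((hι h).1 z).symm⟩
end
end CrBir
end

theorem stmt4 (k F K K' : Type*) [Field k] [Field F] [Field K] [Field K'] [CharZero k]
    [Algebra k F] [Algebra F K] [Algebra k K] [IsScalarTower k F K]
    [Algebra K K'] [Algebra k K'] [IsScalarTower k K K']
    (hFG : (⊤ : IntermediateField k F).FG)
    (htrdeg : ∃ a : F, Transcendental k a)
    (hrelclosed : ∀ a : F, IsAlgebraic k a → ∃ b : k, algebraMap k F b = a)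
    (m : ℕ) (hm : 3 ≤ m)
    (x : Fin m → K) (hx : AlgebraicIndependent F x)
    (hxgen : IntermediateField.adjoin F (Set.range x) = ⊤)
    (t : K') (ht : Transcendental K t)
    (htgen : IntermediateField.adjoin K {t} = ⊤)
    (ι : (K ≃ₐ[k] K) →* (K' ≃ₐ[k] K'))
    (hι : ∀ σ : K ≃ₐ[k] K,
      (∀ a : K, ι σ (algebraMap K K' a) = algebraMap K K' (σ a)) ∧ ι σ t = t) :
    ¬ Function.Surjective (Abelianization.map ι) := by
  obtain ⟨n, rfl⟩ : ∃ n, m = n + 3 := ⟨m - 3, by omega⟩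
  exact CrBir.main_final k F K K' hFG n x hx hxgen t ht htgen ι hι
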